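/- Classification of conical global minimizers in the plane: Assume N = 2 and that ℂ is the isotropic Lamé tensor, ℂe = λ tr(e) Id + 2μ e on symmetric matrices e, with Lamé coefficients satisfying μ > 0 and μ + λ > 0. Let (u,K) be a Griffith global minimizer in ℝ² and assume K is a cone centered at 0 (i.e. tK = K for all t > 0). Then K is either empty, a line through 0, a half-line emanating from 0, or a triple junction: the union of three half-lines emanating from 0 making pairwise angles of 2π/3. -/

import Mathlib

open MeasureTheory Metric Set Filter Topology Matrix
open scoped ENNReal NNReal RealInnerProductSpace

noncomputable section

namespace Griffith

abbrev Euc (N : ℕ) := EuclideanSpace ℝ (Fin N)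
abbrev Mat (N : ℕ) := Matrix (Fin N) (Fin N) ℝ

variable {N : ℕ}

/-- Frobenius inner product of two matrices. -/
def frob (ξ η : Mat N) : ℝ := ∑ i, ∑ j, ξ i j * η i j

/-- Frobenius norm of a matrix. -/
def frobNorm (ξ : Mat N) : ℝ := Real.sqrt (frob ξ ξ)

/-- Euclidean norm of a plain vector. -/
def vecNorm (w : Fin N → ℝ) : ℝ := Real.sqrt (∑ i, w i ^ 2)

/-- Real inner product on `ℝ^N`. -/
def rInner (x y : Euc N) : ℝ := @inner ℝ _ _ x y

/-- The gradient matrix `(∇u)_{ij} = ∂_j u_i` of `u` at `x`. -/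
def gradm (u : Euc N → Euc N) (x : Euc N) : Mat N :=
  fun i j => fderiv ℝ u x (EuclideanSpace.single j (1 : ℝ)) i

/-- The symmetrized gradient `e(u) = (∇u + ∇uᵀ)/2`. -/
def eSym (u : Euc N → Euc N) (x : Euc N) : Mat N :=
  (1 / 2 : ℝ) • (gradm u x + (gradm u x)ᵀ)

/-- The hypotheses on the elasticity tensor `𝓒`. -/
structure IsElasticityTensor (𝓒 : Mat N →ₗ[ℝ] Mat N) (c₀ : ℝ) : Prop where
  one_le : 1 ≤ c₀
  symm : ∀ ξ η : Mat N, frob (𝓒 ξ) η = frob ξ (𝓒 η)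
  skew_vanish : ∀ ξ : Mat N, 𝓒 (ξ - ξᵀ) = 0
  coercive : ∀ ξ : Mat N, c₀⁻¹ * frobNorm (ξ + ξᵀ) ^ 2 ≤ frob (𝓒 ξ) ξ

/-- `(N-1)`-dimensional Hausdorff measure on `ℝ^N`. -/
def Hm (N : ℕ) : Measure (Euc N) := μH[(N : ℝ) - 1]

/-- `K` is relatively closed in `Ω`. -/
def RelClosedIn (K Ω : Set (Euc N)) : Prop := K ⊆ Ω ∧ closure K ∩ Ω ⊆ K

/-- `K` is coral. -/
def Coral (K : Set (Euc N)) : Prop :=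
  ∀ x ∈ K, ∀ r : ℝ, 0 < r → 0 < Hm N (K ∩ ball x r)

/-- Admissible pair `(u,K)` in the open set `Ω` : `K` relatively closed
and `u ∈ W^{1,2}_loc(Ω \ K ; ℝ^N)`. -/
structure AdmissiblePair (Ω : Set (Euc N)) (u : Euc N → Euc N) (K : Set (Euc N)) : Prop where
  open_amb : IsOpen Ω
  relClosed : RelClosedIn K Ω
  diffOn : ∀ x ∈ Ω \ K, DifferentiableAt ℝ u x
  locSobolev : ∀ x ∈ Ω \ K, ∃ ε > (0:ℝ), ball x ε ⊆ Ω \ K ∧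
    IntegrableOn (fun y => ‖u y‖ ^ 2 + frobNorm (gradm u y) ^ 2) (ball x ε) volume

/-- Elastic energy `∫_A ℂ e(u) : e(u) dx`. -/
def elastic (𝓒 : Mat N →ₗ[ℝ] Mat N) (u : Euc N → Euc N) (A : Set (Euc N)) : ℝ≥0∞ :=
  ∫⁻ x in A, ENNReal.ofReal (frob (𝓒 (eSym u x)) (eSym u x))

/-- Elastic energy with exponent `p/2` : `∫_A (ℂ e(u) : e(u))^{p/2} dx`. -/
def elasticP (𝓒 : Mat N →ₗ[ℝ] Mat N) (u : Euc N → Euc N) (p : ℝ) (A : Set (Euc N)) : ℝ≥0∞ :=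
  ∫⁻ x in A, ENNReal.ofReal (frob (𝓒 (eSym u x)) (eSym u x)) ^ (p / 2)

/-- The pair `(u,K)` has locally finite energy in `Ω`. -/
def LocFiniteEnergy (Ω : Set (Euc N)) (u : Euc N → Euc N) (K : Set (Euc N)) : Prop :=
  ∀ (x : Euc N) (r : ℝ), 0 < r → closedBall x r ⊆ Ω →
    (∫⁻ y in ball x r \ K, ENNReal.ofReal (frobNorm (eSym u y) ^ 2)) + Hm N (K ∩ ball x r) < ⊤

/-- `(v,L)` is a competitor of `(u,K)` in `B`. -/
structure Competitor (Ω : Set (Euc N)) (u : Euc N → Euc N) (K : Set (Euc N))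
    (B : Set (Euc N)) (v : Euc N → Euc N) (L : Set (Euc N)) : Prop where
  pair : AdmissiblePair Ω v L
  eq_outside : L \ B = K \ B
  ae_eq : ∀ᵐ x ∂volume, x ∈ Ω \ (K ∪ B) → v x = u x

/-- Points of `Ω \ (K ∪ B)` separated by `K` stay separated by `L`. -/
def KeepsSeparation (Ω K B L : Set (Euc N)) : Prop :=
  ∀ x ∈ Ω \ (K ∪ B), ∀ y ∈ Ω \ (K ∪ B),
    y ∉ connectedComponentIn (Ω \ K) x → y ∉ connectedComponentIn (Ω \ L) x

/-- `(v,L)` is a topological competitor of `(u,K)` in `B`. -/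
structure TopCompetitor (Ω : Set (Euc N)) (u : Euc N → Euc N) (K : Set (Euc N))
    (B : Set (Euc N)) (v : Euc N → Euc N) (L : Set (Euc N)) : Prop where
  compet : Competitor Ω u K B v L
  sep : KeepsSeparation Ω K B L

/-- `L` is a topological competitor of the set `K` in `B`. -/
structure TopSetCompetitor (Ω K B L : Set (Euc N)) : Prop where
  relClosed : RelClosedIn L Ω
  eq_outside : L \ B = K \ B
  sep : KeepsSeparation Ω K B L

/-- A gauge. -/
structure IsGauge (h : ℝ → ℝ≥0∞) : Prop where
  mono : ∀ ⦃r s : ℝ⦄, 0 < r → r ≤ s → h r ≤ h s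
  eventually_finite : ∃ r₀ > (0:ℝ), ∀ r : ℝ, 0 < r → r < r₀ → h r ≠ ⊤

/-- Topological Griffith `M`-quasiminimizer with gauge `h` in `Ω`. -/
structure TopQuasiMin (𝓒 : Mat N →ₗ[ℝ] Mat N) (M : ℝ) (Ω : Set (Euc N))
    (u : Euc N → Euc N) (K : Set (Euc N)) (h : ℝ → ℝ≥0∞) : Prop where
  gauge : IsGauge h
  pair : AdmissiblePair Ω u K
  coral : Coral K
  locFin : LocFiniteEnergy Ω u K
  minimality : ∀ (x : Euc N) (r : ℝ), 0 < r → closedBall x r ⊆ Ω →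
    ∀ (v : Euc N → Euc N) (L : Set (Euc N)), TopCompetitor Ω u K (ball x r) v L →
      elastic 𝓒 u (ball x r \ K) + ENNReal.ofReal M⁻¹ * Hm N (K ∩ ball x r) ≤
        elastic 𝓒 v (ball x r \ L) + ENNReal.ofReal M * Hm N (L ∩ ball x r)
          + h r * ENNReal.ofReal (r ^ (N - 1))

/-- Topological Griffith almost-minimizer with gauge `h` in `Ω`. -/
structure TopAlmostMin (𝓒 : Mat N →ₗ[ℝ] Mat N) (Ω : Set (Euc N))
    (u : Euc N → Euc N) (K : Set (Euc N)) (h : ℝ → ℝ≥0∞) : Prop where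
  gauge : IsGauge h
  gauge_zero : Tendsto h (𝓝[>] (0:ℝ)) (𝓝 0)
  pair : AdmissiblePair Ω u K
  coral : Coral K
  locFin : LocFiniteEnergy Ω u K
  minimality : ∀ (x : Euc N) (r : ℝ), 0 < r → closedBall x r ⊆ Ω →
    ∀ (v : Euc N → Euc N) (L : Set (Euc N)), TopCompetitor Ω u K (ball x r) v L →
      elastic 𝓒 u (ball x r \ K) + Hm N (K ∩ ball x r) ≤
        elastic 𝓒 v (ball x r \ L) + Hm N (L ∩ ball x r) + h r * ENNReal.ofReal (r ^ (N - 1))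

/-- Plain Griffith almost-minimizer with gauge `h` in `Ω`. -/
structure AlmostMin (𝓒 : Mat N →ₗ[ℝ] Mat N) (Ω : Set (Euc N))
    (u : Euc N → Euc N) (K : Set (Euc N)) (h : ℝ → ℝ≥0∞) : Prop where
  gauge : IsGauge h
  gauge_zero : Tendsto h (𝓝[>] (0:ℝ)) (𝓝 0)
  pair : AdmissiblePair Ω u K
  coral : Coral K
  locFin : LocFiniteEnergy Ω u K
  minimality : ∀ (x : Euc N) (r : ℝ), 0 < r → closedBall x r ⊆ Ω →
    ∀ (v : Euc N → Euc N) (L : Set (Euc N)), Competitor Ω u K (ball x r) v L →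
      elastic 𝓒 u (ball x r \ K) + Hm N (K ∩ ball x r) ≤
        elastic 𝓒 v (ball x r \ L) + Hm N (L ∩ ball x r) + h r * ENNReal.ofReal (r ^ (N - 1))

/-- Griffith global minimizer in `ℝ^N`. -/
structure GlobalMin (𝓒 : Mat N →ₗ[ℝ] Mat N) (u : Euc N → Euc N) (K : Set (Euc N)) : Prop where
  pair : AdmissiblePair univ u K
  coral : Coral K
  locFin : LocFiniteEnergy univ u K
  minimality : ∀ x ∈ K, ∀ r : ℝ, 0 < r →
    ∀ (v : Euc N → Euc N) (L : Set (Euc N)), TopCompetitor univ u K (ball x r) v L →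
      elastic 𝓒 u (ball x r \ K) + Hm N (K ∩ ball x r) ≤
        elastic 𝓒 v (ball x r \ L) + Hm N (L ∩ ball x r)

/-- Almost-minimal set with gauge `h` in `Ω`. -/
structure AlmostMinimalSet (Ω K : Set (Euc N)) (h : ℝ → ℝ≥0∞) : Prop where
  gauge : IsGauge h
  gauge_zero : Tendsto h (𝓝[>] (0:ℝ)) (𝓝 0)
  relClosed : RelClosedIn K Ω
  coral : Coral K
  minimality : ∀ x ∈ K, ∀ r : ℝ, 0 < r → closedBall x r ⊆ Ω →
    ∀ L : Set (Euc N), TopSetCompetitor Ω K (ball x r) L →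
      Hm N (K ∩ ball x r) ≤ Hm N (L ∩ ball x r) + h r * ENNReal.ofReal (r ^ (N - 1))

/-- Minimal set in `Ω`. -/
structure MinimalSet (Ω K : Set (Euc N)) : Prop where
  relClosed : RelClosedIn K Ω
  coral : Coral K
  minimality : ∀ x ∈ K, ∀ r : ℝ, 0 < r → closedBall x r ⊆ Ω →
    ∀ L : Set (Euc N), TopSetCompetitor Ω K (ball x r) L →
      Hm N (K ∩ ball x r) ≤ Hm N (L ∩ ball x r)

/-- The flatness `β_K(x₀,r₀)`. -/
def flatness (K : Set (Euc N)) (x₀ : Euc N) (r₀ : ℝ) : ℝ :=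
  sInf {t : ℝ | 0 ≤ t ∧ ∃ ν : Euc N, ‖ν‖ = 1 ∧
    ∀ x ∈ K ∩ ball x₀ r₀, |rInner ν (x - x₀)| ≤ t * r₀}

/-- The bilateral flatness `β^bil_K(x₀,r₀)`. -/
def bilFlatness (K : Set (Euc N)) (x₀ : Euc N) (r₀ : ℝ) : ℝ :=
  sInf {t : ℝ | 0 ≤ t ∧ ∃ ν : Euc N, ‖ν‖ = 1 ∧
    (∀ x ∈ K ∩ ball x₀ r₀, |rInner ν (x - x₀)| ≤ t * r₀) ∧
    (∀ y ∈ ball x₀ r₀, rInner ν (y - x₀) = 0 → infDist y K ≤ t * r₀)}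

/-- The unit vector `ν₀` is normal to a hyperplane through `x₀` attaining the flatness. -/
def AttainsFlatness (K : Set (Euc N)) (x₀ : Euc N) (r₀ : ℝ) (ν₀ : Euc N) : Prop :=
  ‖ν₀‖ = 1 ∧ ∀ x ∈ K ∩ ball x₀ r₀, |rInner ν₀ (x - x₀)| ≤ flatness K x₀ r₀ * r₀

/-- The normalized elastic energy `ω_p(x₀,r₀)`. -/
def omegaP (u : Euc N → Euc N) (K : Set (Euc N)) (p : ℝ) (x₀ : Euc N) (r₀ : ℝ) : ℝ≥0∞ :=
  ENNReal.ofReal (r₀ ^ (1 - 2 * (N : ℝ) / p)) *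
    (∫⁻ x in ball x₀ r₀ \ K, ENNReal.ofReal (frobNorm (eSym u x) ^ p)) ^ (2 / p)

/-- `ω_{N-1}`, the Lebesgue measure of the `(N-1)`-dimensional unit disk. -/
def unitDiskVol (N : ℕ) : ℝ≥0∞ := volume (ball (0 : EuclideanSpace ℝ (Fin (N - 1))) 1)

/-- The ball `D₁ = B(x₀ + (3r₀/4)ν₀, r₀/8)`. -/
def Dplus (x₀ : Euc N) (r₀ : ℝ) (ν₀ : Euc N) : Set (Euc N) :=
  ball (x₀ + (3 * r₀ / 4) • ν₀) (r₀ / 8)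

/-- The ball `D₂ = B(x₀ - (3r₀/4)ν₀, r₀/8)`. -/
def Dminus (x₀ : Euc N) (r₀ : ℝ) (ν₀ : Euc N) : Set (Euc N) :=
  ball (x₀ - (3 * r₀ / 4) • ν₀) (r₀ / 8)

/-- `b_i = ⨍_{D_i} u`. -/
def avgDisp (u : Euc N → Euc N) (D : Set (Euc N)) : Euc N := ⨍ y in D, u y

/-- `A_i = ⨍_{D_i} (∇u - ∇uᵀ)/2`. -/
def avgRot (u : Euc N → Euc N) (D : Set (Euc N)) : Mat N :=
  fun i j => ⨍ y in D, (gradm u y i j - gradm u y j i) / 2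

/-- The normalized jump `J(x₀,r₀)` (relative to an optimal normal direction `ν₀`). -/
def normJump (u : Euc N → Euc N) (x₀ : Euc N) (r₀ : ℝ) (ν₀ : Euc N) : ℝ :=
  (‖avgDisp u (Dplus x₀ r₀ ν₀) - avgDisp u (Dminus x₀ r₀ ν₀)‖ +
    r₀ * frobNorm (avgRot u (Dplus x₀ r₀ ν₀) - avgRot u (Dminus x₀ r₀ ν₀))) / Real.sqrt r₀

/-- The component `J(ν)` of the jump in the direction `ν`. -/
def dirJump (u : Euc N → Euc N) (x₀ : Euc N) (r₀ : ℝ) (ν₀ ν : Euc N) : ℝ :=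
  (|rInner (avgDisp u (Dplus x₀ r₀ ν₀) - avgDisp u (Dminus x₀ r₀ ν₀)) ν| +
    r₀ * vecNorm ((avgRot u (Dplus x₀ r₀ ν₀) - avgRot u (Dminus x₀ r₀ ν₀)).mulVec
      (fun j => ν j))) / Real.sqrt r₀

/-- Orthogonal projection onto the hyperplane `x₀ + ν^⊥`. -/
def projHyp (x₀ ν : Euc N) (y : Euc N) : Euc N := y - (rInner ν (y - x₀)) • ν

/-- The set of holes `S(x₀,r₀,ν,ε)` through slicing in the direction `ν`. -/
def slicedHoles (K : Set (Euc N)) (x₀ : Euc N) (r₀ : ℝ) (ν : Euc N) (ε : ℝ) : Set (Euc N) :=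
  ({y : Euc N | rInner ν (y - x₀) = 0} ∩ ball x₀ ((1 - 4 * ε) * r₀)) \
    (projHyp x₀ ν '' (K ∩ ball x₀ r₀))

/-- Rigid motion: `x ↦ b + Ax` with `A` skew-symmetric. -/
def IsRigidMotion (a : Euc N → Euc N) : Prop :=
  ∃ (b : Euc N) (A : Euc N →ₗ[ℝ] Euc N),
    (∀ x y : Euc N, rInner (A x) y = - rInner x (A y)) ∧ ∀ x, a x = b + A x

/-- Every compact subset of `Ω` is contained in `Ωs i` for all large `i`. -/
def ExhaustsCompacts (Ωs : ℕ → Set (Euc N)) (Ω : Set (Euc N)) : Prop :=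
  ∀ H : Set (Euc N), IsCompact H → H ⊆ Ω → ∀ᶠ i in atTop, H ⊆ Ωs i

/-- Local Hausdorff convergence of `Ks i` towards `K` inside `Ω`. -/
def LocalHausdorffConv (Ω : Set (Euc N)) (Ks : ℕ → Set (Euc N)) (K : Set (Euc N)) : Prop :=
  ∀ H : Set (Euc N), IsCompact H → H ⊆ Ω →
    Tendsto (fun i => (⨆ x ∈ Ks i ∩ H, EMetric.infEdist x K) +
      ⨆ x ∈ K ∩ H, EMetric.infEdist x (Ks i)) atTop (𝓝 0)

/-- Convergence of the pairs `(us i, Ks i)` towards the pair `(u,K)` in `Ω`. -/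
def PairsConv (Ω : Set (Euc N)) (us : ℕ → Euc N → Euc N) (Ks : ℕ → Set (Euc N))
    (u : Euc N → Euc N) (K : Set (Euc N)) : Prop :=
  RelClosedIn K Ω ∧ LocalHausdorffConv Ω Ks K ∧
  ∀ z ∈ Ω \ K, ∃ a : ℕ → Euc N → Euc N, (∀ i, IsRigidMotion (a i)) ∧
    ∀ H : Set (Euc N), IsCompact H → H ⊆ connectedComponentIn (Ω \ K) z →
      Tendsto (fun i => ∫ x in H, ‖us i x - a i x - u x‖ ^ 2) atTop (𝓝 (0 : ℝ))

/-- `h⁺(r) = lim_{t → r⁺} limsup_i hs i t` (for nondecreasing gauges, the right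
limit is the infimum over `t > r`). -/
def limsupGauge (hs : ℕ → ℝ → ℝ≥0∞) (r : ℝ) : ℝ≥0∞ :=
  ⨅ t ∈ Ioi r, Filter.limsup (fun i => hs i t) atTop

open Classical in
/-- The limit gauge, truncated at the threshold `ε'`. -/
def limitGauge (hs : ℕ → ℝ → ℝ≥0∞) (ε' : ℝ) (r : ℝ) : ℝ≥0∞ :=
  if limsupGauge hs r < ENNReal.ofReal ε' then limsupGauge hs r else ⊤

/-- `x` is a regular point of `K`. -/
def RegularPoint (K : Set (Euc N)) (x : Euc N) : Prop :=
  ∃ r : ℕ → ℝ, (∀ i, 0 < r i) ∧ Tendsto r atTop (𝓝 (0:ℝ)) ∧ ∃ ν : Euc N, ‖ν‖ = 1 ∧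
    Tendsto (fun i =>
      (ENNReal.ofReal (r i))⁻¹ *
        ((⨆ y ∈ {z : Euc N | rInner ν (z - x) = 0} ∩ ball x (r i), EMetric.infEdist y K) +
          ⨆ y ∈ K ∩ ball x (r i), EMetric.infEdist y {z : Euc N | rInner ν (z - x) = 0}))
      atTop (𝓝 0)

/-- The singular part of `K`. -/
def singularPart (K : Set (Euc N)) : Set (Euc N) := {x ∈ K | ¬ RegularPoint K x}


section
section Calculus
open scoped ContDiff

/-- Partial derivative in the first variable. -/
def dx (f : ℝ × ℝ → ℝ) : ℝ × ℝ → ℝ := fun p => fderiv ℝ f p (1, 0)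

/-- Partial derivative in the second variable. -/
def dy (f : ℝ × ℝ → ℝ) : ℝ × ℝ → ℝ := fun p => fderiv ℝ f p (0, 1)

/-- Smooth functions on the plane. -/
def Sm (f : ℝ × ℝ → ℝ) : Prop := ContDiff ℝ ∞ f

lemma Sm.cd {f : ℝ × ℝ → ℝ} (hf : Sm f) : ContDiff ℝ ∞ f := hf

lemma Sm.diff {f : ℝ × ℝ → ℝ} (hf : Sm f) : Differentiable ℝ f :=
  hf.cd.differentiable (by simp)

lemma Sm.cont {f : ℝ × ℝ → ℝ} (hf : Sm f) : Continuous f := hf.cd.continuous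

lemma Sm.dx {f : ℝ × ℝ → ℝ} (hf : Sm f) : Sm (dx f) := by
  have h := hf.cd.fderiv_right (m := ∞) (by simp)
  exact h.clm_apply contDiff_const

lemma Sm.dy {f : ℝ × ℝ → ℝ} (hf : Sm f) : Sm (dy f) := by
  have h := hf.cd.fderiv_right (m := ∞) (by simp)
  exact h.clm_apply contDiff_const

lemma Sm.mul {f g : ℝ × ℝ → ℝ} (hf : Sm f) (hg : Sm g) : Sm (fun p => f p * g p) :=
  ContDiff.mul hf hg

lemma Sm.add {f g : ℝ × ℝ → ℝ} (hf : Sm f) (hg : Sm g) : Sm (fun p => f p + g p) :=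
  ContDiff.add hf hg

lemma Sm.sub {f g : ℝ × ℝ → ℝ} (hf : Sm f) (hg : Sm g) : Sm (fun p => f p - g p) :=
  ContDiff.sub hf hg

lemma Sm.const (c : ℝ) : Sm (fun _ => c) := contDiff_const

lemma Sm.of_fst {h : ℝ → ℝ} (hh : ContDiff ℝ ∞ h) : Sm (fun p => h p.1) := hh.comp contDiff_fst
lemma Sm.of_snd {h : ℝ → ℝ} (hh : ContDiff ℝ ∞ h) : Sm (fun p => h p.2) := hh.comp contDiff_snd

lemma dx_mul {f g : ℝ × ℝ → ℝ} (hf : Sm f) (hg : Sm g) :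
    dx (fun p => f p * g p) = fun p => dx f p * g p + f p * dx g p := by
  funext p
  simp only [dx]
  rw [fderiv_fun_mul (hf.diff p) (hg.diff p)]
  simp; ring

lemma dy_mul {f g : ℝ × ℝ → ℝ} (hf : Sm f) (hg : Sm g) :
    dy (fun p => f p * g p) = fun p => dy f p * g p + f p * dy g p := by
  funext p
  simp only [dy]
  rw [fderiv_fun_mul (hf.diff p) (hg.diff p)]
  simp; ring

lemma dx_add {f g : ℝ × ℝ → ℝ} (hf : Sm f) (hg : Sm g) :
    dx (fun p => f p + g p) = fun p => dx f p + dx g p := by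
  funext p
  simp only [dx]
  rw [fderiv_fun_add (hf.diff p) (hg.diff p)]
  simp

lemma dy_add {f g : ℝ × ℝ → ℝ} (hf : Sm f) (hg : Sm g) :
    dy (fun p => f p + g p) = fun p => dy f p + dy g p := by
  funext p
  simp only [dy]
  rw [fderiv_fun_add (hf.diff p) (hg.diff p)]
  simp

lemma dx_const (c : ℝ) : dx (fun _ => c) = fun _ => 0 := by
  funext p; simp [dx]

lemma dy_const (c : ℝ) : dy (fun _ => c) = fun _ => 0 := by
  funext p; simp [dy]

lemma dx_fst {h : ℝ → ℝ} (hh : ContDiff ℝ ∞ h) : dx (fun p => h p.1) = fun p => deriv h p.1 := by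
  funext p
  have h1 : HasFDerivAt (fun q : ℝ × ℝ => h q.1) _ p :=
    ((hh.differentiable (by simp) p.1).hasDerivAt.hasFDerivAt).comp p hasFDerivAt_fst
  simp [dx, h1.fderiv]

lemma dy_fst {h : ℝ → ℝ} (hh : ContDiff ℝ ∞ h) : dy (fun p => h p.1) = fun _ => 0 := by
  funext p
  have h1 : HasFDerivAt (fun q : ℝ × ℝ => h q.1) _ p :=
    ((hh.differentiable (by simp) p.1).hasDerivAt.hasFDerivAt).comp p hasFDerivAt_fst
  simp [dy, h1.fderiv]

lemma dx_snd {h : ℝ → ℝ} (hh : ContDiff ℝ ∞ h) : dx (fun p => h p.2) = fun _ => 0 := by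
  funext p
  have h1 : HasFDerivAt (fun q : ℝ × ℝ => h q.2) _ p :=
    ((hh.differentiable (by simp) p.2).hasDerivAt.hasFDerivAt).comp p hasFDerivAt_snd
  simp [dx, h1.fderiv]

lemma dy_snd {h : ℝ → ℝ} (hh : ContDiff ℝ ∞ h) : dy (fun p => h p.2) = fun p => deriv h p.2 := by
  funext p
  have h1 : HasFDerivAt (fun q : ℝ × ℝ => h q.2) _ p :=
    ((hh.differentiable (by simp) p.2).hasDerivAt.hasFDerivAt).comp p hasFDerivAt_snd
  simp [dy, h1.fderiv]

lemma dxdy_comm {f : ℝ × ℝ → ℝ} (hf : Sm f) : dy (dx f) = dx (dy f) := by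
  funext p
  have hd : DifferentiableAt ℝ (fderiv ℝ f) p :=
    (hf.cd.fderiv_right (m := ∞) (by simp)).differentiable (by simp) p
  have hs : IsSymmSndFDerivAt ℝ f p := by
    apply hf.cd.contDiffAt.isSymmSndFDerivAt
    simp only [minSmoothness_of_isRCLikeNormedField]
    exact WithTop.coe_le_coe.2 (le_top : (2 : ℕ∞) ≤ ⊤)
  change fderiv ℝ (fun y => fderiv ℝ f y (1, 0)) p (0, 1) = fderiv ℝ (fun y => fderiv ℝ f y (0, 1)) p (1, 0)
  rw [fderiv_clm_apply hd (differentiableAt_const _), fderiv_clm_apply hd (differentiableAt_const _)]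
  simpa using hs.eq (0, 1) (1, 0)

lemma hasDerivAt_slice_fst {f : ℝ × ℝ → ℝ} {a b : ℝ} (hf : DifferentiableAt ℝ f (a, b)) :
    HasDerivAt (fun s => f (s, b)) (dx f (a, b)) a := by
  have h1 : HasDerivAt (fun s : ℝ => (s, b)) ((1 : ℝ), (0 : ℝ)) a :=
    (hasDerivAt_id a).prodMk (hasDerivAt_const a b)
  exact hf.hasFDerivAt.comp_hasDerivAt a h1

lemma hasDerivAt_slice_snd {f : ℝ × ℝ → ℝ} {a b : ℝ} (hf : DifferentiableAt ℝ f (a, b)) :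
    HasDerivAt (fun s => f (a, s)) (dy f (a, b)) b := by
  have h1 : HasDerivAt (fun s : ℝ => (a, s)) ((0 : ℝ), (1 : ℝ)) b :=
    (hasDerivAt_const b a).prodMk (hasDerivAt_id b)
  exact hf.hasFDerivAt.comp_hasDerivAt b h1

lemma hcs_dx {f : ℝ × ℝ → ℝ} (hc : HasCompactSupport f) : HasCompactSupport (dx f) :=
  hc.fderiv_apply ℝ (1, 0)

lemma hcs_dy {f : ℝ × ℝ → ℝ} (hc : HasCompactSupport f) : HasCompactSupport (dy f) :=
  hc.fderiv_apply ℝ (0, 1)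

lemma Sm.integrable {f : ℝ × ℝ → ℝ} (hf : Sm f) (hc : HasCompactSupport f) : Integrable f :=
  hf.cont.integrable_of_hasCompactSupport hc

lemma integral_dx_zero {f : ℝ × ℝ → ℝ} (hf : Sm f) (hc : HasCompactSupport f) :
    ∫ p, dx f p = 0 := by
  have h := integral_mul_fderiv_eq_neg_fderiv_mul_of_integrable (μ := (volume : Measure (ℝ × ℝ)))
    (f := fun _ : ℝ × ℝ => (1 : ℝ)) (g := f) (v := ((1 : ℝ), (0 : ℝ)))
    (by simp) (by simpa using (show Integrable (fun p => fderiv ℝ f p (1, 0)) (volume : Measure (ℝ × ℝ)) from hf.dx.integrable (hcs_dx hc))) (by simpa using hf.integrable hc)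
    (fun x _ => differentiableAt_const _) (fun x _ => hf.diff x)
  simpa [dx] using h

lemma integral_dy_zero {f : ℝ × ℝ → ℝ} (hf : Sm f) (hc : HasCompactSupport f) :
    ∫ p, dy f p = 0 := by
  have h := integral_mul_fderiv_eq_neg_fderiv_mul_of_integrable (μ := (volume : Measure (ℝ × ℝ)))
    (f := fun _ : ℝ × ℝ => (1 : ℝ)) (g := f) (v := ((0 : ℝ), (1 : ℝ)))
    (by simp) (by simpa using (show Integrable (fun p => fderiv ℝ f p (0, 1)) (volume : Measure (ℝ × ℝ)) from hf.dy.integrable (hcs_dy hc))) (by simpa using hf.integrable hc)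
    (fun x _ => differentiableAt_const _) (fun x _ => hf.diff x)
  simpa [dy] using h

end Calculus

end

section
section Angular
open scoped ContDiff

/-- `f` vanishes outside the strip `|θ| < om`. -/
def Van (om : ℝ) (f : ℝ × ℝ → ℝ) : Prop := ∀ p : ℝ × ℝ, om ≤ |p.2| → f p = 0

/-- Nonnegative smooth compactly supported weights. -/
structure Wt (χ : ℝ → ℝ) : Prop where
  sm : ContDiff ℝ ∞ χ
  cs : HasCompactSupport χ
  nn : ∀ t, 0 ≤ χ t

lemma Van.mul_left {om : ℝ} {f : ℝ × ℝ → ℝ} (hf : Van om f) (g : ℝ × ℝ → ℝ) :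
    Van om (fun p => g p * f p) := fun p hp => by simp [hf p hp]

lemma Van.mul_right {om : ℝ} {f : ℝ × ℝ → ℝ} (hf : Van om f) (g : ℝ × ℝ → ℝ) :
    Van om (fun p => f p * g p) := fun p hp => by simp [hf p hp]

lemma Van.add {om : ℝ} {f g : ℝ × ℝ → ℝ} (hf : Van om f) (hg : Van om g) :
    Van om (fun p => f p + g p) := fun p hp => by simp [hf p hp, hg p hp]

lemma Van.sub {om : ℝ} {f g : ℝ × ℝ → ℝ} (hf : Van om f) (hg : Van om g) :
    Van om (fun p => f p - g p) := fun p hp => by simp [hf p hp, hg p hp]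

lemma Van.sq {om : ℝ} {f : ℝ × ℝ → ℝ} (hf : Van om f) :
    Van om (fun p => f p ^ 2) := fun p hp => by simp [hf p hp]

lemma Van.dx {om : ℝ} {f : ℝ × ℝ → ℝ} (hs : Sm f) (hf : Van om f) : Van om (dx f) := by
  rintro ⟨a, b⟩ hp
  have h := hasDerivAt_slice_fst (hs.diff (a, b))
  have h2 : (fun s => f (s, b)) = fun _ => 0 := funext fun s => hf (s, b) hp
  rw [h2] at h
  exact h.unique (hasDerivAt_const a 0)

lemma Van.dy {om : ℝ} {f : ℝ × ℝ → ℝ} (hs : Sm f) (hf : Van om f) : Van om (dy f) := by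
  rintro ⟨a, b⟩ hp
  have h := hasDerivAt_slice_snd (hs.diff (a, b))
  simp only at hp
  rcases le_total 0 b with hb | hb
  · rw [abs_of_nonneg hb] at hp
    have h1 := h.hasDerivWithinAt (s := Ici b)
    have h2 : HasDerivWithinAt (fun s => f (a, s)) 0 (Ici b) b := by
      refine (hasDerivWithinAt_const b (Ici b) (0 : ℝ)).congr (fun s hs => ?_) ?_
      · exact hf (a, s) (hp.trans (hs.trans (le_abs_self _)))
      · exact hf (a, b) (hp.trans (le_abs_self _))
    exact (uniqueDiffOn_Ici b b self_mem_Ici).eq_deriv _ h1 h2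
  · rw [abs_of_nonpos hb] at hp
    have h1 := h.hasDerivWithinAt (s := Iic b)
    have h2 : HasDerivWithinAt (fun s => f (a, s)) 0 (Iic b) b := by
      refine (hasDerivWithinAt_const b (Iic b) (0 : ℝ)).congr (fun s hs => ?_) ?_
      · exact hf (a, s) (hp.trans ((neg_le_neg hs).trans (neg_le_abs _)))
      · exact hf (a, b) (hp.trans (neg_le_abs _))
    exact (uniqueDiffOn_Iic b b self_mem_Iic).eq_deriv _ h1 h2

lemma hcs_of {om : ℝ} {f : ℝ × ℝ → ℝ} {χ : ℝ → ℝ} (hc : HasCompactSupport χ) (hf : Van om f) :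
    HasCompactSupport (fun p => χ p.1 * f p) := by
  apply HasCompactSupport.of_support_subset_isCompact (hc.isCompact.prod (isCompact_Icc (a := -om) (b := om)))
  intro p hp
  simp only [Function.mem_support, ne_eq, mul_eq_zero, not_or] at hp
  refine ⟨subset_tsupport _ hp.1, ?_⟩
  have : |p.2| < om := by
    by_contra h
    exact hp.2 (hf p (not_lt.1 h))
  exact ⟨(abs_lt.1 this).1.le, (abs_lt.1 this).2.le⟩

lemma integrable_of {om : ℝ} {f : ℝ × ℝ → ℝ} {χ : ℝ → ℝ} (hχ : Wt χ) (hs : Sm f) (hf : Van om f) :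
    Integrable (fun p => χ p.1 * f p) :=
  ((Sm.of_fst hχ.sm).mul hs).integrable (hcs_of hχ.cs hf)

lemma integral_dy_zero' {om : ℝ} {f : ℝ × ℝ → ℝ} {χ : ℝ → ℝ} (hχ : Wt χ) (hs : Sm f) (hf : Van om f) :
    ∫ p, χ p.1 * dy f p = 0 := by
  have h := integral_dy_zero ((Sm.of_fst hχ.sm).mul hs) (hcs_of hχ.cs hf)
  rw [dy_mul (Sm.of_fst hχ.sm) hs, dy_fst hχ.sm] at h
  simpa using h

lemma Sm.pow {f : ℝ × ℝ → ℝ} (hf : Sm f) (n : ℕ) : Sm (fun p => f p ^ n) := ContDiff.pow hf n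

/-- Poincaré inequality in the angular variable. -/
lemma poinc {om : ℝ} (hom : om ≤ Real.pi) {f : ℝ × ℝ → ℝ} {χ : ℝ → ℝ} (hχ : Wt χ) (hs : Sm f)
    (hf : Van om f) :
    ∫ p, χ p.1 * f p ^ 2 ≤ 4 * Real.pi ^ 2 * ∫ p, χ p.1 * dy f p ^ 2 := by
  have hθ : Sm (fun p : ℝ × ℝ => p.2) := contDiff_snd
  have hg : Sm (fun p => p.2 * (f p * f p)) := hθ.mul (hs.mul hs)
  have hgv : Van om (fun p => p.2 * (f p * f p)) := (hf.mul_left f).mul_left _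
  have h0 := integral_dy_zero' hχ hg hgv
  have hd : dy (fun p => p.2 * (f p * f p)) = fun p => f p * f p + p.2 * (2 * (f p * dy f p)) := by
    rw [dy_mul hθ (hs.mul hs), dy_mul hs hs]
    have : dy (fun p : ℝ × ℝ => p.2) = fun _ => 1 := by
      rw [dy_snd (h := fun x => x) contDiff_id]; simp
    rw [this]
    funext p; ring
  rw [hd] at h0
  have i1 := integrable_of hχ (hs.pow 2) hf.sq
  have i2 := integrable_of hχ (hs.dy.pow 2) (hf.dy hs).sq
  have i3 := integrable_of hχ hg.dy (hgv.dy hg)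
  rw [hd] at i3
  have key : ∫ p, (χ p.1 * f p ^ 2 / 2 - 2 * Real.pi ^ 2 * (χ p.1 * dy f p ^ 2)) ≤
      ∫ p, χ p.1 * (f p * f p + p.2 * (2 * (f p * dy f p))) := by
    apply integral_mono ((i1.div_const 2).sub (i2.const_mul _)) i3
    intro p
    change χ p.1 * f p ^ 2 / 2 - 2 * Real.pi ^ 2 * (χ p.1 * dy f p ^ 2) ≤ _
    by_cases hp : |p.2| ≤ Real.pi
    · have h1 : p.2 ^ 2 ≤ Real.pi ^ 2 := by
        rw [← sq_abs p.2]; exact pow_le_pow_left₀ (abs_nonneg _) hp 2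
      have h2 := hχ.nn p.1
      have h3 : f p ^ 2 / 2 - 2 * Real.pi ^ 2 * dy f p ^ 2 ≤ f p * f p + p.2 * (2 * (f p * dy f p)) := by
        nlinarith [sq_nonneg (f p + 2 * p.2 * dy f p), mul_le_mul_of_nonneg_right h1 (sq_nonneg (dy f p))]
      nlinarith [mul_le_mul_of_nonneg_left h3 h2]
    · have h1 : om ≤ |p.2| := hom.trans (not_le.1 hp).le
      simp [hf p h1, hf.dy hs p h1]
  rw [h0, integral_sub (i1.div_const 2) (i2.const_mul _), integral_div, integral_const_mul] at key
  linarith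

lemma cos_half_lower {om θ : ℝ} (hom : om < Real.pi) (h : |θ| ≤ om) :
    Real.cos (om / 2) ≤ Real.cos (θ / 2) := by
  rw [← Real.cos_abs (θ / 2)]
  apply Real.cos_le_cos_of_nonneg_of_le_pi (abs_nonneg _) (by linarith [Real.pi_pos, abs_nonneg θ])
  rw [abs_div, abs_two]; linarith

/-- The half-angle cosine and sine as functions on the plane. -/
def cH : ℝ × ℝ → ℝ := fun p => Real.cos (p.2 / 2)
def sH : ℝ × ℝ → ℝ := fun p => Real.sin (p.2 / 2)

lemma cH_sm : Sm cH := Sm.of_snd (h := fun x => Real.cos (x / 2)) (by fun_prop)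
lemma sH_sm : Sm sH := Sm.of_snd (h := fun x => Real.sin (x / 2)) (by fun_prop)

lemma dy_cH : dy cH = fun p => - sH p / 2 := by
  have := dy_snd (h := fun x => Real.cos (x / 2)) (by fun_prop)
  change dy (fun p => Real.cos (p.2 / 2)) = _
  rw [this]
  funext p
  have h : HasDerivAt (fun x => Real.cos (x / 2)) (-Real.sin (p.2 / 2) * (1 / 2)) p.2 :=
    ((hasDerivAt_id p.2).div_const 2).cos
  rw [h.deriv, sH]; ring

lemma dy_sH : dy sH = fun p => cH p / 2 := by
  have := dy_snd (h := fun x => Real.sin (x / 2)) (by fun_prop)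
  change dy (fun p => Real.sin (p.2 / 2)) = _
  rw [this]
  funext p
  have h : HasDerivAt (fun x => Real.sin (x / 2)) (Real.cos (p.2 / 2) * (1 / 2)) p.2 :=
    ((hasDerivAt_id p.2).div_const 2).sin
  rw [h.deriv, cH]; ring

lemma sc_one (p : ℝ × ℝ) : sH p ^ 2 + cH p ^ 2 = 1 := Real.sin_sq_add_cos_sq _

/-- Division by the cube of the half-angle cosine. -/
lemma exists_quot {om : ℝ} (hom : om < Real.pi) {ψ : ℝ × ℝ → ℝ} (hs : Sm ψ) (hv : Van om ψ) :
    ∃ m, Sm m ∧ Van om m ∧ ψ = fun p => (cH p * (cH p * cH p)) * m p := by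
  set om2 := (om + Real.pi) / 2 with hom2
  refine ⟨fun p => ψ p / (cH p * (cH p * cH p)), ?_, fun p hp => by simp [hv p hp], ?_⟩
  · rw [Sm, contDiff_iff_contDiffAt]
    intro p
    by_cases hp : |p.2| < Real.pi
    · have : 0 < cH p := by
        apply Real.cos_pos_of_mem_Ioo
        rw [abs_lt] at hp
        constructor <;> linarith
      exact hs.cd.contDiffAt.div (cH_sm.mul (cH_sm.mul cH_sm)).cd.contDiffAt (by positivity)
    · have : (fun p => ψ p / (cH p * (cH p * cH p))) =ᶠ[𝓝 p] fun _ => 0 := by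
        have ho : IsOpen {q : ℝ × ℝ | om < |q.2|} := isOpen_lt continuous_const (by fun_prop)
        filter_upwards [ho.mem_nhds (show om < |p.2| by linarith)] with q hq
        simp [hv q (le_of_lt hq)]
      exact contDiffAt_const.congr_of_eventuallyEq this
  · funext p
    by_cases hp : om ≤ |p.2|
    · simp [hv p hp]
    · have : 0 < cH p := by
        apply Real.cos_pos_of_mem_Ioo
        rw [not_le, abs_lt] at hp
        constructor <;> linarith
      field_simp

end Angular

end

section
section Pos
open scoped ContDiff

lemma dy_eq_of {f : ℝ × ℝ → ℝ} (hf : Sm f) {a b d : ℝ} (h : HasDerivAt (fun s => f (a, s)) d b) :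
    dy f (a, b) = d := (hasDerivAt_slice_snd (hf.diff (a, b))).unique h

lemma dx_eq_of {f : ℝ × ℝ → ℝ} (hf : Sm f) {a b d : ℝ} (h : HasDerivAt (fun s => f (s, b)) d a) :
    dx f (a, b) = d := (hasDerivAt_slice_fst (hf.diff (a, b))).unique h

lemma Sm.hy {f : ℝ × ℝ → ℝ} (hf : Sm f) (a b : ℝ) : HasDerivAt (fun s => f (a, s)) (Griffith.dy f (a, b)) b :=
  hasDerivAt_slice_snd (hf.diff (a, b))

lemma Sm.hx {f : ℝ × ℝ → ℝ} (hf : Sm f) (a b : ℝ) : HasDerivAt (fun s => f (s, b)) (Griffith.dx f (a, b)) a :=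
  hasDerivAt_slice_fst (hf.diff (a, b))

/-- The auxiliary flux in the angular identity. -/
def Zf (m : ℝ × ℝ → ℝ) : ℝ × ℝ → ℝ := fun p =>
  2 * (sH p * (cH p * cH p * cH p) * ((cH p * dy m p - 3 / 2 * (sH p * m p)) * (cH p * dy m p - 3 / 2 * (sH p * m p))))
  + (3 * (sH p * sH p) + 3 / 2 * (cH p * cH p)) * (cH p * cH p * cH p) * (m p * (cH p * dy m p - 3 / 2 * (sH p * m p)))
  - 3 / 2 * (sH p * (cH p * cH p * cH p) * (m p * m p))
  + (3 * (sH p * sH p * sH p * (cH p * cH p * cH p)) + 3 / 2 * (sH p * (cH p * cH p * cH p * cH p * cH p))) * (m p * m p)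

lemma Zf_sm {m : ℝ × ℝ → ℝ} (hm : Sm m) : Sm (Zf m) := by
  have h1 := cH_sm.cd
  have h2 := sH_sm.cd
  have h3 := hm.cd
  have h4 := hm.dy.cd
  unfold Sm Zf
  fun_prop

lemma Zf_van {om : ℝ} {m : ℝ × ℝ → ℝ} (hm : Sm m) (hv : Van om m) : Van om (Zf m) := by
  intro p hp
  simp [Zf, hv p hp, hv.dy hm p hp]

lemma angular_identity {m ψ : ℝ × ℝ → ℝ} (hm : Sm m) (hψ : ψ = fun p => (cH p * (cH p * cH p)) * m p) (p : ℝ × ℝ) :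
    dy (dy ψ) p ^ 2 - 5 / 2 * dy ψ p ^ 2 + 9 / 16 * ψ p ^ 2 =
      cH p ^ 4 * (cH p * dy (dy m) p - sH p * dy m p) ^ 2 - dy (Zf m) p := by
  obtain ⟨a, b⟩ := p
  have hc : ∀ b, HasDerivAt (fun s => cH (a, s)) (-sH (a, b) / 2) b := fun b => by
    have := cH_sm.hy a b; rwa [dy_cH] at this
  have hs : ∀ b, HasDerivAt (fun s => sH (a, s)) (cH (a, b) / 2) b := fun b => by
    have := sH_sm.hy a b; rwa [dy_sH] at this
  have h0 := hm.hy a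
  have h1 := hm.dy.hy a
  have hψs : Sm ψ := hψ ▸ (cH_sm.mul (cH_sm.mul cH_sm)).mul hm
  have e1 : dy ψ = fun p => cH p * cH p * (cH p * dy m p - 3 / 2 * (sH p * m p)) := by
    funext ⟨a', b⟩
    have hc : HasDerivAt (fun s => cH (a', s)) (-sH (a', b) / 2) b := by
      have := cH_sm.hy a' b; rwa [dy_cH] at this
    apply dy_eq_of hψs
    subst hψ
    refine ((hc.mul (hc.mul hc)).mul (hm.hy a' b)).congr_deriv ?_
    simp only [Pi.mul_apply]
    ring
  have e2 : dy (dy ψ) (a, b) = 2 * (cH (a, b) * (-sH (a, b) / 2)) * (cH (a, b) * dy m (a, b) - 3 / 2 * (sH (a, b) * m (a, b)))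
      + cH (a, b) * cH (a, b) * (-sH (a, b) / 2 * dy m (a, b) + cH (a, b) * dy (dy m) (a, b) - 3 / 2 * (cH (a, b) / 2 * m (a, b) + sH (a, b) * dy m (a, b))) := by
    apply dy_eq_of hψs.dy
    rw [e1]
    refine (((hc b).mul (hc b)).mul (((hc b).mul (h1 b)).sub (((hs b).mul (h0 b)).const_mul (3 / 2)))).congr_deriv ?_
    simp only [Pi.mul_apply, Pi.sub_apply]
    ring
  have e3 := dy_eq_of (Zf_sm hm) (a := a) (b := b) (d := _)
    (by
      have hP := ((hc b).mul (h1 b)).sub (((hs b).mul (h0 b)).const_mul (3 / 2))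
      have hc3 := ((hc b).mul (hc b)).mul (hc b)
      exact ((((((hs b).mul hc3).mul (hP.mul hP)).const_mul 2).add
        ((((((hs b).mul (hs b)).const_mul 3).add (((hc b).mul (hc b)).const_mul (3 / 2))).mul hc3).mul ((h0 b).mul hP))).sub
        (((((hs b).mul hc3).mul ((h0 b).mul (h0 b)))).const_mul (3 / 2))).add
        (((((((hs b).mul (hs b)).mul (hs b)).mul hc3).const_mul 3).add
          (((hs b).mul ((hc3.mul (hc b)).mul (hc b))).const_mul (3 / 2))).mul ((h0 b).mul (h0 b))))
  rw [e3, e2, e1, hψ]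
  simp only [Pi.mul_apply, Pi.sub_apply, Pi.add_apply]
  have h := sc_one (a, b)
  generalize cH (a, b) = c at *
  generalize sH (a, b) = s at *
  generalize dy (dy m) (a, b) = m2
  generalize dy m (a, b) = m1
  generalize m (a, b) = m0
  clear e1 e2 e3 hc hs h0 h1
  grind


lemma wint_mono {om : ℝ} {χ : ℝ → ℝ} (hχ : Wt χ) {f g : ℝ × ℝ → ℝ} (hf : Sm f) (hfv : Van om f)
    (hg : Sm g) (hgv : Van om g) (h : ∀ p : ℝ × ℝ, |p.2| < om → f p ≤ g p) :
    ∫ p, χ p.1 * f p ≤ ∫ p, χ p.1 * g p := by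
  apply integral_mono (integrable_of hχ hf hfv) (integrable_of hχ hg hgv)
  intro p
  by_cases hp : |p.2| < om
  · exact mul_le_mul_of_nonneg_left (h p hp) (hχ.nn _)
  · simp [hfv p (not_lt.1 hp), hgv p (not_lt.1 hp)]

lemma wint_add {om : ℝ} {χ : ℝ → ℝ} (hχ : Wt χ) {f g : ℝ × ℝ → ℝ} (hf : Sm f) (hfv : Van om f)
    (hg : Sm g) (hgv : Van om g) :
    ∫ p, χ p.1 * (f p + g p) = (∫ p, χ p.1 * f p) + ∫ p, χ p.1 * g p := by
  rw [← integral_add (integrable_of hχ hf hfv) (integrable_of hχ hg hgv)]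
  congr 1; funext p; ring

lemma wint_sub {om : ℝ} {χ : ℝ → ℝ} (hχ : Wt χ) {f g : ℝ × ℝ → ℝ} (hf : Sm f) (hfv : Van om f)
    (hg : Sm g) (hgv : Van om g) :
    ∫ p, χ p.1 * (f p - g p) = (∫ p, χ p.1 * f p) - ∫ p, χ p.1 * g p := by
  rw [← integral_sub (integrable_of hχ hf hfv) (integrable_of hχ hg hgv)]
  congr 1; funext p; ring

lemma wint_cmul {χ : ℝ → ℝ} (c : ℝ) (f : ℝ × ℝ → ℝ) :
    ∫ p : ℝ × ℝ, χ p.1 * (c * f p) = c * ∫ p : ℝ × ℝ, χ p.1 * f p := by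
  rw [← integral_const_mul]
  congr 1; funext p; ring

lemma Sm.cmul {f : ℝ × ℝ → ℝ} (c : ℝ) (hf : Sm f) : Sm (fun p => c * f p) := (Sm.const c).mul hf

lemma wint_nonneg {χ : ℝ → ℝ} (hχ : Wt χ) {f : ℝ × ℝ → ℝ} (h : ∀ p, 0 ≤ f p) :
    0 ≤ ∫ p : ℝ × ℝ, χ p.1 * f p := integral_nonneg fun p => mul_nonneg (hχ.nn _) (h p)

lemma ang_coer {om : ℝ} (hom0 : 0 < om) (hom : om < Real.pi) :
    ∃ κ > 0, ∀ (χ : ℝ → ℝ) (ψ : ℝ × ℝ → ℝ), Wt χ → Sm ψ → Van om ψ →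
      κ * ((∫ p, χ p.1 * dy (dy ψ) p ^ 2) + (∫ p, χ p.1 * dy ψ p ^ 2) + ∫ p, χ p.1 * ψ p ^ 2) ≤
        (∫ p, χ p.1 * dy (dy ψ) p ^ 2) - 5 / 2 * (∫ p, χ p.1 * dy ψ p ^ 2) + 9 / 16 * ∫ p, χ p.1 * ψ p ^ 2 := by
  set c0 := Real.cos (om / 2) with hc0
  have hc0p : 0 < c0 := Real.cos_pos_of_mem_Ioo ⟨by linarith, by linarith⟩
  set D : ℝ := 1 + (7 + 68 * Real.pi ^ 2) * (4 * Real.pi ^ 2) / c0 ^ 6 with hD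
  have hDp : 0 < D := by positivity
  refine ⟨1 / D, by positivity, fun χ ψ hχ hψ hv => ?_⟩
  obtain ⟨m, hm, hmv, hψm⟩ := exists_quot hom hψ hv
  have hlow : ∀ p : ℝ × ℝ, |p.2| < om → c0 ≤ cH p := fun p hp => cos_half_lower hom hp.le
  have hw : Sm (fun p => cH p * cH p * dy m p) := (cH_sm.mul cH_sm).mul hm.dy
  have hwv : Van om (fun p => cH p * cH p * dy m p) := (hmv.dy hm).mul_left _
  have hwd : dy (fun p => cH p * cH p * dy m p) = fun p => cH p * (cH p * dy (dy m) p - sH p * dy m p) := by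
    rw [dy_mul (cH_sm.mul cH_sm) hm.dy, dy_mul cH_sm cH_sm, dy_cH]
    funext p; ring
  have hd1 : dy ψ = fun p => cH p * cH p * (cH p * dy m p - 3 / 2 * (sH p * m p)) := by
    rw [hψm, dy_mul (cH_sm.mul (cH_sm.mul cH_sm)) hm, dy_mul cH_sm (cH_sm.mul cH_sm), dy_mul cH_sm cH_sm, dy_cH]
    funext p; ring
  have hc1 : ∀ p, cH p ^ 2 ≤ 1 := fun p => by nlinarith [sc_one p, sq_nonneg (sH p)]
  have hs1 : ∀ p, sH p ^ 2 ≤ 1 := fun p => by nlinarith [sc_one p, sq_nonneg (cH p)]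
  have h0 := integral_dy_zero' hχ (Zf_sm hm) (Zf_van hm hmv)
  -- the identity integrated
  have hQ : (∫ p, χ p.1 * dy (dy ψ) p ^ 2) - 5 / 2 * (∫ p, χ p.1 * dy ψ p ^ 2) + 9 / 16 * ∫ p, χ p.1 * ψ p ^ 2
      = ∫ p, χ p.1 * (cH p * dy (fun p => cH p * cH p * dy m p) p) ^ 2 := by
    have e1 : (fun p => χ p.1 * (cH p * dy (fun p => cH p * cH p * dy m p) p) ^ 2) =
      fun p => χ p.1 * ((dy (dy ψ) p ^ 2 - 5 / 2 * dy ψ p ^ 2 + 9 / 16 * ψ p ^ 2) + dy (Zf m) p) := by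
      funext p
      rw [angular_identity hm hψm p, hwd]; ring
    have v0 := hv.sq
    have v1 : Van om (fun p => dy ψ p ^ 2) := (hv.dy hψ).sq
    have v2 : Van om (fun p => dy (dy ψ) p ^ 2) := ((hv.dy hψ).dy hψ.dy).sq
    have s0 := hψ.pow 2
    have s1 := hψ.dy.pow 2
    have s2 := hψ.dy.dy.pow 2
    rw [e1, wint_add hχ ((s2.sub (s1.cmul _)).add (s0.cmul _)) ((v2.sub (v1.mul_left _)).add (v0.mul_left _)) (Zf_sm hm).dy ((Zf_van hm hmv).dy (Zf_sm hm)), h0,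
      wint_add hχ (s2.sub (s1.cmul _)) (v2.sub (v1.mul_left _)) (s0.cmul _) (v0.mul_left _), wint_sub hχ s2 v2 (s1.cmul _) (v1.mul_left _),
      wint_cmul, wint_cmul]
    ring
  have hA : c0 ^ 2 * ∫ p, χ p.1 * dy (fun p => cH p * cH p * dy m p) p ^ 2 ≤ ∫ p, χ p.1 * (cH p * dy (fun p => cH p * cH p * dy m p) p) ^ 2 := by
    rw [← wint_cmul]
    apply wint_mono hχ ((hw.dy.pow 2).cmul _) (((hwv.dy hw).sq).mul_left _) ((cH_sm.mul hw.dy).pow 2) ((hwv.dy hw).mul_left _).sq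
    intro p hp
    rw [mul_pow]
    exact mul_le_mul_of_nonneg_right (pow_le_pow_left₀ hc0p.le (hlow p hp) 2) (sq_nonneg _)
  have hB := poinc hom.le hχ hw hwv
  have hC : c0 ^ 4 * ∫ p, χ p.1 * dy m p ^ 2 ≤ ∫ p, χ p.1 * (cH p * cH p * dy m p) ^ 2 := by
    rw [← wint_cmul]
    apply wint_mono hχ ((hm.dy.pow 2).cmul _) (((hmv.dy hm).sq).mul_left _) (hw.pow 2) hwv.sq
    intro p hp
    have := mul_le_mul_of_nonneg_right (pow_le_pow_left₀ hc0p.le (hlow p hp) 4) (sq_nonneg (dy m p))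
    nlinarith
  have hM := poinc hom.le hχ hm hmv
  have hP0 : ∫ p, χ p.1 * ψ p ^ 2 ≤ ∫ p, χ p.1 * m p ^ 2 := by
    apply wint_mono hχ (hψ.pow 2) hv.sq (hm.pow 2) hmv.sq
    intro p hp
    rw [hψm]
    have h6 : cH p ^ 6 ≤ 1 := by
      have := pow_le_one₀ (n := 3) (sq_nonneg (cH p)) (hc1 p)
      nlinarith
    have := mul_le_mul_of_nonneg_right h6 (sq_nonneg (m p))
    nlinarith
  have hP1 : ∫ p, χ p.1 * dy ψ p ^ 2 ≤ 2 * (∫ p, χ p.1 * dy m p ^ 2) + 9 / 2 * ∫ p, χ p.1 * m p ^ 2 := by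
    rw [← wint_cmul, ← wint_cmul, ← wint_add hχ ((hm.dy.pow 2).cmul _) (((hmv.dy hm).sq).mul_left _) ((hm.pow 2).cmul _) (hmv.sq.mul_left _)]
    apply wint_mono hχ (hψ.dy.pow 2) (hv.dy hψ).sq (((hm.dy.pow 2).cmul _).add ((hm.pow 2).cmul _))
      ((((hmv.dy hm).sq).mul_left _).add (hmv.sq.mul_left _))
    intro p hp
    rw [hd1]
    have h4 : cH p ^ 4 ≤ 1 := by
      have := pow_le_one₀ (n := 2) (sq_nonneg (cH p)) (hc1 p)
      nlinarith
    have e : (cH p * dy m p - 3 / 2 * (sH p * m p)) ^ 2 ≤ 2 * dy m p ^ 2 + 9 / 2 * m p ^ 2 := by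
      have a1 := mul_le_mul_of_nonneg_right (hc1 p) (sq_nonneg (dy m p))
      have a2 := mul_le_mul_of_nonneg_right (hs1 p) (sq_nonneg (m p))
      nlinarith [sq_nonneg (cH p * dy m p + 3 / 2 * (sH p * m p))]
    have := mul_le_mul_of_nonneg_right h4 (sq_nonneg (cH p * dy m p - 3 / 2 * (sH p * m p)))
    simp only
    nlinarith
  have n0 := wint_nonneg hχ (f := fun p => ψ p ^ 2) (fun p => sq_nonneg _)
  have nA := wint_nonneg hχ (f := fun p => (cH p * dy (fun p => cH p * cH p * dy m p) p) ^ 2) (fun p => sq_nonneg _)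
  rw [hQ]
  generalize (∫ p, χ p.1 * (cH p * dy (fun p => cH p * cH p * dy m p) p) ^ 2) = A at *
  generalize (∫ p, χ p.1 * dy (fun p => cH p * cH p * dy m p) p ^ 2) = W2 at *
  generalize (∫ p, χ p.1 * (cH p * cH p * dy m p) ^ 2) = W at *
  generalize (∫ p, χ p.1 * dy m p ^ 2) = M1 at *
  generalize (∫ p, χ p.1 * m p ^ 2) = M0 at *
  generalize (∫ p, χ p.1 * dy (dy ψ) p ^ 2) = P2 at *
  generalize (∫ p, χ p.1 * dy ψ p ^ 2) = P1 at *
  generalize (∫ p, χ p.1 * ψ p ^ 2) = P0 at *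
  have hpi := Real.pi_pos
  have hM1 : M1 ≤ 4 * Real.pi ^ 2 / c0 ^ 6 * A := by
    rw [div_mul_eq_mul_div, le_div_iff₀ (by positivity)]
    have := mul_le_mul_of_nonneg_left hA (show 0 ≤ 4 * Real.pi ^ 2 by positivity)
    have h5 : c0 ^ 2 * (c0 ^ 4 * M1) ≤ c0 ^ 2 * (4 * Real.pi ^ 2 * W2) := mul_le_mul_of_nonneg_left (hC.trans hB) (by positivity)
    nlinarith
  rw [one_div, inv_mul_le_iff₀ hDp]
  have : D * A = A + (7 + 68 * Real.pi ^ 2) * (4 * Real.pi ^ 2 / c0 ^ 6 * A) := by rw [hD]; ring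
  rw [this]
  have h7 := mul_le_mul_of_nonneg_left hM1 (show 0 ≤ 7 + 68 * Real.pi ^ 2 by positivity)
  nlinarith

end Pos

end

section
section Form
open scoped ContDiff

lemma integrable_of_gen {om : ℝ} {f : ℝ × ℝ → ℝ} {χ : ℝ → ℝ} (hχ : ContDiff ℝ ∞ χ) (hc : HasCompactSupport χ)
    (hs : Sm f) (hf : Van om f) : Integrable (fun p => χ p.1 * f p) :=
  ((Sm.of_fst hχ).mul hs).integrable (hcs_of hc hf)

/-- `f` is integrable with integral `v`. -/
def HI {α : Type*} [MeasureSpace α] (f : α → ℝ) (v : ℝ) : Prop := Integrable f ∧ ∫ p, f p = v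

lemma HI.of {α : Type*} [MeasureSpace α] {f : α → ℝ} (h : Integrable f) : HI f (∫ p, f p) := ⟨h, rfl⟩
lemma HI.add {α : Type*} [MeasureSpace α] {f g : α → ℝ} {v w : ℝ} (h : HI f v) (k : HI g w) :
    HI (fun p => f p + g p) (v + w) := ⟨h.1.add k.1, by rw [integral_add h.1 k.1, h.2, k.2]⟩
lemma HI.sub {α : Type*} [MeasureSpace α] {f g : α → ℝ} {v w : ℝ} (h : HI f v) (k : HI g w) :
    HI (fun p => f p - g p) (v - w) := ⟨h.1.sub k.1, by rw [integral_sub h.1 k.1, h.2, k.2]⟩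
lemma HI.cmul {α : Type*} [MeasureSpace α] {f : α → ℝ} {v : ℝ} (c : ℝ) (h : HI f v) :
    HI (fun p => c * f p) (c * v) := ⟨h.1.const_mul c, by rw [integral_const_mul, h.2]⟩
lemma HI.congr {α : Type*} [MeasureSpace α] {f g : α → ℝ} {v : ℝ} (h : HI f v) (k : ∀ p, g p = f p) : HI g v :=
  (funext k : g = f) ▸ h

/-- Sum of squares of all derivatives of order at most two. -/
def qh (ψ : ℝ × ℝ → ℝ) : ℝ × ℝ → ℝ := fun p =>
  dx (dx ψ) p ^ 2 + dx (dy ψ) p ^ 2 + dy (dy ψ) p ^ 2 + dx ψ p ^ 2 + dy ψ p ^ 2 + ψ p ^ 2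

lemma qh_sm {ψ : ℝ × ℝ → ℝ} (h : Sm ψ) : Sm (qh ψ) :=
  (((((h.dx.dx.pow 2).add (h.dy.dx.pow 2)).add (h.dy.dy.pow 2)).add (h.dx.pow 2)).add (h.dy.pow 2)).add (h.pow 2)

lemma qh_van {om : ℝ} {ψ : ℝ × ℝ → ℝ} (h : Sm ψ) (hv : Van om ψ) : Van om (qh ψ) := fun p hp => by
  simp [qh, hv p hp, hv.dx h p hp, hv.dy h p hp, (hv.dx h).dx h.dx p hp, (hv.dy h).dx h.dy p hp, (hv.dy h).dy h.dy p hp]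

lemma qh_nonneg (ψ : ℝ × ℝ → ℝ) (p : ℝ × ℝ) : 0 ≤ qh ψ p := by unfold qh; positivity

/-- First factor of the weighted form. -/
def La (ψ : ℝ × ℝ → ℝ) : ℝ × ℝ → ℝ := fun p => dx (dx ψ) p + 3 * dx ψ p + 9 / 4 * ψ p + dy (dy ψ) p
/-- Second factor of the weighted form. -/
def Lb (ψ : ℝ × ℝ → ℝ) : ℝ × ℝ → ℝ := fun p => dx (dx ψ) p + dx ψ p + 1 / 4 * ψ p + dy (dy ψ) p

def Xf (ψ : ℝ × ℝ → ℝ) : ℝ × ℝ → ℝ := fun p =>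
  2 * (dx ψ p * dy (dy ψ) p) + 2 * (dx ψ p * dx ψ p) + 5 / 2 * (ψ p * dx ψ p) + 3 / 2 * (ψ p * ψ p) - 2 * (dy ψ p * dy ψ p)
def Yf (ψ : ℝ × ℝ → ℝ) : ℝ × ℝ → ℝ := fun p =>
  4 * (dx ψ p * dy ψ p) + 5 / 2 * (ψ p * dy ψ p) - 2 * (dx ψ p * dx (dy ψ) p)

lemma Xf_sm {ψ : ℝ × ℝ → ℝ} (h : Sm ψ) : Sm (Xf ψ) :=
  (((((h.dx.mul h.dy.dy).cmul 2).add ((h.dx.mul h.dx).cmul 2)).add ((h.mul h.dx).cmul _)).add ((h.mul h).cmul _)).sub ((h.dy.mul h.dy).cmul 2)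

lemma Yf_sm {ψ : ℝ × ℝ → ℝ} (h : Sm ψ) : Sm (Yf ψ) :=
  (((h.dx.mul h.dy).cmul 4).add ((h.mul h.dy).cmul _)).sub ((h.dx.mul h.dy.dx).cmul 2)

lemma dx_cmul {f : ℝ × ℝ → ℝ} (c : ℝ) (hf : Sm f) : dx (fun p => c * f p) = fun p => c * dx f p := by
  rw [dx_mul (Sm.const c) hf, dx_const]; simp
lemma dy_cmul {f : ℝ × ℝ → ℝ} (c : ℝ) (hf : Sm f) : dy (fun p => c * f p) = fun p => c * dy f p := by
  rw [dy_mul (Sm.const c) hf, dy_const]; simp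
lemma dx_sub {f g : ℝ × ℝ → ℝ} (hf : Sm f) (hg : Sm g) :
    dx (fun p => f p - g p) = fun p => dx f p - dx g p := by
  funext p
  simp only [dx]
  rw [fderiv_fun_sub (hf.diff p) (hg.diff p)]
  simp
lemma dy_sub {f g : ℝ × ℝ → ℝ} (hf : Sm f) (hg : Sm g) :
    dy (fun p => f p - g p) = fun p => dy f p - dy g p := by
  funext p
  simp only [dy]
  rw [fderiv_fun_sub (hf.diff p) (hg.diff p)]
  simp

lemma form_pointwise {ψ : ℝ × ℝ → ℝ} (h : Sm ψ) (p : ℝ × ℝ) :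
    La ψ p * Lb ψ p = (dx (dx ψ) p ^ 2 + 2 * dx (dy ψ) p ^ 2 + 1 / 2 * dx ψ p ^ 2
      + (dy (dy ψ) p ^ 2 - 5 / 2 * dy ψ p ^ 2 + 9 / 16 * ψ p ^ 2)) + dx (Xf ψ) p + dy (Yf ψ) p := by
  have e1 : dx (Xf ψ) p = 2 * (dx (dx ψ) p * dy (dy ψ) p + dx ψ p * dx (dy (dy ψ)) p) + 2 * (2 * dx ψ p * dx (dx ψ) p)
    + 5 / 2 * (dx ψ p * dx ψ p + ψ p * dx (dx ψ) p) + 3 / 2 * (2 * ψ p * dx ψ p) - 2 * (2 * dy ψ p * dx (dy ψ) p) := by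
    obtain ⟨a, b⟩ := p
    apply dx_eq_of (Xf_sm h)
    refine ((((((h.dx.hx a b).mul (h.dy.dy.hx a b)).const_mul 2).add (((h.dx.hx a b).mul (h.dx.hx a b)).const_mul 2)).add
      (((h.hx a b).mul (h.dx.hx a b)).const_mul (5 / 2))).add (((h.hx a b).mul (h.hx a b)).const_mul (3 / 2))).sub
      (((h.dy.hx a b).mul (h.dy.hx a b)).const_mul 2) |>.congr_deriv ?_
    ring
  have e2 : dy (Yf ψ) p = 4 * (dx (dy ψ) p * dy ψ p + dx ψ p * dy (dy ψ) p) + 5 / 2 * (dy ψ p * dy ψ p + ψ p * dy (dy ψ) p)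
     - 2 * (dx (dy ψ) p * dx (dy ψ) p + dx ψ p * dx (dy (dy ψ)) p) := by
    rw [← dxdy_comm h.dy, ← dxdy_comm h]
    obtain ⟨a, b⟩ := p
    apply dy_eq_of (Yf_sm h)
    unfold Yf
    rw [← dxdy_comm h]
    refine ((((h.dx.hy a b).mul (h.dy.hy a b)).const_mul 4).add (((h.hy a b).mul (h.dy.hy a b)).const_mul (5 / 2))).sub
      (((h.dx.hy a b).mul (h.dx.dy.hy a b)).const_mul 2)
  rw [e1, e2, La, Lb]
  ring

lemma Lb_mul {ψ : ℝ × ℝ → ℝ} {χ : ℝ → ℝ} (h : Sm ψ) (hχ : ContDiff ℝ ∞ χ) (p : ℝ × ℝ) :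
    Lb (fun p => χ p.1 * ψ p) p = χ p.1 * Lb ψ p + 
      (deriv χ p.1 * (2 * dx ψ p + ψ p) + deriv (deriv χ) p.1 * ψ p) := by
  have hχ' : ContDiff ℝ ∞ (deriv χ) := (contDiff_infty_iff_deriv.1 hχ).2
  have e1 : dx (fun p => χ p.1 * ψ p) = fun p => deriv χ p.1 * ψ p + χ p.1 * dx ψ p := by
    rw [dx_mul (Sm.of_fst hχ) h, dx_fst hχ]
  have e2 : dy (fun p => χ p.1 * ψ p) = fun p => χ p.1 * dy ψ p := by
    rw [dy_mul (Sm.of_fst hχ) h, dy_fst hχ]; simp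
  have e3 : dy (dy (fun p => χ p.1 * ψ p)) = fun p => χ p.1 * dy (dy ψ) p := by
    rw [e2, dy_mul (Sm.of_fst hχ) h.dy, dy_fst hχ]; simp
  rw [Lb, e3, e1, dx_add ((Sm.of_fst hχ').mul h) ((Sm.of_fst hχ).mul h.dx), dx_mul (Sm.of_fst hχ) h.dx, dx_fst hχ,
    dx_mul (Sm.of_fst hχ') h, dx_fst hχ', Lb]
  ring

lemma ab_le (a b : ℝ) : |a * b| ≤ (a ^ 2 + b ^ 2) / 2 := by
  rw [abs_le]; constructor <;> nlinarith [sq_nonneg (a + b), sq_nonneg (a - b)]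

lemma form_lower {om : ℝ} (hom0 : 0 < om) (hom : om < Real.pi) :
    ∃ κ > 0, ∀ (χ χh : ℝ → ℝ) (ψ : ℝ × ℝ → ℝ) (ε : ℝ), Wt χ → Wt χh → Sm ψ → Van om ψ → 0 ≤ ε →
      (∀ t, |deriv χ t| ≤ ε * χh t) → (∀ t, |deriv (deriv χ) t| ≤ ε * χh t) →
      κ * (∫ p, χ p.1 * qh ψ p) ≤
        (∫ p, La ψ p * Lb (fun p => χ p.1 * ψ p) p) + ε * (300 * ∫ p, χh p.1 * qh ψ p) := by
  obtain ⟨κ, hκ, H⟩ := ang_coer hom0 hom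
  refine ⟨min κ (1 / 2), by positivity, fun χ χh ψ ε hχ hχh h hv hε h1 h2 => ?_⟩
  have hχ' : ContDiff ℝ ∞ (deriv χ) := (contDiff_infty_iff_deriv.1 hχ.sm).2
  have hχ'' : ContDiff ℝ ∞ (deriv (deriv χ)) := (contDiff_infty_iff_deriv.1 hχ').2
  have hc' := hχ.cs.deriv
  have hc'' := hc'.deriv
  have hx := hv.dx h
  have hy := hv.dy h
  have hxx := hx.dx h.dx
  have hxy := hy.dx h.dy
  have hyy := hy.dy h.dy
  have hXv : Van om (Xf ψ) := fun p hp => by simp [Xf, hv p hp, hx p hp, hy p hp]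
  have hYv : Van om (Yf ψ) := fun p hp => by simp [Yf, hv p hp, hx p hp, hy p hp]
  have hLs : Sm (La ψ) := ((h.dx.dx.add (h.dx.cmul 3)).add (h.cmul _)).add h.dy.dy
  have hLv : Van om (La ψ) := fun p hp => by simp [La, hv p hp, hx p hp, hxx p hp, hyy p hp]
  -- split
  have eX : ∫ p, χ p.1 * dx (Xf ψ) p = - ∫ p, deriv χ p.1 * Xf ψ p := by
    have h0 := integral_dx_zero ((Sm.of_fst hχ.sm).mul (Xf_sm h)) (hcs_of hχ.cs hXv)
    rw [dx_mul (Sm.of_fst hχ.sm) (Xf_sm h), dx_fst hχ.sm, integral_add (integrable_of_gen hχ' hc' (Xf_sm h) hXv)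
      (integrable_of hχ (Xf_sm h).dx (hXv.dx (Xf_sm h)))] at h0
    linarith
  have eY := integral_dy_zero' hχ (Yf_sm h) hYv
  have i0 := integrable_of hχ (h.pow 2) hv.sq
  have iy := integrable_of hχ (h.dy.pow 2) hy.sq
  have iyy := integrable_of hχ (h.dy.dy.pow 2) hyy.sq
  have ix := integrable_of hχ (h.dx.pow 2) hx.sq
  have ixx := integrable_of hχ (h.dx.dx.pow 2) hxx.sq
  have ixy := integrable_of hχ (h.dy.dx.pow 2) hxy.sq
  have iX := integrable_of hχ (Xf_sm h).dx (hXv.dx (Xf_sm h))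
  have iY := integrable_of hχ (Yf_sm h).dy (hYv.dy (Yf_sm h))
  have iE1 := integrable_of_gen hχ' hc' (hLs.mul ((h.dx.cmul 2).add h)) (hLv.mul_right _)
  have iE2 := integrable_of_gen hχ'' hc'' (hLs.mul h) (hLv.mul_right _)
  have iXf := integrable_of_gen hχ' hc' (Xf_sm h) hXv
  have ih := integrable_of hχh (qh_sm h) (qh_van h hv)
  have split : (∫ p, La ψ p * Lb (fun p => χ p.1 * ψ p) p) =
      (∫ p, χ p.1 * dx (dx ψ) p ^ 2) + 2 * (∫ p, χ p.1 * dx (dy ψ) p ^ 2) + 1 / 2 * (∫ p, χ p.1 * dx ψ p ^ 2)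
      + ((∫ p, χ p.1 * dy (dy ψ) p ^ 2) - 5 / 2 * (∫ p, χ p.1 * dy ψ p ^ 2) + 9 / 16 * ∫ p, χ p.1 * ψ p ^ 2)
      + (∫ p, χ p.1 * dx (Xf ψ) p) + (∫ p, χ p.1 * dy (Yf ψ) p)
      + (∫ p, deriv χ p.1 * (La ψ p * (2 * dx ψ p + ψ p))) + ∫ p, deriv (deriv χ) p.1 * (La ψ p * ψ p) := by
    refine ((((((((HI.of ixx).add ((HI.of ixy).cmul 2)).add ((HI.of ix).cmul (1 / 2))).add
      (((HI.of iyy).sub ((HI.of iy).cmul (5 / 2))).add ((HI.of i0).cmul (9 / 16)))).add (HI.of iX)).add (HI.of iY)).add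
      (HI.of iE1)).add (HI.of iE2)).congr (fun p => ?_) |>.2
    rw [Lb_mul h hχ.sm]
    linear_combination χ p.1 * form_pointwise h p
  have bX : ∫ p, deriv χ p.1 * Xf ψ p ≤ ∫ p, ε * (100 * (χh p.1 * qh ψ p)) := by
    apply integral_mono iXf ((ih.const_mul _).const_mul _)
    intro p
    have a1 : |Xf ψ p| ≤ 100 * qh ψ p := by
      unfold Xf qh
      rw [abs_le]; constructor <;>
      nlinarith [abs_le.1 (ab_le (dx ψ p) (dy (dy ψ) p)), abs_le.1 (ab_le (ψ p) (dx ψ p)), sq_nonneg (dx (dx ψ) p), sq_nonneg (dx (dy ψ) p),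
        sq_nonneg (dx ψ p), sq_nonneg (dy (dy ψ) p), sq_nonneg (ψ p), sq_nonneg (dy ψ p)]
    calc deriv χ p.1 * Xf ψ p ≤ |deriv χ p.1| * |Xf ψ p| := by rw [← abs_mul]; exact le_abs_self _
      _ ≤ (ε * χh p.1) * (100 * qh ψ p) := mul_le_mul (h1 _) a1 (abs_nonneg _) (mul_nonneg hε (hχh.nn _))
      _ = _ := by ring
  have bE1 : - ∫ p, deriv χ p.1 * (La ψ p * (2 * dx ψ p + ψ p)) ≤ ∫ p, ε * (100 * (χh p.1 * qh ψ p)) := by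
    rw [← integral_neg]
    apply integral_mono iE1.neg ((ih.const_mul _).const_mul _)
    intro p
    have a1 : |La ψ p * (2 * dx ψ p + ψ p)| ≤ 100 * qh ψ p := by
      refine (ab_le _ _).trans ?_
      unfold La qh
      nlinarith [sq_nonneg (dx (dx ψ) p - 3 * dx ψ p), sq_nonneg (dx (dx ψ) p - 9 / 4 * ψ p), sq_nonneg (dx (dx ψ) p - dy (dy ψ) p),
        sq_nonneg (3 * dx ψ p - 9 / 4 * ψ p), sq_nonneg (3 * dx ψ p - dy (dy ψ) p), sq_nonneg (9 / 4 * ψ p - dy (dy ψ) p), 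
        sq_nonneg (2 * dx ψ p - ψ p), sq_nonneg (dx (dy ψ) p),
        sq_nonneg (dx (dx ψ) p), sq_nonneg (dx ψ p), sq_nonneg (dy (dy ψ) p), sq_nonneg (ψ p), sq_nonneg (dy ψ p)]
    calc - (deriv χ p.1 * (La ψ p * (2 * dx ψ p + ψ p))) ≤ |deriv χ p.1| * |La ψ p * (2 * dx ψ p + ψ p)| := by rw [← abs_mul]; exact neg_le_abs _
      _ ≤ (ε * χh p.1) * (100 * qh ψ p) := mul_le_mul (h1 _) a1 (abs_nonneg _) (mul_nonneg hε (hχh.nn _))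
      _ = _ := by ring
  have bE2 : - ∫ p, deriv (deriv χ) p.1 * (La ψ p * ψ p) ≤ ∫ p, ε * (100 * (χh p.1 * qh ψ p)) := by
    rw [← integral_neg]
    apply integral_mono iE2.neg ((ih.const_mul _).const_mul _)
    intro p
    have a1 : |La ψ p * ψ p| ≤ 100 * qh ψ p := by
      refine (ab_le _ _).trans ?_
      unfold La qh
      nlinarith [sq_nonneg (dx (dx ψ) p - 3 * dx ψ p), sq_nonneg (dx (dx ψ) p - 9 / 4 * ψ p), sq_nonneg (dx (dx ψ) p - dy (dy ψ) p),
        sq_nonneg (3 * dx ψ p - 9 / 4 * ψ p), sq_nonneg (3 * dx ψ p - dy (dy ψ) p), sq_nonneg (9 / 4 * ψ p - dy (dy ψ) p), sq_nonneg (dx (dy ψ) p),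
        sq_nonneg (dx (dx ψ) p), sq_nonneg (dx ψ p), sq_nonneg (dy (dy ψ) p), sq_nonneg (ψ p), sq_nonneg (dy ψ p)]
    calc - (deriv (deriv χ) p.1 * (La ψ p * ψ p)) ≤ |deriv (deriv χ) p.1| * |La ψ p * ψ p| := by rw [← abs_mul]; exact neg_le_abs _
      _ ≤ (ε * χh p.1) * (100 * qh ψ p) := mul_le_mul (h2 _) a1 (abs_nonneg _) (mul_nonneg hε (hχh.nn _))
      _ = _ := by ring
  rw [integral_const_mul, integral_const_mul] at bX bE1 bE2
  have hq : ∫ p, χ p.1 * qh ψ p = (∫ p, χ p.1 * dx (dx ψ) p ^ 2) + (∫ p, χ p.1 * dx (dy ψ) p ^ 2) + (∫ p, χ p.1 * dy (dy ψ) p ^ 2)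
      + (∫ p, χ p.1 * dx ψ p ^ 2) + (∫ p, χ p.1 * dy ψ p ^ 2) + ∫ p, χ p.1 * ψ p ^ 2 := by
    refine (((((HI.of ixx).add (HI.of ixy)).add (HI.of iyy)).add (HI.of ix)).add (HI.of iy)).add (HI.of i0) |>.congr (fun p => ?_) |>.2
    unfold qh; ring
  have hco := H χ ψ hχ h hv
  have n1 := wint_nonneg hχ (f := fun p => dx (dx ψ) p ^ 2) (fun p => sq_nonneg _)
  have n2 := wint_nonneg hχ (f := fun p => dx (dy ψ) p ^ 2) (fun p => sq_nonneg _)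
  have n3 := wint_nonneg hχ (f := fun p => dx ψ p ^ 2) (fun p => sq_nonneg _)
  have n4 := wint_nonneg hχ (f := fun p => dy (dy ψ) p ^ 2) (fun p => sq_nonneg _)
  have n5 := wint_nonneg hχ (f := fun p => dy ψ p ^ 2) (fun p => sq_nonneg _)
  have n6 := wint_nonneg hχ (f := fun p => ψ p ^ 2) (fun p => sq_nonneg _)
  rw [split, hq, eX, eY]
  have m1 : min κ (1 / 2) ≤ κ := min_le_left _ _
  have m2 : min κ (1 / 2) ≤ 1 / 2 := min_le_right _ _
  generalize min κ (1 / 2) = k at *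
  clear split hq eX eY ixx ix ixy iX iXf iY iE1 iE2 iyy iy i0 ih
  have q1 := mul_le_mul_of_nonneg_right m2 n1
  have q2 := mul_le_mul_of_nonneg_right m2 n2
  have q3 := mul_le_mul_of_nonneg_right m2 n3
  have q4 := mul_le_mul_of_nonneg_right m1 n4
  have q5 := mul_le_mul_of_nonneg_right m1 n5
  have q6 := mul_le_mul_of_nonneg_right m1 n6
  linarith

end Form

end

section
section LogPolar
open scoped ContDiff

/-- Log-polar coordinates. -/
def Ex (p : ℝ × ℝ) : ℝ × ℝ := (Real.exp p.1 * Real.cos p.2, Real.exp p.1 * Real.sin p.2)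

/-- The open sector of half-angle `om`. -/
def Sec (om : ℝ) : Set (ℝ × ℝ) := {y | Real.cos om * |y.2| < Real.sin om * y.1}

lemma Ex_sm : ContDiff ℝ ∞ Ex := by unfold Ex; fun_prop

lemma isOpen_Sec (om : ℝ) : IsOpen (Sec om) := isOpen_lt (by fun_prop) (by fun_prop)

lemma abs_sin_of {θ : ℝ} (h : |θ| ≤ Real.pi) : |Real.sin θ| = Real.sin |θ| := by
  rcases le_total 0 θ with h0 | h0
  · rw [abs_of_nonneg h0] at *
    exact abs_of_nonneg (Real.sin_nonneg_of_nonneg_of_le_pi h0 h)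
  · rw [abs_of_nonpos h0] at *
    rw [Real.sin_neg, abs_of_nonpos]
    have := Real.sin_nonneg_of_nonneg_of_le_pi (x := -θ) (by linarith) h
    rw [Real.sin_neg] at this; linarith

lemma Ex_mem_Sec {om : ℝ} {p : ℝ × ℝ} (hp : |p.2| ≤ Real.pi) :
    Ex p ∈ Sec om ↔ 0 < Real.sin (om - |p.2|) := by
  have e : Real.sin (om - |p.2|) = Real.sin om * Real.cos p.2 - Real.cos om * |Real.sin p.2| := by
    rw [Real.sin_sub, Real.cos_abs, abs_sin_of hp]
  rw [e]
  simp only [Sec, Ex, mem_ofPred_eq, abs_mul, abs_of_pos (Real.exp_pos _)]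
  have hexp := Real.exp_pos p.1
  constructor
  · intro h
    have : 0 < Real.exp p.1 * (Real.sin om * Real.cos p.2 - Real.cos om * |Real.sin p.2|) := by linarith
    exact (mul_pos_iff_of_pos_left hexp).1 this
  · intro h
    have := mul_pos hexp h
    linarith

lemma Ex_not_mem {om : ℝ} (h0 : 0 < om) {p : ℝ × ℝ} (hp : |p.2| ≤ Real.pi) (h : om ≤ |p.2|) :
    Ex p ∉ Sec om := by
  rw [Ex_mem_Sec hp, not_lt]
  exact Real.sin_nonpos_of_nonpos_of_neg_pi_le (by linarith) (by linarith)

/-- Functions supported in the sector. -/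
def SupS (om : ℝ) (G : ℝ × ℝ → ℝ) : Prop := tsupport G ⊆ Sec om

lemma SupS.zero {om : ℝ} {G : ℝ × ℝ → ℝ} (h : SupS om G) {x : ℝ × ℝ} (hx : x ∉ Sec om) : G x = 0 :=
  image_eq_zero_of_notMem_tsupport fun hh => hx (h hh)

lemma SupS.mono {om : ℝ} {G H : ℝ × ℝ → ℝ} (h : SupS om G) (hh : Function.support H ⊆ Function.support G) : SupS om H :=
  (closure_mono hh).trans h

lemma SupS.mul_left {om : ℝ} {G : ℝ × ℝ → ℝ} (h : SupS om G) (f : ℝ × ℝ → ℝ) : SupS om (fun p => f p * G p) :=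
  h.mono fun p hp => by simp at hp ⊢; exact hp.2

lemma SupS.add {om : ℝ} {G H : ℝ × ℝ → ℝ} (h : SupS om G) (k : SupS om H) : SupS om (fun p => G p + H p) :=
  (tsupport_add G H).trans (union_subset h k)

lemma SupS.dx {om : ℝ} {G : ℝ × ℝ → ℝ} (h : SupS om G) : SupS om (Griffith.dx G) :=
  (tsupport_fderiv_apply_subset ℝ _).trans h

lemma SupS.dy {om : ℝ} {G : ℝ × ℝ → ℝ} (h : SupS om G) : SupS om (Griffith.dy G) :=
  (tsupport_fderiv_apply_subset ℝ _).trans h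

/-- Pull-back to log-polar coordinates, cut to one period. -/
def cutE (G : ℝ × ℝ → ℝ) : ℝ × ℝ → ℝ := fun p => if |p.2| < Real.pi then G (Ex p) else 0

lemma cutE_van {om : ℝ} (h0 : 0 < om) {G : ℝ × ℝ → ℝ} (h : SupS om G) : Van om (cutE G) := by
  intro p hp
  unfold cutE
  split_ifs with h1
  · exact h.zero (Ex_not_mem h0 h1.le hp)
  · rfl

lemma cutE_ev_in {G : ℝ × ℝ → ℝ} {p : ℝ × ℝ} (hp : |p.2| < Real.pi) : cutE G =ᶠ[𝓝 p] fun q => G (Ex q) := by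
  have ho : IsOpen {q : ℝ × ℝ | |q.2| < Real.pi} := isOpen_lt (by fun_prop) continuous_const
  filter_upwards [ho.mem_nhds hp] with q hq
  exact if_pos hq

lemma cutE_ev_out {om : ℝ} (h0 : 0 < om) (hom : om < Real.pi) {G : ℝ × ℝ → ℝ} (h : SupS om G) {p : ℝ × ℝ}
    (hp : ¬ |p.2| < Real.pi) : cutE G =ᶠ[𝓝 p] fun _ => 0 := by
  have ho : IsOpen {q : ℝ × ℝ | om < |q.2|} := isOpen_lt continuous_const (by fun_prop)
  filter_upwards [ho.mem_nhds (show om < |p.2| by linarith)] with q hq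
  exact cutE_van h0 h q (le_of_lt hq)

lemma cutE_sm {om : ℝ} (h0 : 0 < om) (hom : om < Real.pi) {G : ℝ × ℝ → ℝ} (hG : Sm G) (h : SupS om G) : Sm (cutE G) := by
  rw [Sm, contDiff_iff_contDiffAt]
  intro p
  by_cases hp : |p.2| < Real.pi
  · exact (hG.cd.comp Ex_sm).contDiffAt.congr_of_eventuallyEq (cutE_ev_in hp)
  · exact contDiffAt_const.congr_of_eventuallyEq (cutE_ev_out h0 hom h hp)

lemma fderiv_eq_dxdy (f : ℝ × ℝ → ℝ) (p : ℝ × ℝ) (a b : ℝ) : fderiv ℝ f p (a, b) = a * dx f p + b * dy f p := by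
  have : ((a, b) : ℝ × ℝ) = a • (1, 0) + b • (0, 1) := by simp
  rw [this, map_add, map_smul, map_smul]; rfl

/-- The radial derivative. -/
def R1 (G : ℝ × ℝ → ℝ) : ℝ × ℝ → ℝ := fun p => p.1 * dx G p + p.2 * dy G p
/-- The angular derivative. -/
def R2 (G : ℝ × ℝ → ℝ) : ℝ × ℝ → ℝ := fun p => (- p.2) * dx G p + p.1 * dy G p

lemma fst_sm : Sm (fun p => p.1) := contDiff_fst
lemma snd_sm : Sm (fun p => p.2) := contDiff_snd
lemma nsnd_sm : Sm (fun p => - p.2) := contDiff_snd.neg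

lemma R1_sm {G : ℝ × ℝ → ℝ} (h : Sm G) : Sm (R1 G) := (fst_sm.mul h.dx).add (snd_sm.mul h.dy)
lemma R2_sm {G : ℝ × ℝ → ℝ} (h : Sm G) : Sm (R2 G) := (nsnd_sm.mul h.dx).add (fst_sm.mul h.dy)
lemma R1_sup {om : ℝ} {G : ℝ × ℝ → ℝ} (h : SupS om G) : SupS om (R1 G) := (h.dx.mul_left _).add (h.dy.mul_left _)
lemma R2_sup {om : ℝ} {G : ℝ × ℝ → ℝ} (h : SupS om G) : SupS om (R2 G) := (h.dx.mul_left _).add (h.dy.mul_left _)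

lemma dx_cutE {om : ℝ} (h0 : 0 < om) (hom : om < Real.pi) {G : ℝ × ℝ → ℝ} (hG : Sm G) (h : SupS om G) :
    dx (cutE G) = cutE (R1 G) := by
  funext ⟨a, b⟩
  by_cases hp : |b| < Real.pi
  · have e : dx (cutE G) (a, b) = dx (fun q => G (Ex q)) (a, b) := by
      unfold dx; rw [(cutE_ev_in (p := (a, b)) hp).fderiv_eq]
    rw [e, cutE, if_pos hp]
    apply dx_eq_of (hG.cd.comp Ex_sm)
    have h1 : HasDerivAt (fun s : ℝ => Ex (s, b)) (Real.exp a * Real.cos b, Real.exp a * Real.sin b) a :=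
      ((Real.hasDerivAt_exp a).mul_const (Real.cos b)).prodMk ((Real.hasDerivAt_exp a).mul_const (Real.sin b))
    refine ((hG.diff _).hasFDerivAt.comp_hasDerivAt a h1).congr_deriv ?_
    rw [fderiv_eq_dxdy]; rfl
  · have e : dx (cutE G) (a, b) = 0 := by
      unfold dx; rw [(cutE_ev_out (p := (a, b)) h0 hom h hp).fderiv_eq]; simp
    rw [e, cutE, if_neg hp]

lemma dy_cutE {om : ℝ} (h0 : 0 < om) (hom : om < Real.pi) {G : ℝ × ℝ → ℝ} (hG : Sm G) (h : SupS om G) :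
    dy (cutE G) = cutE (R2 G) := by
  funext ⟨a, b⟩
  by_cases hp : |b| < Real.pi
  · have e : dy (cutE G) (a, b) = dy (fun q => G (Ex q)) (a, b) := by
      unfold dy; rw [(cutE_ev_in (p := (a, b)) hp).fderiv_eq]
    rw [e, cutE, if_pos hp]
    apply dy_eq_of (hG.cd.comp Ex_sm)
    have h1 : HasDerivAt (fun s : ℝ => Ex (a, s)) (Real.exp a * (-Real.sin b), Real.exp a * Real.cos b) b :=
      ((Real.hasDerivAt_cos b).const_mul (Real.exp a)).prodMk ((Real.hasDerivAt_sin b).const_mul (Real.exp a))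
    refine ((hG.diff _).hasFDerivAt.comp_hasDerivAt b h1).congr_deriv ?_
    rw [fderiv_eq_dxdy]; simp only [R2, Ex]; ring
  · have e : dy (cutE G) (a, b) = 0 := by
      unfold dy; rw [(cutE_ev_out (p := (a, b)) h0 hom h hp).fderiv_eq]; simp
    rw [e, cutE, if_neg hp]

/-- Change of variables to log-polar coordinates. -/
lemma integral_cutE (H : ℝ × ℝ → ℝ) :
    ∫ x, H x = ∫ p : ℝ × ℝ, Real.exp (2 * p.1) * cutE H p := by
  rw [← integral_comp_polarCoord_symm]
  set g : ℝ × ℝ → ℝ × ℝ := fun p => (Real.exp p.1, p.2) with hg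
  set A : Set (ℝ × ℝ) := univ ×ˢ Ioo (-Real.pi) Real.pi with hA
  have himg : g '' A = polarCoord.target := by
    ext ⟨r, θ⟩
    simp only [hg, hA, mem_image, mem_prod, mem_univ, true_and, Prod.mk.injEq, Prod.exists, polarCoord_target, mem_Ioi]
    constructor
    · rintro ⟨a, b, hb, rfl, rfl⟩
      exact ⟨Real.exp_pos a, hb⟩
    · rintro ⟨hr, hθ⟩
      exact ⟨Real.log r, θ, hθ, Real.exp_log hr, rfl⟩
  set g' : ℝ × ℝ → (ℝ × ℝ →L[ℝ] ℝ × ℝ) := fun p =>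
    LinearMap.toContinuousLinearMap (Matrix.toLin (Module.Basis.finTwoProd ℝ) (Module.Basis.finTwoProd ℝ) !![Real.exp p.1, 0; 0, 1]) with hg'
  have hdet : ∀ p, (g' p).det = Real.exp p.1 := fun p => by
    rw [hg', ContinuousLinearMap.det, LinearMap.coe_toContinuousLinearMap, LinearMap.det_toLin]
    simp
  have hder : ∀ p ∈ A, HasFDerivWithinAt g (g' p) A p := fun p _ => by
    have : HasFDerivAt g (g' p) p := by
      simp only [hg']
      rw [Matrix.toLin_finTwoProd_toContinuousLinearMap]
      have hh : HasFDerivAt g _ p :=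
        ((Real.hasDerivAt_exp p.1).comp_hasFDerivAt p hasFDerivAt_fst).prodMk (hasFDerivAt_snd (𝕜 := ℝ) (E := ℝ) (F := ℝ) (p := p))
      refine hh.congr_fderiv ?_
      ext <;> simp
    exact this.hasFDerivWithinAt
  have hinj : InjOn g A := by
    rintro ⟨a, b⟩ _ ⟨c, d⟩ _ he
    simp only [hg, Prod.mk.injEq, Real.exp_eq_exp] at he
    rw [he.1, he.2]
  have hm : MeasurableSet A := MeasurableSet.univ.prod measurableSet_Ioo
  rw [← himg, integral_image_eq_integral_abs_det_fderiv_smul volume hm hder hinj, ← integral_indicator hm]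
  congr 1; funext p
  have hAi : p ∈ A ↔ |p.2| < Real.pi := by simp [hA, abs_lt]
  by_cases hp : |p.2| < Real.pi
  · rw [indicator_of_mem (hAi.2 hp), cutE, if_pos hp, hdet, abs_of_pos (Real.exp_pos _), two_mul, Real.exp_add]
    simp only [hg, smul_eq_mul, Ex, polarCoord_symm_apply]
    ring
  · rw [indicator_of_notMem (fun hh => hp (hAi.1 hh)), cutE, if_neg hp, mul_zero]

end LogPolar

end

section
section Cartesian
open scoped ContDiff

/-- Squared norm of the Hessian. -/
def D2 (Φ : ℝ × ℝ → ℝ) : ℝ × ℝ → ℝ := fun p => dx (dx Φ) p ^ 2 + 2 * dx (dy Φ) p ^ 2 + dy (dy Φ) p ^ 2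
/-- Laplacian. -/
def Lap (Φ : ℝ × ℝ → ℝ) : ℝ × ℝ → ℝ := fun p => dx (dx Φ) p + dy (dy Φ) p
/-- Radial weights. -/
def zeta (χ : ℝ → ℝ) : ℝ × ℝ → ℝ := fun p => (Real.sqrt (p.1 ^ 2 + p.2 ^ 2))⁻¹ * χ (Real.log (p.1 ^ 2 + p.2 ^ 2) / 2)

lemma D2_nonneg (Φ : ℝ × ℝ → ℝ) (p : ℝ × ℝ) : 0 ≤ D2 Φ p := by unfold D2; positivity

lemma zeta_nonneg {χ : ℝ → ℝ} (h : Wt χ) (p : ℝ × ℝ) : 0 ≤ zeta χ p :=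
  mul_nonneg (by positivity) (h.nn _)

lemma Ex_sq (p : ℝ × ℝ) : (Ex p).1 ^ 2 + (Ex p).2 ^ 2 = Real.exp p.1 ^ 2 := by
  simp only [Ex]; linear_combination Real.exp p.1 ^ 2 * Real.sin_sq_add_cos_sq p.2

lemma zeta_Ex (χ : ℝ → ℝ) (p : ℝ × ℝ) : zeta χ (Ex p) = (Real.exp p.1)⁻¹ * χ p.1 := by
  unfold zeta
  rw [Ex_sq, Real.sqrt_sq (Real.exp_pos _).le, Real.log_pow, Real.log_exp]
  congr 2; push_cast; ring

lemma R1_R1 {Φ : ℝ × ℝ → ℝ} (h : Sm Φ) (p : ℝ × ℝ) : R1 (R1 Φ) p =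
    p.1 ^ 2 * dx (dx Φ) p + 2 * p.1 * p.2 * dx (dy Φ) p + p.2 ^ 2 * dy (dy Φ) p + R1 Φ p := by
  have e1 : dx (R1 Φ) p = dx Φ p + p.1 * dx (dx Φ) p + p.2 * dx (dy Φ) p := by
    obtain ⟨a, b⟩ := p
    apply dx_eq_of (R1_sm h)
    refine (((hasDerivAt_id a).mul (h.dx.hx a b)).add ((h.dy.hx a b).const_mul b)).congr_deriv ?_
    simp
  have e2 : dy (R1 Φ) p = p.1 * dx (dy Φ) p + dy Φ p + p.2 * dy (dy Φ) p := by
    obtain ⟨a, b⟩ := p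
    rw [← dxdy_comm h]
    apply dy_eq_of (R1_sm h)
    refine (((h.dx.hy a b).const_mul a).add ((hasDerivAt_id b).mul (h.dy.hy a b))).congr_deriv ?_
    simp; ring
  rw [R1, e1, e2, R1]; ring

lemma dxR2 {Φ : ℝ × ℝ → ℝ} (h : Sm Φ) (p : ℝ × ℝ) :
    dx (R2 Φ) p = - p.2 * dx (dx Φ) p + dy Φ p + p.1 * dx (dy Φ) p := by
  obtain ⟨a, b⟩ := p
  apply dx_eq_of (R2_sm h)
  refine (((h.dx.hx a b).const_mul (-b)).add ((hasDerivAt_id a).mul (h.dy.hx a b))).congr_deriv ?_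
  simp; ring

lemma dyR2 {Φ : ℝ × ℝ → ℝ} (h : Sm Φ) (p : ℝ × ℝ) :
    dy (R2 Φ) p = - dx Φ p - p.2 * dx (dy Φ) p + p.1 * dy (dy Φ) p := by
  obtain ⟨a, b⟩ := p
  rw [← dxdy_comm h]
  apply dy_eq_of (R2_sm h)
  refine (((hasDerivAt_id b).neg.mul (h.dx.hy a b)).add ((h.dy.hy a b).const_mul a)).congr_deriv ?_
  simp; ring

lemma R1_R2 {Φ : ℝ × ℝ → ℝ} (h : Sm Φ) (p : ℝ × ℝ) : R1 (R2 Φ) p =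
    - (p.1 * p.2) * dx (dx Φ) p + (p.1 ^ 2 - p.2 ^ 2) * dx (dy Φ) p + p.1 * p.2 * dy (dy Φ) p + R2 Φ p := by
  rw [R1, dxR2 h, dyR2 h, R2]; ring

lemma R2_R2 {Φ : ℝ × ℝ → ℝ} (h : Sm Φ) (p : ℝ × ℝ) : R2 (R2 Φ) p =
    p.2 ^ 2 * dx (dx Φ) p - 2 * p.1 * p.2 * dx (dy Φ) p + p.1 ^ 2 * dy (dy Φ) p - R1 Φ p := by
  rw [R2, dxR2 h, dyR2 h, R1]; ring

section

lemma cut_derivs {om : ℝ} (h0 : 0 < om) (hom : om < Real.pi) {Φ : ℝ × ℝ → ℝ} (h : Sm Φ) (hS : SupS om Φ) :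
    dx (dx (cutE Φ)) = cutE (R1 (R1 Φ)) ∧ dx (dy (cutE Φ)) = cutE (R1 (R2 Φ)) ∧
    dy (dy (cutE Φ)) = cutE (R2 (R2 Φ)) := by
  refine ⟨?_, ?_, ?_⟩
  · rw [dx_cutE h0 hom h hS, dx_cutE h0 hom (R1_sm h) (R1_sup hS)]
  · rw [dy_cutE h0 hom h hS, dx_cutE h0 hom (R2_sm h) (R2_sup hS)]
  · rw [dy_cutE h0 hom h hS, dy_cutE h0 hom (R2_sm h) (R2_sup hS)]

lemma cut_D2 {om : ℝ} (h0 : 0 < om) (hom : om < Real.pi) {Φ : ℝ × ℝ → ℝ} (h : Sm Φ) (hS : SupS om Φ)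
    (p : ℝ × ℝ) : Real.exp p.1 ^ 4 * cutE (D2 Φ) p =
    (dx (dx (cutE Φ)) p - dx (cutE Φ) p) ^ 2 + 2 * (dx (dy (cutE Φ)) p - dy (cutE Φ) p) ^ 2
      + (dy (dy (cutE Φ)) p + dx (cutE Φ) p) ^ 2 := by
  obtain ⟨e1, e2, e3⟩ := cut_derivs h0 hom h hS
  rw [e1, e2, e3, dx_cutE h0 hom h hS, dy_cutE h0 hom h hS]
  unfold cutE
  split_ifs with hp
  · rw [R1_R1 h, R1_R2 h, R2_R2 h, D2]
    have := Ex_sq p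
    have e4 : Real.exp p.1 ^ 4 = ((Ex p).1 ^ 2 + (Ex p).2 ^ 2) ^ 2 := by rw [this]; ring
    rw [e4]; ring
  · simp

lemma cut_Lap {om : ℝ} (h0 : 0 < om) (hom : om < Real.pi) {Φ : ℝ × ℝ → ℝ} (h : Sm Φ) (hS : SupS om Φ)
    (p : ℝ × ℝ) : Real.exp p.1 ^ 2 * cutE (Lap Φ) p = dx (dx (cutE Φ)) p + dy (dy (cutE Φ)) p := by
  obtain ⟨e1, e2, e3⟩ := cut_derivs h0 hom h hS
  rw [e1, e3]
  unfold cutE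
  split_ifs with hp
  · rw [R1_R1 h, R2_R2 h, Lap, ← Ex_sq]; ring
  · simp
end

lemma exp_factor {f F : ℝ × ℝ → ℝ} (c : ℝ) (hf : Sm f) (hF : F = fun p => Real.exp (c * p.1) * f p) :
    dx F = (fun p => Real.exp (c * p.1) * (dx f p + c * f p)) ∧
    dy F = (fun p => Real.exp (c * p.1) * dy f p) ∧
    dx (dx F) = (fun p => Real.exp (c * p.1) * (dx (dx f) p + 2 * c * dx f p + c ^ 2 * f p)) ∧
    dx (dy F) = (fun p => Real.exp (c * p.1) * (dx (dy f) p + c * dy f p)) ∧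
    dy (dy F) = (fun p => Real.exp (c * p.1) * dy (dy f) p) := by
  have hes : ContDiff ℝ ∞ (fun t => Real.exp (c * t)) := by fun_prop
  have hE : Sm (fun p => Real.exp (c * p.1)) := Sm.of_fst hes
  have hde : deriv (fun t => Real.exp (c * t)) = fun t => c * Real.exp (c * t) := by
    funext t
    have := ((hasDerivAt_id t).const_mul c).exp
    simp only [id, mul_one] at this
    rw [this.deriv]; ring
  have key : ∀ g : ℝ × ℝ → ℝ, Sm g → dx (fun p => Real.exp (c * p.1) * g p) = fun p => Real.exp (c * p.1) * (dx g p + c * g p) := by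
    intro g hg
    rw [dx_mul hE hg, dx_fst hes, hde]
    funext p; ring
  have key2 : ∀ g : ℝ × ℝ → ℝ, Sm g → dy (fun p => Real.exp (c * p.1) * g p) = fun p => Real.exp (c * p.1) * dy g p := by
    intro g hg
    rw [dy_mul hE hg, dy_fst hes]
    funext p; ring
  subst hF
  refine ⟨key f hf, key2 f hf, ?_, ?_, ?_⟩
  · rw [key f hf, key _ (hf.dx.add (hf.cmul c)), dx_add hf.dx (hf.cmul c), dx_cmul c hf]
    funext p; ring
  · rw [key2 f hf, key _ hf.dy]
  · rw [key2 f hf, key2 _ hf.dy]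

lemma exp_mul_two (c t : ℝ) : Real.exp (c * t) * Real.exp (c * t) = Real.exp (2 * c * t) := by
  rw [← Real.exp_add]; congr 1; ring

/-- The weighted energy. -/
def JJ (χ : ℝ → ℝ) (Φ : ℝ × ℝ → ℝ) : ℝ := ∫ x, zeta χ x * D2 Φ x

lemma JJ_eq (χ : ℝ → ℝ) (Φ : ℝ × ℝ → ℝ) : JJ χ Φ = ∫ p : ℝ × ℝ, χ p.1 * (Real.exp p.1 * cutE (D2 Φ) p) := by
  rw [JJ, integral_cutE]
  congr 1; funext p
  unfold cutE
  split_ifs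
  · beta_reduce
    rw [zeta_Ex, two_mul, Real.exp_add]
    have := (Real.exp_pos p.1).ne'
    field_simp
  · simp

lemma log_lower {a b : ℝ} {s : ℝ} (hs : 0 < s) (h : a ≤ Real.log s / 2) (h2 : Real.log s / 2 ≤ b) :
    Real.exp (2 * a) ≤ s ∧ s ≤ Real.exp (2 * b) :=
  ⟨(Real.le_log_iff_exp_le hs).1 (by linarith), (Real.log_le_iff_le_exp hs).1 (by linarith)⟩

lemma zeta_zero_of {χ : ℝ → ℝ} {a b : ℝ} (hab : ∀ t, χ t ≠ 0 → a ≤ t ∧ t ≤ b) {p : ℝ × ℝ} (hp : zeta χ p ≠ 0) :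
    Real.exp (2 * a) ≤ p.1 ^ 2 + p.2 ^ 2 ∧ p.1 ^ 2 + p.2 ^ 2 ≤ Real.exp (2 * b) := by
  have h1 := left_ne_zero_of_mul hp
  have h2 := right_ne_zero_of_mul hp
  have hs : 0 < p.1 ^ 2 + p.2 ^ 2 := by
    by_contra hh
    apply h1
    rw [Real.sqrt_eq_zero_of_nonpos (not_lt.1 hh), _root_.inv_zero]
  exact log_lower hs (hab _ h2).1 (hab _ h2).2

lemma exists_bds {χ : ℝ → ℝ} (h : HasCompactSupport χ) : ∃ a b : ℝ, ∀ t, χ t ≠ 0 → a ≤ t ∧ t ≤ b := by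
  obtain ⟨R, hR⟩ := h.isCompact.isBounded.subset_closedBall 0
  refine ⟨-R, R, fun t ht => ?_⟩
  have := hR (subset_tsupport _ ht)
  rw [mem_closedBall_zero_iff, Real.norm_eq_abs, abs_le] at this
  exact this

lemma zeta_sm {χ : ℝ → ℝ} (h : Wt χ) : Sm (zeta χ) := by
  obtain ⟨a, b, hab⟩ := exists_bds h.cs
  rw [Sm, contDiff_iff_contDiffAt]
  intro p
  by_cases hp : p.1 ^ 2 + p.2 ^ 2 = 0
  · have ho : IsOpen {q : ℝ × ℝ | q.1 ^ 2 + q.2 ^ 2 < Real.exp (2 * a)} := isOpen_lt (by fun_prop) continuous_const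
    have : zeta χ =ᶠ[𝓝 p] fun _ => 0 := by
      filter_upwards [ho.mem_nhds (show p.1 ^ 2 + p.2 ^ 2 < _ by rw [hp]; positivity)] with q hq
      by_contra hne
      have := (zeta_zero_of hab hne).1
      exact absurd hq (not_lt.2 this)
    exact contDiffAt_const.congr_of_eventuallyEq this
  · have hq : ContDiffAt ℝ ∞ (fun p : ℝ × ℝ => p.1 ^ 2 + p.2 ^ 2) p := by fun_prop
    have h1 := hq.sqrt hp
    have h2 := (hq.log hp).div_const 2
    refine (h1.inv ?_).mul (h.sm.contDiffAt.comp p h2)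
    rw [Real.sqrt_ne_zero (by positivity)]; exact hp

lemma zeta_cs {χ : ℝ → ℝ} (h : HasCompactSupport χ) : HasCompactSupport (zeta χ) := by
  obtain ⟨a, b, hab⟩ := exists_bds h
  have hb : Bornology.IsBounded {q : ℝ × ℝ | q.1 ^ 2 + q.2 ^ 2 ≤ Real.exp (2 * b)} := by
    rw [isBounded_iff_forall_norm_le]
    refine ⟨Real.exp b, fun q hq => ?_⟩
    rw [mem_ofPred_eq, mul_comm 2 b, Real.exp_mul, Real.rpow_two] at hq
    rw [Prod.norm_def, max_le_iff, Real.norm_eq_abs, Real.norm_eq_abs]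
    exact ⟨abs_le_of_sq_le_sq (by nlinarith [sq_nonneg q.2]) (Real.exp_pos b).le,
      abs_le_of_sq_le_sq (by nlinarith [sq_nonneg q.1]) (Real.exp_pos b).le⟩
  have hc : IsClosed {q : ℝ × ℝ | q.1 ^ 2 + q.2 ^ 2 ≤ Real.exp (2 * b)} := isClosed_le (by fun_prop) continuous_const
  exact HasCompactSupport.of_support_subset_isCompact (Metric.isCompact_of_isClosed_isBounded hc hb)
    fun q hq => (zeta_zero_of hab hq).2

end Cartesian

end

section
section Cartesian2
open scoped ContDiff

/-- Hessian norm in log-polar coordinates after factoring out an exponential. -/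
def Qc (c : ℝ) (f : ℝ × ℝ → ℝ) : ℝ × ℝ → ℝ := fun p =>
  (dx (dx f) p + (2 * c - 1) * dx f p + (c ^ 2 - c) * f p) ^ 2 + 2 * (dx (dy f) p + (c - 1) * dy f p) ^ 2
    + (dy (dy f) p + dx f p + c * f p) ^ 2

lemma Qc_sm (c : ℝ) {f : ℝ × ℝ → ℝ} (h : Sm f) : Sm (Qc c f) :=
  (((((h.dx.dx.add (h.dx.cmul _)).add (h.cmul _)).pow 2).add (((h.dy.dx.add (h.dy.cmul _)).pow 2).cmul 2))).add
    (((h.dy.dy.add h.dx).add (h.cmul c)).pow 2)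

lemma Qc_van (c : ℝ) {om : ℝ} {ψ : ℝ × ℝ → ℝ} (h : Sm ψ) (hv : Van om ψ) : Van om (Qc c ψ) := fun p hp => by
  simp [Qc, hv p hp, hv.dx h p hp, hv.dy h p hp, (hv.dx h).dx h.dx p hp, (hv.dy h).dx h.dy p hp, (hv.dy h).dy h.dy p hp]

lemma cut_Qc {om : ℝ} (h0 : 0 < om) (hom : om < Real.pi) {Φ : ℝ × ℝ → ℝ} (h : Sm Φ) (hS : SupS om Φ)
    (c : ℝ) {f : ℝ × ℝ → ℝ} (hf : Sm f) (hF : cutE Φ = fun p => Real.exp (c * p.1) * f p) (p : ℝ × ℝ) :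
    Real.exp p.1 ^ 4 * cutE (D2 Φ) p = Real.exp (2 * c * p.1) * Qc c f p := by
  rw [cut_D2 h0 hom h hS]
  obtain ⟨e1, e2, e3, e4, e5⟩ := exp_factor c hf hF
  rw [e3, e4, e5, e1, e2, ← exp_mul_two, Qc]
  ring

lemma cut_LapF {om : ℝ} (h0 : 0 < om) (hom : om < Real.pi) {Φ : ℝ × ℝ → ℝ} (h : Sm Φ) (hS : SupS om Φ)
    (c : ℝ) {f : ℝ × ℝ → ℝ} (hf : Sm f) (hF : cutE Φ = fun p => Real.exp (c * p.1) * f p) (p : ℝ × ℝ) :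
    Real.exp p.1 ^ 2 * cutE (Lap Φ) p = Real.exp (c * p.1) *
      (dx (dx f) p + 2 * c * dx f p + c ^ 2 * f p + dy (dy f) p) := by
  rw [cut_Lap h0 hom h hS]
  obtain ⟨e1, e2, e3, e4, e5⟩ := exp_factor c hf hF
  rw [e3, e5]
  ring

lemma sq3 (a b c : ℝ) : (a + b + c) ^ 2 ≤ 3 * (a ^ 2 + b ^ 2 + c ^ 2) := by
  nlinarith [sq_nonneg (a - b), sq_nonneg (a - c), sq_nonneg (b - c)]
lemma sq2 (a b : ℝ) : (a + b) ^ 2 ≤ 2 * (a ^ 2 + b ^ 2) := by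
  nlinarith [sq_nonneg (a - b)]

lemma Qc_le_half (f : ℝ × ℝ → ℝ) (p : ℝ × ℝ) : Qc (1 / 2) f p ≤ 20 * qh f p := by
  unfold Qc qh
  have h1 := sq3 (dx (dx f) p) ((2 * (1 / 2) - 1) * dx f p) (((1 / 2) ^ 2 - 1 / 2) * f p)
  have h2 := sq2 (dx (dy f) p) ((1 / 2 - 1) * dy f p)
  have h3 := sq3 (dy (dy f) p) (dx f p) (1 / 2 * f p)
  nlinarith [sq_nonneg (dx (dx f) p), sq_nonneg (dx f p), sq_nonneg (f p), sq_nonneg (dx (dy f) p), sq_nonneg (dy f p), sq_nonneg (dy (dy f) p)]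

lemma Qc_le (f : ℝ × ℝ → ℝ) (p : ℝ × ℝ) : Qc (3 / 2) f p ≤ 20 * qh f p := by
  unfold Qc qh
  have h1 := sq3 (dx (dx f) p) ((2 * (3 / 2) - 1) * dx f p) (((3 / 2) ^ 2 - 3 / 2) * f p)
  have h2 := sq2 (dx (dy f) p) ((3 / 2 - 1) * dy f p)
  have h3 := sq3 (dy (dy f) p) (dx f p) (3 / 2 * f p)
  nlinarith [sq_nonneg (dx (dx f) p), sq_nonneg (dx f p), sq_nonneg (f p), sq_nonneg (dx (dy f) p), sq_nonneg (dy f p), sq_nonneg (dy (dy f) p)]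

lemma qh_le (f : ℝ × ℝ → ℝ) (p : ℝ × ℝ) :
    qh f p ≤ 6 * Qc (3 / 2) f p + 60 * (dx f p + 3 / 2 * f p) ^ 2 + 60 * dy f p ^ 2 + 300 * f p ^ 2 := by
  unfold Qc qh
  have h1 := sq3 (dx (dx f) p + (2 * (3 / 2) - 1) * dx f p + ((3 / 2) ^ 2 - 3 / 2) * f p)
    (-((2 * (3 / 2) - 1) * dx f p)) (- (((3 / 2) ^ 2 - 3 / 2) * f p))
  have h2 := sq2 (dx (dy f) p + (3 / 2 - 1) * dy f p) (-((3 / 2 - 1) * dy f p))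
  have h3 := sq3 (dy (dy f) p + dx f p + 3 / 2 * f p) (-dx f p) (-(3 / 2 * f p))
  have h4 := sq2 (dx f p + 3 / 2 * f p) (- (3 / 2 * f p))
  ring_nf at h1 h2 h3 h4 ⊢
  nlinarith [sq_nonneg (f p), sq_nonneg (dy f p), sq_nonneg (dx f p + 3 / 2 * f p),
    sq_nonneg (dx (dx f) p + (2 * (3 / 2) - 1) * dx f p + ((3 / 2) ^ 2 - 3 / 2) * f p),
    sq_nonneg (dx (dy f) p + (3 / 2 - 1) * dy f p), sq_nonneg (dy (dy f) p + dx f p + 3 / 2 * f p)]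

/-- Rescaled potential in log-polar coordinates. -/
def psi (Φ : ℝ × ℝ → ℝ) : ℝ × ℝ → ℝ := fun p => Real.exp (-(3 / 2) * p.1) * cutE Φ p

lemma psi_sm {om : ℝ} (h0 : 0 < om) (hom : om < Real.pi) {Φ : ℝ × ℝ → ℝ} (h : Sm Φ) (hS : SupS om Φ) : Sm (psi Φ) :=
  (Sm.of_fst (by fun_prop : ContDiff ℝ ∞ (fun t => Real.exp (-(3 / 2) * t)))).mul (cutE_sm h0 hom h hS)

lemma psi_van {om : ℝ} (h0 : 0 < om) {Φ : ℝ × ℝ → ℝ} (hS : SupS om Φ) : Van om (psi Φ) :=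
  (cutE_van h0 hS).mul_left _

lemma cutE_psi (Φ : ℝ × ℝ → ℝ) : cutE Φ = fun p => Real.exp (3 / 2 * p.1) * psi Φ p := by
  funext p
  rw [psi, ← mul_assoc, ← Real.exp_add]
  have : 3 / 2 * p.1 + -(3 / 2) * p.1 = 0 := by ring
  rw [this, Real.exp_zero, one_mul]

lemma exp_four (t : ℝ) : Real.exp t ^ 4 = Real.exp (2 * (3 / 2) * t) * Real.exp t := by
  rw [← Real.exp_add, ← Real.exp_nat_mul]; congr 1; push_cast; ring

lemma D2_psi {om : ℝ} (h0 : 0 < om) (hom : om < Real.pi) {Φ : ℝ × ℝ → ℝ} (h : Sm Φ) (hS : SupS om Φ) (p : ℝ × ℝ) :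
    Real.exp p.1 * cutE (D2 Φ) p = Qc (3 / 2) (psi Φ) p := by
  have := cut_Qc h0 hom h hS (3 / 2) (psi_sm h0 hom h hS) (cutE_psi Φ) p
  rw [exp_four, mul_assoc] at this
  exact mul_left_cancel₀ (Real.exp_pos _).ne' this

lemma JJ_psi {om : ℝ} (h0 : 0 < om) (hom : om < Real.pi) {Φ : ℝ × ℝ → ℝ} (h : Sm Φ) (hS : SupS om Φ) (χ : ℝ → ℝ) :
    JJ χ Φ = ∫ p, χ p.1 * Qc (3 / 2) (psi Φ) p := by
  rw [JJ_eq]; congr 1; funext p; rw [D2_psi h0 hom h hS]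

lemma JJ_nonneg {χ : ℝ → ℝ} (hχ : Wt χ) (Φ : ℝ × ℝ → ℝ) : 0 ≤ JJ χ Φ :=
  integral_nonneg fun p => mul_nonneg (zeta_nonneg hχ p) (D2_nonneg Φ p)

lemma JJ_le {om : ℝ} (h0 : 0 < om) (hom : om < Real.pi) {Φ : ℝ × ℝ → ℝ} (h : Sm Φ) (hS : SupS om Φ) {χ : ℝ → ℝ}
    (hχ : Wt χ) : JJ χ Φ ≤ 20 * ∫ p, χ p.1 * qh (psi Φ) p := by
  have hp := psi_sm h0 hom h hS
  have hv := psi_van h0 hS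
  rw [JJ_psi h0 hom h hS, ← wint_cmul]
  exact wint_mono hχ (Qc_sm _ hp) (Qc_van _ hp hv) ((qh_sm hp).cmul 20) ((qh_van hp hv).mul_left _)
    fun p _ => Qc_le _ p

lemma Wt.expw {χ : ℝ → ℝ} (hχ : Wt χ) : Wt (fun t => Real.exp (-t) * χ t) :=
  ⟨(by fun_prop : ContDiff ℝ ∞ (fun t => Real.exp (-t))).mul hχ.sm, hχ.cs.mul_left, fun t => mul_nonneg (Real.exp_pos _).le (hχ.nn t)⟩

lemma cutE_mul (f g : ℝ × ℝ → ℝ) (p : ℝ × ℝ) : cutE (fun q => f q * g q) p = cutE f p * cutE g p := by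
  unfold cutE; split_ifs <;> simp

lemma D2_sm {Φ : ℝ × ℝ → ℝ} (h : Sm Φ) : Sm (D2 Φ) :=
  ((h.dx.dx.pow 2).add ((h.dy.dx.pow 2).cmul 2)).add (h.dy.dy.pow 2)

lemma D2_sup {om : ℝ} {Φ : ℝ × ℝ → ℝ} (h : SupS om Φ) : SupS om (D2 Φ) := by
  have e : D2 Φ = fun p => (dx (dx Φ) p * dx (dx Φ) p + (2 * dx (dy Φ) p) * dx (dy Φ) p) + dy (dy Φ) p * dy (dy Φ) p := by
    funext p; unfold D2; ring
  rw [e]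
  exact ((h.dx.dx.mul_left _).add (h.dy.dx.mul_left _)).add (h.dy.dy.mul_left _)

/-- First derivatives are controlled by the Hessian. -/
lemma grad_ctrl {om : ℝ} (h0 : 0 < om) (hom : om < Real.pi) {Φ : ℝ × ℝ → ℝ} (h : Sm Φ) (hS : SupS om Φ) {χ : ℝ → ℝ}
    (hχ : Wt χ) : (∫ p : ℝ × ℝ, χ p.1 * (Real.exp (-p.1) * (cutE (dx Φ) p ^ 2 + cutE (dy Φ) p ^ 2))) ≤
      4 * Real.pi ^ 2 * JJ χ Φ := by
  have hw := hχ.expw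
  have s1 := cutE_sm h0 hom h.dx hS.dx
  have s2 := cutE_sm h0 hom h.dy hS.dy
  have v1 := cutE_van h0 hS.dx
  have v2 := cutE_van h0 hS.dy
  have p1 := poinc hom.le hw s1 v1
  have p2 := poinc hom.le hw s2 v2
  have e1 : (∫ p : ℝ × ℝ, χ p.1 * (Real.exp (-p.1) * (cutE (dx Φ) p ^ 2 + cutE (dy Φ) p ^ 2))) =
      (∫ p : ℝ × ℝ, (Real.exp (-p.1) * χ p.1) * cutE (dx Φ) p ^ 2) + ∫ p : ℝ × ℝ, (Real.exp (-p.1) * χ p.1) * cutE (dy Φ) p ^ 2 := by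
    rw [← wint_add hw (s1.pow 2) v1.sq (s2.pow 2) v2.sq]
    congr 1; funext p; ring
  have e2 : ((∫ p : ℝ × ℝ, (Real.exp (-p.1) * χ p.1) * dy (cutE (dx Φ)) p ^ 2) +
      ∫ p : ℝ × ℝ, (Real.exp (-p.1) * χ p.1) * dy (cutE (dy Φ)) p ^ 2) ≤ JJ χ Φ := by
    rw [← wint_add hw (s1.dy.pow 2) (v1.dy s1).sq (s2.dy.pow 2) (v2.dy s2).sq, JJ_eq]
    have e3 : (∫ p : ℝ × ℝ, χ p.1 * (Real.exp p.1 * cutE (D2 Φ) p)) =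
        ∫ p : ℝ × ℝ, (Real.exp (-p.1) * χ p.1) * (Real.exp (2 * p.1) * cutE (D2 Φ) p) := by
      congr 1; funext p
      have : Real.exp p.1 = Real.exp (-p.1) * Real.exp (2 * p.1) := by rw [← Real.exp_add]; congr 1; ring
      rw [this]; ring
    rw [e3]
    refine wint_mono hw ((s1.dy.pow 2).add (s2.dy.pow 2)) ((v1.dy s1).sq.add (v2.dy s2).sq)
      ((Sm.of_fst (by fun_prop : ContDiff ℝ ∞ (fun t => Real.exp (2 * t)))).mul (cutE_sm h0 hom (D2_sm h) (D2_sup hS)))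
      ((cutE_van h0 (D2_sup hS)).mul_left _) fun p _ => ?_
    rw [dy_cutE h0 hom h.dx hS.dx, dy_cutE h0 hom h.dy hS.dy]
    unfold cutE
    split_ifs
    · have hq := Ex_sq p
      have : Real.exp (2 * p.1) = Real.exp p.1 ^ 2 := by rw [← Real.exp_nat_mul]; norm_cast
      rw [this, ← hq, R2, R2, D2, dxdy_comm h]
      nlinarith [sq_nonneg ((Ex p).1 * dx (dx Φ) (Ex p) + (Ex p).2 * dx (dy Φ) (Ex p)),
        sq_nonneg ((Ex p).1 * dx (dy Φ) (Ex p) + (Ex p).2 * dy (dy Φ) (Ex p))]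
    · simp
  rw [e1]
  nlinarith [sq_nonneg Real.pi, mul_le_mul_of_nonneg_left e2 (by positivity : 0 ≤ 4 * Real.pi ^ 2)]

lemma qh_ctrl {om : ℝ} (h0 : 0 < om) (hom : om < Real.pi) : ∃ C > 0, ∀ {Φ : ℝ × ℝ → ℝ} (_ : Sm Φ) (_ : SupS om Φ) {χ : ℝ → ℝ}
    (_ : Wt χ), (∫ p, χ p.1 * qh (psi Φ) p) ≤ C * JJ χ Φ := by
  refine ⟨6 + (60 + 1200 * Real.pi ^ 2) * (4 * Real.pi ^ 2), by positivity, ?_⟩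
  intro Φ h hS χ hχ
  have hp := psi_sm h0 hom h hS
  have hv := psi_van h0 hS
  have sa : Sm (fun p => dx (psi Φ) p + 3 / 2 * psi Φ p) := hp.dx.add (hp.cmul _)
  have va : Van om (fun p => dx (psi Φ) p + 3 / 2 * psi Φ p) := (hv.dx hp).add (hv.mul_left _)
  have i1 := HI.of (integrable_of hχ (Qc_sm (3 / 2) hp) (Qc_van _ hp hv))
  have i2 := HI.of (integrable_of hχ ((sa.pow 2).add (hp.dy.pow 2)) (va.sq.add (hv.dy hp).sq))
  have i3 := HI.of (integrable_of hχ (hp.pow 2) hv.sq)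
  have i4 := HI.of (integrable_of hχ (hp.dy.pow 2) (hv.dy hp).sq)
  have i0 := HI.of (integrable_of hχ (qh_sm hp) (qh_van hp hv))
  have b1 : (∫ p, χ p.1 * qh (psi Φ) p) ≤ 6 * JJ χ Φ + 60 * (∫ p, χ p.1 * ((dx (psi Φ) p + 3 / 2 * psi Φ p) ^ 2 + dy (psi Φ) p ^ 2))
      + 300 * ∫ p, χ p.1 * psi Φ p ^ 2 := by
    have hh := ((i1.cmul 6).add (i2.cmul 60)).add (i3.cmul 300)
    rw [JJ_psi h0 hom h hS, ← hh.2]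
    refine integral_mono i0.1 hh.1 fun p => ?_
    have := mul_le_mul_of_nonneg_left (qh_le (psi Φ) p) (hχ.nn p.1)
    simp only
    linarith
  have b2 := poinc hom.le hχ hp hv
  have b3 : (∫ p, χ p.1 * dy (psi Φ) p ^ 2) ≤ ∫ p, χ p.1 * ((dx (psi Φ) p + 3 / 2 * psi Φ p) ^ 2 + dy (psi Φ) p ^ 2) := by
    refine integral_mono i4.1 i2.1 fun p => ?_
    have := mul_nonneg (hχ.nn p.1) (sq_nonneg (dx (psi Φ) p + 3 / 2 * psi Φ p))
    simp only
    linarith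
  have b4 : (∫ p, χ p.1 * ((dx (psi Φ) p + 3 / 2 * psi Φ p) ^ 2 + dy (psi Φ) p ^ 2)) ≤ 4 * Real.pi ^ 2 * JJ χ Φ := by
    refine le_of_eq_of_le ?_ (grad_ctrl h0 hom h hS hχ)
    congr 1; funext p
    congr 1
    obtain ⟨e1, e2, -⟩ := exp_factor (3 / 2) hp (cutE_psi Φ)
    have e1' := congrFun e1 p
    have e2' := congrFun e2 p
    rw [dx_cutE h0 hom h hS] at e1'
    rw [dy_cutE h0 hom h hS] at e2'
    have hE : Real.exp (3 / 2 * p.1) ^ 2 * Real.exp (-p.1) = Real.exp p.1 ^ 2 := by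
      rw [← Real.exp_nat_mul, ← Real.exp_nat_mul, ← Real.exp_add]; congr 1; push_cast; ring
    have key : cutE (R1 Φ) p ^ 2 + cutE (R2 Φ) p ^ 2 = Real.exp p.1 ^ 2 * (cutE (dx Φ) p ^ 2 + cutE (dy Φ) p ^ 2) := by
      unfold cutE
      split_ifs
      · rw [← Ex_sq, R1, R2]; ring
      · simp
    rw [e1', e2', ← hE] at key
    have hne := (Real.exp_pos (3 / 2 * p.1)).ne'
    apply mul_left_cancel₀ (pow_ne_zero 2 hne)
    linarith
  have hJ := JJ_nonneg hχ Φ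
  nlinarith [mul_le_mul_of_nonneg_left b3 (by positivity : 0 ≤ 4 * Real.pi ^ 2), mul_le_mul_of_nonneg_left b4 (by positivity : 0 ≤ 60 + 1200 * Real.pi ^ 2)]

lemma cutE_G {χ : ℝ → ℝ} (Φ : ℝ × ℝ → ℝ) :
    cutE (fun q => zeta χ q * Φ q) = fun p => Real.exp (1 / 2 * p.1) * (χ p.1 * psi Φ p) := by
  funext p
  rw [cutE_mul, cutE_psi Φ]
  have h2 : Real.exp (3 / 2 * p.1) = Real.exp p.1 * Real.exp (1 / 2 * p.1) := by rw [← Real.exp_add]; congr 1; ring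
  by_cases h : |p.2| < Real.pi
  · have : cutE (zeta χ) p = (Real.exp p.1)⁻¹ * χ p.1 := by rw [cutE, if_pos h, zeta_Ex]
    simp only
    rw [this, h2]
    have := (Real.exp_pos p.1).ne'
    field_simp
  · have : psi Φ p = 0 := by simp [psi, cutE, h]
    simp [this]

lemma form_cart {om : ℝ} (h0 : 0 < om) (hom : om < Real.pi) {Φ : ℝ × ℝ → ℝ} (h : Sm Φ) (hS : SupS om Φ) {χ : ℝ → ℝ}
    (hχ : Wt χ) : (∫ x, Lap Φ x * Lap (fun q => zeta χ q * Φ q) x) =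
      ∫ p, La (psi Φ) p * Lb (fun p => χ p.1 * psi Φ p) p := by
  rw [integral_cutE]
  congr 1; funext p
  rw [cutE_mul]
  have hp := psi_sm h0 hom h hS
  have hc : Sm (fun p => χ p.1 * psi Φ p) := (Sm.of_fst hχ.sm).mul hp
  have k1 := cut_LapF h0 hom h hS (3 / 2) hp (cutE_psi Φ) p
  have k2 := cut_LapF h0 hom ((zeta_sm hχ).mul h) (hS.mul_left _) (1 / 2) hc (cutE_G Φ) p
  have e : Real.exp (2 * p.1) * Real.exp (2 * p.1) = Real.exp p.1 ^ 2 * Real.exp p.1 ^ 2 := by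
    rw [← Real.exp_nat_mul]; norm_cast
  have e' : Real.exp (2 * p.1) = Real.exp (3 / 2 * p.1) * Real.exp (1 / 2 * p.1) := by rw [← Real.exp_add]; congr 1; ring
  apply mul_left_cancel₀ (Real.exp_pos (2 * p.1)).ne'
  calc _ = (Real.exp (2 * p.1) * Real.exp (2 * p.1)) * (cutE (Lap Φ) p * cutE (Lap fun q => zeta χ q * Φ q) p) := by ring
    _ = (Real.exp p.1 ^ 2 * cutE (Lap Φ) p) * (Real.exp p.1 ^ 2 * cutE (Lap fun q => zeta χ q * Φ q) p) := by rw [e]; ring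
    _ = _ := by rw [k1, k2, e', La, Lb]; ring

/-- Cartesian form of the coercivity estimate. -/
theorem cart_lower {om : ℝ} (h0 : 0 < om) (hom : om < Real.pi) :
    ∃ κ > 0, ∃ C > 0, ∀ (χ χh : ℝ → ℝ) (Φ : ℝ × ℝ → ℝ) (ε : ℝ), Wt χ → Wt χh → Sm Φ → SupS om Φ → 0 ≤ ε →
      (∀ t, |deriv χ t| ≤ ε * χh t) → (∀ t, |deriv (deriv χ) t| ≤ ε * χh t) →
      κ * JJ χ Φ ≤ (∫ x, Lap Φ x * Lap (fun q => zeta χ q * Φ q) x) + ε * (C * JJ χh Φ) := by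
  obtain ⟨κ, hκ, H⟩ := form_lower h0 hom
  obtain ⟨C, hC, HC⟩ := qh_ctrl h0 hom
  refine ⟨κ / 20, by positivity, 300 * C, by positivity, ?_⟩
  intro χ χh Φ ε hχ hχh h hS hε d1 d2
  have hh := H χ χh (psi Φ) ε hχ hχh (psi_sm h0 hom h hS) (psi_van h0 hS) hε d1 d2
  rw [form_cart h0 hom h hS hχ]
  have b1 := JJ_le h0 hom h hS hχ
  have b2 := HC h hS hχh
  have := mul_le_mul_of_nonneg_left b2 hε
  nlinarith

lemma qh_mul_le {ψ : ℝ × ℝ → ℝ} {χ : ℝ → ℝ} (h : Sm ψ) (hχ : ContDiff ℝ ∞ χ) (p : ℝ × ℝ) {D : ℝ}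
    (d0 : χ p.1 ^ 2 ≤ D) (d1 : deriv χ p.1 ^ 2 ≤ D) (d2 : deriv (deriv χ) p.1 ^ 2 ≤ D) :
    qh (fun p => χ p.1 * ψ p) p ≤ 30 * (D * qh ψ p) := by
  have hχ' : ContDiff ℝ ∞ (deriv χ) := (contDiff_infty_iff_deriv.1 hχ).2
  have hs := Sm.of_fst hχ
  have hs' := Sm.of_fst hχ'
  have e1 : dx (fun p => χ p.1 * ψ p) = fun p => deriv χ p.1 * ψ p + χ p.1 * dx ψ p := by
    rw [dx_mul hs h, dx_fst hχ]
  have e2 : dy (fun p => χ p.1 * ψ p) = fun p => χ p.1 * dy ψ p := by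
    rw [dy_mul hs h, dy_fst hχ]; funext p; ring
  have e3 : dy (dy (fun p => χ p.1 * ψ p)) = fun p => χ p.1 * dy (dy ψ) p := by
    rw [e2, dy_mul hs h.dy, dy_fst hχ]; funext p; ring
  have e4 : dx (dy (fun p => χ p.1 * ψ p)) = fun p => deriv χ p.1 * dy ψ p + χ p.1 * dx (dy ψ) p := by
    rw [e2, dx_mul hs h.dy, dx_fst hχ]
  have e5 : dx (dx (fun p => χ p.1 * ψ p)) = fun p => deriv (deriv χ) p.1 * ψ p + 2 * (deriv χ p.1 * dx ψ p) + χ p.1 * dx (dx ψ) p := by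
    rw [e1, dx_add (hs'.mul h) (hs.mul h.dx), dx_mul hs' h, dx_mul hs h.dx, dx_fst hχ, dx_fst hχ']; funext p; ring
  unfold qh
  rw [e5, e4, e3, e1, e2]
  have f1 := sq3 (deriv (deriv χ) p.1 * ψ p) (2 * (deriv χ p.1 * dx ψ p)) (χ p.1 * dx (dx ψ) p)
  have f2 := sq2 (deriv χ p.1 * dy ψ p) (χ p.1 * dx (dy ψ) p)
  have f3 := sq2 (deriv χ p.1 * ψ p) (χ p.1 * dx ψ p)
  simp only [mul_pow] at f1 f2 f3 ⊢
  have m := fun (a : ℝ) => mul_le_mul_of_nonneg_right d0 (sq_nonneg a)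
  have m1 := fun (a : ℝ) => mul_le_mul_of_nonneg_right d1 (sq_nonneg a)
  have m2 := fun (a : ℝ) => mul_le_mul_of_nonneg_right d2 (sq_nonneg a)
  have hD : 0 ≤ D := (sq_nonneg _).trans d0
  have n := fun (a : ℝ) => mul_nonneg hD (sq_nonneg a)
  linarith [m (ψ p), m (dx ψ p), m (dy ψ p), m (dx (dx ψ) p), m (dx (dy ψ) p), m (dy (dy ψ) p), m1 (ψ p), m1 (dx ψ p),
    m1 (dy ψ p), m2 (ψ p), n (ψ p), n (dx ψ p), n (dy ψ p), n (dx (dx ψ) p), n (dx (dy ψ) p), n (dy (dy ψ) p)]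

/-- The Hessian of the test function is controlled. -/
theorem cart_test {om : ℝ} (h0 : 0 < om) (hom : om < Real.pi) {χ χh : ℝ → ℝ} (hχ : Wt χ) (hχh : Wt χh) (B : ℝ)
    (b0 : ∀ t, χ t ^ 2 ≤ B * χh t) (b1 : ∀ t, deriv χ t ^ 2 ≤ B * χh t) (b2 : ∀ t, deriv (deriv χ) t ^ 2 ≤ B * χh t) :
    ∃ C, 0 ≤ C ∧ ∀ Φ : ℝ × ℝ → ℝ, Sm Φ → SupS om Φ → (∫ x, D2 (fun q => zeta χ q * Φ q) x) ≤ C * JJ χh Φ := by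
  obtain ⟨C, hC, HC⟩ := qh_ctrl h0 hom
  obtain ⟨a, b, hab⟩ := exists_bds hχh.cs
  refine ⟨600 * (|B| * Real.exp (-a)) * C, by positivity, ?_⟩
  intro Φ h hS
  have hp := psi_sm h0 hom h hS
  have hv := psi_van h0 hS
  have hc : Sm (fun p => χ p.1 * psi Φ p) := (Sm.of_fst hχ.sm).mul hp
  have key : (∫ x, D2 (fun q => zeta χ q * Φ q) x) ≤ ∫ p, 600 * (|B| * Real.exp (-a)) * (χh p.1 * qh (psi Φ) p) := by
    rw [integral_cutE]
    refine integral_mono_of_nonneg (Eventually.of_forall fun p => ?_)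
      ((integrable_of hχh (qh_sm hp) (qh_van hp hv)).const_mul _) (Eventually.of_forall fun p => ?_)
    · refine mul_nonneg (Real.exp_pos _).le ?_
      unfold cutE; split_ifs
      · exact D2_nonneg _ _
      · exact le_rfl
    · have k := cut_Qc h0 hom ((zeta_sm hχ).mul h) (hS.mul_left _) (1 / 2) hc (cutE_G Φ) p
      have e : Real.exp (2 * p.1) * cutE (D2 fun q => zeta χ q * Φ q) p = Real.exp (-p.1) * Qc (1 / 2) (fun p => χ p.1 * psi Φ p) p := by
        apply mul_left_cancel₀ (Real.exp_pos (2 * p.1)).ne'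
        have e1 : Real.exp (2 * p.1) * Real.exp (2 * p.1) = Real.exp p.1 ^ 4 := by
          rw [← Real.exp_nat_mul, ← Real.exp_add]; congr 1; push_cast; ring
        have e2 : Real.exp (2 * p.1) * Real.exp (- p.1) = Real.exp (2 * (1 / 2) * p.1) := by
          rw [← Real.exp_add]; congr 1; ring
        rw [← mul_assoc, ← mul_assoc, e1, e2, k]
      simp only
      rw [e]
      have q1 := Qc_le_half (fun p => χ p.1 * psi Φ p) p
      have q2 := qh_mul_le hp hχ.sm p (b0 p.1) (b1 p.1) (b2 p.1)
      have hq := qh_nonneg (psi Φ) p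
      have q3 : Qc (1 / 2) (fun p => χ p.1 * psi Φ p) p ≤ 600 * (B * χh p.1 * qh (psi Φ) p) := by linarith
      by_cases hz : χh p.1 = 0
      · rw [hz] at q3 ⊢
        have := mul_le_mul_of_nonneg_left q3 (Real.exp_pos (-p.1)).le
        simpa using this
      · have ha := (hab _ hz).1
        have hexp : Real.exp (-p.1) ≤ Real.exp (-a) := Real.exp_le_exp.2 (by linarith)
        have hpos : 0 ≤ χh p.1 * qh (psi Φ) p := mul_nonneg (hχh.nn _) hq
        have q4 : Qc (1 / 2) (fun p => χ p.1 * psi Φ p) p ≤ 600 * (|B| * (χh p.1 * qh (psi Φ) p)) := by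
          have := mul_le_mul_of_nonneg_right (le_abs_self B) hpos
          linarith
        calc _ ≤ Real.exp (-p.1) * (600 * (|B| * (χh p.1 * qh (psi Φ) p))) := mul_le_mul_of_nonneg_left q4 (Real.exp_pos _).le
          _ ≤ Real.exp (-a) * (600 * (|B| * (χh p.1 * qh (psi Φ) p))) := mul_le_mul_of_nonneg_right hexp (by positivity)
          _ = _ := by ring
  refine key.trans ?_
  rw [integral_const_mul]
  have := mul_le_mul_of_nonneg_left (HC h hS hχh) (by positivity : 0 ≤ 600 * (|B| * Real.exp (-a)))
  linarith

end Cartesian2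

end

section
section Moll
open scoped ContDiff

lemma transl_cont {s : ℝ × ℝ → ℝ} (hs : MemLp s 2) {η : ℝ≥0∞} (hη : 0 < η) :
    ∃ d > 0, ∀ z : ℝ × ℝ, ‖z‖ < d → ∫⁻ x, ‖s (x - z) - s x‖ₑ ^ 2 ≤ η := by
  have hmp : ∀ z : ℝ × ℝ, MeasurePreserving (fun x : ℝ × ℝ => x - z) volume volume := fun z =>
    measurePreserving_sub_right volume z
  let g : ℝ × ℝ → C(ℝ × ℝ, ℝ × ℝ) := fun z => ⟨fun x => x - z, by fun_prop⟩
  have hg : Continuous g := by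
    apply ContinuousMap.continuous_of_continuous_uncurry
    change Continuous (fun p : (ℝ × ℝ) × (ℝ × ℝ) => p.2 - p.1)
    fun_prop
  have hc := Continuous.compMeasurePreservingLp (μ := volume) (ν := volume) (f := fun _ : ℝ × ℝ => hs.toLp s) (g := g)
    continuous_const hg hmp (by norm_num)
  have hc0 := hc.tendsto 0
  rw [EMetric.tendsto_nhds] at hc0
  have h1 : (0 : ℝ≥0∞) < min η 1 := lt_min hη one_pos
  have h2 := hc0 (min η 1) h1
  rw [Metric.eventually_nhds_iff] at h2
  obtain ⟨d, hd, H⟩ := h2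
  refine ⟨d, hd, fun z hz => ?_⟩
  have h3 := H (y := z) (by simpa using hz)
  rw [Lp.edist_def] at h3
  have e : eLpNorm (⇑(Lp.compMeasurePreserving (g z) (hmp z) (hs.toLp s)) - ⇑(Lp.compMeasurePreserving (g 0) (hmp 0) (hs.toLp s))) 2 volume
      = eLpNorm (fun x => s (x - z) - s x) 2 volume := by
    apply eLpNorm_congr_ae
    have a1 := Lp.coeFn_compMeasurePreserving (hs.toLp s) (hmp z)
    have a2 := Lp.coeFn_compMeasurePreserving (hs.toLp s) (hmp 0)
    have b1 := (hmp z).quasiMeasurePreserving.ae_eq_comp hs.coeFn_toLp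
    have b2 := (hmp 0).quasiMeasurePreserving.ae_eq_comp hs.coeFn_toLp
    filter_upwards [a1, a2, b1, b2] with x x1 x2 x3 x4
    simp only [Pi.sub_apply]
    erw [x1, x2, x3, x4]
    simp
  rw [e] at h3
  have h4 : eLpNorm (fun x => s (x - z) - s x) 2 volume ^ 2 ≤ η := by
    have h5 : eLpNorm (fun x => s (x - z) - s x) 2 volume ≤ min η 1 := h3.le
    calc _ = eLpNorm (fun x => s (x - z) - s x) 2 volume * eLpNorm (fun x => s (x - z) - s x) 2 volume := sq _
      _ ≤ η * 1 := mul_le_mul' (h5.trans (min_le_left _ _)) (h5.trans (min_le_right _ _))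
      _ = η := mul_one _
  rw [eLpNorm_eq_lintegral_rpow_enorm_toReal (by norm_num) (by norm_num)] at h4
  simp only [ENNReal.toReal_ofNat] at h4
  rw [← ENNReal.rpow_natCast, ← ENNReal.rpow_mul] at h4
  norm_num at h4
  exact h4

lemma jensen_aux {ρ w : ℝ × ℝ → ℝ} (hrm : Measurable ρ) (hl1 : ∫⁻ z, ‖ρ z‖ₑ = 1) (hw : AEMeasurable w) :
    ‖∫ z, ρ z * w z‖ₑ ^ 2 ≤ ∫⁻ z, ‖ρ z‖ₑ * ‖w z‖ₑ ^ 2 := by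
  have b1 : ‖∫ z, ρ z * w z‖ₑ ≤ ∫⁻ z, ‖ρ z‖ₑ ^ (1 / 2 : ℝ) * (‖ρ z‖ₑ ^ (1 / 2 : ℝ) * ‖w z‖ₑ) := by
    refine (enorm_integral_le_lintegral_enorm _).trans (le_of_eq ?_)
    congr 1; funext z
    rw [enorm_mul, ← mul_assoc, ← ENNReal.rpow_add_of_nonneg _ _ (by norm_num) (by norm_num)]
    norm_num
  have m1 : AEMeasurable (fun z => ‖ρ z‖ₑ ^ (1 / 2 : ℝ)) := (hrm.enorm.pow_const _).aemeasurable
  have hold := ENNReal.lintegral_mul_le_Lp_mul_Lq volume (p := 2) (q := 2) (by norm_num [Real.holderConjugate_iff])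
    m1 (m1.mul hw.enorm)
  have b2 := b1.trans hold
  have e3 : (∫⁻ z, (‖ρ z‖ₑ ^ (1 / 2 : ℝ)) ^ (2 : ℝ)) = 1 := by
    rw [← hl1]; congr 1; funext z; rw [← ENNReal.rpow_mul]; norm_num
  have e4 : (∫⁻ z, (‖ρ z‖ₑ ^ (1 / 2 : ℝ) * ‖w z‖ₑ) ^ (2 : ℝ)) = ∫⁻ z, ‖ρ z‖ₑ * ‖w z‖ₑ ^ 2 := by
    congr 1; funext z
    rw [ENNReal.mul_rpow_of_nonneg _ _ (by norm_num), ← ENNReal.rpow_mul]; norm_num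
  simp only [Pi.mul_apply] at b2
  rw [e3, e4, ENNReal.one_rpow, one_mul] at b2
  calc _ ≤ ((∫⁻ z, ‖ρ z‖ₑ * ‖w z‖ₑ ^ 2) ^ (1 / 2 : ℝ)) ^ 2 := pow_le_pow_left' b2 2
    _ = _ := by rw [← ENNReal.rpow_natCast, ← ENNReal.rpow_mul]; norm_num

lemma moll {s : ℝ × ℝ → ℝ} (hs : MemLp s 2) {η : ℝ≥0∞} (hη : 0 < η) :
    ∃ d > 0, ∀ ρ : ℝ × ℝ → ℝ, Continuous ρ → (∀ z, 0 ≤ ρ z) → (∀ z, ρ z ≠ 0 → ‖z‖ < d) → (∫ z, ρ z = 1) →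
      HasCompactSupport ρ →
      ∫⁻ x, ‖(∫ y, s y * ρ (x - y)) - s x‖ₑ ^ 2 ≤ η := by
  obtain ⟨d, hd, H⟩ := transl_cont hs hη
  refine ⟨d, hd, fun ρ hc h0 hsup h1 hcs => ?_⟩
  have hloc : LocallyIntegrable s := hs.locallyIntegrable (by norm_num)
  have hρi : Integrable ρ := hc.integrable_of_hasCompactSupport hcs
  have hl1 : ∫⁻ z, ‖ρ z‖ₑ = 1 := by
    have := ofReal_integral_eq_lintegral_ofReal hρi (Eventually.of_forall h0)
    rw [h1, ENNReal.ofReal_one] at this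
    rw [this]; congr 1; funext z; rw [Real.enorm_eq_ofReal (h0 z)]
  have hsm := hs.1.aemeasurable
  have hrm : Measurable ρ := hc.measurable
  have pt : ∀ x, ‖(∫ y, s y * ρ (x - y)) - s x‖ₑ ^ 2 ≤ ∫⁻ z, ‖ρ z‖ₑ * ‖s (x - z) - s x‖ₑ ^ 2 := by
    intro x
    have e1 : (∫ y, s y * ρ (x - y)) = ∫ z, s (x - z) * ρ z := by
      rw [← integral_sub_left_eq_self (fun z => s (x - z) * ρ z) volume x]; simp
    have hInt : Integrable (fun z => s (x - z) * ρ z) := by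
      have : Integrable (fun y => s y * ρ (x - y)) := by
        have h2 : HasCompactSupport (fun y => ρ (x - y)) := hcs.comp_homeomorph (Homeomorph.subLeft x)
        have := hloc.integrable_smul_right_of_hasCompactSupport (g := fun y => ρ (x - y)) (by fun_prop) h2
        simpa using this
      have h3 := this.comp_sub_left x
      simpa using h3
    have e2 : (∫ y, s y * ρ (x - y)) - s x = ∫ z, ρ z * (s (x - z) - s x) := by
      rw [e1]
      have : (fun z => ρ z * (s (x - z) - s x)) = fun z => s (x - z) * ρ z - s x * ρ z := by funext z; ring
      rw [this, integral_sub hInt (hρi.const_mul _), integral_const_mul, h1, mul_one]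
    rw [e2]
    have hmx : AEMeasurable (fun z => s (x - z)) :=
      hsm.comp_quasiMeasurePreserving (Measure.measurePreserving_sub_left volume x).quasiMeasurePreserving
    exact jensen_aux hrm hl1 (hmx.sub_const (s x))
  calc _ ≤ ∫⁻ x, ∫⁻ z, ‖ρ z‖ₑ * ‖s (x - z) - s x‖ₑ ^ 2 := lintegral_mono pt
    _ = ∫⁻ z, ∫⁻ x, ‖ρ z‖ₑ * ‖s (x - z) - s x‖ₑ ^ 2 := by
        apply lintegral_lintegral_swap
        have q1 : AEMeasurable (fun p : (ℝ × ℝ) × (ℝ × ℝ) => s (p.1 - p.2)) (volume.prod volume) :=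
          hsm.comp_quasiMeasurePreserving (quasiMeasurePreserving_sub_of_right_invariant volume volume)
        have q2 : AEMeasurable (fun p : (ℝ × ℝ) × (ℝ × ℝ) => s p.1) (volume.prod volume) :=
          hsm.comp_quasiMeasurePreserving Measure.quasiMeasurePreserving_fst
        have q3 : AEMeasurable (fun p : (ℝ × ℝ) × (ℝ × ℝ) => ρ p.2) (volume.prod volume) :=
          (hrm.comp measurable_snd).aemeasurable
        exact q3.enorm.mul ((q1.sub q2).enorm.pow_const 2)
    _ = ∫⁻ z, ‖ρ z‖ₑ * ∫⁻ x, ‖s (x - z) - s x‖ₑ ^ 2 := by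
        congr 1; funext z
        exact lintegral_const_mul' _ _ (by simp)
    _ ≤ ∫⁻ z, ‖ρ z‖ₑ * η := by
        apply lintegral_mono; intro z
        by_cases hz : ρ z = 0
        · simp [hz]
        · exact mul_le_mul_right (H z (hsup z hz)) _
    _ = η := by rw [lintegral_mul_const _ hrm.enorm, hl1, one_mul]

end Moll

end

section
section Airy
open scoped ContDiff Convolution

/-- Convolution-type integral. -/
def cv (s k : ℝ × ℝ → ℝ) : ℝ × ℝ → ℝ := fun x => ∫ y, s y * k (x - y)

lemma cv_eq (s k : ℝ × ℝ → ℝ) : cv s k = s ⋆[ContinuousLinearMap.mul ℝ ℝ, volume] k := rfl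

lemma cv_sm {s k : ℝ × ℝ → ℝ} (hs : LocallyIntegrable s) (hk : Sm k) (hc : HasCompactSupport k) : Sm (cv s k) := by
  rw [cv_eq]; exact hc.contDiff_convolution_right _ hs hk.cd

lemma cv_fderiv {s k : ℝ × ℝ → ℝ} (hs : LocallyIntegrable s) (hk : Sm k) (hc : HasCompactSupport k) (v x : ℝ × ℝ) :
    fderiv ℝ (cv s k) x v = cv s (fun z => fderiv ℝ k z v) x := by
  have h1 : ContDiff ℝ 1 k := hk.cd.of_le (by simp)
  rw [cv_eq, (hc.hasFDerivAt_convolution_right (ContinuousLinearMap.mul ℝ ℝ) hs h1 x).fderiv,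
    convolution_precompR_apply _ hs (hc.fderiv ℝ) (h1.continuous_fderiv (by simp))]
  rfl

lemma cv_dx {s k : ℝ × ℝ → ℝ} (hs : LocallyIntegrable s) (hk : Sm k) (hc : HasCompactSupport k) :
    dx (cv s k) = cv s (dx k) := funext fun x => cv_fderiv hs hk hc (1, 0) x
lemma cv_dy {s k : ℝ × ℝ → ℝ} (hs : LocallyIntegrable s) (hk : Sm k) (hc : HasCompactSupport k) :
    dy (cv s k) = cv s (dy k) := funext fun x => cv_fderiv hs hk hc (0, 1) x

lemma cv_int {s k : ℝ × ℝ → ℝ} (hs : LocallyIntegrable s) (hk : Continuous k) (hc : HasCompactSupport k) (x : ℝ × ℝ) :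
    Integrable (fun y => s y * k (x - y)) :=
  hc.convolutionExists_right (ContinuousLinearMap.mul ℝ ℝ) hs hk x

/-- Weakly divergence free symmetric fields, supported in a sector. -/
structure Stress (om : ℝ) (s11 s12 s22 : ℝ × ℝ → ℝ) : Prop where
  l11 : ∀ R : ℝ, MemLp ((ball 0 R).indicator s11) 2
  l12 : ∀ R : ℝ, MemLp ((ball 0 R).indicator s12) 2
  l22 : ∀ R : ℝ, MemLp ((ball 0 R).indicator s22) 2
  z11 : ∀ x, x ∉ Sec om → s11 x = 0
  z12 : ∀ x, x ∉ Sec om → s12 x = 0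
  z22 : ∀ x, x ∉ Sec om → s22 x = 0
  div1 : ∀ g : ℝ × ℝ → ℝ, Sm g → HasCompactSupport g → (∫ x, (s11 x * dx g x + s12 x * dy g x)) = 0
  div2 : ∀ g : ℝ × ℝ → ℝ, Sm g → HasCompactSupport g → (∫ x, (s12 x * dx g x + s22 x * dy g x)) = 0

lemma loc_of_trunc {s : ℝ × ℝ → ℝ} (h : ∀ R : ℝ, MemLp ((ball 0 R).indicator s) 2) : LocallyIntegrable s := by
  intro x
  refine ⟨ball 0 (‖x‖ + 1), isOpen_ball.mem_nhds (by simp), ?_⟩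
  have h1 := (h (‖x‖ + 1)).locallyIntegrable (by norm_num)
  have h2 : IntegrableOn ((ball 0 (‖x‖ + 1)).indicator s) (ball 0 (‖x‖ + 1)) :=
    (h1.integrableOn_isCompact (isCompact_closedBall 0 (‖x‖ + 1))).mono_set ball_subset_closedBall
  refine h2.congr_fun (fun y hy => ?_) measurableSet_ball
  exact indicator_of_mem hy _

lemma fderiv_refl {h : ℝ × ℝ → ℝ} (hh : Sm h) (x y v : ℝ × ℝ) :
    fderiv ℝ (fun y => h (x - y)) y v = - fderiv ℝ h (x - y) v := by
  have h1 : HasFDerivAt (fun y : ℝ × ℝ => x - y) (-ContinuousLinearMap.id ℝ (ℝ × ℝ)) y := (hasFDerivAt_id y).const_sub x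
  have h2 := (hh.diff (x - y)).hasFDerivAt.comp y h1
  have h3 : fderiv ℝ (fun y => h (x - y)) y = _ := h2.fderiv
  rw [h3]; simp

lemma div_cv {s t : ℝ × ℝ → ℝ} (hs : LocallyIntegrable s) (ht : LocallyIntegrable t)
    (H : ∀ g : ℝ × ℝ → ℝ, Sm g → HasCompactSupport g → (∫ x, (s x * dx g x + t x * dy g x)) = 0)
    {k : ℝ × ℝ → ℝ} (hk : Sm k) (hc : HasCompactSupport k) (x : ℝ × ℝ) : cv t (dy k) x = - cv s (dx k) x := by
  have hg : Sm (fun y => k (x - y)) := hk.cd.comp (contDiff_const.sub contDiff_id)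
  have hgc : HasCompactSupport (fun y => k (x - y)) := hc.comp_homeomorph (Homeomorph.subLeft x)
  have h1 := H _ hg hgc
  have e1 : ∀ y, dx (fun y => k (x - y)) y = - dx k (x - y) := fun y => fderiv_refl hk x y _
  have e2 : ∀ y, dy (fun y => k (x - y)) y = - dy k (x - y) := fun y => fderiv_refl hk x y _
  have i1 := HI.of (cv_int hs hk.dx.cont (hcs_dx hc) x)
  have i2 := HI.of (cv_int ht hk.dy.cont (hcs_dy hc) x)
  have h2 := ((i1.add i2).cmul (-1)).2
  have e3 : (∫ y, (s y * dx (fun y => k (x - y)) y + t y * dy (fun y => k (x - y)) y)) =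
      ∫ p, -1 * (s p * dx k (x - p) + t p * dy k (x - p)) := by
    congr 1; funext y; rw [e1, e2]; ring
  rw [e3, h2] at h1
  unfold cv; linarith

/-- Second derivatives of the potential. -/
lemma airy_derivs {om : ℝ} {s11 s12 s22 : ℝ × ℝ → ℝ} (S : Stress om s11 s12 s22) {k : ℝ × ℝ → ℝ} (hk : Sm k)
    (hc : HasCompactSupport k) :
    dx (dx (cv s22 k)) = cv s22 (dx (dx k)) ∧ (dx (dy (cv s22 k)) = fun x => - cv s12 (dx (dx k)) x) ∧
      dy (dy (cv s22 k)) = cv s11 (dx (dx k)) := by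
  have h1 := loc_of_trunc S.l11
  have h2 := loc_of_trunc S.l12
  have h3 := loc_of_trunc S.l22
  refine ⟨?_, ?_, ?_⟩
  · rw [cv_dx h3 hk hc, cv_dx h3 hk.dx (hcs_dx hc)]
  · rw [cv_dy h3 hk hc, cv_dx h3 hk.dy (hcs_dy hc), ← dxdy_comm hk]
    funext x
    exact div_cv h2 h3 S.div2 hk.dx (hcs_dx hc) x
  · rw [cv_dy h3 hk hc, cv_dy h3 hk.dy (hcs_dy hc)]
    funext x
    rw [div_cv h2 h3 S.div2 hk.dy (hcs_dy hc) x, ← dxdy_comm hk, div_cv h1 h2 S.div1 hk.dx (hcs_dx hc) x, neg_neg]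

lemma prim_sm {a : ℝ → ℝ} (ha : ContDiff ℝ ∞ a) : ContDiff ℝ ∞ (fun t => ∫ u in (0:ℝ)..t, a u) ∧
    deriv (fun t => ∫ u in (0:ℝ)..t, a u) = a := by
  have h1 : ∀ t, HasDerivAt (fun t => ∫ u in (0:ℝ)..t, a u) (a t) t := fun t =>
    intervalIntegral.integral_hasDerivAt_right (ha.continuous.intervalIntegrable _ _)
      (ha.continuous.stronglyMeasurableAtFilter _ _) ha.continuous.continuousAt
  have h2 : deriv (fun t => ∫ u in (0:ℝ)..t, a u) = a := funext fun t => (h1 t).deriv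
  refine ⟨contDiff_infty_iff_deriv.2 ⟨fun t => (h1 t).differentiableAt, by rw [h2]; exact ha⟩, h2⟩

lemma prim_zero {a : ℝ → ℝ} {c : ℝ} (hc : 0 ≤ c) (h : ∀ t, t < c → a t = 0) {t : ℝ} (ht : t < c) : (∫ u in (0:ℝ)..t, a u) = 0 := by
  have : (∫ u in (0:ℝ)..t, a u) = ∫ u in (0:ℝ)..t, (0:ℝ) := by
    apply intervalIntegral.integral_congr_uIoo
    intro u hu
    apply h
    rcases hu with ⟨_, h2⟩
    rcases le_total 0 t with h3 | h3
    · rw [max_eq_right h3] at h2; linarith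
    · rw [max_eq_left h3] at h2; linarith
  rw [this]; simp

lemma kernel_exists {δ ε : ℝ} (hδ : 0 < δ) (hδ1 : δ < 1) (hε : 0 < ε) (R : ℝ) : ∃ k ρ : ℝ × ℝ → ℝ,
    Sm k ∧ HasCompactSupport k ∧ Continuous ρ ∧ (∀ z, 0 ≤ ρ z) ∧ (∫ z, ρ z = 1) ∧ HasCompactSupport ρ ∧
    (∀ z, ρ z ≠ 0 → ‖z‖ < 2 * ε) ∧ (∀ z : ℝ × ℝ, z.1 < R → dx (dx k) z = ρ z) ∧
    (∀ z, k z ≠ 0 → (1 - δ) * ε ≤ z.1 ∧ |z.2| ≤ δ * ε) := by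
  have hde : 0 < δ * ε := by positivity
  let fa : ContDiffBump (ε : ℝ) := ⟨δ * ε / 2, δ * ε, by positivity, by linarith⟩
  let fb : ContDiffBump (0 : ℝ) := ⟨δ * ε / 2, δ * ε, by positivity, by linarith⟩
  let fc : ContDiffBump (0 : ℝ) := ⟨|R| + 1, |R| + 2, by positivity, by linarith⟩
  set a := fa.normed volume with ha
  set b := fb.normed volume with hb
  have has : ContDiff ℝ ∞ a := fa.contDiff_normed
  have hbs : ContDiff ℝ ∞ b := fb.contDiff_normed
  have hcs : ContDiff ℝ ∞ fc := fc.contDiff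
  have az : ∀ t, a t ≠ 0 → |t - ε| < δ * ε := fun t ht => by
    have : t ∈ Function.support a := ht
    rw [ha, fa.support_normed_eq] at this
    simpa [Real.dist_eq] using this
  have bz : ∀ t, b t ≠ 0 → |t| < δ * ε := fun t ht => by
    have : t ∈ Function.support b := ht
    rw [hb, fb.support_normed_eq] at this
    simpa [Real.dist_eq] using this
  obtain ⟨p1, p2⟩ := prim_sm has
  set A1 := fun t => ∫ u in (0:ℝ)..t, a u with hA1
  obtain ⟨p3, p4⟩ := prim_sm p1
  set A2 := fun t => ∫ u in (0:ℝ)..t, A1 u with hA2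
  have hc0 : 0 ≤ (1 - δ) * ε := mul_nonneg (by linarith) hε.le
  have A1z : ∀ t, t < (1 - δ) * ε → A1 t = 0 := fun t ht => prim_zero hc0 (fun u hu => by
    by_contra hne
    have := (abs_lt.1 (az u hne)).1
    nlinarith) ht
  have A2z : ∀ t, t < (1 - δ) * ε → A2 t = 0 := fun t ht => prim_zero hc0 A1z ht
  have hAc : ContDiff ℝ ∞ (fun t => A2 t * fc t) := p3.mul hcs
  have hAc1 : ContDiff ℝ ∞ (deriv (fun t => A2 t * fc t)) := (contDiff_infty_iff_deriv.1 hAc).2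
  refine ⟨fun z => (A2 z.1 * fc z.1) * b z.2, fun z => a z.1 * b z.2, (Sm.of_fst hAc).mul (Sm.of_snd hbs), ?_, ?_, ?_, ?_, ?_, ?_, ?_, ?_⟩
  · refine HasCompactSupport.of_support_subset_isCompact ((isCompact_closedBall (0:ℝ) (|R| + 2)).prod (isCompact_closedBall (0:ℝ) (δ * ε))) ?_
    intro z hz
    simp only [Function.mem_support, ne_eq, mul_eq_zero, not_or] at hz
    refine ⟨?_, ?_⟩
    · have : z.1 ∈ Function.support fc := hz.1.2
      rw [fc.support_eq] at this
      exact ball_subset_closedBall this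
    · rw [mem_closedBall_zero_iff, Real.norm_eq_abs]; exact (bz _ hz.2).le
  · exact (has.continuous.comp continuous_fst).mul (hbs.continuous.comp continuous_snd)
  · exact fun z => mul_nonneg (fa.nonneg_normed _) (fb.nonneg_normed _)
  · rw [Measure.volume_eq_prod, integral_prod_mul a b, ha, hb, fa.integral_normed, fb.integral_normed, one_mul]
  · refine HasCompactSupport.of_support_subset_isCompact ((isCompact_closedBall (ε:ℝ) (δ * ε)).prod (isCompact_closedBall (0:ℝ) (δ * ε))) ?_
    intro z hz
    simp only [Function.mem_support, ne_eq, mul_eq_zero, not_or] at hz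
    refine ⟨?_, ?_⟩
    · rw [mem_closedBall, Real.dist_eq]; exact (az _ hz.1).le
    · rw [mem_closedBall_zero_iff, Real.norm_eq_abs]; exact (bz _ hz.2).le
  · intro z hz
    simp only [ne_eq, mul_eq_zero, not_or] at hz
    have h1 := abs_lt.1 (az _ hz.1)
    have h2 := bz _ hz.2
    have : δ * ε < ε := by nlinarith
    rw [Prod.norm_def, max_lt_iff, Real.norm_eq_abs, Real.norm_eq_abs, abs_lt]
    exact ⟨⟨by linarith, by linarith⟩, by linarith⟩
  · intro z hz
    have e1 : dx (fun z : ℝ × ℝ => (A2 z.1 * fc z.1) * b z.2) = fun z => deriv (fun t => A2 t * fc t) z.1 * b z.2 := by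
      rw [dx_mul (Sm.of_fst hAc) (Sm.of_snd hbs), dx_fst hAc, dx_snd hbs]; funext p; ring
    have e2 : dx (fun z : ℝ × ℝ => deriv (fun t => A2 t * fc t) z.1 * b z.2) = fun z => deriv (deriv (fun t => A2 t * fc t)) z.1 * b z.2 := by
      rw [dx_mul (Sm.of_fst hAc1) (Sm.of_snd hbs), dx_fst hAc1, dx_snd hbs]; funext p; ring
    rw [e1, e2]
    simp only
    congr 1
    have ev : (fun t => A2 t * fc t) =ᶠ[𝓝 z.1] A2 := by
      rcases lt_or_ge z.1 0 with hz0 | hz0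
      · filter_upwards [Iio_mem_nhds hz0] with t ht
        rw [A2z t (lt_of_lt_of_le ht hc0), zero_mul]
      · have : z.1 ∈ ball (0:ℝ) (|R| + 1) := by
          rw [mem_ball_zero_iff, Real.norm_eq_abs, abs_of_nonneg hz0]
          linarith [le_abs_self R]
        filter_upwards [isOpen_ball.mem_nhds this] with t ht
        rw [fc.one_of_mem_closedBall (ball_subset_closedBall ht), mul_one]
    rw [ev.deriv.deriv_eq, p4, p2]
  · intro z hz
    simp only [ne_eq, mul_eq_zero, not_or] at hz
    refine ⟨?_, (bz _ hz.2).le⟩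
    by_contra hh
    exact hz.1.1 (A2z _ (not_le.1 hh))

end Airy

end

section
section AiryApprox
open scoped ContDiff

lemma fderiv_zero_of {f : ℝ × ℝ → ℝ} {C : Set (ℝ × ℝ)} (hC : IsClosed C) (h : ∀ z, f z ≠ 0 → z ∈ C) (v z : ℝ × ℝ)
    (hz : fderiv ℝ f z v ≠ 0) : z ∈ C := by
  by_contra hn
  apply hz
  have : f =ᶠ[𝓝 z] fun _ => (0:ℝ) := by
    filter_upwards [hC.isOpen_compl.mem_nhds hn] with y hy
    by_contra h0
    exact hy (h y h0)
  rw [this.fderiv_eq]; simp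

lemma trunc_moll {s : ℝ × ℝ → ℝ} {om δ ε M : ℝ} (h0 : 0 < om) (hom : om < Real.pi) (hM : 0 < M) (hz : ∀ x, x ∉ Sec om → s x = 0)
    (hδ : 0 < δ) (hδ1 : δ < 1) (hε : 0 < ε) (hε1 : 2 * ε ≤ 1) {k ρ : ℝ × ℝ → ℝ}
    (k1 : ∀ z, ρ z ≠ 0 → ‖z‖ < 2 * ε) (k2 : ∀ z : ℝ × ℝ, z.1 < M + 1 + (M + 1) / Real.sin om → dx (dx k) z = ρ z)
    (k3 : ∀ z, k z ≠ 0 → (1 - δ) * ε ≤ z.1 ∧ |z.2| ≤ δ * ε) {x : ℝ × ℝ} (hx : x ∈ ball (0 : ℝ × ℝ) M) :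
    cv s (dx (dx k)) x = ∫ y, (ball 0 (M + 3)).indicator s y * ρ (x - y) := by
  have hs : 0 < Real.sin om := Real.sin_pos_of_pos_of_lt_pi h0 hom
  unfold cv
  congr 1; funext y
  have hde : δ * ε ≤ 1 := by nlinarith
  have hR : 0 ≤ (M + 1) / Real.sin om := by positivity
  rw [mem_ball_zero_iff, Prod.norm_def, max_lt_iff, Real.norm_eq_abs, Real.norm_eq_abs] at hx
  by_cases hsy : s y = 0
  · rw [hsy]
    by_cases hb : y ∈ ball (0 : ℝ × ℝ) (M + 3)
    · rw [indicator_of_mem hb, hsy]; simp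
    · rw [indicator_of_notMem hb]; simp
  have hy : y ∈ Sec om := by
    by_contra h; exact hsy (hz y h)
  have C : IsClosed {z : ℝ × ℝ | |z.2| ≤ δ * ε} := isClosed_le (by fun_prop) (by fun_prop)
  have d1 : ∀ z, dx (dx k) z ≠ 0 → |z.2| ≤ δ * ε := fun z h =>
    fderiv_zero_of C (fun w hw => fderiv_zero_of C (fun q hq => (k3 q hq).2) _ w hw) _ z h
  have key : dx (dx k) (x - y) = ρ (x - y) := by
    by_cases hρ : ρ (x - y) = 0
    · by_contra hne
      have h1 : dx (dx k) (x - y) ≠ 0 := fun h => hne (h.trans hρ.symm)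
      have h2 := d1 _ h1
      apply hne
      apply k2
      rw [Prod.snd_sub, abs_le] at h2
      rw [Prod.fst_sub]
      have h4 : |y.2| ≤ M + 1 := by
        have := abs_lt.1 hx.2
        rw [abs_le]; constructor <;> linarith
      have h5 : Real.cos om * |y.2| < Real.sin om * y.1 := hy
      have h6 : -(M + 1) ≤ Real.cos om * |y.2| := by
        nlinarith [Real.neg_one_le_cos om, abs_nonneg y.2]
      have h7 : -((M + 1) / Real.sin om) < y.1 := by
        rw [← neg_div, div_lt_iff₀ hs]; linarith
      linarith [(abs_lt.1 hx.1).2]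
    · apply k2
      have := k1 _ hρ
      rw [Prod.norm_def, max_lt_iff, Real.norm_eq_abs, abs_lt] at this
      linarith [this.1.2]
  rw [key]
  by_cases hρ : ρ (x - y) = 0
  · rw [hρ]; simp
  · rw [indicator_of_mem]
    have := k1 _ hρ
    rw [Prod.norm_def, max_lt_iff, Real.norm_eq_abs, Real.norm_eq_abs, abs_lt, abs_lt, Prod.fst_sub, Prod.snd_sub] at this
    have h1 := abs_lt.1 hx.1
    have h2 := abs_lt.1 hx.2
    rw [mem_ball_zero_iff, Prod.norm_def, max_lt_iff, Real.norm_eq_abs, Real.norm_eq_abs, abs_lt, abs_lt]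
    refine ⟨⟨?_, ?_⟩, ?_, ?_⟩ <;> linarith [this.1.1, this.1.2, this.2.1, this.2.2]

lemma trunc_est {s g : ℝ × ℝ → ℝ} {M : ℝ} {ρ : ℝ × ℝ → ℝ} {η : ℝ≥0∞}
    (h : ∫⁻ x, ‖(∫ y, (ball 0 (M + 3)).indicator s y * ρ (x - y)) - (ball 0 (M + 3)).indicator s x‖ₑ ^ 2 ≤ η)
    (hg : ∀ x ∈ ball (0 : ℝ × ℝ) M, g x = ∫ y, (ball 0 (M + 3)).indicator s y * ρ (x - y)) :
    ∫⁻ x in ball 0 M, ‖g x - s x‖ₑ ^ 2 ≤ η := by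
  refine le_trans ?_ h
  refine le_trans (le_of_eq ?_) (setLIntegral_le_lintegral (ball 0 M) _)
  refine setLIntegral_congr_fun measurableSet_ball (fun x hx => ?_)
  show _ = _
  rw [hg x hx, indicator_of_mem]
  exact ball_subset_ball (by linarith) hx

lemma cv_sup {s k : ℝ × ℝ → ℝ} {om δ ε : ℝ} (h0 : 0 < om) (hom : om < Real.pi) (hz : ∀ x, x ∉ Sec om → s x = 0)
    (hδ : δ = Real.sin om / 4) (hε : 0 < ε)
    (k3 : ∀ z, k z ≠ 0 → (1 - δ) * ε ≤ z.1 ∧ |z.2| ≤ δ * ε) : SupS om (cv s k) := by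
  have hs : 0 < Real.sin om := Real.sin_pos_of_pos_of_lt_pi h0 hom
  have hs1 := Real.sin_le_one om
  have C : IsClosed {z : ℝ × ℝ | Real.cos om * |z.2| ≤ Real.sin om * z.1 - (Real.sin om * ε / 2)} :=
    isClosed_le (by fun_prop) (by fun_prop)
  refine (closure_minimal (fun x hx => ?_) C).trans (fun x hx => ?_)
  · by_contra hn
    apply hx
    unfold cv
    rw [← integral_zero (ℝ × ℝ) ℝ]
    congr 1; funext y
    by_contra hne
    have h1 : s y ≠ 0 := left_ne_zero_of_mul hne
    have h2 := k3 _ (right_ne_zero_of_mul hne)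
    have hy : y ∈ Sec om := by
      by_contra h; exact h1 (hz y h)
    apply hn
    have h5 : Real.cos om * |y.2| < Real.sin om * y.1 := hy
    show Real.cos om * |x.2| ≤ Real.sin om * x.1 - (Real.sin om * ε / 2)
    rw [Prod.snd_sub, Prod.fst_sub] at h2
    have h3 : Real.cos om * |x.2| ≤ Real.cos om * |y.2| + δ * ε := by
      have a1 : |x.2| ≤ |y.2| + |x.2 - y.2| := by
        have := abs_add_le y.2 (x.2 - y.2); simpa using this
      have a2 : |y.2| ≤ |x.2| + |x.2 - y.2| := by
        have := abs_add_le x.2 (y.2 - x.2); rw [abs_sub_comm y.2] at this; simpa using this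
      have a3 : |(|x.2| - |y.2|)| ≤ δ * ε := by rw [abs_le]; constructor <;> linarith [h2.2]
      have a4 : |Real.cos om * (|x.2| - |y.2|)| ≤ 1 * (δ * ε) := by
        rw [abs_mul]; exact mul_le_mul (Real.abs_cos_le_one om) a3 (abs_nonneg _) zero_le_one
      linarith [(abs_le.1 a4).2]
    have h4 : Real.sin om * ((1 - δ) * ε) ≤ Real.sin om * (x.1 - y.1) := mul_le_mul_of_nonneg_left h2.1 hs.le
    rw [hδ] at h3 h4
    nlinarith [mul_pos hs hε, mul_le_mul_of_nonneg_left hs1 (mul_pos hs hε).le]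
  · have h1 : Real.cos om * |x.2| ≤ Real.sin om * x.1 - (Real.sin om * ε / 2) := hx
    show Real.cos om * |x.2| < Real.sin om * x.1
    have := mul_pos hs hε
    linarith

lemma airy_approx {om : ℝ} (h0 : 0 < om) (hom : om < Real.pi) {s11 s12 s22 : ℝ × ℝ → ℝ} (S : Stress om s11 s12 s22)
    {M : ℝ} (hM : 0 < M) {η : ℝ≥0∞} (hη : 0 < η) : ∃ Φ : ℝ × ℝ → ℝ, Sm Φ ∧ SupS om Φ ∧
      ∫⁻ x in ball 0 M, ‖dx (dx Φ) x - s22 x‖ₑ ^ 2 ≤ η ∧ ∫⁻ x in ball 0 M, ‖dx (dy Φ) x + s12 x‖ₑ ^ 2 ≤ η ∧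
      ∫⁻ x in ball 0 M, ‖dy (dy Φ) x - s11 x‖ₑ ^ 2 ≤ η := by
  have hs : 0 < Real.sin om := Real.sin_pos_of_pos_of_lt_pi h0 hom
  have hs1 := Real.sin_le_one om
  obtain ⟨d1, p1, m1⟩ := moll (S.l11 (M + 3)) hη
  obtain ⟨d2, p2, m2⟩ := moll (S.l12 (M + 3)) hη
  obtain ⟨d3, p3, m3⟩ := moll (S.l22 (M + 3)) hη
  obtain ⟨d, hd, hd1, hd2, hd3, hd4⟩ : ∃ d : ℝ, 0 < d ∧ d ≤ d1 ∧ d ≤ d2 ∧ d ≤ d3 ∧ d ≤ 1 :=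
    ⟨min (min d1 d2) (min d3 1), by positivity, (min_le_left _ _).trans (min_le_left _ _), (min_le_left _ _).trans (min_le_right _ _),
      (min_le_right _ _).trans (min_le_left _ _), (min_le_right _ _).trans (min_le_right _ _)⟩
  have hε : 0 < d / 2 := by positivity
  have hε1 : 2 * (d / 2) ≤ 1 := by linarith
  have hδ : 0 < Real.sin om / 4 := by positivity
  have hδ1 : Real.sin om / 4 < 1 := by linarith
  obtain ⟨k, ρ, hk, hkc, ρc, ρn, ρi, ρs, k1, k2, k3⟩ := kernel_exists hδ hδ1 hε (M + 1 + (M + 1) / Real.sin om)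
  obtain ⟨e1, e2, e3⟩ := airy_derivs S hk hkc
  have q : ∀ z, ρ z ≠ 0 → ‖z‖ < d := fun z hz => by have := k1 z hz; linarith
  refine ⟨cv s22 k, cv_sm (loc_of_trunc S.l22) hk hkc, cv_sup h0 hom S.z22 rfl hε k3, ?_, ?_, ?_⟩
  · rw [e1]
    exact trunc_est (m3 ρ ρc ρn (fun z hz => (q z hz).trans_le hd3) ρi ρs) (fun x hx =>
      trunc_moll h0 hom hM S.z22 hδ hδ1 hε hε1 k1 k2 k3 hx)
  · rw [e2]
    have := trunc_est (m2 ρ ρc ρn (fun z hz => (q z hz).trans_le hd2) ρi ρs) (fun x hx =>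
      trunc_moll h0 hom hM S.z12 hδ hδ1 hε hε1 k1 k2 k3 hx)
    refine le_trans (le_of_eq ?_) this
    congr 1; funext x
    rw [← enorm_neg]; congr 2; ring
  · rw [e3]
    exact trunc_est (m1 ρ ρc ρn (fun z hz => (q z hz).trans_le hd1) ρi ρs) (fun x hx =>
      trunc_moll h0 hom hM S.z11 hδ hδ1 hε hε1 k1 k2 k3 hx)

end AiryApprox

end

section
section OneStep
open scoped ContDiff

lemma hcs_mul_right {f g : ℝ × ℝ → ℝ} (hg : HasCompactSupport g) : HasCompactSupport (fun x => f x * g x) := hg.mul_left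

lemma hi_sm {f g : ℝ × ℝ → ℝ} (hf : Sm f) (hg : Sm g) (hc : HasCompactSupport g) : HI (fun x => f x * g x) (∫ x, f x * g x) :=
  HI.of (Sm.integrable (hf.mul hg) hc.mul_left)

lemma null_lag {Φ Ψ : ℝ × ℝ → ℝ} (hΦ : Sm Φ) (hΨ : Sm Ψ) (hc : HasCompactSupport Ψ) :
    HI (fun x => dx (dx Φ) x * dx (dx Ψ) x + 2 * (dx (dy Φ) x * dx (dy Ψ) x) + dy (dy Φ) x * dy (dy Ψ) x)
      (∫ x, Lap Φ x * Lap Ψ x) := by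
  have c1 : Sm (fun x => dy Φ x * dx (dy Ψ) x) := hΦ.dy.mul hΨ.dy.dx
  have c2 : Sm (fun x => dy Φ x * dx (dx Ψ) x) := hΦ.dy.mul hΨ.dx.dx
  have c3 : Sm (fun x => dx Φ x * dx (dy Ψ) x) := hΦ.dx.mul hΨ.dy.dx
  have c4 : Sm (fun x => dx Φ x * dy (dy Ψ) x) := hΦ.dx.mul hΨ.dy.dy
  have s1 : HasCompactSupport (fun x => dy Φ x * dx (dy Ψ) x) := (hcs_dx (hcs_dy hc)).mul_left
  have s2 : HasCompactSupport (fun x => dy Φ x * dx (dx Ψ) x) := (hcs_dx (hcs_dx hc)).mul_left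
  have s3 : HasCompactSupport (fun x => dx Φ x * dx (dy Ψ) x) := (hcs_dx (hcs_dy hc)).mul_left
  have s4 : HasCompactSupport (fun x => dx Φ x * dy (dy Ψ) x) := (hcs_dy (hcs_dy hc)).mul_left
  have i1 : HI _ 0 := ⟨Sm.integrable c1.dx (hcs_dx s1), integral_dx_zero c1 s1⟩
  have i2 : HI _ 0 := ⟨Sm.integrable c2.dy (hcs_dy s2), integral_dy_zero c2 s2⟩
  have i3 : HI _ 0 := ⟨Sm.integrable c3.dy (hcs_dy s3), integral_dy_zero c3 s3⟩
  have i4 : HI _ 0 := ⟨Sm.integrable c4.dx (hcs_dx s4), integral_dx_zero c4 s4⟩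
  have hL : Sm (Lap Φ) := hΦ.dx.dx.add hΦ.dy.dy
  have hL2 : Sm (Lap Ψ) := hΨ.dx.dx.add hΨ.dy.dy
  have hLc : HasCompactSupport (Lap Ψ) := (hcs_dx (hcs_dx hc)).add (hcs_dy (hcs_dy hc))
  have i5 := hi_sm hL hL2 hLc
  have i6 := (i5.add ((i1.sub i2).add (i3.sub i4)))
  simp only [sub_zero, add_zero] at i6
  refine i6.congr fun p => ?_
  rw [dx_mul hΦ.dy hΨ.dy.dx, dy_mul hΦ.dy hΨ.dx.dx, dy_mul hΦ.dx hΨ.dy.dx, dx_mul hΦ.dx hΨ.dy.dy]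
  rw [dxdy_comm hΨ.dx, dxdy_comm hΨ.dy, dxdy_comm hΨ, dxdy_comm hΦ]
  unfold Lap; ring

lemma young_pt {ν τ t1 t2 t3 a b c : ℝ} (hτ : 0 < τ) :
    t1 * c + t3 * a + 2 * (t2 * b) - ν * ((t1 + t3) * (a + c)) ≤
      (1 + |ν|) * (τ * (a ^ 2 + 2 * b ^ 2 + c ^ 2) + τ⁻¹ * (t1 ^ 2 + 2 * t2 ^ 2 + t3 ^ 2)) := by
  have key : ∀ p q : ℝ, |p * q| ≤ (τ * q ^ 2 + τ⁻¹ * p ^ 2) / 2 := fun p q => by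
    have h1 : τ * τ⁻¹ = 1 := mul_inv_cancel₀ hτ.ne'
    have h2 : 0 ≤ τ⁻¹ := by positivity
    rw [abs_mul]
    have h3 : 0 ≤ τ⁻¹ * (|p| - τ * |q|) ^ 2 := by positivity
    have e : τ⁻¹ * (|p| - τ * |q|) ^ 2 = τ⁻¹ * |p| ^ 2 - 2 * (|p| * |q|) * (τ * τ⁻¹) + τ * |q| ^ 2 * (τ * τ⁻¹) := by ring
    rw [e, h1, sq_abs, sq_abs] at h3
    linarith
  have k1 := (abs_le.1 (key t1 c)).2
  have k2 := (abs_le.1 (key t3 a)).2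
  have k3 := (abs_le.1 (key t2 b)).2
  have k4 := key (t1 + t3) (a + c)
  have k5 : -(ν * ((t1 + t3) * (a + c))) ≤ |ν| * |(t1 + t3) * (a + c)| := by
    rw [← abs_mul]; exact neg_le_abs _
  have h2 : 0 ≤ τ⁻¹ := by positivity
  have k6 : |(t1 + t3) * (a + c)| ≤ τ * (a ^ 2 + 2 * b ^ 2 + c ^ 2) + τ⁻¹ * (t1 ^ 2 + 2 * t2 ^ 2 + t3 ^ 2) := by
    have e1 : (a + c) ^ 2 / 2 ≤ a ^ 2 + 2 * b ^ 2 + c ^ 2 := by nlinarith [sq_nonneg (a - c), sq_nonneg b]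
    have e2 : (t1 + t3) ^ 2 / 2 ≤ t1 ^ 2 + 2 * t2 ^ 2 + t3 ^ 2 := by nlinarith [sq_nonneg (t1 - t3), sq_nonneg t2]
    have e3 := mul_le_mul_of_nonneg_left e1 hτ.le
    have e4 := mul_le_mul_of_nonneg_left e2 h2
    linarith
  have k7 := mul_le_mul_of_nonneg_left k6 (abs_nonneg ν)
  have p1 : 0 ≤ τ * (a ^ 2 + 2 * b ^ 2 + c ^ 2) := by positivity
  have p2 : 0 ≤ τ⁻¹ * (t1 ^ 2 + 2 * t2 ^ 2 + t3 ^ 2) := by positivity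
  nlinarith

lemma core_ineq {ν τ : ℝ} (hτ : 0 < τ) {Φ Ψ s11 s12 s22 t1 t2 t3 : ℝ × ℝ → ℝ} (hΦ : Sm Φ) (hΨ : Sm Ψ) (hc : HasCompactSupport Ψ)
    (H : (∫ x, ((s11 x - ν * (s11 x + s22 x)) * dy (dy Ψ) x + (s22 x - ν * (s11 x + s22 x)) * dx (dx Ψ) x
      - 2 * s12 x * dx (dy Ψ) x)) = 0)
    (m1 : MemLp t1 2) (m2 : MemLp t2 2) (m3 : MemLp t3 2)
    (n1 : (∫ x, t1 x ^ 2) ≤ τ ^ 2) (n2 : (∫ x, t2 x ^ 2) ≤ τ ^ 2) (n3 : (∫ x, t3 x ^ 2) ≤ τ ^ 2)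
    (q : ∀ x, (t1 x = dy (dy Φ) x - s11 x ∧ t2 x = dx (dy Φ) x + s12 x ∧ t3 x = dx (dx Φ) x - s22 x) ∨
      (dx (dx Ψ) x = 0 ∧ dx (dy Ψ) x = 0 ∧ dy (dy Ψ) x = 0)) :
    (1 - ν) * (∫ x, Lap Φ x * Lap Ψ x) ≤ (1 + |ν|) * (τ * (∫ x, D2 Ψ x) + 4 * τ) := by
  have l1 : MemLp (dx (dx Ψ)) 2 := hΨ.dx.dx.cont.memLp_of_hasCompactSupport (hcs_dx (hcs_dx hc))
  have l2 : MemLp (dx (dy Ψ)) 2 := hΨ.dy.dx.cont.memLp_of_hasCompactSupport (hcs_dx (hcs_dy hc))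
  have l3 : MemLp (dy (dy Ψ)) 2 := hΨ.dy.dy.cont.memLp_of_hasCompactSupport (hcs_dy (hcs_dy hc))
  have hL : Sm (Lap Φ) := hΦ.dx.dx.add hΦ.dy.dy
  have hL2 : Sm (Lap Ψ) := hΨ.dx.dx.add hΨ.dy.dy
  have hLc : HasCompactSupport (Lap Ψ) := (hcs_dx (hcs_dx hc)).add (hcs_dy (hcs_dy hc))
  have i5 := hi_sm hL hL2 hLc
  have i1 := null_lag hΦ hΨ hc
  have j1 := HI.of (m1.integrable_mul l3)
  have j2 := HI.of (m3.integrable_mul l1)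
  have j3 := HI.of (m2.integrable_mul l2)
  have j4 := HI.of (m1.integrable_mul l1)
  have j5 := HI.of (m3.integrable_mul l3)
  have jj := ((j1.add j2).add (j3.cmul 2)).sub ((((j1.add j2).add (j4.add j5))).cmul ν)
  have kk := (i1.sub (i5.cmul ν)).sub jj
  have kk2 := kk.congr (g := fun x => ((s11 x - ν * (s11 x + s22 x)) * dy (dy Ψ) x + (s22 x - ν * (s11 x + s22 x)) * dx (dx Ψ) x
      - 2 * s12 x * dx (dy Ψ) x)) (fun x => by
    simp only [Pi.mul_apply, Lap]
    rcases q x with ⟨e1, e2, e3⟩ | ⟨e1, e2, e3⟩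
    · rw [e1, e2, e3]; ring
    · rw [e1, e2, e3]; ring)
  have e0 := kk2.2
  rw [H] at e0
  have iD : Integrable (D2 Ψ) := by
    have := ((l1.integrable_mul l1).add ((l2.integrable_mul l2).const_mul 2)).add (l3.integrable_mul l3)
    refine this.congr (ae_of_all _ fun x => ?_)
    simp only [D2, Pi.add_apply, Pi.mul_apply]; ring
  have u1 : HI _ _ := ⟨m1.integrable_sq, rfl⟩
  have u2 : HI _ _ := ⟨m2.integrable_sq, rfl⟩
  have u3 : HI _ _ := ⟨m3.integrable_sq, rfl⟩
  have uu := ((((HI.of iD).cmul τ).add (((u1.add (u2.cmul 2)).add u3).cmul τ⁻¹))).cmul (1 + |ν|)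
  have fin := integral_mono jj.1 uu.1 (fun x => by
    simp only [Pi.mul_apply, D2]
    have := young_pt (ν := ν) (t1 := t1 x) (t2 := t2 x) (t3 := t3 x) (a := dx (dx Ψ) x) (b := dx (dy Ψ) x) (c := dy (dy Ψ) x) hτ
    linarith)
  rw [uu.2, jj.2] at fin
  refine le_trans (le_of_eq (by linarith)) (fin.trans ?_)
  refine mul_le_mul_of_nonneg_left ?_ (by positivity)
  have : τ⁻¹ * ((∫ x, t1 x ^ 2) + 2 * (∫ x, t2 x ^ 2) + ∫ x, t3 x ^ 2) ≤ τ⁻¹ * (4 * τ ^ 2) :=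
    mul_le_mul_of_nonneg_left (by linarith) (by positivity)
  have e : τ⁻¹ * (4 * τ ^ 2) = 4 * τ := by field_simp
  linarith

lemma L2pack {T : ℝ × ℝ → ℝ} {M τ : ℝ} (hT : AEStronglyMeasurable T) (h : ∫⁻ x in ball 0 M, ‖T x‖ₑ ^ 2 ≤ ENNReal.ofReal (τ ^ 2)) :
    MemLp ((ball 0 M).indicator T) 2 ∧ (∫ x, (ball 0 M).indicator T x ^ 2) ≤ τ ^ 2 := by
  have hm : AEStronglyMeasurable ((ball 0 M).indicator T) := hT.indicator measurableSet_ball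
  have e : ∀ x, ‖(ball 0 M).indicator T x‖ₑ ^ 2 = (ball 0 M).indicator (fun x => ‖T x‖ₑ ^ 2) x := fun x => by
    by_cases hx : x ∈ ball (0 : ℝ × ℝ) M
    · rw [indicator_of_mem hx, indicator_of_mem hx]
    · rw [indicator_of_notMem hx, indicator_of_notMem hx]; simp
  have h2 : ∫⁻ x, ‖(ball 0 M).indicator T x‖ₑ ^ 2 ≤ ENNReal.ofReal (τ ^ 2) := by
    simp only [e]
    rw [lintegral_indicator measurableSet_ball]; exact h
  have h3 : MemLp ((ball 0 M).indicator T) 2 := by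
    refine ⟨hm, ?_⟩
    rw [eLpNorm_lt_top_iff_lintegral_rpow_enorm_lt_top (by norm_num) (by norm_num)]
    simp only [ENNReal.toReal_ofNat, ENNReal.rpow_ofNat]
    exact h2.trans_lt ENNReal.ofReal_lt_top
  refine ⟨h3, ?_⟩
  rw [integral_eq_lintegral_of_nonneg_ae (ae_of_all _ fun x => sq_nonneg _) h3.integrable_sq.1]
  refine ENNReal.toReal_le_of_le_ofReal (sq_nonneg _) (le_trans (le_of_eq ?_) h2)
  congr 1; funext x
  rw [← enorm_pow, Real.enorm_eq_ofReal (sq_nonneg _)]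

end OneStep

end

section
section OneStep2
open scoped ContDiff

/-- Energy density. -/
def gg (s11 s12 s22 : ℝ × ℝ → ℝ) : ℝ × ℝ → ℝ := fun x => s11 x ^ 2 + 2 * s12 x ^ 2 + s22 x ^ 2
/-- Weighted energy. -/
def EE (χ : ℝ → ℝ) (s11 s12 s22 : ℝ × ℝ → ℝ) : ℝ := ∫ x, zeta χ x * gg s11 s12 s22 x

lemma gg_nonneg (s11 s12 s22 : ℝ × ℝ → ℝ) (x : ℝ × ℝ) : 0 ≤ gg s11 s12 s22 x := by unfold gg; positivity

lemma EE_nonneg {χ : ℝ → ℝ} (h : Wt χ) (s11 s12 s22 : ℝ × ℝ → ℝ) : 0 ≤ EE χ s11 s12 s22 :=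
  integral_nonneg fun x => mul_nonneg (zeta_nonneg h x) (gg_nonneg _ _ _ x)

lemma zeta_ball {χ : ℝ → ℝ} (h : HasCompactSupport χ) : ∃ M, 0 < M ∧ ∀ x, zeta χ x ≠ 0 → x ∈ ball (0 : ℝ × ℝ) M := by
  obtain ⟨R, hR⟩ := (isBounded_iff_subset_ball (0 : ℝ × ℝ)).1 (zeta_cs h).isCompact.isBounded
  exact ⟨max R 1, by positivity, fun x hx => ball_subset_ball (le_max_left _ _) (hR (subset_tsupport _ hx))⟩

lemma zeta_bdd {χ : ℝ → ℝ} (h : Wt χ) : ∃ Z, 0 ≤ Z ∧ ∀ x, |zeta χ x| ≤ Z := by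
  obtain ⟨C, hC⟩ := (zeta_sm h).cont.bounded_above_of_compact_support (zeta_cs h.cs)
  exact ⟨C, (norm_nonneg _).trans (hC 0), fun x => by simpa using hC x⟩

lemma EE_int {om : ℝ} {s11 s12 s22 : ℝ × ℝ → ℝ} (S : Stress om s11 s12 s22) {χ : ℝ → ℝ} (h : Wt χ) :
    Integrable (fun x => zeta χ x * gg s11 s12 s22 x) := by
  obtain ⟨M, hM, hb⟩ := zeta_ball h.cs
  obtain ⟨Z, hZ, hz⟩ := zeta_bdd h
  have h1 := ((S.l11 M).integrable_sq.add ((S.l12 M).integrable_sq.const_mul 2)).add (S.l22 M).integrable_sq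
  have h2 := h1.bdd_mul (f := zeta χ) (c := Z) (zeta_sm h).cont.aestronglyMeasurable (ae_of_all _ fun x => by simpa using hz x)
  refine h2.congr (ae_of_all _ fun x => ?_)
  by_cases hx : zeta χ x = 0
  · simp [hx]
  · have := hb x hx
    simp only [Pi.add_apply, indicator_of_mem this, gg]

lemma cmp_aux {Z : ℝ} {z : ℝ} (hz : 0 ≤ z) (hZ : z ≤ Z) (a b c a' b' c' d1 d2 d3 : ℝ) (h1 : d1 = a - a') (h2 : d2 = b + b') (h3 : d3 = c - c') :
    z * (a ^ 2 + 2 * b ^ 2 + c ^ 2) ≤ 2 * (z * (a' ^ 2 + 2 * b' ^ 2 + c' ^ 2)) + 2 * Z * (d1 ^ 2 + 2 * d2 ^ 2 + d3 ^ 2) := by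
  have e1 : a ^ 2 + 2 * b ^ 2 + c ^ 2 ≤ 2 * (a' ^ 2 + 2 * b' ^ 2 + c' ^ 2) + 2 * (d1 ^ 2 + 2 * d2 ^ 2 + d3 ^ 2) := by
    rw [h1, h2, h3]; nlinarith [sq_nonneg (a - 2 * a'), sq_nonneg (b + 2 * b'), sq_nonneg (c - 2 * c')]
  have e2 := mul_le_mul_of_nonneg_left e1 hz
  have e3 : z * (d1 ^ 2 + 2 * d2 ^ 2 + d3 ^ 2) ≤ Z * (d1 ^ 2 + 2 * d2 ^ 2 + d3 ^ 2) :=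
    mul_le_mul_of_nonneg_right hZ (by positivity)
  linarith

lemma EE_JJ {om : ℝ} {s11 s12 s22 t1 t2 t3 Φ : ℝ × ℝ → ℝ} (S : Stress om s11 s12 s22) {χ : ℝ → ℝ} (h : Wt χ) {Z τ M : ℝ} (hZ : 0 ≤ Z)
    (hz : ∀ x, |zeta χ x| ≤ Z) (hM : ∀ x, zeta χ x ≠ 0 → x ∈ ball (0 : ℝ × ℝ) M) (hΦ : Sm Φ)
    (m1 : MemLp t1 2) (m2 : MemLp t2 2) (m3 : MemLp t3 2)
    (n1 : (∫ x, t1 x ^ 2) ≤ τ ^ 2) (n2 : (∫ x, t2 x ^ 2) ≤ τ ^ 2) (n3 : (∫ x, t3 x ^ 2) ≤ τ ^ 2)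
    (q : ∀ x ∈ ball (0 : ℝ × ℝ) M, t1 x = dy (dy Φ) x - s11 x ∧ t2 x = dx (dy Φ) x + s12 x ∧ t3 x = dx (dx Φ) x - s22 x) :
    EE χ s11 s12 s22 ≤ 2 * JJ χ Φ + 8 * Z * τ ^ 2 ∧ JJ χ Φ ≤ 2 * EE χ s11 s12 s22 + 8 * Z * τ ^ 2 := by
  have i1 : HI _ (EE χ s11 s12 s22) := ⟨EE_int S h, rfl⟩
  have i2 : HI _ (JJ χ Φ) := ⟨Sm.integrable ((zeta_sm h).mul (D2_sm hΦ)) (zeta_cs h.cs).mul_right, rfl⟩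
  have u1 : HI _ _ := ⟨m1.integrable_sq, rfl⟩
  have u2 : HI _ _ := ⟨m2.integrable_sq, rfl⟩
  have u3 : HI _ _ := ⟨m3.integrable_sq, rfl⟩
  have uu := ((u1.add (u2.cmul 2)).add u3).cmul (2 * Z)
  have hb : 2 * Z * ((∫ x, t1 x ^ 2) + 2 * (∫ x, t2 x ^ 2) + ∫ x, t3 x ^ 2) ≤ 2 * Z * (4 * τ ^ 2) :=
    mul_le_mul_of_nonneg_left (by linarith) (by positivity)
  have nn : ∀ x, 0 ≤ 2 * Z * (t1 x ^ 2 + 2 * t2 x ^ 2 + t3 x ^ 2) := fun x => by positivity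
  constructor
  · have := integral_mono i1.1 ((i2.cmul 2).add uu).1 (fun x => by
      by_cases hx : zeta χ x = 0
      · simp only [hx]; have := nn x; linarith
      · obtain ⟨e1, e2, e3⟩ := q x (hM x hx)
        have := cmp_aux (zeta_nonneg h x) ((le_abs_self _).trans (hz x)) (s11 x) (-s12 x) (s22 x) (dy (dy Φ) x) (dx (dy Φ) x) (dx (dx Φ) x)
          (-t1 x) (t2 x - 2 * s12 x) (-t3 x) (by rw [e1]; ring) (by rw [e2]; ring) (by rw [e3]; ring)
        have h2 := cmp_aux (zeta_nonneg h x) ((le_abs_self _).trans (hz x)) (s11 x) (s12 x) (s22 x) (dy (dy Φ) x) (dx (dy Φ) x) (dx (dx Φ) x)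
          (-t1 x) (t2 x) (-t3 x) (by rw [e1]; ring) (by rw [e2]; ring) (by rw [e3]; ring)
        simp only [gg, D2]
        simp only [neg_sq] at h2
        linarith)
    rw [i1.2, ((i2.cmul 2).add uu).2] at this
    linarith
  · have := integral_mono i2.1 ((i1.cmul 2).add uu).1 (fun x => by
      by_cases hx : zeta χ x = 0
      · simp only [hx]; have := nn x; linarith
      · obtain ⟨e1, e2, e3⟩ := q x (hM x hx)
        have h2 := cmp_aux (zeta_nonneg h x) ((le_abs_self _).trans (hz x)) (dy (dy Φ) x) (dx (dy Φ) x) (dx (dx Φ) x) (s11 x) (s12 x) (s22 x)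
          (t1 x) (t2 x) (t3 x) e1 e2 e3
        simp only [gg, D2]
        linarith)
    rw [i2.2, ((i1.cmul 2).add uu).2] at this
    linarith

/-- Compatibility of the strain in weak form. -/
def Compat (om ν : ℝ) (s11 s12 s22 : ℝ × ℝ → ℝ) : Prop :=
  ∀ Ψ : ℝ × ℝ → ℝ, Sm Ψ → HasCompactSupport Ψ → SupS om Ψ →
    (∫ x, ((s11 x - ν * (s11 x + s22 x)) * dy (dy Ψ) x + (s22 x - ν * (s11 x + s22 x)) * dx (dx Ψ) x
      - 2 * s12 x * dx (dy Ψ) x)) = 0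

lemma lim_le {A B D : ℝ} (h : ∀ τ : ℝ, 0 < τ → τ < 1 → A ≤ B + D * τ) : A ≤ B := by
  by_contra hn
  push Not at hn
  have hD : 0 ≤ |D| := abs_nonneg D
  set τ := min (1/2) ((A - B) / (2 * (|D| + 1))) with hτ
  have h1 : 0 < (A - B) / (2 * (|D| + 1)) := div_pos (by linarith) (by linarith)
  have h2 : 0 < τ := lt_min (by norm_num) h1
  have h3 : τ < 1 := lt_of_le_of_lt (min_le_left _ _) (by norm_num)
  have h4 := h τ h2 h3
  have h5 : τ ≤ (A - B) / (2 * (|D| + 1)) := min_le_right _ _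
  have h6 : D * τ ≤ (|D| + 1) * ((A - B) / (2 * (|D| + 1))) :=
    le_trans (mul_le_mul_of_nonneg_right (by linarith [le_abs_self D]) h2.le) (mul_le_mul_of_nonneg_left h5 (by linarith))
  have h7 : (|D| + 1) * ((A - B) / (2 * (|D| + 1))) = (A - B) / 2 := by field_simp
  linarith

lemma one_step {om : ℝ} (h0 : 0 < om) (hom : om < Real.pi) {ν : ℝ} (hν : ν < 1) : ∃ C, 0 < C ∧
    ∀ (s11 s12 s22 : ℝ × ℝ → ℝ) (χ χh : ℝ → ℝ) (ε B : ℝ), Stress om s11 s12 s22 → Compat om ν s11 s12 s22 → Wt χ → Wt χh → 0 ≤ ε →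
    (∀ t, |deriv χ t| ≤ ε * χh t) → (∀ t, |deriv (deriv χ) t| ≤ ε * χh t) →
    (∀ t, χ t ^ 2 ≤ B * χh t) → (∀ t, deriv χ t ^ 2 ≤ B * χh t) → (∀ t, deriv (deriv χ) t ^ 2 ≤ B * χh t) →
    EE χ s11 s12 s22 ≤ ε * (C * EE χh s11 s12 s22) := by
  obtain ⟨κ, hκ, C, hC, hlow⟩ := cart_lower h0 hom
  refine ⟨4 * C / κ, by positivity, ?_⟩
  intro s11 s12 s22 χ χh ε B S H hχ hχh hε d1 d2 b0 b1 b2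
  obtain ⟨C', hC', htest⟩ := cart_test h0 hom hχ hχh B b0 b1 b2
  obtain ⟨M1, hM1, hb1⟩ := zeta_ball hχ.cs
  obtain ⟨M2, hM2, hb2⟩ := zeta_ball hχh.cs
  obtain ⟨Z1, hZ1, hz1⟩ := zeta_bdd hχ
  obtain ⟨Z2, hZ2, hz2⟩ := zeta_bdd hχh
  obtain ⟨M, hM, hMM1, hMM2⟩ : ∃ M : ℝ, 0 < M ∧ M1 < M ∧ M2 < M := ⟨max M1 M2 + 1, by positivity, by linarith [le_max_left M1 M2], by linarith [le_max_right M1 M2]⟩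
  set E := EE χ s11 s12 s22 with hE
  set Eh := EE χh s11 s12 s22 with hEh
  have hEh0 : 0 ≤ Eh := EE_nonneg hχh _ _ _
  set c := (1 + |ν|) / (1 - ν) with hcdef
  have hc0 : 0 ≤ c := div_nonneg (by positivity) (by linarith)
  suffices hs : ∀ τ : ℝ, 0 < τ → τ < 1 → κ * E ≤ 4 * ε * C * Eh + (2 * c * (C' * (2 * Eh + 8 * Z2) + 4) + 16 * ε * C * Z2 + 8 * κ * Z1) * τ by
    have := lim_le hs
    have e : ε * (4 * C / κ * Eh) = (4 * ε * C * Eh) / κ := by ring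
    rw [e, le_div_iff₀ hκ]; linarith
  intro τ hτ hτ1
  have hτ2 : τ ^ 2 ≤ τ := by nlinarith
  obtain ⟨Φ, hΦ, hsup, a1, a2, a3⟩ := airy_approx h0 hom S hM (η := ENNReal.ofReal (τ ^ 2)) (by simp; positivity)
  have q1 := L2pack (T := fun x => dy (dy Φ) x - s11 x) (hΦ.dy.dy.cont.aestronglyMeasurable.sub (loc_of_trunc S.l11).aestronglyMeasurable) a3
  have q2 := L2pack (T := fun x => dx (dy Φ) x + s12 x) (hΦ.dy.dx.cont.aestronglyMeasurable.add (loc_of_trunc S.l12).aestronglyMeasurable) a2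
  have q3 := L2pack (T := fun x => dx (dx Φ) x - s22 x) (hΦ.dx.dx.cont.aestronglyMeasurable.sub (loc_of_trunc S.l22).aestronglyMeasurable) a1
  set t1 := (ball 0 M).indicator (fun x => dy (dy Φ) x - s11 x) with ht1
  set t2 := (ball 0 M).indicator (fun x => dx (dy Φ) x + s12 x) with ht2
  set t3 := (ball 0 M).indicator (fun x => dx (dx Φ) x - s22 x) with ht3
  have q : ∀ x ∈ ball (0 : ℝ × ℝ) M, t1 x = dy (dy Φ) x - s11 x ∧ t2 x = dx (dy Φ) x + s12 x ∧ t3 x = dx (dx Φ) x - s22 x := fun x hx => by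
    rw [ht1, ht2, ht3, indicator_of_mem hx, indicator_of_mem hx, indicator_of_mem hx]
    exact ⟨rfl, rfl, rfl⟩
  have r1 := (EE_JJ S hχ hZ1 hz1 (fun x hx => ball_subset_ball hMM1.le (hb1 x hx)) hΦ q1.1 q2.1 q3.1 q1.2 q2.2 q3.2 q).1
  have r2 := (EE_JJ S hχh hZ2 hz2 (fun x hx => ball_subset_ball hMM2.le (hb2 x hx)) hΦ q1.1 q2.1 q3.1 q1.2 q2.2 q3.2 q).2
  have hΨ : Sm (fun x => zeta χ x * Φ x) := (zeta_sm hχ).mul hΦ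
  have hΨc : HasCompactSupport (fun x => zeta χ x * Φ x) := (zeta_cs hχ.cs).mul_right
  have hΨs : SupS om (fun x => zeta χ x * Φ x) := hsup.mul_left _
  set Ψ := fun x => zeta χ x * Φ x with hΨdef
  have g0 : ∀ z, Ψ z ≠ 0 → z ∈ closedBall (0 : ℝ × ℝ) M1 := fun z hz => ball_subset_closedBall (hb1 z (left_ne_zero_of_mul hz))
  have C1 : IsClosed (closedBall (0 : ℝ × ℝ) M1) := isClosed_closedBall
  have gx : ∀ z, dx Ψ z ≠ 0 → z ∈ closedBall (0 : ℝ × ℝ) M1 := fun z hz => fderiv_zero_of C1 g0 _ z hz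
  have gy : ∀ z, dy Ψ z ≠ 0 → z ∈ closedBall (0 : ℝ × ℝ) M1 := fun z hz => fderiv_zero_of C1 g0 _ z hz
  have sub : closedBall (0 : ℝ × ℝ) M1 ⊆ ball 0 M := closedBall_subset_ball hMM1
  have main := core_ineq (ν := ν) hτ hΦ hΨ hΨc (H Ψ hΨ hΨc hΨs) q1.1 q2.1 q3.1 q1.2 q2.2 q3.2 (fun x => by
    by_cases hx : x ∈ closedBall (0 : ℝ × ℝ) M1
    · exact Or.inl (q x (sub hx))
    · right
      refine ⟨?_, ?_, ?_⟩ <;> by_contra hne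
      · exact hx (fderiv_zero_of C1 gx _ x hne)
      · exact hx (fderiv_zero_of C1 gy _ x hne)
      · exact hx (fderiv_zero_of C1 gy _ x hne))
  have low := hlow χ χh Φ ε hχ hχh hΦ hsup hε d1 d2
  have tst := htest Φ hΦ hsup
  have hJh : 0 ≤ JJ χh Φ := JJ_nonneg hχh Φ
  have hJh2 : JJ χh Φ ≤ 2 * Eh + 8 * Z2 := by nlinarith
  have hJh3 : JJ χh Φ ≤ 2 * Eh + 8 * Z2 * τ := by nlinarith
  have m2 : (∫ x, Lap Φ x * Lap Ψ x) ≤ c * (τ * (C' * (2 * Eh + 8 * Z2)) + 4 * τ) := by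
    have h1 : (∫ x, D2 Ψ x) ≤ C' * (2 * Eh + 8 * Z2) := tst.trans (mul_le_mul_of_nonneg_left hJh2 hC')
    have h2 : (1 + |ν|) * (τ * (∫ x, D2 Ψ x) + 4 * τ) ≤ (1 + |ν|) * (τ * (C' * (2 * Eh + 8 * Z2)) + 4 * τ) :=
      mul_le_mul_of_nonneg_left (by have := mul_le_mul_of_nonneg_left h1 hτ.le; linarith) (by positivity)
    rw [hcdef, div_mul_eq_mul_div, le_div_iff₀ (by linarith)]
    linarith
  have m3 : ε * (C * JJ χh Φ) ≤ ε * (C * (2 * Eh + 8 * Z2 * τ)) :=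
    mul_le_mul_of_nonneg_left (mul_le_mul_of_nonneg_left hJh3 hC.le) hε
  have m4 : κ * E ≤ κ * (2 * JJ χ Φ + 8 * Z1 * τ) := mul_le_mul_of_nonneg_left (by nlinarith) hκ.le
  linarith

end OneStep2

end

section
section Targ
open scoped ContDiff

lemma bump_cut : ∃ f g : ℝ → ℝ, Wt f ∧ Wt g ∧ (∀ t, |t| ≤ 1 → f t = 1) ∧ (∀ t, g t ≠ 0 → |t| ≤ 3) ∧ (∀ t, g t ≤ 1) ∧
    (∀ t, f t ≤ 1) ∧ (∀ t, f t ≠ 0 → |t| ≤ 2) ∧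
    ∃ c : ℝ, 0 < c ∧ (∀ t, |deriv f t| ≤ c * g t) ∧ (∀ t, |deriv (deriv f) t| ≤ c * g t) ∧ (∀ t, f t ≤ g t) := by
  let f : ContDiffBump (0 : ℝ) := ⟨1, 2, by norm_num, by norm_num⟩
  let g : ContDiffBump (0 : ℝ) := ⟨2, 3, by norm_num, by norm_num⟩
  have fz : ∀ t, f t ≠ 0 → |t| ≤ 2 := fun t ht => by
    have : t ∈ Function.support f := ht
    rw [f.support_eq] at this
    have := ball_subset_closedBall this
    simpa using this
  have gz : ∀ t, g t ≠ 0 → |t| ≤ 3 := fun t ht => by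
    have : t ∈ Function.support g := ht
    rw [g.support_eq] at this
    have := ball_subset_closedBall this
    simpa using this
  have g1 : ∀ t, |t| ≤ 2 → g t = 1 := fun t ht => g.one_of_mem_closedBall (by simpa using ht)
  have sf : ContDiff ℝ ∞ f := f.contDiff
  have sf1 : ContDiff ℝ ∞ (deriv f) := (contDiff_infty_iff_deriv.1 sf).2
  have sf2 : ContDiff ℝ ∞ (deriv (deriv f)) := (contDiff_infty_iff_deriv.1 sf1).2
  obtain ⟨c1, hc1⟩ := sf1.continuous.bounded_above_of_compact_support f.hasCompactSupport.deriv
  obtain ⟨c2, hc2⟩ := sf2.continuous.bounded_above_of_compact_support f.hasCompactSupport.deriv.deriv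
  have C : IsClosed {t : ℝ | |t| ≤ 2} := isClosed_le (by fun_prop) (by fun_prop)
  have dz : ∀ h : ℝ → ℝ, (∀ t, h t ≠ 0 → |t| ≤ 2) → ∀ t, deriv h t ≠ 0 → |t| ≤ 2 := fun h hh t ht => by
    by_contra hn
    apply ht
    have : h =ᶠ[𝓝 t] fun _ => (0:ℝ) := by
      filter_upwards [C.isOpen_compl.mem_nhds hn] with y hy
      by_contra h0
      exact hy (hh y h0)
    rw [this.deriv_eq]; simp
  have c1' : 0 ≤ c1 := (norm_nonneg _).trans (hc1 0)
  have c2' : 0 ≤ c2 := (norm_nonneg _).trans (hc2 0)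
  refine ⟨f, g, ⟨sf, f.hasCompactSupport, fun t => f.nonneg⟩, ⟨g.contDiff, g.hasCompactSupport, fun t => g.nonneg⟩,
    fun t ht => f.one_of_mem_closedBall (by simpa using ht), gz, fun t => g.le_one, fun t => f.le_one, fz, c1 + c2 + 1, by positivity, ?_, ?_, ?_⟩
  · intro t
    by_cases h : deriv f t = 0
    · rw [h, abs_zero]; exact mul_nonneg (by positivity) g.nonneg
    · rw [g1 t (dz f fz t h), mul_one]
      have := hc1 t; rw [Real.norm_eq_abs] at this; linarith
  · intro t
    by_cases h : deriv (deriv f) t = 0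
    · rw [h, abs_zero]; exact mul_nonneg (by positivity) g.nonneg
    · rw [g1 t (dz _ (dz f fz) t h), mul_one]
      have := hc2 t; rw [Real.norm_eq_abs] at this; linarith
  · intro t
    by_cases h : f t = 0
    · rw [h]; exact g.nonneg
    · rw [g1 t (fz t h)]; exact f.le_one

lemma Wt.scale {f : ℝ → ℝ} (h : Wt f) {T : ℝ} (hT : 0 < T) : Wt (fun t => f (T⁻¹ * t)) where
  sm := h.sm.comp (contDiff_const.mul contDiff_id)
  cs := by
    have := h.cs.comp_homeomorph (Homeomorph.mulLeft₀ T⁻¹ (by positivity))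
    exact this
  nn := fun t => h.nn _

lemma deriv_scale {f : ℝ → ℝ} (T : ℝ) : deriv (fun t => f (T * t)) = fun t => T * deriv f (T * t) := by
  funext t; rw [deriv_comp_mul_left]; rfl

lemma zeta_mono {χ χ' : ℝ → ℝ} (h : ∀ t, χ t ≤ χ' t) (x : ℝ × ℝ) : zeta χ x ≤ zeta χ' x :=
  mul_le_mul_of_nonneg_left (h _) (by positivity)

lemma EE_mono {om : ℝ} {s11 s12 s22 : ℝ × ℝ → ℝ} (S : Stress om s11 s12 s22) {χ χ' : ℝ → ℝ} (h : Wt χ) (h' : Wt χ') (hle : ∀ t, χ t ≤ χ' t) :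
    EE χ s11 s12 s22 ≤ EE χ' s11 s12 s22 :=
  integral_mono (EE_int S h) (EE_int S h') fun x => mul_le_mul_of_nonneg_right (zeta_mono hle x) (gg_nonneg _ _ _ x)

lemma gg_int {om : ℝ} {s11 s12 s22 : ℝ × ℝ → ℝ} (S : Stress om s11 s12 s22) (R : ℝ) : IntegrableOn (gg s11 s12 s22) (ball 0 R) := by
  have h1 := ((S.l11 R).integrable_sq.add ((S.l12 R).integrable_sq.const_mul 2)).add (S.l22 R).integrable_sq
  refine h1.integrableOn.congr_fun (fun x hx => ?_) measurableSet_ball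
  simp only [Pi.add_apply, indicator_of_mem hx, gg]

lemma EE_growth {om : ℝ} {s11 s12 s22 : ℝ × ℝ → ℝ} (S : Stress om s11 s12 s22) {C0 : ℝ}
    (hG : ∀ R : ℝ, 0 < R → (∫ x in ball 0 R, gg s11 s12 s22 x) ≤ C0 * R) {χ : ℝ → ℝ} (h : Wt χ) (h1 : ∀ t, χ t ≤ 1) (n : ℕ)
    (hs : ∀ t, χ t ≠ 0 → |t| ≤ 3 * n) : EE χ s11 s12 s22 ≤ C0 * Real.exp 1 * (6 * n + 1) := by
  set G := gg s11 s12 s22 with hGdef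
  have hi : ∀ k : ℤ, HI (fun x => Real.exp (-k) * (ball 0 (Real.exp (k + 1))).indicator G x) (Real.exp (-k) * ∫ x in ball 0 (Real.exp (k + 1)), G x) := fun k => by
    apply HI.cmul
    refine ⟨(integrable_indicator_iff measurableSet_ball).2 (gg_int S _), integral_indicator measurableSet_ball⟩
  have hle : ∀ k : ℤ, Real.exp (-k) * (∫ x in ball 0 (Real.exp (k + 1)), G x) ≤ C0 * Real.exp 1 := fun k => by
    have := mul_le_mul_of_nonneg_left (hG (Real.exp (k + 1)) (Real.exp_pos _)) (Real.exp_pos (-k)).le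
    refine this.trans (le_of_eq ?_)
    rw [Real.exp_add, Real.exp_neg]; field_simp
  have pt : ∀ x, zeta χ x * G x ≤ ∑ k ∈ Finset.Icc (-(3 * n : ℤ)) (3 * n), Real.exp (-k) * (ball 0 (Real.exp (k + 1))).indicator G x := fun x => by
    have nn : ∀ k : ℤ, 0 ≤ Real.exp (-k) * (ball 0 (Real.exp (k + 1))).indicator G x := fun k =>
      mul_nonneg (Real.exp_pos _).le (indicator_nonneg (fun y _ => gg_nonneg _ _ _ y) x)
    by_cases hz : zeta χ x = 0
    · rw [hz, zero_mul]; exact Finset.sum_nonneg fun k _ => nn k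
    set r := x.1 ^ 2 + x.2 ^ 2 with hr
    have hr0 : 0 < r := by
      rcases (show 0 ≤ r by positivity).eq_or_lt with h0 | h0
      · exfalso; apply hz; unfold zeta; rw [← hr, ← h0]; simp
      · exact h0
    have hχ : χ (Real.log r / 2) ≠ 0 := right_ne_zero_of_mul hz
    have hb := abs_le.1 (hs _ hχ)
    set k := ⌊Real.log r / 2⌋ with hk
    have k1 : (k : ℝ) ≤ Real.log r / 2 := Int.floor_le _
    have k2 : Real.log r / 2 < k + 1 := Int.lt_floor_add_one _
    have hsq : Real.sqrt r = Real.exp (Real.log r / 2) := by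
      rw [Real.sqrt_eq_rpow, Real.rpow_def_of_pos hr0]; congr 1; ring
    have hmem : x ∈ ball (0 : ℝ × ℝ) (Real.exp (k + 1)) := by
      have h3 : Real.sqrt r < Real.exp (k + 1) := by rw [hsq]; exact Real.exp_lt_exp.2 k2
      rw [mem_ball_zero_iff, Prod.norm_def, max_lt_iff]
      constructor
      · refine lt_of_le_of_lt ?_ h3
        rw [Real.norm_eq_abs]; apply Real.abs_le_sqrt; rw [hr]; nlinarith [sq_nonneg x.2]
      · refine lt_of_le_of_lt ?_ h3
        rw [Real.norm_eq_abs]; apply Real.abs_le_sqrt; rw [hr]; nlinarith [sq_nonneg x.1]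
    have hkm : k ∈ Finset.Icc (-(3 * n : ℤ)) (3 * n) := by
      rw [Finset.mem_Icc]
      constructor
      · rw [hk, Int.le_floor]; push_cast; exact hb.1
      · have : (k : ℝ) ≤ 3 * n := k1.trans hb.2
        exact_mod_cast this
    refine le_trans ?_ (Finset.single_le_sum (fun k _ => nn k) hkm)
    rw [indicator_of_mem hmem]
    refine mul_le_mul_of_nonneg_right ?_ (gg_nonneg _ _ _ x)
    unfold zeta
    rw [← hr, hsq, ← Real.exp_neg]
    calc Real.exp (-(Real.log r / 2)) * χ (Real.log r / 2) ≤ Real.exp (-k) * 1 :=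
          mul_le_mul (Real.exp_le_exp.2 (by linarith)) (h1 _) (h.nn _) (Real.exp_pos _).le
      _ = _ := mul_one _
  have := integral_mono (EE_int S h) (integrable_finsetSum (Finset.Icc (-(3 * n : ℤ)) (3 * n)) (fun k _ => (hi k).1)) pt
  rw [integral_finsetSum _ (fun k _ => (hi k).1)] at this
  refine this.trans ?_
  refine (Finset.sum_le_sum (fun k _ => (le_of_eq (hi k).2).trans (hle k))).trans ?_
  rw [Finset.sum_const, Int.card_Icc, nsmul_eq_mul]
  have e : ((3 * n + 1 - -(3 * n) : ℤ).toNat : ℝ) = 6 * n + 1 := by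
    have : (3 * n + 1 - -(3 * n) : ℤ).toNat = 6 * n + 1 := by omega
    rw [this]; push_cast; ring
  rw [e]; exact le_of_eq (by ring)

theorem core_thm {om : ℝ} (h0 : 0 < om) (hom : om < Real.pi) {ν : ℝ} (hν : ν < 1) {s11 s12 s22 : ℝ × ℝ → ℝ}
    (S : Stress om s11 s12 s22) (H : Compat om ν s11 s12 s22) {C0 : ℝ}
    (hG : ∀ R : ℝ, 0 < R → (∫ x in ball 0 R, gg s11 s12 s22 x) ≤ C0 * R) :
    ∀ᵐ x, gg s11 s12 s22 x = 0 := by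
  obtain ⟨C, hC, step⟩ := one_step h0 hom hν
  obtain ⟨f, g, hf, hg, f1, gz, g1, fle, fz, c, hc, d1, d2, fg⟩ := bump_cut
  have hC0 : 0 ≤ C0 := by
    have := hG 1 one_pos
    have h2 : 0 ≤ ∫ x in ball 0 1, gg s11 s12 s22 x := integral_nonneg fun x => gg_nonneg _ _ _ x
    linarith
  let F : ℕ → ℝ → ℝ := fun n t => f ((n:ℝ)⁻¹ * t)
  let Gf : ℕ → ℝ → ℝ := fun n t => g ((n:ℝ)⁻¹ * t)
  have hF : ∀ n : ℕ, 0 < n → Wt (F n) := fun n hn => hf.scale (by exact_mod_cast hn)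
  have hGf : ∀ n : ℕ, 0 < n → Wt (Gf n) := fun n hn => hg.scale (by exact_mod_cast hn)
  have st : ∀ n : ℕ, 0 < n → EE (F n) s11 s12 s22 ≤ c / n * (C * EE (Gf n) s11 s12 s22) := fun n hn => by
    have hn' : (1:ℝ) ≤ n := by exact_mod_cast hn
    have hi : (n:ℝ)⁻¹ ≤ 1 := inv_le_one_of_one_le₀ hn'
    have hi0 : 0 ≤ (n:ℝ)⁻¹ := by positivity
    have e1 : deriv (F n) = fun t => (n:ℝ)⁻¹ * deriv f ((n:ℝ)⁻¹ * t) := deriv_scale _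
    have e2 : deriv (deriv (F n)) = fun t => (n:ℝ)⁻¹ * ((n:ℝ)⁻¹ * deriv (deriv f) ((n:ℝ)⁻¹ * t)) := by
      rw [e1]; funext t; rw [deriv_const_mul_field, deriv_scale]
    have a1 : ∀ t, |deriv (F n) t| ≤ c / n * Gf n t := fun t => by
      rw [e1]; simp only [abs_mul, abs_of_nonneg hi0]
      have := mul_le_mul_of_nonneg_left (d1 ((n:ℝ)⁻¹ * t)) hi0
      refine this.trans (le_of_eq ?_); simp only [Gf]; ring
    have a2 : ∀ t, |deriv (deriv (F n)) t| ≤ c / n * Gf n t := fun t => by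
      rw [e2]; simp only [abs_mul, abs_of_nonneg hi0]
      have h1 := mul_le_mul_of_nonneg_left (d2 ((n:ℝ)⁻¹ * t)) hi0
      have h2 : (n:ℝ)⁻¹ * |deriv (deriv f) ((n:ℝ)⁻¹ * t)| ≤ |deriv (deriv f) ((n:ℝ)⁻¹ * t)| :=
        mul_le_of_le_one_left (abs_nonneg _) hi
      have h3 := mul_le_mul_of_nonneg_left h2 hi0
      refine (h3.trans h1).trans (le_of_eq ?_); simp only [Gf]; ring
    have gg1 : ∀ t, Gf n t ≤ 1 := fun t => g1 _
    have gg0 : ∀ t, 0 ≤ Gf n t := fun t => (hGf n hn).nn t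
    have cn : c / n ≤ c := div_le_self hc.le hn'
    have cn0 : 0 ≤ c / n := by positivity
    have sqb : ∀ (y : ℝ) t, |y| ≤ c / n * Gf n t → y ^ 2 ≤ (1 + c ^ 2) * Gf n t := fun y t hy => by
      have h1 : |y| ≤ c * Gf n t := hy.trans (mul_le_mul_of_nonneg_right cn (gg0 t))
      rw [← sq_abs]
      have h2 : |y| ^ 2 ≤ (c * Gf n t) ^ 2 := pow_le_pow_left₀ (abs_nonneg _) h1 2
      have h3 : Gf n t ^ 2 ≤ Gf n t := by nlinarith [gg0 t, gg1 t]
      have h4 : c ^ 2 * Gf n t ^ 2 ≤ c ^ 2 * Gf n t := mul_le_mul_of_nonneg_left h3 (sq_nonneg c)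
      nlinarith [gg0 t]
    refine step s11 s12 s22 (F n) (Gf n) (c / n) (1 + c ^ 2) S H (hF n hn) (hGf n hn) (by positivity) a1 a2 ?_ ?_ ?_
    · intro t
      have h1 : F n t ≤ Gf n t := fg _
      have h2 : F n t ≤ 1 := fle _
      have h3 : 0 ≤ F n t := (hF n hn).nn t
      nlinarith [mul_nonneg (sq_nonneg c) (gg0 t)]
    · exact fun t => sqb _ t (a1 t)
    · exact fun t => sqb _ t (a2 t)
  have gs : ∀ n : ℕ, 0 < n → ∀ t, Gf n t ≠ 0 → |t| ≤ 3 * n := fun n hn t ht => by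
    have hn' : (0:ℝ) < n := by exact_mod_cast hn
    have := gz _ ht
    rw [abs_mul, abs_of_nonneg (by positivity), inv_mul_le_iff₀ hn'] at this
    linarith
  have bd1 : ∀ n : ℕ, 0 < n → EE (F n) s11 s12 s22 ≤ c * C * (C0 * Real.exp 1 * 7) := fun n hn => by
    have hn' : (1:ℝ) ≤ n := by exact_mod_cast hn
    have h1 := EE_growth S hG (hGf n hn) (fun t => g1 _) n (gs n hn)
    have hp : 0 ≤ C0 * Real.exp 1 := by positivity
    have h2 : EE (Gf n) s11 s12 s22 ≤ C0 * Real.exp 1 * (7 * n) := h1.trans (mul_le_mul_of_nonneg_left (by linarith) hp)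
    have h3 := mul_le_mul_of_nonneg_left (mul_le_mul_of_nonneg_left h2 hC.le) (show 0 ≤ c / n by positivity)
    refine (st n hn).trans (h3.trans (le_of_eq ?_))
    field_simp
  set A := c * C * (C0 * Real.exp 1 * 7) with hA
  have bd2 : ∀ n : ℕ, 0 < n → EE (F n) s11 s12 s22 ≤ c * C * A / n := fun n hn => by
    have hn' : (0:ℝ) < n := by exact_mod_cast hn
    have h3n : 0 < 3 * n := by omega
    have h1 : EE (Gf n) s11 s12 s22 ≤ EE (F (3 * n)) s11 s12 s22 := EE_mono S (hGf n hn) (hF _ h3n) (fun t => by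
      by_cases h : Gf n t = 0
      · rw [h]; exact (hF _ h3n).nn t
      · have h2 := gs n hn t h
        have : F (3 * n) t = 1 := f1 _ (by
          rw [abs_mul, abs_of_nonneg (by positivity), inv_mul_le_iff₀ (by exact_mod_cast h3n)]
          push_cast; linarith)
        rw [this]; exact g1 _)
    have h2 := h1.trans (bd1 _ h3n)
    have h3 := mul_le_mul_of_nonneg_left (mul_le_mul_of_nonneg_left h2 hC.le) (show 0 ≤ c / n by positivity)
    refine (st n hn).trans (h3.trans (le_of_eq ?_))
    ring
  have zero : ∀ n : ℕ, 0 < n → EE (F n) s11 s12 s22 = 0 := fun n hn => by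
    have hn' : (0:ℝ) < n := by exact_mod_cast hn
    refine le_antisymm ?_ (EE_nonneg (hF n hn) _ _ _)
    have lim : Tendsto (fun m : ℕ => c * C * A / (m : ℝ)) atTop (𝓝 0) := tendsto_const_div_atTop_nhds_zero_nat _
    refine ge_of_tendsto lim ?_
    filter_upwards [eventually_ge_atTop (2 * n)] with m hm
    have hm0 : 0 < m := by omega
    have hm' : (2 * n : ℝ) ≤ m := by exact_mod_cast hm
    refine le_trans (EE_mono S (hF n hn) (hF m hm0) (fun t => ?_)) (bd2 m hm0)
    by_cases h : F n t = 0
    · rw [h]; exact (hF m hm0).nn t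
    · have h2 := fz _ h
      rw [abs_mul, abs_of_nonneg (by positivity), inv_mul_le_iff₀ hn'] at h2
      have : F m t = 1 := f1 _ (by
        rw [abs_mul, abs_of_nonneg (by positivity), inv_mul_le_iff₀ (by linarith)]
        linarith)
      rw [this]; exact fle _
  have ae : ∀ᵐ x, ∀ n : ℕ, 0 < n → zeta (F n) x * gg s11 s12 s22 x = 0 := by
    rw [ae_all_iff]; intro n
    by_cases hn : 0 < n
    · have := (integral_eq_zero_iff_of_nonneg (fun x => mul_nonneg (zeta_nonneg (hF n hn) x) (gg_nonneg _ _ _ x)) (EE_int S (hF n hn))).1 (zero n hn)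
      filter_upwards [this] with x hx _ using hx
    · exact ae_of_all _ fun x h => absurd h hn
  have ne0 : ∀ᵐ x : ℝ × ℝ, x ≠ 0 := by
    rw [ae_iff]; simp
  filter_upwards [ae, ne0] with x hx hx0
  set r := x.1 ^ 2 + x.2 ^ 2 with hr
  have hr0 : 0 < r := by
    rcases (show 0 ≤ r by positivity).eq_or_lt with h | h
    · exfalso; apply hx0
      have h1 : x.1 = 0 := by nlinarith [sq_nonneg x.1, sq_nonneg x.2]
      have h2 : x.2 = 0 := by nlinarith [sq_nonneg x.1, sq_nonneg x.2]
      exact Prod.ext h1 h2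
    · exact h
  obtain ⟨n, hn⟩ := exists_nat_ge (|Real.log r / 2| + 1)
  have hn0 : (0:ℝ) < n := by have := abs_nonneg (Real.log r / 2); linarith
  have hnp : 0 < n := by exact_mod_cast hn0
  refine (mul_eq_zero.1 (hx n hnp)).resolve_left ?_
  unfold zeta
  rw [← hr]
  have : F n (Real.log r / 2) = 1 := f1 _ (by
    rw [abs_mul, abs_of_nonneg (by positivity), inv_mul_le_iff₀ hn0]; linarith)
  rw [this, mul_one]
  exact inv_ne_zero (Real.sqrt_pos.2 hr0).ne'

end Targ

end

section
section SecApp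
open scoped ContDiff

/-- Displacement components on a sector. -/
structure Disp (om : ℝ) (c : ℝ × ℝ → ℝ) : Prop where
  diff : ∀ p ∈ Sec om, DifferentiableAt ℝ c p
  loc : LocallyIntegrableOn c (Sec om)
  locx : LocallyIntegrableOn (dx c) (Sec om)
  locy : LocallyIntegrableOn (dy c) (Sec om)

lemma loc_mul {om : ℝ} {c Ψ : ℝ × ℝ → ℝ} (hl : LocallyIntegrableOn c (Sec om)) (hΨ : Continuous Ψ) (hc : HasCompactSupport Ψ) (hs : SupS om Ψ) :
    Integrable (fun p => c p * Ψ p) := by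
  have h1 : IntegrableOn c (tsupport Ψ) := hl.integrableOn_compact_subset hs hc
  have h2 : IntegrableOn (fun p => c p * Ψ p) (tsupport Ψ) := h1.mul_continuousOn hΨ.continuousOn hc
  refine (integrableOn_iff_integrable_of_support_subset ?_).1 h2
  intro p hp
  exact subset_tsupport _ (right_ne_zero_of_mul hp)

lemma fderiv_zero_int {f : ℝ × ℝ → ℝ} (hf : Differentiable ℝ f) (hi : Integrable f) (v : ℝ × ℝ) (hv : Integrable (fun p => fderiv ℝ f p v)) :
    ∫ p, fderiv ℝ f p v = 0 := by
  have h := integral_mul_fderiv_eq_neg_fderiv_mul_of_integrable (μ := (volume : Measure (ℝ × ℝ)))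
    (f := fun _ : ℝ × ℝ => (1 : ℝ)) (g := f) (v := v)
    (by simp) (by simpa using hv) (by simpa using hi)
    (fun x _ => differentiableAt_const _) (fun x _ => hf x)
  simpa using h

lemma ibp_gen {om : ℝ} {c Ψ : ℝ × ℝ → ℝ} (hd : ∀ p ∈ Sec om, DifferentiableAt ℝ c p) (hl : LocallyIntegrableOn c (Sec om)) (v : ℝ × ℝ)
    (hv : LocallyIntegrableOn (fun p => fderiv ℝ c p v) (Sec om)) (hΨ : Sm Ψ) (hc : HasCompactSupport Ψ) (hs : SupS om Ψ) :
    HI (fun p => fderiv ℝ c p v * Ψ p + c p * fderiv ℝ Ψ p v) 0 := by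
  have hc2 : HasCompactSupport (fun p => fderiv ℝ Ψ p v) := hc.fderiv_apply ℝ v
  have hs2 : SupS om (fun p => fderiv ℝ Ψ p v) := (tsupport_fderiv_apply_subset ℝ _).trans hs
  have hcont : Continuous (fun p => fderiv ℝ Ψ p v) := ((hΨ.cd.continuous_fderiv (by simp)).clm_apply continuous_const)
  have i1 := loc_mul hv hΨ.cont hc hs
  have i2 := loc_mul hl hcont hc2 hs2
  have hD : Differentiable ℝ (fun p => c p * Ψ p) := fun p => by
    by_cases hp : p ∈ tsupport Ψ
    · exact (hd p (hs hp)).mul (hΨ.diff p)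
    · have : (fun p => c p * Ψ p) =ᶠ[𝓝 p] fun _ => 0 := by
        filter_upwards [(isClosed_tsupport Ψ).isOpen_compl.mem_nhds hp] with q hq
        rw [image_eq_zero_of_notMem_tsupport hq, mul_zero]
      exact this.differentiableAt_iff.2 (differentiableAt_const _)
  have e : ∀ p, fderiv ℝ c p v * Ψ p + c p * fderiv ℝ Ψ p v = fderiv ℝ (fun p => c p * Ψ p) p v := fun p => by
    by_cases hp : p ∈ tsupport Ψ
    · rw [fderiv_fun_mul (hd p (hs hp)) (hΨ.diff p)]; simp; ring
    · have : (fun p => c p * Ψ p) =ᶠ[𝓝 p] fun _ => 0 := by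
        filter_upwards [(isClosed_tsupport Ψ).isOpen_compl.mem_nhds hp] with q hq
        rw [image_eq_zero_of_notMem_tsupport hq, mul_zero]
      rw [this.fderiv_eq, image_eq_zero_of_notMem_tsupport hp]
      have h2 : p ∉ tsupport (fun p => fderiv ℝ Ψ p v) := fun h => hp (tsupport_fderiv_apply_subset ℝ _ h)
      rw [image_eq_zero_of_notMem_tsupport (f := fun p => fderiv ℝ Ψ p v) h2]; simp
  refine HI.congr ⟨?_, ?_⟩ e
  · refine (i1.add i2).congr (ae_of_all _ fun p => e p)
  · refine fderiv_zero_int hD (loc_mul hl hΨ.cont hc hs) v ((i1.add i2).congr (ae_of_all _ fun p => e p))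

lemma compat_of {om : ℝ} {c1 c2 Ψ : ℝ × ℝ → ℝ} (h1 : Disp om c1) (h2 : Disp om c2) (hΨ : Sm Ψ) (hc : HasCompactSupport Ψ) (hs : SupS om Ψ) :
    (∫ p, (dx c1 p * dy (dy Ψ) p + dy c2 p * dx (dx Ψ) p - (dy c1 p + dx c2 p) * dx (dy Ψ) p)) = 0 := by
  have a1 := ibp_gen h1.diff h1.loc (1, 0) h1.locx hΨ.dy.dy (hcs_dy (hcs_dy hc)) hs.dy.dy
  have a2 := ibp_gen h2.diff h2.loc (0, 1) h2.locy hΨ.dx.dx (hcs_dx (hcs_dx hc)) hs.dx.dx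
  have a3 := ibp_gen h1.diff h1.loc (0, 1) h1.locy hΨ.dy.dx (hcs_dx (hcs_dy hc)) hs.dy.dx
  have a4 := ibp_gen h2.diff h2.loc (1, 0) h2.locx hΨ.dy.dx (hcs_dx (hcs_dy hc)) hs.dy.dx
  have := ((a1.add a2).sub (a3.add a4)).congr (g := fun p => (dx c1 p * dy (dy Ψ) p + dy c2 p * dx (dx Ψ) p - (dy c1 p + dx c2 p) * dx (dy Ψ) p)) (fun p => by
    have e1 : fderiv ℝ (dy (dy Ψ)) p (1, 0) = dx (dy (dy Ψ)) p := rfl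
    have e2 : fderiv ℝ (dx (dx Ψ)) p (0, 1) = dy (dx (dx Ψ)) p := rfl
    have e3 : fderiv ℝ (dx (dy Ψ)) p (0, 1) = dy (dx (dy Ψ)) p := rfl
    have e4 : fderiv ℝ (dx (dy Ψ)) p (1, 0) = dx (dx (dy Ψ)) p := rfl
    rw [e1, e2, e3, e4, dxdy_comm hΨ.dy, dxdy_comm hΨ.dx, dxdy_comm hΨ]
    simp only [dx, dy]; ring)
  rw [this.2]; ring

lemma meas_dx (c : ℝ × ℝ → ℝ) : Measurable (dx c) := measurable_fderiv_apply_const ℝ c _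
lemma meas_dy (c : ℝ × ℝ → ℝ) : Measurable (dy c) := measurable_fderiv_apply_const ℝ c _

/-- The elastic core: finite energy growth and equilibrium on a sector force zero strain. -/
theorem sec_zero {om : ℝ} (h0 : 0 < om) (hom : om < Real.pi) {lam μ : ℝ} (hμ : 0 < μ) (hl : 0 < μ + lam) {c1 c2 : ℝ × ℝ → ℝ}
    (h1 : Disp om c1) (h2 : Disp om c2) {C0 : ℝ} (hC0 : 0 ≤ C0)
    (hE : ∀ R : ℝ, 0 < R → ∫⁻ p in Sec om ∩ ball 0 R, ENNReal.ofReal (dx c1 p ^ 2 + (dy c1 p + dx c2 p) ^ 2 + dy c2 p ^ 2) ≤ ENNReal.ofReal (C0 * R))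
    (hEL : ∀ g1 g2 : ℝ × ℝ → ℝ, Sm g1 → HasCompactSupport g1 → Sm g2 → HasCompactSupport g2 →
      (∫ p in Sec om, ((lam * (dx c1 p + dy c2 p) + 2 * μ * dx c1 p) * dx g1 p + μ * (dy c1 p + dx c2 p) * (dy g1 p + dx g2 p)
        + (lam * (dx c1 p + dy c2 p) + 2 * μ * dy c2 p) * dy g2 p)) = 0) :
    ∀ᵐ p, p ∈ Sec om → dx c1 p = 0 ∧ dy c1 p + dx c2 p = 0 ∧ dy c2 p = 0 := by
  have hS : MeasurableSet (Sec om) := (isOpen_Sec om).measurableSet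
  set s11 := (Sec om).indicator (fun p => lam * (dx c1 p + dy c2 p) + 2 * μ * dx c1 p) with hs11
  set s12 := (Sec om).indicator (fun p => μ * (dy c1 p + dx c2 p)) with hs12
  set s22 := (Sec om).indicator (fun p => lam * (dx c1 p + dy c2 p) + 2 * μ * dy c2 p) with hs22
  have q1 := meas_dx c1
  have q2 := meas_dy c1
  have q3 := meas_dx c2
  have q4 := meas_dy c2
  have m11 : Measurable s11 := (((q1.add q4).const_mul lam).add (q1.const_mul (2 * μ))).indicator hS
  have m12 : Measurable s12 := ((q2.add q3).const_mul μ).indicator hS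
  have m22 : Measurable s22 := (((q1.add q4).const_mul lam).add (q4.const_mul (2 * μ))).indicator hS
  set C1 := 2 * (lam + 2 * μ) ^ 2 + 2 * lam ^ 2 + 2 * μ ^ 2 with hC1
  have hC1n : 0 ≤ C1 := by positivity
  set w := fun p => dx c1 p ^ 2 + (dy c1 p + dx c2 p) ^ 2 + dy c2 p ^ 2 with hw
  have v11 : ∀ p ∈ Sec om, s11 p = lam * (dx c1 p + dy c2 p) + 2 * μ * dx c1 p := fun p hp => indicator_of_mem hp _
  have v12 : ∀ p ∈ Sec om, s12 p = μ * (dy c1 p + dx c2 p) := fun p hp => indicator_of_mem hp _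
  have v22 : ∀ p ∈ Sec om, s22 p = lam * (dx c1 p + dy c2 p) + 2 * μ * dy c2 p := fun p hp => indicator_of_mem hp _
  have z11 : ∀ p, p ∉ Sec om → s11 p = 0 := fun p hp => indicator_of_notMem hp _
  have z12 : ∀ p, p ∉ Sec om → s12 p = 0 := fun p hp => indicator_of_notMem hp _
  have z22 : ∀ p, p ∉ Sec om → s22 p = 0 := fun p hp => indicator_of_notMem hp _
  have gle : ∀ p, gg s11 s12 s22 p ≤ (Sec om).indicator (fun p => C1 * w p) p := fun p => by
    by_cases hp : p ∈ Sec om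
    · rw [indicator_of_mem hp, gg, v11 p hp, v12 p hp, v22 p hp, hC1, hw]
      simp only
      generalize dx c1 p = a; generalize dy c2 p = d; generalize dy c1 p + dx c2 p = g
      nlinarith [sq_nonneg ((lam + 2 * μ) * a - lam * d), sq_nonneg ((lam + 2 * μ) * d - lam * a), sq_nonneg (lam * g), sq_nonneg ((lam + 2 * μ) * g),
        sq_nonneg (μ * a), sq_nonneg (μ * d)]
    · rw [indicator_of_notMem hp, gg, z11 p hp, z12 p hp, z22 p hp]; simp
  have lint : ∀ R : ℝ, 0 < R → ∫⁻ p in ball 0 R, ENNReal.ofReal (gg s11 s12 s22 p) ≤ ENNReal.ofReal (C1 * (C0 * R)) := fun R hR => by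
    calc ∫⁻ p in ball 0 R, ENNReal.ofReal (gg s11 s12 s22 p)
        ≤ ∫⁻ p in ball 0 R, (Sec om).indicator (fun p => ENNReal.ofReal C1 * ENNReal.ofReal (w p)) p := by
          refine lintegral_mono fun p => ?_
          refine (ENNReal.ofReal_le_ofReal (gle p)).trans (le_of_eq ?_)
          by_cases hp : p ∈ Sec om
          · rw [indicator_of_mem hp, indicator_of_mem hp, ENNReal.ofReal_mul hC1n]
          · rw [indicator_of_notMem hp, indicator_of_notMem hp, ENNReal.ofReal_zero]
      _ = ∫⁻ p in Sec om ∩ ball 0 R, ENNReal.ofReal C1 * ENNReal.ofReal (w p) := by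
          rw [lintegral_indicator hS, Measure.restrict_restrict hS]
      _ = ENNReal.ofReal C1 * ∫⁻ p in Sec om ∩ ball 0 R, ENNReal.ofReal (w p) :=
          lintegral_const_mul' _ _ ENNReal.ofReal_ne_top
      _ ≤ ENNReal.ofReal C1 * ENNReal.ofReal (C0 * R) := by gcongr; exact hE R hR
      _ = _ := (ENNReal.ofReal_mul hC1n).symm
  have memR : ∀ s : ℝ × ℝ → ℝ, Measurable s → (∀ p, s p ^ 2 ≤ gg s11 s12 s22 p) → ∀ R : ℝ, MemLp ((ball 0 R).indicator s) 2 := by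
    intro s hm hs R
    rcases le_or_gt R 0 with hR | hR
    · rw [ball_eq_empty.2 hR, indicator_empty]; exact MemLp.zero
    · refine (L2pack (τ := Real.sqrt (C1 * (C0 * R))) hm.aestronglyMeasurable ?_).1
      rw [Real.sq_sqrt (by positivity)]
      refine le_trans (lintegral_mono fun p => ?_) (lint R hR)
      rw [← enorm_pow, Real.enorm_eq_ofReal (sq_nonneg _)]
      exact ENNReal.ofReal_le_ofReal (hs p)
  have S : Stress om s11 s12 s22 := by
    refine ⟨memR s11 m11 fun p => ?_, memR s12 m12 fun p => ?_, memR s22 m22 fun p => ?_, z11, z12, z22, fun g hg hgc => ?_, fun g hg hgc => ?_⟩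
    · unfold gg; nlinarith [sq_nonneg (s12 p), sq_nonneg (s22 p)]
    · unfold gg; nlinarith [sq_nonneg (s12 p), sq_nonneg (s22 p), sq_nonneg (s11 p)]
    · unfold gg; nlinarith [sq_nonneg (s12 p), sq_nonneg (s11 p)]
    · have z0 : Sm (fun _ : ℝ × ℝ => (0:ℝ)) := contDiff_const
      have := hEL g (fun _ => 0) hg hgc z0 HasCompactSupport.zero
      rw [← integral_indicator hS] at this
      rw [← this]
      congr 1; funext p
      have ex : dx (fun _ : ℝ × ℝ => (0:ℝ)) p = 0 := by simp [dx]
      have ey : dy (fun _ : ℝ × ℝ => (0:ℝ)) p = 0 := by simp [dy]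
      by_cases hp : p ∈ Sec om
      · rw [indicator_of_mem hp, v11 p hp, v12 p hp, ex, ey]; ring
      · rw [indicator_of_notMem hp, z11 p hp, z12 p hp]; ring
    · have z0 : Sm (fun _ : ℝ × ℝ => (0:ℝ)) := contDiff_const
      have := hEL (fun _ => 0) g z0 HasCompactSupport.zero hg hgc
      rw [← integral_indicator hS] at this
      rw [← this]
      congr 1; funext p
      have ex : dx (fun _ : ℝ × ℝ => (0:ℝ)) p = 0 := by simp [dx]
      have ey : dy (fun _ : ℝ × ℝ => (0:ℝ)) p = 0 := by simp [dy]
      by_cases hp : p ∈ Sec om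
      · rw [indicator_of_mem hp, v22 p hp, v12 p hp, ex, ey]; ring
      · rw [indicator_of_notMem hp, z22 p hp, z12 p hp]; ring
  have hC : Compat om (lam / (2 * (lam + μ))) s11 s12 s22 := by
    intro Ψ hΨ hc hs
    have := compat_of h1 h2 hΨ hc hs
    have e : ∀ p, ((s11 p - lam / (2 * (lam + μ)) * (s11 p + s22 p)) * dy (dy Ψ) p + (s22 p - lam / (2 * (lam + μ)) * (s11 p + s22 p)) * dx (dx Ψ) p
      - 2 * s12 p * dx (dy Ψ) p) = 2 * μ * (dx c1 p * dy (dy Ψ) p + dy c2 p * dx (dx Ψ) p - (dy c1 p + dx c2 p) * dx (dy Ψ) p) := fun p => by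
      by_cases hp : p ∈ Sec om
      · rw [v11 p hp, v12 p hp, v22 p hp]
        have : lam + μ ≠ 0 := by linarith
        field_simp; ring
      · have y1 : dy (dy Ψ) p = 0 := by
          by_contra h; exact hp (hs.dy.dy (subset_tsupport _ h))
        have y2 : dx (dx Ψ) p = 0 := by
          by_contra h; exact hp (hs.dx.dx (subset_tsupport _ h))
        have y3 : dx (dy Ψ) p = 0 := by
          by_contra h; exact hp (hs.dy.dx (subset_tsupport _ h))
        rw [y1, y2, y3]; ring
    simp only [e]
    rw [integral_const_mul, this, mul_zero]
  have hν : lam / (2 * (lam + μ)) < 1 := by rw [div_lt_one (by linarith)]; linarith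
  have := core_thm h0 hom hν S hC (C0 := C1 * C0) (fun R hR => by
    rw [integral_eq_lintegral_of_nonneg_ae (ae_of_all _ fun p => gg_nonneg _ _ _ p) (gg_int S R).1]
    refine ENNReal.toReal_le_of_le_ofReal (by positivity) ((lint R hR).trans (le_of_eq ?_))
    congr 1; ring)
  filter_upwards [this] with p hp hpS
  have g1 : s11 p = 0 := by unfold gg at hp; nlinarith [sq_nonneg (s11 p), sq_nonneg (s12 p), sq_nonneg (s22 p)]
  have g2 : s12 p = 0 := by unfold gg at hp; nlinarith [sq_nonneg (s11 p), sq_nonneg (s12 p), sq_nonneg (s22 p)]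
  have g3 : s22 p = 0 := by unfold gg at hp; nlinarith [sq_nonneg (s11 p), sq_nonneg (s12 p), sq_nonneg (s22 p)]
  rw [v11 p hpS] at g1
  rw [v12 p hpS] at g2
  rw [v22 p hpS] at g3
  have t : dx c1 p + dy c2 p = 0 := by
    have : (μ + lam) * (dx c1 p + dy c2 p) = 0 := by linarith
    exact (mul_eq_zero.1 this).resolve_left hl.ne'
  rw [t] at g1 g3
  refine ⟨?_, (mul_eq_zero.1 g2).resolve_left hμ.ne', ?_⟩
  · have : μ * dx c1 p = 0 := by linarith
    exact (mul_eq_zero.1 this).resolve_left hμ.ne'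
  · have : μ * dy c2 p = 0 := by linarith
    exact (mul_eq_zero.1 this).resolve_left hμ.ne'

end SecApp

end

section
section Frames

/-- rotation of the plane -/
def rotL (m : ℝ) : Euc 2 →ₗ[ℝ] Euc 2 where
  toFun x := !₂[Real.cos m * x 0 - Real.sin m * x 1, Real.sin m * x 0 + Real.cos m * x 1]
  map_add' x y := by
    ext i; fin_cases i <;> simp <;> ring
  map_smul' c x := by
    ext i; fin_cases i <;> simp <;> ring

lemma norm_sq_euc (x : Euc 2) : ‖x‖ ^ 2 = x 0 ^ 2 + x 1 ^ 2 := by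
  rw [EuclideanSpace.real_norm_sq_eq]; simp [Fin.sum_univ_two]

lemma rotL_norm (m : ℝ) (x : Euc 2) : ‖rotL m x‖ = ‖x‖ := by
  have h : ‖rotL m x‖ ^ 2 = ‖x‖ ^ 2 := by
    rw [norm_sq_euc, norm_sq_euc]
    simp only [rotL, LinearMap.coe_mk, AddHom.coe_mk]
    simp
    nlinarith [Real.sin_sq_add_cos_sq m]
  exact (sq_eq_sq₀ (norm_nonneg _) (norm_nonneg _)).1 h

def rotE (m : ℝ) : Euc 2 ≃ₗᵢ[ℝ] Euc 2 :=
  LinearIsometry.toLinearIsometryEquiv ⟨rotL m, rotL_norm m⟩ rfl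

def frE (m : ℝ) : (ℝ × ℝ) ≃L[ℝ] Euc 2 :=
  ((ContinuousLinearEquiv.finTwoArrow ℝ ℝ).symm.trans
    (EuclideanSpace.equiv (Fin 2) ℝ).symm).trans (rotE m).toContinuousLinearEquiv

lemma frE_0 (m : ℝ) (p : ℝ × ℝ) : frE m p 0 = Real.cos m * p.1 - Real.sin m * p.2 := by
  simp [frE, rotE, rotL]

lemma frE_1 (m : ℝ) (p : ℝ × ℝ) : frE m p 1 = Real.sin m * p.1 + Real.cos m * p.2 := by
  simp [frE, rotE, rotL]

lemma frE_mp (m : ℝ) : MeasurePreserving (frE m) volume volume := by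
  have h1 := ((volume_preserving_finTwoArrow ℝ).symm)
  have h2 := (EuclideanSpace.volume_preserving_symm_measurableEquiv_toLp (Fin 2)).symm
  have h3 := (rotE m).measurePreserving
  exact h3.comp (h2.comp h1)

lemma frE_norm (m : ℝ) (p : ℝ × ℝ) : ‖frE m p‖ ^ 2 = p.1 ^ 2 + p.2 ^ 2 := by
  rw [norm_sq_euc, frE_0, frE_1]
  nlinarith [Real.sin_sq_add_cos_sq m]

/-- components in the rotated frame -/
def cc1 (m : ℝ) (w : Euc 2 → Euc 2) (p : ℝ × ℝ) : ℝ :=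
  Real.cos m * w (frE m p) 0 + Real.sin m * w (frE m p) 1
def cc2 (m : ℝ) (w : Euc 2 → Euc 2) (p : ℝ × ℝ) : ℝ :=
  -Real.sin m * w (frE m p) 0 + Real.cos m * w (frE m p) 1

lemma comp_hasF {m : ℝ} {w : Euc 2 → Euc 2} {p : ℝ × ℝ} (i : Fin 2)
    (h : DifferentiableAt ℝ w (frE m p)) :
    HasFDerivAt (fun q => w (frE m q) i)
      ((EuclideanSpace.proj i : Euc 2 →L[ℝ] ℝ).comp
        ((fderiv ℝ w (frE m p)).comp (frE m : (ℝ × ℝ) →L[ℝ] Euc 2))) p :=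
  ((EuclideanSpace.proj i : Euc 2 →L[ℝ] ℝ).hasFDerivAt).comp p
    (h.hasFDerivAt.comp p (frE m).hasFDerivAt)

lemma frE_e1 (m : ℝ) : frE m (1, 0) = Real.cos m • EuclideanSpace.single 0 (1:ℝ)
    + Real.sin m • EuclideanSpace.single 1 (1:ℝ) := by
  ext i; fin_cases i
  · have := frE_0 m (1, 0); simp at this; simp [this]
  · have := frE_1 m (1, 0); simp at this; simp [this]

lemma frE_e2 (m : ℝ) : frE m (0, 1) = -Real.sin m • EuclideanSpace.single 0 (1:ℝ)
    + Real.cos m • EuclideanSpace.single 1 (1:ℝ) := by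
  ext i; fin_cases i
  · have := frE_0 m (0, 1); simp at this; simp [this]
  · have := frE_1 m (0, 1); simp at this; simp [this]

lemma comp_dx {m : ℝ} {w : Euc 2 → Euc 2} {p : ℝ × ℝ} (i : Fin 2)
    (h : DifferentiableAt ℝ w (frE m p)) :
    fderiv ℝ (fun q => w (frE m q) i) p (1, 0) =
      Real.cos m * gradm w (frE m p) i 0 + Real.sin m * gradm w (frE m p) i 1 := by
  rw [(comp_hasF i h).fderiv]
  simp [frE_e1, gradm]

lemma comp_dy {m : ℝ} {w : Euc 2 → Euc 2} {p : ℝ × ℝ} (i : Fin 2)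
    (h : DifferentiableAt ℝ w (frE m p)) :
    fderiv ℝ (fun q => w (frE m q) i) p (0, 1) =
      -Real.sin m * gradm w (frE m p) i 0 + Real.cos m * gradm w (frE m p) i 1 := by
  rw [(comp_hasF i h).fderiv]
  simp [frE_e2, gradm]

lemma cc1_diff {m : ℝ} {w : Euc 2 → Euc 2} {p : ℝ × ℝ}
    (h : DifferentiableAt ℝ w (frE m p)) : DifferentiableAt ℝ (cc1 m w) p :=
  ((comp_hasF 0 h).differentiableAt.const_mul _).add ((comp_hasF 1 h).differentiableAt.const_mul _)
lemma cc2_diff {m : ℝ} {w : Euc 2 → Euc 2} {p : ℝ × ℝ}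
    (h : DifferentiableAt ℝ w (frE m p)) : DifferentiableAt ℝ (cc2 m w) p :=
  ((comp_hasF 0 h).differentiableAt.const_mul _).add ((comp_hasF 1 h).differentiableAt.const_mul _)

lemma cc1_fd {m : ℝ} {w : Euc 2 → Euc 2} {p : ℝ × ℝ} (h : DifferentiableAt ℝ w (frE m p))
    (z : ℝ × ℝ) : fderiv ℝ (cc1 m w) p z = Real.cos m * fderiv ℝ (fun q => w (frE m q) 0) p z +
      Real.sin m * fderiv ℝ (fun q => w (frE m q) 1) p z := by
  have := ((comp_hasF 0 h).const_mul (Real.cos m)).add ((comp_hasF 1 h).const_mul (Real.sin m))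
  rw [show cc1 m w = _ from rfl, (comp_hasF 0 h).fderiv, (comp_hasF 1 h).fderiv]
  erw [this.fderiv]; simp
lemma cc2_fd {m : ℝ} {w : Euc 2 → Euc 2} {p : ℝ × ℝ} (h : DifferentiableAt ℝ w (frE m p))
    (z : ℝ × ℝ) : fderiv ℝ (cc2 m w) p z = -Real.sin m * fderiv ℝ (fun q => w (frE m q) 0) p z +
      Real.cos m * fderiv ℝ (fun q => w (frE m q) 1) p z := by
  have := ((comp_hasF 0 h).const_mul (-Real.sin m)).add ((comp_hasF 1 h).const_mul (Real.cos m))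
  rw [show cc2 m w = _ from rfl, (comp_hasF 0 h).fderiv, (comp_hasF 1 h).fderiv]
  erw [this.fderiv]; simp

lemma cc_frob {m : ℝ} {w : Euc 2 → Euc 2} {p : ℝ × ℝ} (h : DifferentiableAt ℝ w (frE m p)) :
    frob (eSym w (frE m p)) (eSym w (frE m p)) =
      dx (cc1 m w) p ^ 2 + (dy (cc1 m w) p + dx (cc2 m w) p) ^ 2 / 2 + dy (cc2 m w) p ^ 2 := by
  have hc : Real.cos m ^ 2 = 1 - Real.sin m ^ 2 := by linarith [Real.sin_sq_add_cos_sq m]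
  simp only [dx, dy, cc1_fd h, cc2_fd h, comp_dx _ h, comp_dy _ h, frob, eSym, Fin.sum_univ_two,
    Matrix.smul_apply, Matrix.add_apply, Matrix.transpose_apply, smul_eq_mul]
  generalize Real.cos m = c at *
  generalize Real.sin m = s at *
  generalize gradm w (frE m p) 0 0 = a
  generalize gradm w (frE m p) 0 1 = b
  generalize gradm w (frE m p) 1 0 = d
  generalize gradm w (frE m p) 1 1 = e
  have h1 : c ^ 2 + s ^ 2 = 1 := by linarith
  have h2 : (c ^ 2 + s ^ 2) ^ 2 = 1 := by rw [h1]; ring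
  linear_combination (-(a ^ 2 + (b + d) ^ 2 / 2 + e ^ 2)) * h2

lemma cc_tr {m : ℝ} {w : Euc 2 → Euc 2} {p : ℝ × ℝ} (h : DifferentiableAt ℝ w (frE m p)) :
    Matrix.trace (eSym w (frE m p)) = dx (cc1 m w) p + dy (cc2 m w) p := by
  simp only [dx, dy, cc1_fd h, cc2_fd h, comp_dx _ h, comp_dy _ h, eSym, Matrix.trace_fin_two,
    Matrix.smul_apply, Matrix.add_apply, Matrix.transpose_apply, smul_eq_mul]
  linear_combination (-(gradm w (frE m p) 0 0 + gradm w (frE m p) 1 1)) * Real.sin_sq_add_cos_sq m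

/-- elastic density in terms of strain components -/
def QQ (lam μ a g d : ℝ) : ℝ := lam * (a + d) ^ 2 + 2 * μ * (a ^ 2 + g ^ 2 / 2 + d ^ 2)

lemma QQ_ge {lam μ : ℝ} (hμ : 0 < μ) (hl : 0 < μ + lam) (a g d : ℝ) :
    min μ (μ + lam) * (a ^ 2 + g ^ 2 + d ^ 2) ≤ QQ lam μ a g d := by
  have h1 := min_le_left μ (μ + lam)
  have h2 := min_le_right μ (μ + lam)
  have h3 : 0 < min μ (μ + lam) := lt_min hμ hl
  unfold QQ
  generalize min μ (μ + lam) = k at *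
  nlinarith [mul_le_mul_of_nonneg_right h1 (sq_nonneg (a - d)), mul_le_mul_of_nonneg_right h2 (sq_nonneg (a + d)),
    mul_le_mul_of_nonneg_right h1 (sq_nonneg g), mul_nonneg h3.le (sq_nonneg a), mul_nonneg h3.le (sq_nonneg d)]

lemma eSym_symm (w : Euc 2 → Euc 2) (x : Euc 2) : (eSym w x)ᵀ = eSym w x := by
  simp [eSym, add_comm]

lemma dens_eq {𝓒 : Mat 2 →ₗ[ℝ] Mat 2} {lam μ : ℝ}
    (hiso : ∀ ξ : Mat 2, ξᵀ = ξ → 𝓒 ξ = (lam * Matrix.trace ξ) • (1 : Mat 2) + (2 * μ) • ξ)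
    (w : Euc 2 → Euc 2) (x : Euc 2) :
    frob (𝓒 (eSym w x)) (eSym w x) = lam * Matrix.trace (eSym w x) ^ 2
      + 2 * μ * frob (eSym w x) (eSym w x) := by
  rw [hiso _ (eSym_symm w x)]
  simp only [frob, Fin.sum_univ_two, Matrix.trace_fin_two, Matrix.add_apply, Matrix.smul_apply,
    Matrix.one_apply, smul_eq_mul]
  simp; ring

lemma dens_cc {𝓒 : Mat 2 →ₗ[ℝ] Mat 2} {lam μ m : ℝ}
    (hiso : ∀ ξ : Mat 2, ξᵀ = ξ → 𝓒 ξ = (lam * Matrix.trace ξ) • (1 : Mat 2) + (2 * μ) • ξ)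
    {w : Euc 2 → Euc 2} {p : ℝ × ℝ} (h : DifferentiableAt ℝ w (frE m p)) :
    frob (𝓒 (eSym w (frE m p))) (eSym w (frE m p)) =
      QQ lam μ (dx (cc1 m w) p) (dy (cc1 m w) p + dx (cc2 m w) p) (dy (cc2 m w) p) := by
  rw [dens_eq hiso, cc_frob h, cc_tr h]; unfold QQ; ring

/-- pull back of the elastic energy -/
lemma elastic_pull {𝓒 : Mat 2 →ₗ[ℝ] Mat 2} {lam μ : ℝ} (m : ℝ)
    (hiso : ∀ ξ : Mat 2, ξᵀ = ξ → 𝓒 ξ = (lam * Matrix.trace ξ) • (1 : Mat 2) + (2 * μ) • ξ)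
    {w : Euc 2 → Euc 2} {A : Set (Euc 2)} (hA : MeasurableSet A)
    (h : ∀ x ∈ A, DifferentiableAt ℝ w x) :
    elastic 𝓒 w A = ∫⁻ p in frE m ⁻¹' A, ENNReal.ofReal
      (QQ lam μ (dx (cc1 m w) p) (dy (cc1 m w) p + dx (cc2 m w) p) (dy (cc2 m w) p)) := by
  unfold elastic
  rw [← (frE_mp m).setLIntegral_comp_preimage_emb (frE m).toHomeomorph.measurableEmbedding]
  refine setLIntegral_congr_fun ((frE m).continuous.measurable hA) fun p hp => ?_
  rw [dens_cc hiso (h _ hp)]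

end Frames

end

section
section Comp

def GoodAt (w : Euc 2 → Euc 2) (x : Euc 2) : Prop :=
  ∃ ε > (0:ℝ), (∀ y ∈ ball x ε, DifferentiableAt ℝ w y) ∧
    IntegrableOn (fun y => ‖w y‖ ^ 2 + frobNorm (gradm w y) ^ 2) (ball x ε) volume

lemma frobNorm_sq (ξ : Mat 2) : frobNorm ξ ^ 2 = ξ 0 0 ^ 2 + ξ 0 1 ^ 2 + ξ 1 0 ^ 2 + ξ 1 1 ^ 2 := by
  unfold frobNorm
  rw [Real.sq_sqrt]
  · simp only [frob, Fin.sum_univ_two]; ring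
  · simp only [frob, Fin.sum_univ_two]; nlinarith [sq_nonneg (ξ 0 0), sq_nonneg (ξ 0 1), sq_nonneg (ξ 1 0), sq_nonneg (ξ 1 1)]

lemma gradm_congr {v w : Euc 2 → Euc 2} {x : Euc 2} (h : v =ᶠ[𝓝 x] w) : gradm v x = gradm w x := by
  unfold gradm; rw [h.fderiv_eq]

lemma eSym_congr {v w : Euc 2 → Euc 2} {x : Euc 2} (h : v =ᶠ[𝓝 x] w) : eSym v x = eSym w x := by
  unfold eSym; rw [gradm_congr h]

lemma closed_of_pair {u : Euc 2 → Euc 2} {K : Set (Euc 2)} (h : AdmissiblePair univ u K) :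
    IsClosed K := by
  have := h.relClosed.2
  rw [inter_univ] at this
  exact isClosed_of_closure_subset this

lemma GoodAt.of_pair {u : Euc 2 → Euc 2} {K : Set (Euc 2)} (h : AdmissiblePair univ u K)
    {x : Euc 2} (hx : x ∉ K) : GoodAt u x := by
  obtain ⟨ε, e0, h1, h2⟩ := h.locSobolev x ⟨trivial, hx⟩
  exact ⟨ε, e0, fun y hy => h.diffOn y (h1 hy), h2⟩

lemma pair_of_good {v : Euc 2 → Euc 2} {L : Set (Euc 2)} (hL : IsClosed L)
    (h : ∀ x, x ∉ L → ∃ w, v =ᶠ[𝓝 x] w ∧ GoodAt w x) : AdmissiblePair univ v L where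
  open_amb := isOpen_univ
  relClosed := ⟨subset_univ _, by rw [inter_univ, hL.closure_eq]⟩
  diffOn x hx := by
    obtain ⟨w, h1, ε, e0, h2, -⟩ := h x hx.2
    exact h1.symm.differentiableAt_iff.1 (h2 x (mem_ball_self e0))
  locSobolev x hx := by
    obtain ⟨w, h1, ε, e0, h2, h3⟩ := h x hx.2
    have h4 : ∀ᶠ y in 𝓝 x, v y = w y ∧ y ∉ L := h1.and (hL.isOpen_compl.mem_nhds hx.2)
    obtain ⟨δ, d0, h5⟩ := Metric.eventually_nhds_iff_ball.1 h4
    refine ⟨min ε δ, lt_min e0 d0, fun y hy => ⟨trivial, (h5 y (ball_subset_ball (min_le_right _ _) hy)).2⟩, ?_⟩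
    refine (h3.mono_set (ball_subset_ball (min_le_left ε δ))).congr_fun (fun y hy => ?_) measurableSet_ball
    have hy' := ball_subset_ball (min_le_right ε δ) hy
    have : w =ᶠ[𝓝 y] v := by
      filter_upwards [isOpen_ball.mem_nhds hy'] with z hz using ((h5 z hz).1).symm
    show ‖w y‖ ^ 2 + frobNorm (gradm w y) ^ 2 = ‖v y‖ ^ 2 + frobNorm (gradm v y) ^ 2
    rw [gradm_congr this, this.self_of_nhds]

lemma gradm_meas (w : Euc 2 → Euc 2) (i j : Fin 2) : Measurable fun y => gradm w y i j := by
  have : Measurable fun y => fderiv ℝ w y (EuclideanSpace.single j (1:ℝ)) :=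
    measurable_fderiv_apply_const ℝ w _
  exact (EuclideanSpace.proj i : Euc 2 →L[ℝ] ℝ).continuous.measurable.comp this

lemma frobgrad_meas (w : Euc 2 → Euc 2) : Measurable fun y => frobNorm (gradm w y) ^ 2 := by
  simp only [frobNorm_sq]
  exact ((((gradm_meas w 0 0).pow_const 2).add ((gradm_meas w 0 1).pow_const 2)).add
    ((gradm_meas w 1 0).pow_const 2)).add ((gradm_meas w 1 1).pow_const 2)

lemma GoodAt.add_smooth {w φ : Euc 2 → Euc 2} {x : Euc 2} (h : GoodAt w x) (hφ : ContDiff ℝ 1 φ) :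
    GoodAt (fun y => w y + φ y) x := by
  obtain ⟨ε, e0, h1, h2⟩ := h
  have hd : Differentiable ℝ φ := hφ.differentiable one_ne_zero
  refine ⟨ε, e0, fun y hy => (h1 y hy).add (hd y), ?_⟩
  have hg : ∀ i j, Continuous fun y => gradm φ y i j := fun i j =>
    (EuclideanSpace.proj i : Euc 2 →L[ℝ] ℝ).continuous.comp
      ((hφ.continuous_fderiv one_ne_zero).clm_apply continuous_const)
  have c : Continuous fun y => ‖φ y‖ ^ 2 + frobNorm (gradm φ y) ^ 2 := by
    simp only [frobNorm_sq]
    have := hφ.continuous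
    have := hg 0 0; have := hg 0 1; have := hg 1 0; have := hg 1 1
    fun_prop
  have h3 : IntegrableOn (fun y => ‖φ y‖ ^ 2 + frobNorm (gradm φ y) ^ 2) (ball x ε) volume :=
    (c.continuousOn.integrableOn_compact (isCompact_closedBall x ε)).mono_set ball_subset_closedBall
  refine Integrable.mono' ((h2.const_mul 2).add (h3.const_mul 2)) ?_ ?_
  · refine AEStronglyMeasurable.add ?_ (frobgrad_meas _).aestronglyMeasurable
    have : ContinuousOn (fun y => ‖w y + φ y‖ ^ 2) (ball x ε) := fun y hy =>
      (((h1 y hy).add (hd y)).continuousAt.norm.pow 2).continuousWithinAt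
    exact this.aestronglyMeasurable measurableSet_ball
  · filter_upwards [ae_restrict_mem measurableSet_ball] with y hy
    have g : ∀ i j, gradm (fun y => w y + φ y) y i j = gradm w y i j + gradm φ y i j := by
      intro i j
      unfold gradm
      rw [fderiv_fun_add (h1 y hy) (hd y)]; simp
    rw [Real.norm_of_nonneg (by positivity)]
    simp only [Pi.add_apply, frobNorm_sq, g]
    have n : ‖w y + φ y‖ ^ 2 ≤ 2 * ‖w y‖ ^ 2 + 2 * ‖φ y‖ ^ 2 := by
      have := norm_add_le (w y) (φ y)
      nlinarith [norm_nonneg (w y + φ y), sq_nonneg (‖w y‖ - ‖φ y‖), norm_nonneg (w y), norm_nonneg (φ y)]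
    nlinarith [sq_nonneg (gradm w y 0 0 - gradm φ y 0 0), sq_nonneg (gradm w y 0 1 - gradm φ y 0 1),
      sq_nonneg (gradm w y 1 0 - gradm φ y 1 0), sq_nonneg (gradm w y 1 1 - gradm φ y 1 1)]

lemma GoodAt.smooth {φ : Euc 2 → Euc 2} {x : Euc 2} (hφ : ContDiff ℝ 1 φ) : GoodAt φ x := by
  have : GoodAt (fun _ => 0) x := ⟨1, one_pos, fun y _ => differentiableAt_const _, by
    have : (fun y : Euc 2 => ‖(0 : Euc 2)‖ ^ 2 + frobNorm (gradm (fun _ => (0 : Euc 2)) y) ^ 2) = fun _ => 0 := by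
      ext y; simp [frobNorm_sq, gradm]
    rw [this]; exact integrableOn_zero⟩
  simpa using this.add_smooth hφ

lemma polar (x : Euc 2) : ∃ θ ∈ Ioc (-Real.pi) Real.pi,
    x 0 = ‖x‖ * Real.cos θ ∧ x 1 = ‖x‖ * Real.sin θ := by
  let z : ℂ := ⟨x 0, x 1⟩
  have hz : ‖z‖ = ‖x‖ := by
    have : ‖z‖ ^ 2 = ‖x‖ ^ 2 := by
      rw [norm_sq_euc, Complex.sq_norm, Complex.normSq_apply]; ring
    exact (sq_eq_sq₀ (norm_nonneg _) (norm_nonneg _)).1 this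
  refine ⟨z.arg, z.arg_mem_Ioc, ?_, ?_⟩
  · rw [← hz, Complex.norm_mul_cos_arg]
  · rw [← hz, Complex.norm_mul_sin_arg]

/-- unit vector with angle θ -/
def dir (θ : ℝ) : Euc 2 := !₂[Real.cos θ, Real.sin θ]

@[simp] lemma dir_0 (θ : ℝ) : dir θ 0 = Real.cos θ := by simp [dir]
@[simp] lemma dir_1 (θ : ℝ) : dir θ 1 = Real.sin θ := by simp [dir]

lemma dir_norm (θ : ℝ) : ‖dir θ‖ = 1 := by
  have : ‖dir θ‖ ^ 2 = 1 ^ 2 := by rw [norm_sq_euc]; simp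
  exact (sq_eq_sq₀ (norm_nonneg _) zero_le_one).1 this

lemma dir_lip : LipschitzWith 2 dir := by
  refine LipschitzWith.of_dist_le_mul fun a b => ?_
  rw [dist_eq_norm, Real.dist_eq]
  have e1 := Real.abs_cos_sub_cos_le a b
  have e2 := Real.abs_sin_sub_sin_le a b
  refine abs_le_of_sq_le_sq' ?_ (by positivity) |>.2
  rw [norm_sq_euc]
  simp only [PiLp.sub_apply, dir_0, dir_1]
  have e1' := sq_le_sq' (neg_le_of_abs_le e1) (le_of_abs_le e1)
  have e2' := sq_le_sq' (neg_le_of_abs_le e2) (le_of_abs_le e2)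
  rw [mul_pow]; norm_num
  nlinarith [abs_nonneg (a - b), sq_abs (a-b), sq_nonneg (a - b)]

lemma polar_dir (x : Euc 2) : ∃ θ ∈ Ioc (-Real.pi) Real.pi, x = ‖x‖ • dir θ := by
  obtain ⟨θ, h, h0, h1⟩ := polar x
  refine ⟨θ, h, ?_⟩
  ext i; fin_cases i
  · simpa using h0
  · simpa using h1

lemma Hm_eq : Hm 2 = (μH[1] : Measure (Euc 2)) := by
  unfold Hm; norm_num

lemma Hm_sphere {R : ℝ} (hR : 0 < R) : Hm 2 (sphere (0 : Euc 2) R) ≤ ENNReal.ofReal (4 * Real.pi * R) := by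
  have h1 : sphere (0 : Euc 2) R ⊆ (fun θ => R • dir θ) '' Ioc (-Real.pi) Real.pi := by
    intro x hx
    obtain ⟨θ, h, e⟩ := polar_dir x
    rw [mem_sphere_zero_iff_norm.1 hx] at e
    exact ⟨θ, h, e.symm⟩
  have lip : LipschitzWith (R.toNNReal * 2) (fun θ => R • dir θ) := by
    refine LipschitzWith.of_dist_le_mul fun a b => ?_
    rw [dist_smul₀]
    have := dir_lip.dist_le_mul a b
    rw [Real.norm_of_nonneg hR.le]
    rw [NNReal.coe_mul, Real.coe_toNNReal _ hR.le, mul_assoc]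
    exact mul_le_mul_of_nonneg_left this hR.le
  rw [Hm_eq]
  refine (measure_mono h1).trans ((lip.hausdorffMeasure_image_le zero_le_one _).trans ?_)
  rw [hausdorffMeasure_real, Real.volume_Ioc, ENNReal.rpow_one, show ((R.toNNReal * 2 : NNReal) : ℝ≥0∞) = ENNReal.ofReal (R * 2) from ?_, ← ENNReal.ofReal_mul (by positivity)]
  · apply le_of_eq; congr 1; ring
  · rw [ENNReal.ofReal_mul hR.le]; simp [ENNReal.ofReal]

end Comp

end

section
section EnergyBound

lemma frobNorm_sq' (ξ : Mat 2) : frobNorm ξ ^ 2 = frob ξ ξ := by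
  rw [frobNorm_sq]; simp only [frob, Fin.sum_univ_two]; ring

lemma dens_le {𝓒 : Mat 2 →ₗ[ℝ] Mat 2} {lam μ : ℝ}
    (hiso : ∀ ξ : Mat 2, ξᵀ = ξ → 𝓒 ξ = (lam * Matrix.trace ξ) • (1 : Mat 2) + (2 * μ) • ξ)
    (w : Euc 2 → Euc 2) (x : Euc 2) :
    frob (𝓒 (eSym w x)) (eSym w x) ≤ (2 * |lam| + 2 * |μ|) * frobNorm (eSym w x) ^ 2 := by
  rw [dens_eq hiso, ← frobNorm_sq', add_mul]
  have h1 : Matrix.trace (eSym w x) ^ 2 ≤ 2 * frobNorm (eSym w x) ^ 2 := by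
    rw [frobNorm_sq, Matrix.trace_fin_two]
    nlinarith [sq_nonneg (eSym w x 0 0 - eSym w x 1 1), sq_nonneg (eSym w x 0 1), sq_nonneg (eSym w x 1 0)]
  have h2 := mul_le_mul_of_nonneg_right (le_abs_self lam) (sq_nonneg (Matrix.trace (eSym w x)))
  have h3 := mul_le_mul_of_nonneg_right (le_abs_self μ) (sq_nonneg (frobNorm (eSym w x)))
  nlinarith [abs_nonneg lam, abs_nonneg μ]

lemma elastic_fin {𝓒 : Mat 2 →ₗ[ℝ] Mat 2} {lam μ : ℝ}
    (hiso : ∀ ξ : Mat 2, ξᵀ = ξ → 𝓒 ξ = (lam * Matrix.trace ξ) • (1 : Mat 2) + (2 * μ) • ξ)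
    {u : Euc 2 → Euc 2} {K : Set (Euc 2)} (hmin : GlobalMin 𝓒 u K) (x : Euc 2) {r : ℝ} (hr : 0 < r) :
    elastic 𝓒 u (ball x r \ K) ≠ ⊤ := by
  have h := hmin.locFin x r hr (subset_univ _)
  have h1 := (ENNReal.add_lt_top.1 h).1
  have h2 : elastic 𝓒 u (ball x r \ K) ≤ ENNReal.ofReal (2 * |lam| + 2 * |μ|) *
      ∫⁻ y in ball x r \ K, ENNReal.ofReal (frobNorm (eSym u y) ^ 2) := by
    rw [← lintegral_const_mul' _ _ ENNReal.ofReal_ne_top]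
    refine lintegral_mono fun y => ?_
    rw [← ENNReal.ofReal_mul (by positivity)]
    exact ENNReal.ofReal_le_ofReal (dens_le hiso u y)
  exact (h2.trans_lt (ENNReal.mul_lt_top ENNReal.ofReal_lt_top h1)).ne

lemma Hm_fin {𝓒 : Mat 2 →ₗ[ℝ] Mat 2}
    {u : Euc 2 → Euc 2} {K : Set (Euc 2)} (hmin : GlobalMin 𝓒 u K) (x : Euc 2) {r : ℝ} (hr : 0 < r) :
    Hm 2 (K ∩ ball x r) ≠ ⊤ :=
  (ENNReal.add_lt_top.1 (hmin.locFin x r hr (subset_univ _))).2.ne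

lemma elastic_congr {𝓒 : Mat 2 →ₗ[ℝ] Mat 2} {v w : Euc 2 → Euc 2} {A : Set (Euc 2)}
    (hA : MeasurableSet A) (h : ∀ x ∈ A, v =ᶠ[𝓝 x] w) : elastic 𝓒 v A = elastic 𝓒 w A := by
  refine setLIntegral_congr_fun hA fun x hx => ?_
  rw [eSym_congr (h x hx)]

lemma elastic_union {𝓒 : Mat 2 →ₗ[ℝ] Mat 2} {v : Euc 2 → Euc 2} {A B : Set (Euc 2)}
    (hB : MeasurableSet B) (h : Disjoint A B) :
    elastic 𝓒 v (A ∪ B) = elastic 𝓒 v A + elastic 𝓒 v B :=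
  lintegral_union hB h

lemma sep_of_subset {K L B : Set (Euc 2)} (h : K ⊆ L) : KeepsSeparation univ K B L := by
  intro x hx y hy hn hc
  exact hn (connectedComponentIn_mono x (diff_subset_diff_right h) hc)

lemma eSym_zero (x : Euc 2) : eSym (fun _ : Euc 2 => (0 : Euc 2)) x = 0 := by
  ext i j; simp [eSym, gradm]

lemma elastic_zero_of {𝓒 : Mat 2 →ₗ[ℝ] Mat 2} {v : Euc 2 → Euc 2} {A : Set (Euc 2)}
    (hA : MeasurableSet A) (h : ∀ᵐ x, x ∈ A → eSym v x = 0) : elastic 𝓒 v A = 0 := by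
  unfold elastic
  rw [setLIntegral_congr_fun_ae hA (g := fun _ => 0), lintegral_zero]
  filter_upwards [h] with x hx hxA
  simp [hx hxA, frob]

lemma energy_bound {𝓒 : Mat 2 →ₗ[ℝ] Mat 2} {lam μ : ℝ}
    (hiso : ∀ ξ : Mat 2, ξᵀ = ξ → 𝓒 ξ = (lam * Matrix.trace ξ) • (1 : Mat 2) + (2 * μ) • ξ)
    {u : Euc 2 → Euc 2} {K : Set (Euc 2)} (hmin : GlobalMin 𝓒 u K) (h0 : (0 : Euc 2) ∈ K)
    {R : ℝ} (hR : 0 < R) :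
    elastic 𝓒 u (ball 0 R \ K) ≤ ENNReal.ofReal (4 * Real.pi * R) := by
  classical
  have hK := closed_of_pair hmin.pair
  set L := K ∪ sphere (0 : Euc 2) R with hLdef
  have hL : IsClosed L := hK.union isClosed_sphere
  set v : Euc 2 → Euc 2 := fun x => if ‖x‖ < R then 0 else u x with hv
  have hv1 : ∀ x ∈ ball (0 : Euc 2) R, v =ᶠ[𝓝 x] fun _ => 0 := by
    intro x hx
    filter_upwards [isOpen_ball.mem_nhds hx] with y hy
    simp [hv, mem_ball_zero_iff.1 hy]
  have hv2 : ∀ x ∈ (closedBall (0 : Euc 2) R)ᶜ, v =ᶠ[𝓝 x] u := by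
    intro x hx
    filter_upwards [isClosed_closedBall.isOpen_compl.mem_nhds hx] with y hy
    have : R < ‖y‖ := by simpa using hy
    simp [hv, this.le]
  have tri : ∀ x, x ∉ sphere (0 : Euc 2) R → x ∈ ball (0 : Euc 2) R ∨ x ∈ (closedBall (0 : Euc 2) R)ᶜ := by
    intro x hx
    simp only [mem_sphere_zero_iff_norm, mem_ball_zero_iff, mem_compl_iff, mem_closedBall_zero_iff, not_le] at *
    exact lt_or_gt_of_ne hx
  have pair : AdmissiblePair univ v L := by
    refine pair_of_good hL fun x hx => ?_
    rw [hLdef, mem_union, not_or] at hx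
    rcases tri x hx.2 with h | h
    · exact ⟨_, hv1 x h, GoodAt.smooth contDiff_const⟩
    · exact ⟨_, hv2 x h, GoodAt.of_pair hmin.pair hx.1⟩
  have top : TopCompetitor univ u K (ball 0 (R + 1)) v L := by
    refine ⟨⟨pair, ?_, ae_of_all _ fun x hx => ?_⟩, sep_of_subset subset_union_left⟩
    · rw [hLdef, union_diff_distrib, union_eq_left]
      intro x hx
      exfalso; apply hx.2
      rw [mem_ball_zero_iff, mem_sphere_zero_iff_norm.1 hx.1]; linarith
    · have : ¬ ‖x‖ < R := by
        intro h; apply hx.2; right; rw [mem_ball_zero_iff]; linarith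
      simp [hv, this]
  have key := hmin.minimality 0 h0 (R + 1) (by linarith) v L top
  set B := ball (0 : Euc 2) (R + 1)
  have e1 : elastic 𝓒 u (B \ K) = elastic 𝓒 u (ball 0 R \ K) + elastic 𝓒 u ((B \ ball 0 R) \ K) := by
    rw [← elastic_union ((measurableSet_ball.diff measurableSet_ball).diff hK.measurableSet)]
    · congr 1
      have : ball (0 : Euc 2) R ⊆ B := ball_subset_ball (by linarith)
      rw [← union_diff_distrib, union_diff_cancel this]
    · rw [Set.disjoint_left]; intro x hx hx2; exact hx2.1.2 hx.1
  have e2 : elastic 𝓒 v (B \ L) ≤ elastic 𝓒 u ((B \ ball 0 R) \ K) := by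
    have sp : B \ L ⊆ (ball 0 R \ L) ∪ ((B \ closedBall 0 R) \ K) := by
      intro x hx
      rcases tri x (fun h => hx.2 (Or.inr h)) with h | h
      · exact Or.inl ⟨h, hx.2⟩
      · exact Or.inr ⟨⟨hx.1, h⟩, fun h => hx.2 (Or.inl h)⟩
    have m2 : MeasurableSet ((B \ closedBall (0 : Euc 2) R) \ K) :=
      (measurableSet_ball.diff measurableSet_closedBall).diff hK.measurableSet
    calc elastic 𝓒 v (B \ L) ≤ elastic 𝓒 v ((ball 0 R \ L) ∪ ((B \ closedBall 0 R) \ K)) :=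
          lintegral_mono_set sp
      _ = elastic 𝓒 v (ball 0 R \ L) + elastic 𝓒 v ((B \ closedBall 0 R) \ K) := by
          refine elastic_union m2 ?_
          rw [Set.disjoint_left]; intro x hx hx2
          exact hx2.1.2 (ball_subset_closedBall hx.1)
      _ = 0 + elastic 𝓒 u ((B \ closedBall 0 R) \ K) := by
          congr 1
          · refine elastic_zero_of (measurableSet_ball.diff hL.measurableSet) (ae_of_all _ fun x hx => ?_)
            rw [eSym_congr (hv1 x hx.1), eSym_zero]
          · exact elastic_congr m2 fun x hx => hv2 x hx.1.2
      _ ≤ _ := by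
          rw [zero_add]
          exact lintegral_mono_set (diff_subset_diff_left (diff_subset_diff_right ball_subset_closedBall))
  have e3 : Hm 2 (L ∩ B) ≤ Hm 2 (K ∩ B) + Hm 2 (sphere 0 R) := by
    rw [hLdef, union_inter_distrib_right]
    exact (measure_union_le _ _).trans (by gcongr; exact inter_subset_left)
  have f1 := Hm_fin hmin 0 (show 0 < R + 1 by linarith)
  have f2 : elastic 𝓒 u ((B \ ball 0 R) \ K) ≠ ⊤ :=
    ne_top_of_le_ne_top (elastic_fin hiso hmin 0 (show 0 < R + 1 by linarith))
      (lintegral_mono_set (diff_subset_diff_left diff_subset))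
  refine le_trans ?_ (Hm_sphere hR)
  have k2 : elastic 𝓒 u (ball 0 R \ K) + (elastic 𝓒 u ((B \ ball 0 R) \ K) + Hm 2 (K ∩ B)) ≤
      Hm 2 (sphere 0 R) + (elastic 𝓒 u ((B \ ball 0 R) \ K) + Hm 2 (K ∩ B)) := by
    calc _ = elastic 𝓒 u (B \ K) + Hm 2 (K ∩ B) := by rw [e1, add_assoc]
      _ ≤ _ := key
      _ ≤ elastic 𝓒 u ((B \ ball 0 R) \ K) + (Hm 2 (K ∩ B) + Hm 2 (sphere 0 R)) := add_le_add e2 e3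
      _ = _ := by ring
  exact (ENNReal.add_le_add_iff_right (ENNReal.add_ne_top.2 ⟨f2, f1⟩)).1 k2

end EnergyBound

end

section
section EL

lemma var_zero {α : Type*} [MeasurableSpace α] {ν : Measure α} {lam μ : ℝ} (hμ : 0 < μ) (hl : 0 < μ + lam)
    {a g d a' g' d' : α → ℝ} (ma : Measurable a) (mg : Measurable g) (md : Measurable d)
    (la : MemLp a' 2 ν) (lg : MemLp g' 2 ν) (ld : MemLp d' 2 ν)
    (hf : ∫⁻ x, ENNReal.ofReal (QQ lam μ (a x) (g x) (d x)) ∂ν ≠ ⊤)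
    (hmin : ∀ s : ℝ, ∫⁻ x, ENNReal.ofReal (QQ lam μ (a x) (g x) (d x)) ∂ν ≤
      ∫⁻ x, ENNReal.ofReal (QQ lam μ (a x + s * a' x) (g x + s * g' x) (d x + s * d' x)) ∂ν) :
    ∫ x, ((lam * (a x + d x) + 2 * μ * a x) * a' x + μ * g x * g' x
      + (lam * (a x + d x) + 2 * μ * d x) * d' x) ∂ν = 0 := by
  have k0 : 0 < min μ (μ + lam) := lt_min hμ hl
  have nn : ∀ x y z, 0 ≤ QQ lam μ x y z := fun x y z =>
    le_trans (by positivity) (QQ_ge hμ hl x y z)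
  have mQ : Measurable fun x => QQ lam μ (a x) (g x) (d x) := by
    unfold QQ; fun_prop
  have iQ : Integrable (fun x => QQ lam μ (a x) (g x) (d x)) ν := by
    refine ⟨mQ.aestronglyMeasurable, ?_⟩
    rw [hasFiniteIntegral_iff_ofReal (ae_of_all _ fun x => nn _ _ _)]
    exact lt_top_iff_ne_top.2 hf
  have l2 : ∀ f : α → ℝ, Measurable f → (∀ x, min μ (μ + lam) * f x ^ 2 ≤ QQ lam μ (a x) (g x) (d x)) → MemLp f 2 ν := by
    intro f mf h
    rw [memLp_two_iff_integrable_sq mf.aestronglyMeasurable]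
    refine (iQ.const_mul (min μ (μ + lam))⁻¹).mono' (mf.pow_const 2).aestronglyMeasurable (ae_of_all _ fun x => ?_)
    rw [Real.norm_of_nonneg (sq_nonneg _), ← div_eq_inv_mul, le_div_iff₀ k0, mul_comm]
    exact h x
  have La := l2 a ma fun x => by nlinarith [QQ_ge hμ hl (a x) (g x) (d x), mul_nonneg k0.le (sq_nonneg (d x)), mul_nonneg k0.le (sq_nonneg (g x))]
  have Lg := l2 g mg fun x => by nlinarith [QQ_ge hμ hl (a x) (g x) (d x), mul_nonneg k0.le (sq_nonneg (d x)), mul_nonneg k0.le (sq_nonneg (a x))]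
  have Ld := l2 d md fun x => by nlinarith [QQ_ge hμ hl (a x) (g x) (d x), mul_nonneg k0.le (sq_nonneg (a x)), mul_nonneg k0.le (sq_nonneg (g x))]
  have iB : Integrable (fun x => (lam * (a x + d x) + 2 * μ * a x) * a' x + μ * g x * g' x
      + (lam * (a x + d x) + 2 * μ * d x) * d' x) ν := by
    have e1 := ((La.add Ld).const_mul lam).add (La.const_mul (2 * μ))
    have e2 := ((La.add Ld).const_mul lam).add (Ld.const_mul (2 * μ))
    have e3 := Lg.const_mul μ
    exact ((e1.integrable_mul la).add (e3.integrable_mul lg)).add (e2.integrable_mul ld)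
  have iQ' : Integrable (fun x => QQ lam μ (a' x) (g' x) (d' x)) ν := by
    have e1 := ((la.add ld).integrable_sq).const_mul lam
    have e2 := ((la.integrable_sq.add (lg.integrable_sq.div_const 2)).add ld.integrable_sq).const_mul (2 * μ)
    exact e1.add e2
  set b := ∫ x, ((lam * (a x + d x) + 2 * μ * a x) * a' x + μ * g x * g' x
      + (lam * (a x + d x) + 2 * μ * d x) * d' x) ∂ν with hb
  set q := ∫ x, QQ lam μ (a' x) (g' x) (d' x) ∂ν with hq
  have q0 : 0 ≤ q := integral_nonneg fun x => nn _ _ _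
  have key : ∀ s : ℝ, 0 ≤ 2 * s * b + s ^ 2 * q := by
    intro s
    have ex : (fun x => QQ lam μ (a x + s * a' x) (g x + s * g' x) (d x + s * d' x)) =
        fun x => QQ lam μ (a x) (g x) (d x) + ((2 * s) * ((lam * (a x + d x) + 2 * μ * a x) * a' x + μ * g x * g' x
      + (lam * (a x + d x) + 2 * μ * d x) * d' x) + s ^ 2 * QQ lam μ (a' x) (g' x) (d' x)) := by
      ext x; unfold QQ; ring
    have iS := iQ.add ((iB.const_mul (2 * s)).add (iQ'.const_mul (s ^ 2)))
    have iS' : Integrable (fun x => QQ lam μ (a x + s * a' x) (g x + s * g' x) (d x + s * d' x)) ν := by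
      rw [ex]; exact iS
    have h := hmin s
    rw [← ofReal_integral_eq_lintegral_ofReal iQ (ae_of_all _ fun x => nn _ _ _),
      ← ofReal_integral_eq_lintegral_ofReal iS' (ae_of_all _ fun x => nn _ _ _),
      ENNReal.ofReal_le_ofReal_iff (integral_nonneg fun x => nn _ _ _), ex,
      integral_add iQ (g := fun x => (2 * s) * ((lam * (a x + d x) + 2 * μ * a x) * a' x + μ * g x * g' x
      + (lam * (a x + d x) + 2 * μ * d x) * d' x) + s ^ 2 * QQ lam μ (a' x) (g' x) (d' x))
        ((iB.const_mul (2 * s)).add (iQ'.const_mul (s ^ 2))),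
      integral_add (iB.const_mul (2 * s)) (iQ'.const_mul (s ^ 2)),
      integral_const_mul, integral_const_mul] at h
    linarith
  have h := key (-b / (q + 1))
  have q1 : 0 < q + 1 := by linarith
  have e : 2 * (-b / (q + 1)) * b + (-b / (q + 1)) ^ 2 * q = -(b ^ 2 * (q + 2)) / (q + 1) ^ 2 := by
    field_simp; ring
  rw [e, le_div_iff₀ (by positivity), zero_mul] at h
  have : b ^ 2 = 0 := by nlinarith [sq_nonneg b]
  exact pow_eq_zero_iff (two_ne_zero) |>.1 this

/-- rotated sector -/
def Sct (m om : ℝ) : Set (Euc 2) := {x | (frE m).symm x ∈ Sec om}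

lemma isOpen_Sct (m om : ℝ) : IsOpen (Sct m om) := (isOpen_Sec om).preimage (frE m).symm.continuous

lemma frE_mem_Sct {m om : ℝ} {p : ℝ × ℝ} : frE m p ∈ Sct m om ↔ p ∈ Sec om := by
  simp [Sct]

lemma abs_le_one_add_sq (t : ℝ) : |t| ≤ 1 + t ^ 2 := by
  rw [← sq_abs]; nlinarith [sq_nonneg (|t| - 1), abs_nonneg t]

lemma locint_of_bound {u : Euc 2 → Euc 2} {K : Set (Euc 2)} (h : AdmissiblePair univ u K) {m om : ℝ}
    (hS : Sct m om ⊆ Kᶜ) {f : ℝ × ℝ → ℝ} (mf : Measurable f)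
    (hf : ∀ p ∈ Sec om, |f p| ≤ 4 + frobNorm (gradm u (frE m p)) ^ 2) :
    LocallyIntegrableOn f (Sec om) := by
  intro p hp
  obtain ⟨ε, e0, h1, h2⟩ := h.locSobolev (frE m p) ⟨trivial, hS (frE_mem_Sct.2 hp)⟩
  refine ⟨(frE m ⁻¹' ball (frE m p) ε) ∩ Sec om, ?_, ?_⟩
  · rw [inter_comm]; exact inter_mem_nhdsWithin _ ((frE m).continuous.continuousAt.preimage_mem_nhds (ball_mem_nhds _ e0))
  · have i1 : IntegrableOn (fun y => frobNorm (gradm u y) ^ 2) (ball (frE m p) ε) := by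
      refine Integrable.mono' h2 (frobgrad_meas u).aestronglyMeasurable (ae_of_all _ fun y => ?_)
      rw [Real.norm_of_nonneg (sq_nonneg _)]; nlinarith [sq_nonneg ‖u y‖]
    have i2 : IntegrableOn (fun y => 4 + frobNorm (gradm u y) ^ 2) (ball (frE m p) ε) :=
      (integrableOn_const (by exact measure_ball_lt_top.ne)).add i1
    have i3 := ((frE_mp m).integrableOn_comp_preimage (frE m).toHomeomorph.measurableEmbedding).2 i2
    have ms : MeasurableSet ((frE m ⁻¹' ball (frE m p) ε) ∩ Sec om) :=
      ((frE m).continuous.measurable measurableSet_ball).inter (isOpen_Sec om).measurableSet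
    refine Integrable.mono' (i3.mono_set inter_subset_left) mf.aestronglyMeasurable ?_
    filter_upwards [ae_restrict_mem ms] with q hq
    exact hf q hq.2

lemma bd4 {c s a b d e : ℝ} (hc : |c| ≤ 1) (hs : |s| ≤ 1) {k1 k2 k3 k4 : ℝ}
    (h1 : |k1| ≤ 1) (h2 : |k2| ≤ 1) (h3 : |k3| ≤ 1) (h4 : |k4| ≤ 1) :
    |c * (k1 * a + k2 * b) + s * (k3 * d + k4 * e)| ≤ 4 + (a ^ 2 + b ^ 2 + d ^ 2 + e ^ 2) := by
  have m1 : ∀ k t : ℝ, |k| ≤ 1 → |k * t| ≤ |t| := fun k t h => by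
    rw [abs_mul]; nlinarith [abs_nonneg t]
  have t1 := abs_add_le (c * (k1 * a + k2 * b)) (s * (k3 * d + k4 * e))
  have t2 := m1 c (k1 * a + k2 * b) hc
  have t3 := m1 s (k3 * d + k4 * e) hs
  have t4 := abs_add_le (k1 * a) (k2 * b)
  have t5 := abs_add_le (k3 * d) (k4 * e)
  have := m1 k1 a h1
  have := m1 k2 b h2
  have := m1 k3 d h3
  have := m1 k4 e h4
  have := abs_le_one_add_sq a
  have := abs_le_one_add_sq b
  have := abs_le_one_add_sq d
  have := abs_le_one_add_sq e
  linarith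

lemma disp_cc {u : Euc 2 → Euc 2} {K : Set (Euc 2)} (h : AdmissiblePair univ u K) {m om : ℝ}
    (hS : Sct m om ⊆ Kᶜ) : Disp om (cc1 m u) ∧ Disp om (cc2 m u) := by
  have hd : ∀ p ∈ Sec om, DifferentiableAt ℝ u (frE m p) := fun p hp =>
    h.diffOn _ ⟨trivial, hS (frE_mem_Sct.2 hp)⟩
  have hc := Real.abs_cos_le_one m
  have hs := Real.abs_sin_le_one m
  have hs' : |-Real.sin m| ≤ 1 := by rwa [abs_neg]
  refine ⟨⟨fun p hp => cc1_diff (hd p hp), ?_, ?_, ?_⟩, ⟨fun p hp => cc2_diff (hd p hp), ?_, ?_, ?_⟩⟩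
  · exact ContinuousOn.locallyIntegrableOn (fun p hp => (cc1_diff (hd p hp)).continuousAt.continuousWithinAt) (isOpen_Sec om).measurableSet
  · refine locint_of_bound h hS (meas_dx _) fun p hp => ?_
    rw [dx, cc1_fd (hd p hp), comp_dx _ (hd p hp), comp_dx _ (hd p hp), frobNorm_sq]
    exact bd4 hc hs hc hs hc hs
  · refine locint_of_bound h hS (meas_dy _) fun p hp => ?_
    rw [dy, cc1_fd (hd p hp), comp_dy _ (hd p hp), comp_dy _ (hd p hp), frobNorm_sq]
    exact bd4 hc hs hs' hc hs' hc
  · exact ContinuousOn.locallyIntegrableOn (fun p hp => (cc2_diff (hd p hp)).continuousAt.continuousWithinAt) (isOpen_Sec om).measurableSet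
  · refine locint_of_bound h hS (meas_dx _) fun p hp => ?_
    rw [dx, cc2_fd (hd p hp), comp_dx _ (hd p hp), comp_dx _ (hd p hp), frobNorm_sq]
    exact bd4 hs' hc hc hs hc hs
  · refine locint_of_bound h hS (meas_dy _) fun p hp => ?_
    rw [dy, cc2_fd (hd p hp), comp_dy _ (hd p hp), comp_dy _ (hd p hp), frobNorm_sq]
    exact bd4 hs' hc hs' hc hs' hc

end EL

end

section
section Apply

lemma dx_out {g : ℝ × ℝ → ℝ} {p : ℝ × ℝ} (h : p ∉ tsupport g) : dx g p = 0 := by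
  unfold dx; rw [fderiv_of_notMem_tsupport ℝ h]; rfl
lemma dy_out {g : ℝ × ℝ → ℝ} {p : ℝ × ℝ} (h : p ∉ tsupport g) : dy g p = 0 := by
  unfold dy; rw [fderiv_of_notMem_tsupport ℝ h]; rfl

variable {𝓒 : Mat 2 →ₗ[ℝ] Mat 2} {lam μ : ℝ}

/-- test field -/
def tf (m : ℝ) (g1 g2 : ℝ × ℝ → ℝ) (x : Euc 2) : Euc 2 :=
  frE m (g1 ((frE m).symm x), g2 ((frE m).symm x))

lemma tf_smooth {m : ℝ} {g1 g2 : ℝ × ℝ → ℝ} (h1 : Sm g1) (h2 : Sm g2) : ContDiff ℝ 1 (tf m g1 g2) := by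
  have h1' : ContDiff ℝ 1 g1 := h1.of_le (by exact_mod_cast le_top)
  have h2' : ContDiff ℝ 1 g2 := h2.of_le (by exact_mod_cast le_top)
  exact (frE m).contDiff.comp ((h1'.comp (frE m).symm.contDiff).prodMk (h2'.comp (frE m).symm.contDiff))

lemma cc1_add_tf {m s : ℝ} {g1 g2 : ℝ × ℝ → ℝ} (u : Euc 2 → Euc 2) :
    cc1 m (fun x => u x + s • tf m g1 g2 x) = fun p => cc1 m u p + s * g1 p := by
  ext p
  simp only [cc1, tf, PiLp.add_apply, PiLp.smul_apply, smul_eq_mul, frE_0, frE_1,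
    ContinuousLinearEquiv.symm_apply_apply]
  linear_combination (s * g1 p) * Real.sin_sq_add_cos_sq m

lemma cc2_add_tf {m s : ℝ} {g1 g2 : ℝ × ℝ → ℝ} (u : Euc 2 → Euc 2) :
    cc2 m (fun x => u x + s • tf m g1 g2 x) = fun p => cc2 m u p + s * g2 p := by
  ext p
  simp only [cc2, tf, PiLp.add_apply, PiLp.smul_apply, smul_eq_mul, frE_0, frE_1,
    ContinuousLinearEquiv.symm_apply_apply]
  linear_combination (s * g2 p) * Real.sin_sq_add_cos_sq m

lemma d_add {c g : ℝ × ℝ → ℝ} {p z : ℝ × ℝ} {s : ℝ} (hc : DifferentiableAt ℝ c p) (hg : DifferentiableAt ℝ g p) :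
    fderiv ℝ (fun p => c p + s * g p) p z = fderiv ℝ c p z + s * fderiv ℝ g p z := by
  rw [fderiv_fun_add hc (hg.const_mul s), fderiv_const_mul hg s]; simp

lemma min_sector
    (hiso : ∀ ξ : Mat 2, ξᵀ = ξ → 𝓒 ξ = (lam * Matrix.trace ξ) • (1 : Mat 2) + (2 * μ) • ξ)
    {u : Euc 2 → Euc 2} {K : Set (Euc 2)} (hmin : GlobalMin 𝓒 u K) (h0 : (0 : Euc 2) ∈ K)
    {S : Set (Euc 2)} (oS : IsOpen S) (hS : S ⊆ Kᶜ) (hcl : closure S ⊆ S ∪ K)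
    {φ : Euc 2 → Euc 2} (hφ : ContDiff ℝ 1 φ) {r : ℝ} (hr : 0 < r) (hs : ∀ x, x ∉ ball (0 : Euc 2) r → φ x = 0) :
    elastic 𝓒 u (ball 0 r ∩ S) ≤ elastic 𝓒 (fun x => u x + φ x) (ball 0 r ∩ S) := by
  classical
  have hK := closed_of_pair hmin.pair
  set v : Euc 2 → Euc 2 := fun x => if x ∈ S then u x + φ x else u x with hv
  have v1 : ∀ x ∈ S, v =ᶠ[𝓝 x] fun x => u x + φ x := by
    intro x hx
    filter_upwards [oS.mem_nhds hx] with y hy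
    simp [hv, hy]
  have v2 : ∀ x, x ∉ S → x ∉ K → v =ᶠ[𝓝 x] u := by
    intro x hx hxK
    have : x ∉ closure S := fun h => (hcl h).elim hx hxK
    filter_upwards [isClosed_closure.isOpen_compl.mem_nhds this] with y hy
    have : y ∉ S := fun h => hy (subset_closure h)
    simp [hv, this]
  have top : TopCompetitor univ u K (ball 0 r) v K := by
    refine ⟨⟨pair_of_good hK fun x hx => ?_, rfl, ae_of_all _ fun x hx => ?_⟩, sep_of_subset subset_rfl⟩
    · by_cases h : x ∈ S
      · exact ⟨_, v1 x h, (GoodAt.of_pair hmin.pair hx).add_smooth hφ⟩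
      · exact ⟨_, v2 x h hx, GoodAt.of_pair hmin.pair hx⟩
    · have : φ x = 0 := hs x fun h => hx.2 (Or.inr h)
      simp [hv, this]
  have key := hmin.minimality 0 h0 r hr v K top
  rw [ENNReal.add_le_add_iff_right (Hm_fin hmin 0 hr)] at key
  have sp : ball (0 : Euc 2) r \ K = (ball 0 r ∩ S) ∪ ((ball 0 r \ K) \ S) := by
    ext x
    have := @hS x
    simp only [mem_diff, mem_union, mem_inter_iff, mem_compl_iff] at *
    tauto
  have m2 : MeasurableSet ((ball (0 : Euc 2) r \ K) \ S) :=
    (measurableSet_ball.diff hK.measurableSet).diff oS.measurableSet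
  have dj : Disjoint (ball (0 : Euc 2) r ∩ S) ((ball 0 r \ K) \ S) := by
    rw [Set.disjoint_left]; intro x hx hx2; exact hx2.2 hx.2
  have fin : elastic 𝓒 u ((ball 0 r \ K) \ S) ≠ ⊤ :=
    ne_top_of_le_ne_top (elastic_fin hiso hmin 0 hr) (lintegral_mono_set diff_subset)
  rw [sp, elastic_union m2 dj, elastic_union m2 dj,
    elastic_congr (v := v) m2 (fun x hx => v2 x hx.2 hx.1.2), ENNReal.add_le_add_iff_right fin,
    elastic_congr (v := v) (measurableSet_ball.inter oS.measurableSet) (fun x hx => v1 x hx.2)] at key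
  exact key

lemma EL_sector (hμ : 0 < μ) (hl : 0 < μ + lam)
    (hiso : ∀ ξ : Mat 2, ξᵀ = ξ → 𝓒 ξ = (lam * Matrix.trace ξ) • (1 : Mat 2) + (2 * μ) • ξ)
    {u : Euc 2 → Euc 2} {K : Set (Euc 2)} (hmin : GlobalMin 𝓒 u K) (h0 : (0 : Euc 2) ∈ K)
    {m om : ℝ} (hS : Sct m om ⊆ Kᶜ) (hcl : closure (Sct m om) ⊆ Sct m om ∪ K)
    {g1 g2 : ℝ × ℝ → ℝ} (sg1 : Sm g1) (cg1 : HasCompactSupport g1) (sg2 : Sm g2) (cg2 : HasCompactSupport g2) :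
    (∫ p in Sec om, ((lam*(dx (cc1 m u) p + dy (cc2 m u) p) + 2*μ*dx (cc1 m u) p)*dx g1 p
      + μ*(dy (cc1 m u) p + dx (cc2 m u) p)*(dy g1 p + dx g2 p)
      + (lam*(dx (cc1 m u) p + dy (cc2 m u) p)+2*μ*dy (cc2 m u) p)*dy g2 p)) = 0 := by
  obtain ⟨r, hr, hsub⟩ : ∃ r > 0, frE m '' (tsupport g1 ∪ tsupport g2) ⊆ ball (0 : Euc 2) r := by
    have c : IsCompact (frE m '' (tsupport g1 ∪ tsupport g2)) :=
      (IsCompact.union cg1 cg2).image (frE m).continuous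
    obtain ⟨r, h⟩ := c.isBounded.subset_ball 0
    exact ⟨max r 1, by positivity, h.trans (ball_subset_ball (le_max_left _ _))⟩
  have nsup : ∀ p, p ∉ frE m ⁻¹' (ball (0 : Euc 2) r) → p ∉ tsupport g1 ∧ p ∉ tsupport g2 := by
    intro p hp
    exact ⟨fun h => hp (hsub ⟨p, Or.inl h, rfl⟩), fun h => hp (hsub ⟨p, Or.inr h, rfl⟩)⟩
  have mball : MeasurableSet (ball (0 : Euc 2) r ∩ Sct m om) :=
    measurableSet_ball.inter (isOpen_Sct m om).measurableSet
  set P := frE m ⁻¹' (ball (0 : Euc 2) r ∩ Sct m om) with hP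
  have mP : MeasurableSet P := (frE m).continuous.measurable mball
  have PS : P ⊆ Sec om := fun p hp => frE_mem_Sct.1 hp.2
  have ud : ∀ x ∈ ball (0 : Euc 2) r ∩ Sct m om, DifferentiableAt ℝ u x := fun x hx =>
    hmin.pair.diffOn x ⟨trivial, hS hx.2⟩
  have volP : volume P ≠ ⊤ := by
    rw [hP, (frE_mp m).measure_preimage mball.nullMeasurableSet]
    exact ((measure_mono inter_subset_left).trans_lt measure_ball_lt_top).ne
  have : IsFiniteMeasure (volume.restrict P) := ⟨by rw [Measure.restrict_apply_univ]; exact lt_top_iff_ne_top.2 volP⟩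
  rw [setIntegral_eq_of_subset_of_forall_sdiff_eq_zero (isOpen_Sec om).measurableSet PS]
  · have lp : ∀ g : ℝ × ℝ → ℝ, Continuous g → HasCompactSupport g → MemLp g 2 (volume.restrict P) :=
      fun g hg hc => (hg.memLp_of_hasCompactSupport hc).restrict P
    refine var_zero (ν := volume.restrict P) hμ hl (meas_dx _) ((meas_dy _).add (meas_dx _)) (meas_dy _)
      (lp _ sg1.dx.continuous (hcs_dx cg1))
      ((lp _ sg1.dy.continuous (hcs_dy cg1)).add (lp _ sg2.dx.continuous (hcs_dx cg2))) (lp _ sg2.dy.continuous (hcs_dy cg2)) ?_ ?_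
    · rw [← elastic_pull m hiso mball ud]
      refine ne_top_of_le_ne_top (elastic_fin hiso hmin 0 hr) (lintegral_mono_set fun x hx => ⟨hx.1, hS hx.2⟩)
    · intro s
      have hφ : ContDiff ℝ 1 (fun x => s • tf m g1 g2 x) := (tf_smooth sg1 sg2).const_smul s
      have key := min_sector hiso hmin h0 (isOpen_Sct m om) hS hcl hφ hr (fun x hx => by
        have := nsup ((frE m).symm x) (by simpa using hx)
        simp [tf, image_eq_zero_of_notMem_tsupport this.1, image_eq_zero_of_notMem_tsupport this.2])
      rw [elastic_pull m hiso mball ud, elastic_pull m hiso (w := fun x => u x + s • tf m g1 g2 x) mball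
        (fun x hx => (ud x hx).add (hφ.differentiable one_ne_zero x))] at key
      refine key.trans (le_of_eq (setLIntegral_congr_fun mP fun p hp => ?_))
      have d1 := cc1_diff (ud _ hp)
      have d2 := cc2_diff (ud _ hp)
      have q1 : DifferentiableAt ℝ g1 p := sg1.differentiable (by simp) p
      have q2 : DifferentiableAt ℝ g2 p := sg2.differentiable (by simp) p
      rw [cc1_add_tf, cc2_add_tf]
      simp only [dx, dy, d_add d1 q1, d_add d2 q2, Pi.add_apply]
      congr 2; ring
  · intro p hp
    have : p ∉ frE m ⁻¹' (ball (0 : Euc 2) r) := fun h => hp.2 ⟨h, frE_mem_Sct.2 hp.1⟩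
    obtain ⟨n1, n2⟩ := nsup p this
    rw [dx_out n1, dy_out n1, dx_out n2, dy_out n2]; ring

lemma sector_zero (hμ : 0 < μ) (hl : 0 < μ + lam)
    (hiso : ∀ ξ : Mat 2, ξᵀ = ξ → 𝓒 ξ = (lam * Matrix.trace ξ) • (1 : Mat 2) + (2 * μ) • ξ)
    {u : Euc 2 → Euc 2} {K : Set (Euc 2)} (hmin : GlobalMin 𝓒 u K) (h0 : (0 : Euc 2) ∈ K)
    {m om : ℝ} (om0 : 0 < om) (hom : om < Real.pi)
    (hS : Sct m om ⊆ Kᶜ) (hcl : closure (Sct m om) ⊆ Sct m om ∪ K) :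
    ∀ᵐ x, x ∈ Sct m om → eSym u x = 0 := by
  obtain ⟨D1, D2⟩ := disp_cc hmin.pair hS
  have ud : ∀ p ∈ Sec om, DifferentiableAt ℝ u (frE m p) := fun p hp =>
    hmin.pair.diffOn _ ⟨trivial, hS (frE_mem_Sct.2 hp)⟩
  have k0 : 0 < min μ (μ + lam) := lt_min hμ hl
  have hz := sec_zero (lam := lam) (C0 := (min μ (μ + lam))⁻¹ * (4 * Real.pi * 2)) om0 hom hμ hl D1 D2
    (by positivity) (fun R hR => by
      have mb : MeasurableSet (ball (0 : Euc 2) (2 * R) ∩ Sct m om) :=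
        measurableSet_ball.inter (isOpen_Sct m om).measurableSet
      have sub : Sec om ∩ ball 0 R ⊆ frE m ⁻¹' (ball (0 : Euc 2) (2 * R) ∩ Sct m om) := by
        intro p hp
        refine ⟨?_, frE_mem_Sct.2 hp.1⟩
        have h := mem_ball_zero_iff.1 hp.2
        have n1 := (norm_fst_le p).trans_lt h
        have n2 := (norm_snd_le p).trans_lt h
        rw [mem_ball_zero_iff]
        refine lt_of_pow_lt_pow_left₀ 2 (by positivity) ?_
        rw [frE_norm]
        rw [Real.norm_eq_abs] at n1 n2
        have := sq_lt_sq' (neg_lt_of_abs_lt n1) (lt_of_abs_lt n1)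
        have := sq_lt_sq' (neg_lt_of_abs_lt n2) (lt_of_abs_lt n2)
        nlinarith
      calc _ ≤ ∫⁻ p in frE m ⁻¹' (ball (0 : Euc 2) (2 * R) ∩ Sct m om), ENNReal.ofReal (min μ (μ + lam))⁻¹ * ENNReal.ofReal (QQ lam μ (dx (cc1 m u) p) (dy (cc1 m u) p + dx (cc2 m u) p) (dy (cc2 m u) p)) := by
            refine (lintegral_mono_set sub).trans (lintegral_mono fun p => ?_)
            rw [← ENNReal.ofReal_mul (by positivity)]
            refine ENNReal.ofReal_le_ofReal ?_
            rw [← div_eq_inv_mul, le_div_iff₀ k0, mul_comm]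
            exact QQ_ge hμ hl _ _ _
        _ = ENNReal.ofReal (min μ (μ + lam))⁻¹ * elastic 𝓒 u (ball (0 : Euc 2) (2 * R) ∩ Sct m om) := by
            rw [lintegral_const_mul' _ _ ENNReal.ofReal_ne_top, elastic_pull m hiso mb
              fun x hx => hmin.pair.diffOn x ⟨trivial, hS hx.2⟩]
        _ ≤ ENNReal.ofReal (min μ (μ + lam))⁻¹ * ENNReal.ofReal (4 * Real.pi * (2 * R)) := by
            gcongr
            refine le_trans (lintegral_mono_set (t := ball (0 : Euc 2) (2 * R) \ K) fun x hx => ⟨hx.1, hS hx.2⟩) (energy_bound hiso hmin h0 (by linarith))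
        _ = _ := by rw [← ENNReal.ofReal_mul (by positivity)]; congr 1; ring)
    (fun g1 g2 s1 c1 s2 c2 => EL_sector hμ hl hiso hmin h0 hS hcl s1 c1 s2 c2)
  have mp : MeasurePreserving (frE m).symm volume volume :=
    MeasurePreserving.symm (frE m).toHomeomorph.toMeasurableEquiv (frE_mp m)
  filter_upwards [mp.quasiMeasurePreserving.ae hz] with x hx hxS
  obtain ⟨a, b, c⟩ := hx hxS
  have h := cc_frob (ud _ hxS)
  rw [a, b, c, ← frobNorm_sq', frobNorm_sq] at h
  simp only [ContinuousLinearEquiv.apply_symm_apply] at h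
  ext i j
  fin_cases i <;> fin_cases j <;> simp <;>
    nlinarith [sq_nonneg (eSym u x 0 0), sq_nonneg (eSym u x 0 1), sq_nonneg (eSym u x 1 0), sq_nonneg (eSym u x 1 1)]

end Apply

end

section
section Rigid

lemma rInner_eq (x y : Euc 2) : rInner x y = x 0 * y 0 + x 1 * y 1 := by
  simp [rInner, EuclideanSpace.inner_eq_star_dotProduct, dotProduct, Fin.sum_univ_two]
  ring

/-- infinitesimal rigid motion -/
def rig (b : Euc 2) (κ : ℝ) (y : Euc 2) : Euc 2 := !₂[b 0 - κ * y 1, b 1 + κ * y 0]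

@[simp] lemma rig_0 (b : Euc 2) (κ : ℝ) (y : Euc 2) : rig b κ y 0 = b 0 - κ * y 1 := by simp [rig]
@[simp] lemma rig_1 (b : Euc 2) (κ : ℝ) (y : Euc 2) : rig b κ y 1 = b 1 + κ * y 0 := by simp [rig]

def rigL (κ : ℝ) : Euc 2 →ₗ[ℝ] Euc 2 where
  toFun x := !₂[-(κ * x 1), κ * x 0]
  map_add' x y := by ext i; fin_cases i <;> simp <;> ring
  map_smul' c x := by ext i; fin_cases i <;> simp <;> ring

lemma rig_eq (b : Euc 2) (κ : ℝ) : rig b κ = fun y => b + LinearMap.toContinuousLinearMap (rigL κ) y := by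
  ext y i; fin_cases i <;> simp [rigL]; ring

lemma rig_contDiff (b : Euc 2) (κ : ℝ) : ContDiff ℝ 1 (rig b κ) := by
  rw [rig_eq]; exact contDiff_const.add (ContinuousLinearMap.contDiff _)

lemma rig_eSym (b : Euc 2) (κ : ℝ) (x : Euc 2) : eSym (rig b κ) x = 0 := by
  have : fderiv ℝ (rig b κ) x = LinearMap.toContinuousLinearMap (rigL κ) := by
    rw [rig_eq, fderiv_const_add, ContinuousLinearMap.fderiv]
  ext i j
  simp only [eSym, gradm, this, Matrix.smul_apply, Matrix.add_apply, Matrix.transpose_apply]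
  fin_cases i <;> fin_cases j <;> simp [rigL]

lemma quad_zero {u : Euc 2 → Euc 2} {x z : Euc 2} (h : eSym u x = 0) :
    rInner (fderiv ℝ u x z) z = 0 := by
  have hz : z = z 0 • EuclideanSpace.single 0 (1:ℝ) + z 1 • EuclideanSpace.single 1 (1:ℝ) := by
    ext i; fin_cases i <;> simp
  have e : ∀ i j, gradm u x i j + gradm u x j i = 0 := by
    intro i j
    have := congrFun (congrFun h i) j
    simp only [eSym, Matrix.smul_apply, Matrix.add_apply, Matrix.transpose_apply, smul_eq_mul, Matrix.zero_apply] at this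
    linarith
  have f : ∀ i, fderiv ℝ u x z i = z 0 * gradm u x i 0 + z 1 * gradm u x i 1 := by
    intro i
    conv_lhs => rw [hz]
    simp [gradm]
  rw [rInner_eq, f, f]
  have := e 0 0; have := e 0 1; have := e 1 1
  linear_combination (z 0 ^ 2 / 2) * e 0 0 + z 0 * z 1 * e 0 1 + (z 1 ^ 2 / 2) * e 1 1

lemma mono_zero {u : Euc 2 → Euc 2} {U : Set (Euc 2)} (hU : IsOpen U) (hc : Convex ℝ U)
    (hd : ∀ x ∈ U, DifferentiableAt ℝ u x) (he : ∀ᵐ x, x ∈ U → eSym u x = 0)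
    (z : Euc 2) : ∀ x, x ∈ U → x + z ∈ U → rInner (u (x + z) - u x) z = 0 := by
  obtain ⟨N, hN1, hN2, hN3⟩ := exists_measurable_superset_of_null (ae_iff.1 he)
  have hae : ∀ᵐ x : Euc 2, ∀ᵐ t : ℝ, x + t • z ∉ N := by
    have ms : MeasurableSet {p : ℝ × Euc 2 | p.2 + p.1 • z ∉ N} := by
      have : Measurable fun p : ℝ × Euc 2 => p.2 + p.1 • z := by fun_prop
      exact this hN2.compl
    refine (Measure.ae_ae_comm (μ := (volume : Measure ℝ)) (ν := (volume : Measure (Euc 2))) (p := fun t x => x + t • z ∉ N) ms).1 (ae_of_all _ fun t => ?_)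
    rw [ae_iff]
    simp only [not_not]
    have : {a : Euc 2 | a + t • z ∈ N} = (fun a => a + t • z) ⁻¹' N := rfl
    rw [this, measure_preimage_add_right, hN3]
  set V : Set (Euc 2) := {x | x ∈ U ∧ x + z ∈ U} with hV
  have oV : IsOpen V := hU.inter (hU.preimage (continuous_id.add continuous_const))
  have cont : ContinuousOn (fun x => rInner (u (x + z) - u x) z) V := by
    intro x hx
    refine ContinuousAt.continuousWithinAt ?_
    have h1 : ContinuousAt u x := (hd x hx.1).continuousAt
    have h2 : ContinuousAt (fun x => u (x + z)) x :=
      ContinuousAt.comp (f := fun x => x + z) (hd _ hx.2).continuousAt (by fun_prop)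
    exact ContinuousAt.inner (𝕜 := ℝ) (h2.sub h1) continuousAt_const
  have good : ∀ᵐ x, x ∈ V → rInner (u (x + z) - u x) z = 0 := by
    filter_upwards [hae] with x hx hxV
    set f : ℝ → ℝ := fun t => rInner (u (x + t • z)) z with hf
    have inU : ∀ t ∈ Icc (0:ℝ) 1, x + t • z ∈ U := by
      intro t ht
      have := hc hxV.1 hxV.2 (sub_nonneg.2 ht.2) ht.1 (by ring)
      convert this using 1
      module
    have der : ∀ t ∈ Icc (0:ℝ) 1, HasDerivAt f (rInner (fderiv ℝ u (x + t • z) z) z) t := by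
      intro t ht
      have h1 : HasDerivAt (fun t : ℝ => x + t • z) z t := by
        simpa using ((hasDerivAt_id t).smul_const z).const_add x
      have h2 := (hd _ (inU t ht)).hasFDerivAt.comp_hasDerivAt t h1
      have h3 := h2.inner ℝ (hasDerivAt_const t z)
      simpa [rInner, hf] using h3
    have z0 : (fun t => rInner (fderiv ℝ u (x + t • z) z) z) =ᵐ[volume.restrict (Icc (0:ℝ) 1)] fun _ => 0 := by
      rw [Filter.EventuallyEq, ae_restrict_iff' measurableSet_Icc]
      filter_upwards [hx] with t ht htI
      have : eSym u (x + t • z) = 0 := by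
        by_contra hne
        exact ht (hN1 (by simpa using ⟨inU t htI, hne⟩))
      exact quad_zero this
    have z1 : (fun t => rInner (fderiv ℝ u (x + t • z) z) z) =ᵐ[volume.restrict (Ioc (0:ℝ) 1)] fun _ => 0 :=
      ae_mono (Measure.restrict_mono Ioc_subset_Icc_self le_rfl) z0
    have int : IntervalIntegrable (fun t => rInner (fderiv ℝ u (x + t • z) z) z) volume 0 1 := by
      rw [intervalIntegrable_iff_integrableOn_Ioc_of_le zero_le_one]
      exact (integrable_congr z1).2 (integrable_zero _ _ _)
    have ftc := intervalIntegral.integral_eq_sub_of_hasDerivAt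
      (fun t ht => der t (by rwa [uIcc_of_le zero_le_one] at ht)) int
    rw [intervalIntegral.integral_of_le zero_le_one, integral_congr_ae z1, integral_zero] at ftc
    simp only [hf, one_smul, zero_smul, add_zero] at ftc
    have : rInner (u (x + z) - u x) z = rInner (u (x + z)) z - rInner (u x) z := by
      simp [rInner, inner_sub_left]
    rw [this]; exact ftc.symm
  intro x h1 h2
  by_contra hne
  have opn : IsOpen (V ∩ (fun x => rInner (u (x + z) - u x) z) ⁻¹' {0}ᶜ) :=
    cont.isOpen_inter_preimage oV isOpen_compl_singleton
  have pos := opn.measure_pos volume ⟨x, ⟨h1, h2⟩, hne⟩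
  refine pos.ne' (measure_mono_null ?_ (ae_iff.1 good))
  intro y hy
  simp only [mem_setOf_eq, Classical.not_imp]
  exact ⟨hy.1, hy.2⟩

lemma rigid_of_zero {u : Euc 2 → Euc 2} {U : Set (Euc 2)} (hU : IsOpen U) (hc : Convex ℝ U)
    (hd : ∀ x ∈ U, DifferentiableAt ℝ u x) (he : ∀ᵐ x, x ∈ U → eSym u x = 0) :
    ∃ b κ, ∀ y ∈ U, u y = rig b κ y := by
  rcases U.eq_empty_or_nonempty with rfl | ⟨x0, hx0⟩
  · exact ⟨0, 0, fun y hy => hy.elim⟩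
  have key : ∀ x ∈ U, ∀ y ∈ U, (u y 0 - u x 0) * (y 0 - x 0) + (u y 1 - u x 1) * (y 1 - x 1) = 0 := by
    intro x hx y hy
    have := mono_zero hU hc hd he (y - x) x hx (by simpa using hy)
    rw [rInner_eq] at this
    simpa using this
  obtain ⟨ρ, r0, hρ⟩ := Metric.isOpen_iff.1 hU x0 hx0
  set s := ρ / 2 with hs
  have s0 : 0 < s := by positivity
  have m : ∀ i, x0 + s • EuclideanSpace.single i (1:ℝ) ∈ U := fun i => hρ (by
    rw [mem_ball, dist_eq_norm]; simp [norm_smul, abs_of_pos s0]; linarith)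
  set P := x0 + s • EuclideanSpace.single 0 (1:ℝ) with hP
  set Q := x0 + s • EuclideanSpace.single 1 (1:ℝ) with hQ
  have P0 : P 0 = x0 0 + s := by simp [hP]
  have P1 : P 1 = x0 1 := by simp [hP]
  have Q0 : Q 0 = x0 0 := by simp [hQ]
  have Q1 : Q 1 = x0 1 + s := by simp [hQ]
  have k1 := key x0 hx0 P (m 0)
  have k2 := key x0 hx0 Q (m 1)
  have k3 := key P (m 0) Q (m 1)
  rw [P0, P1] at k1
  rw [Q0, Q1] at k2
  rw [P0, P1, Q0, Q1] at k3
  have w1 : u P 0 = u x0 0 := by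
    have : s * (u P 0 - u x0 0) = 0 := by linarith
    linarith [(mul_eq_zero.1 this).resolve_left s0.ne']
  have w2 : u Q 1 = u x0 1 := by
    have : s * (u Q 1 - u x0 1) = 0 := by linarith
    linarith [(mul_eq_zero.1 this).resolve_left s0.ne']
  have w3 : u Q 0 - u x0 0 = -(u P 1 - u x0 1) := by
    have : s * ((u Q 0 - u x0 0) + (u P 1 - u x0 1)) = 0 := by rw [w1, w2] at k3; linarith
    linarith [(mul_eq_zero.1 this).resolve_left s0.ne']
  set κ := (u P 1 - u x0 1) / s with hκ
  have hκ' : u P 1 = u x0 1 + κ * s := by rw [hκ]; field_simp; ring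
  have hQ' : u Q 0 = u x0 0 - κ * s := by linarith
  refine ⟨!₂[u x0 0 + κ * x0 1, u x0 1 - κ * x0 0], κ, fun y hy => ?_⟩
  have l1 := key x0 hx0 y hy
  have l2 := key P (m 0) y hy
  have l3 := key Q (m 1) y hy
  rw [P0, P1, w1, hκ'] at l2
  rw [Q0, Q1, w2, hQ'] at l3
  have f0 : u y 0 = u x0 0 + κ * x0 1 - κ * y 1 := by
    have : s * (u y 0 - (u x0 0 + κ * x0 1 - κ * y 1)) = 0 := by linarith
    linarith [(mul_eq_zero.1 this).resolve_left s0.ne']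
  have f1 : u y 1 = u x0 1 - κ * x0 0 + κ * y 0 := by
    have : s * (u y 1 - (u x0 1 - κ * x0 0 + κ * y 0)) = 0 := by linarith
    linarith [(mul_eq_zero.1 this).resolve_left s0.ne']
  ext i; fin_cases i
  · simpa using f0
  · simpa using f1

lemma rig_unique {b b' : Euc 2} {κ κ' : ℝ} {U : Set (Euc 2)} (hU : IsOpen U) (hne : U.Nonempty)
    (h : ∀ y ∈ U, rig b κ y = rig b' κ' y) : rig b κ = rig b' κ' := by
  obtain ⟨x0, hx0⟩ := hne
  obtain ⟨ρ, r0, hρ⟩ := Metric.isOpen_iff.1 hU x0 hx0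
  have s0 : 0 < ρ / 2 := by positivity
  have m := h (x0 + (ρ / 2) • EuclideanSpace.single 0 (1:ℝ)) (hρ (by
    rw [mem_ball, dist_eq_norm]; simp [norm_smul, abs_of_pos r0]; linarith))
  have m0 := h x0 hx0
  have a1 := congrArg (fun z : Euc 2 => z 1) m
  have a2 := congrArg (fun z : Euc 2 => z 1) m0
  have a3 := congrArg (fun z : Euc 2 => z 0) m0
  simp at a1 a2 a3
  have : κ = κ' := by
    have : (ρ / 2) * (κ - κ') = 0 := by linarith
    linarith [(mul_eq_zero.1 this).resolve_left s0.ne']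
  subst this
  ext y i; fin_cases i <;> simp <;> linarith

end Rigid

end

section
lemma frE_dir (m r φ : ℝ) : frE m (r * Real.cos φ, r * Real.sin φ) = r • dir (m + φ) := by
  ext i
  fin_cases i
  · simp [frE_0, dir, Real.cos_add]; ring
  · simp [frE_1, dir, Real.sin_add]; ring

lemma frE_polar (m : ℝ) (x : Euc 2) : ∃ r φ : ℝ, 0 ≤ r ∧ |φ| ≤ Real.pi ∧ x = r • dir (m + φ) ∧
    (frE m).symm x = (r * Real.cos φ, r * Real.sin φ) := by
  obtain ⟨φ, hφ, e⟩ := polar_dir (!₂[((frE m).symm x).1, ((frE m).symm x).2])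
  set r := ‖(!₂[((frE m).symm x).1, ((frE m).symm x).2] : Euc 2)‖ with hr
  have e2 : (frE m).symm x = (r * Real.cos φ, r * Real.sin φ) := by
    have h0 := congrArg (fun z : Euc 2 => z 0) e
    have h1 := congrArg (fun z : Euc 2 => z 1) e
    simp at h0 h1
    exact Prod.ext h0 h1
  refine ⟨r, φ, norm_nonneg _, abs_le.2 ⟨hφ.1.le, hφ.2⟩, ?_, e2⟩
  rw [← frE_dir, ← e2]; simp

lemma sec_id {om r φ : ℝ} (hr : 0 ≤ r) (h : |φ| ≤ Real.pi) :
    Real.sin om * (r * Real.cos φ) - Real.cos om * |r * Real.sin φ| = r * Real.sin (om - |φ|) := by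
  rw [abs_mul, abs_of_nonneg hr, ← Real.cos_abs φ]
  have : |Real.sin φ| = Real.sin |φ| := by
    rcases abs_cases φ with h1 | h1
    · rw [h1.1, abs_of_nonneg]; exact Real.sin_nonneg_of_nonneg_of_le_pi h1.2 (by rw [← h1.1]; exact h)
    · rw [h1.1, Real.sin_neg, abs_of_nonpos]
      have := Real.sin_nonneg_of_nonneg_of_le_pi (x := -φ) (by linarith [h1.2]) (by rw [← h1.1]; exact h)
      rw [Real.sin_neg] at this; linarith
  rw [this, Real.sin_sub]; ring

lemma dir_add_int (θ : ℝ) (n : ℤ) : dir (θ + n • (2 * Real.pi)) = dir θ := by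
  ext i
  fin_cases i
  · simp [dir]
  · simp [dir]

lemma dir_shift {K : Set (Euc 2)} {θ0 : ℝ} (h0 : dir θ0 ∉ K) {ν : Euc 2} (hν : ‖ν‖ = 1) (hK : ν ∈ K) :
    ∃ b ∈ Ioo θ0 (θ0 + 2 * Real.pi), dir b = ν := by
  obtain ⟨θ, -, e⟩ := polar_dir ν
  rw [hν, one_smul] at e
  obtain ⟨n, hn, -⟩ := existsUnique_add_zsmul_mem_Ico Real.two_pi_pos θ θ0
  refine ⟨θ + n • (2 * Real.pi), ⟨lt_of_le_of_ne hn.1 ?_, hn.2⟩, by rw [dir_add_int, e]⟩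
  intro h
  apply h0; rw [h, dir_add_int, ← e]; exact hK

lemma exists_sector {K : Set (Euc 2)} (hcl : IsClosed K) (hcone : ∀ t : ℝ, 0 < t → ∀ x, x ∈ K ↔ t • x ∈ K)
    (h0 : (0 : Euc 2) ∈ K) {ν₁ ν₂ : Euc 2} (n1 : ‖ν₁‖ = 1) (n2 : ‖ν₂‖ = 1) (k1 : ν₁ ∈ K) (k2 : ν₂ ∈ K)
    (hne : ν₁ ≠ ν₂) {x : Euc 2} (hx : x ∉ K) :
    ∃ m om : ℝ, 0 < om ∧ om < Real.pi ∧ x ∈ Sct m om ∧ Sct m om ⊆ Kᶜ ∧ closure (Sct m om) ⊆ Sct m om ∪ K := by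
  obtain ⟨θ0, -, ex⟩ := polar_dir x
  have xpos : 0 < ‖x‖ := by
    rw [norm_pos_iff]; rintro rfl; exact hx h0
  have hθ : dir θ0 ∉ K := by rw [hcone _ xpos, ← ex]; exact hx
  have key : ∃ b1 b2 : ℝ, θ0 < b1 ∧ b1 < b2 ∧ b2 < θ0 + 2 * Real.pi ∧ dir b1 ∈ K ∧ dir b2 ∈ K := by
    obtain ⟨b1, i1, e1⟩ := dir_shift hθ n1 k1
    obtain ⟨b2, i2, e2⟩ := dir_shift hθ n2 k2
    have : b1 ≠ b2 := by rintro rfl; exact hne (e1.symm.trans e2)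
    rcases lt_or_gt_of_ne this with h | h
    · exact ⟨b1, b2, i1.1, h, i2.2, e1 ▸ k1, e2 ▸ k2⟩
    · exact ⟨b2, b1, i2.1, h, i1.2, e2 ▸ k2, e1 ▸ k1⟩
  obtain ⟨b1, b2, hb0, hb, hb2, kb1, kb2⟩ := key
  set A : Set ℝ := {θ | dir θ ∈ K} with hA
  have Acl : IsClosed A := hcl.preimage dir_lip.continuous
  have hb2' : b2 - 2 * Real.pi ∈ A := by
    have := dir_add_int b2 (-1)
    simp only [neg_smul, one_smul] at this
    simp only [hA, mem_ofPred_eq, sub_eq_add_neg, this]; exact kb2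
  have b1A : b1 ∈ A ∩ Ici θ0 := ⟨kb1, hb0.le⟩
  have b2A : b2 - 2 * Real.pi ∈ A ∩ Iic θ0 := ⟨hb2', by simp only [mem_Iic]; linarith⟩
  have bdd1 : BddBelow (A ∩ Ici θ0) := ⟨θ0, fun y hy => hy.2⟩
  have bdd2 : BddAbove (A ∩ Iic θ0) := ⟨θ0, fun y hy => hy.2⟩
  set P := sInf (A ∩ Ici θ0) with hP
  set M := sSup (A ∩ Iic θ0) with hM
  have PA : P ∈ A ∩ Ici θ0 := (Acl.inter isClosed_Ici).csInf_mem ⟨_, b1A⟩ bdd1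
  have MA : M ∈ A ∩ Iic θ0 := (Acl.inter isClosed_Iic).csSup_mem ⟨_, b2A⟩ bdd2
  have P1 : P ≤ b1 := csInf_le bdd1 b1A
  have M1 : b2 - 2 * Real.pi ≤ M := le_csSup bdd2 b2A
  have P0 : θ0 < P := lt_of_le_of_ne PA.2 (fun h => hθ (h ▸ PA.1))
  have M0 : M < θ0 := lt_of_le_of_ne MA.2 (fun h => hθ (h ▸ MA.1))
  have gap : ∀ θ, M < θ → θ < P → dir θ ∉ K := by
    intro θ h1 h2 hk
    rcases le_total θ0 θ with h | h
    · exact absurd (csInf_le bdd1 ⟨hk, h⟩) (not_le.2 h2)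
    · exact absurd (le_csSup bdd2 ⟨hk, h⟩) (not_le.2 h1)
  set m := (P + M) / 2 with hm
  set om := (P - M) / 2 with hom
  have om0 : 0 < om := by rw [hom]; linarith
  have ompi : om < Real.pi := by rw [hom]; linarith
  have mem : ∀ {r φ : ℝ}, 0 ≤ r → |φ| ≤ Real.pi → ((r * Real.cos φ, r * Real.sin φ) ∈ Sec om ↔ 0 < r * Real.sin (om - |φ|)) := by
    intro r φ hr hφ
    rw [← sec_id hr hφ]
    simp only [Sec, mem_ofPred_eq, sub_pos]
  refine ⟨m, om, om0, ompi, ?_, ?_, ?_⟩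
  · have e : x = frE m (‖x‖ * Real.cos (θ0 - m), ‖x‖ * Real.sin (θ0 - m)) := by
      rw [frE_dir]; simpa using ex
    have ab : |θ0 - m| < om := by rw [abs_lt]; constructor <;> rw [hm, hom] <;> linarith
    rw [e, frE_mem_Sct, mem xpos.le (by linarith)]
    exact mul_pos xpos (Real.sin_pos_of_pos_of_lt_pi (by linarith) (by linarith [abs_nonneg (θ0 - m)]))
  · intro y hy hk
    obtain ⟨r, φ, hr, hφ, e1, e2⟩ := frE_polar m y
    have hy' : (frE m).symm y ∈ Sec om := hy
    rw [e2, mem hr hφ] at hy'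
    have rpos : 0 < r := lt_of_le_of_ne hr (by rintro rfl; simp at hy')
    have s := pos_of_mul_pos_right hy' hr
    have : |φ| < om := by
      by_contra hc
      push Not at hc
      have := Real.sin_nonpos_of_nonpos_of_neg_pi_le (x := om - |φ|) (by linarith) (by linarith)
      linarith
    rw [abs_lt] at this
    rw [e1, ← hcone r rpos] at hk
    exact gap _ (by rw [hm]; linarith [this.1]) (by rw [hm]; linarith [this.2]) hk
  · intro y hy
    have hc : IsClosed {y : Euc 2 | Real.cos om * |((frE m).symm y).2| ≤ Real.sin om * ((frE m).symm y).1} := by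
      apply isClosed_le <;> fun_prop
    have hy' := closure_minimal (fun z (hz : z ∈ Sct m om) => (show z ∈ {y : Euc 2 | Real.cos om * |((frE m).symm y).2| ≤ Real.sin om * ((frE m).symm y).1} from (by
      rw [mem_ofPred_eq]; exact le_of_lt (show Real.cos om * |((frE m).symm z).2| < Real.sin om * ((frE m).symm z).1 from hz)))) hc hy
    obtain ⟨r, φ, hr, hφ, e1, e2⟩ := frE_polar m y
    simp only [mem_ofPred_eq] at hy'
    rw [e2, ← sub_nonneg, sec_id hr hφ] at hy'
    rcases hr.eq_or_lt with h | rpos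
    · right; rw [e1, ← h, zero_smul]; exact h0
    have s := nonneg_of_mul_nonneg_right hy' rpos
    have hle : |φ| ≤ om := by
      by_contra hc
      push Not at hc
      have := Real.sin_neg_of_neg_of_neg_pi_lt (x := om - |φ|) (by linarith) (by linarith)
      linarith
    rcases hle.lt_or_eq with hlt | heq
    · left
      show (frE m).symm y ∈ Sec om
      rw [e2, mem hr hφ]
      exact mul_pos rpos (Real.sin_pos_of_pos_of_lt_pi (by linarith) (by linarith [abs_nonneg φ]))
    · right
      rw [e1, ← hcone r rpos]
      rcases abs_choice φ with h | h
      · have : m + φ = P := by rw [← h, heq, hm, hom]; ring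
        rw [this]; exact PA.1
      · have : m + φ = M := by
          have : φ = -om := by linarith
          rw [this, hm, hom]; ring
        rw [this]; exact MA.1

/-- the elastic strain vanishes a.e. off `K` as soon as `K` has two different rays -/
lemma strain_zero {𝓒 : Mat 2 →ₗ[ℝ] Mat 2} {lam μ : ℝ} (hμ : 0 < μ) (hl : 0 < μ + lam)
    (hiso : ∀ ξ : Mat 2, ξᵀ = ξ → 𝓒 ξ = (lam * Matrix.trace ξ) • (1 : Mat 2) + (2 * μ) • ξ)
    {u : Euc 2 → Euc 2} {K : Set (Euc 2)} (hmin : GlobalMin 𝓒 u K)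
    (hcone : ∀ t : ℝ, 0 < t → ∀ x, x ∈ K ↔ t • x ∈ K)
    (h0 : (0 : Euc 2) ∈ K) {ν₁ ν₂ : Euc 2} (n1 : ‖ν₁‖ = 1) (n2 : ‖ν₂‖ = 1) (k1 : ν₁ ∈ K) (k2 : ν₂ ∈ K)
    (hne : ν₁ ≠ ν₂) : ∀ᵐ x, x ∉ K → eSym u x = 0 := by
  rw [ae_iff]
  apply measure_null_of_locally_null
  intro x hx
  simp only [mem_ofPred_eq, Classical.not_imp] at hx
  obtain ⟨m, om, om0, ompi, hxs, hS, hc⟩ := exists_sector (closed_of_pair hmin.pair) hcone h0 n1 n2 k1 k2 hne hx.1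
  refine ⟨Sct m om ∩ {x | ¬(x ∉ K → eSym u x = 0)}, ?_, ?_⟩
  · rw [inter_comm]; exact inter_mem_nhdsWithin _ ((isOpen_Sct m om).mem_nhds hxs)
  · have := sector_zero hμ hl hiso hmin h0 om0 ompi hS hc
    rw [ae_iff] at this
    refine measure_mono_null ?_ this
    rintro y ⟨hy1, hy2⟩
    simp only [mem_ofPred_eq, Classical.not_imp] at hy2 ⊢
    exact ⟨hy1, hy2.2⟩

end

section
instance noAtoms_Hm2 : NullSingletonClass (Hm 2) := by
  rw [Hm_eq]; exact Measure.nullSingletonClass_hausdorff _ one_pos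

lemma Hm_segment (x y : Euc 2) : Hm 2 (segment ℝ x y) = ENNReal.ofReal ‖x - y‖ := by
  rw [Hm_eq, hausdorffMeasure_segment, edist_dist, dist_eq_norm]

lemma isClosed_seg (x y : Euc 2) : IsClosed (segment ℝ x y) := by
  rw [segment_eq_image_lineMap]
  exact (isCompact_Icc.image (by exact AffineMap.lineMap_continuous)).isClosed

/-- open unit segment -/
def ray1 (ν : Euc 2) : Set (Euc 2) := {x | ∃ t : ℝ, 0 < t ∧ t < 1 ∧ x = t • ν}

lemma ray1_eq (ν : Euc 2) (hν : ‖ν‖ = 1) : ray1 ν = segment ℝ 0 ν \ {0, ν} := by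
  have n0 : ν ≠ 0 := by rintro rfl; simp at hν
  ext x
  rw [segment_eq_image]
  constructor
  · rintro ⟨t, h0, h1, rfl⟩
    refine ⟨⟨t, ⟨h0.le, h1.le⟩, by simp⟩, ?_⟩
    simp only [mem_insert_iff, mem_singleton_iff, not_or, smul_eq_zero]
    refine ⟨⟨h0.ne', n0⟩, fun h => ?_⟩
    have := congrArg norm h
    rw [norm_smul, hν, Real.norm_eq_abs, abs_of_pos h0] at this
    linarith
  · rintro ⟨⟨t, ⟨h0, h1⟩, rfl⟩, h⟩
    simp only [smul_zero, zero_add, mem_insert_iff, mem_singleton_iff, not_or] at h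
    refine ⟨t, lt_of_le_of_ne h0 ?_, lt_of_le_of_ne h1 ?_, by simp⟩
    · rintro rfl; simp at h
    · rintro rfl; simp at h

lemma ray1_meas {ν : Euc 2} (hν : ‖ν‖ = 1) : MeasurableSet (ray1 ν) := by
  rw [ray1_eq ν hν]
  exact (isClosed_seg _ _).measurableSet.diff (by simp)

lemma ray1_Hm {ν : Euc 2} (hν : ‖ν‖ = 1) : Hm 2 (ray1 ν) = 1 := by
  rw [ray1_eq ν hν, measure_sdiff_null, Hm_segment]
  · simp [hν]
  · exact (Set.toFinite _).measure_zero _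

lemma unit_eq_of {ν ν' : Euc 2} (h : ‖ν‖ = 1) (h' : ‖ν'‖ = 1) {s t : ℝ} (hs : 0 < s) (ht : 0 < t)
    (e : s • ν = t • ν') : ν = ν' := by
  have := congrArg norm e
  rw [norm_smul, norm_smul, h, h', Real.norm_eq_abs, Real.norm_eq_abs, abs_of_pos hs, abs_of_pos ht, mul_one, mul_one] at this
  subst this
  exact smul_right_injective _ hs.ne' e

lemma ray1_disj {ν ν' : Euc 2} (h : ‖ν‖ = 1) (h' : ‖ν'‖ = 1) (hne : ν ≠ ν') : Disjoint (ray1 ν) (ray1 ν') := by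
  rw [Set.disjoint_left]
  rintro x ⟨t, t0, -, rfl⟩ ⟨s, s0, -, e⟩
  exact hne (unit_eq_of h h' t0 s0 e)

lemma finite_dirs {𝓒 : Mat 2 →ₗ[ℝ] Mat 2} {u : Euc 2 → Euc 2} {K : Set (Euc 2)} (hmin : GlobalMin 𝓒 u K)
    (hcone : ∀ t : ℝ, 0 < t → ∀ x, x ∈ K ↔ t • x ∈ K) : {ν : Euc 2 | ‖ν‖ = 1 ∧ ν ∈ K}.Finite := by
  set D := {ν : Euc 2 | ‖ν‖ = 1 ∧ ν ∈ K} with hD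
  have hfin : Hm 2 (K ∩ ball 0 2) ≠ ⊤ := Hm_fin hmin 0 two_pos
  by_contra hinf
  have hinf : D.Infinite := hinf
  have sub : ∀ ν ∈ D, ray1 ν ⊆ K ∩ ball 0 2 := by
    rintro ν ⟨h1, h2⟩ x ⟨t, t0, t1, rfl⟩
    refine ⟨(hcone t t0 ν).1 h2, ?_⟩
    rw [mem_ball_zero_iff, norm_smul, h1, Real.norm_eq_abs, abs_of_pos t0]; linarith
  have bd : ∀ n : ℕ, (n : ℝ≥0∞) ≤ Hm 2 (K ∩ ball 0 2) := by
    intro n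
    obtain ⟨F, hF, hc⟩ := hinf.exists_subset_card_eq n
    have : Hm 2 (⋃ ν ∈ F, ray1 ν) = n := by
      rw [measure_biUnion_finset]
      · rw [Finset.sum_congr rfl (fun ν hν => ray1_Hm (hF hν).1)]; simp [hc]
      · intro a ha b hb hab
        exact ray1_disj (hF ha).1 (hF hb).1 hab
      · intro b hb; exact ray1_meas (hF hb).1
    rw [← this]
    exact measure_mono (iUnion₂_subset fun ν hν => sub ν (hF hν))
  obtain ⟨n, hn⟩ := ENNReal.exists_nat_gt hfin
  exact absurd (bd n) (not_le.2 hn)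

open Classical in
/-- gluing along two regions -/
def glue {α : Type*} (R1 R2 : Set (Euc 2)) (b1 b2 f : Euc 2 → α) (z : Euc 2) : α :=
  if z ∈ R1 then b1 z else if z ∈ R2 then b2 z else f z

lemma comp_locconst {K : Set (Euc 2)} (hK : IsClosed K) (x z : Euc 2) (hz : z ∉ K) :
    ∀ᶠ y in 𝓝 z, (y ∈ connectedComponentIn (univ \ K) x ↔ z ∈ connectedComponentIn (univ \ K) x) := by
  obtain ⟨ε, e0, he⟩ := Metric.isOpen_iff.1 hK.isOpen_compl z hz
  filter_upwards [ball_mem_nhds z e0] with y hy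
  have hyz : y ∈ connectedComponentIn (univ \ K) z :=
    (convex_ball z ε).isPreconnected.subset_connectedComponentIn (mem_ball_self e0)
      (fun w hw => show w ∈ univ \ K from ⟨trivial, he hw⟩) hy
  have e1 := connectedComponentIn_eq hyz
  constructor
  · intro h
    rw [connectedComponentIn_eq h, ← e1]
    exact mem_connectedComponentIn ⟨trivial, hz⟩
  · intro h
    rw [connectedComponentIn_eq h]; exact hyz

lemma comp_const_on {K H : Set (Euc 2)} (hH : IsPreconnected H) (hHK : H ⊆ Kᶜ) (x : Euc 2) {y w : Euc 2} (hy : y ∈ H)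
    (hw : w ∈ H) (h : y ∈ connectedComponentIn (univ \ K) x) : w ∈ connectedComponentIn (univ \ K) x := by
  rw [connectedComponentIn_eq h]
  exact hH.subset_connectedComponentIn hy (fun a ha => show a ∈ univ \ K from ⟨trivial, hHK ha⟩) hw

/-- The abstract competitor argument. -/
theorem comp_arg {𝓒 : Mat 2 →ₗ[ℝ] Mat 2} {u : Euc 2 → Euc 2} {K : Set (Euc 2)} (hmin : GlobalMin 𝓒 u K)
    (hcone : ∀ t : ℝ, 0 < t → ∀ x, x ∈ K ↔ t • x ∈ K)
    (h0 : (0 : Euc 2) ∈ K) (hz : ∀ᵐ x, x ∉ K → eSym u x = 0)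
    {ν₁ ν₂ : Euc 2} (n1 : ‖ν₁‖ = 1) (n2 : ‖ν₂‖ = 1) (k1 : ν₁ ∈ K) (k2 : ν₂ ∈ K) (hne : ν₁ ≠ ν₂)
    {W S R1 R2 H1 H2 : Set (Euc 2)} (hW : IsOpen W) (hW1 : ray1 ν₁ ⊆ W) (hW2 : ray1 ν₂ ⊆ W)
    (hWK : K ∩ W ⊆ ball 0 2) (hS : IsClosed S) (hSB : S ⊆ ball 0 2)
    (hR1 : R1 ⊆ ball 0 2) (hR2 : R2 ⊆ ball 0 2)
    (hH1 : IsPreconnected H1) (hH2 : IsPreconnected H2) (hK1 : H1 ⊆ Kᶜ) (hK2 : H2 ⊆ Kᶜ)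
    (hu1 : ∃ b κ, ∀ y ∈ H1, u y = rig b κ y) (hu2 : ∃ b κ, ∀ y ∈ H2, u y = rig b κ y)
    (hloc : ∀ z, z ∉ (K \ W) ∪ S → (∀ᶠ y in 𝓝 z, y ∈ R1 ∨ (y ∈ H1 ∧ y ∉ R2)) ∨
      (∀ᶠ y in 𝓝 z, y ∉ R1 ∧ (y ∈ R2 ∨ y ∈ H2)) ∨ (z ∉ K ∧ ∀ᶠ y in 𝓝 z, y ∉ R1 ∧ y ∉ R2)) :
    2 ≤ Hm 2 S := by
  have hKc : IsClosed K := closed_of_pair hmin.pair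
  set L := (K \ W) ∪ S with hL
  have hLc : IsClosed L := (hKc.sdiff hW).union hS
  have gl : ∀ {α : Type} (b1 b2 f : Euc 2 → α), (∀ y ∈ H1, f y = b1 y) → (∀ y ∈ H2, f y = b2 y) →
      ∀ z, z ∉ L → (glue R1 R2 b1 b2 f =ᶠ[𝓝 z] b1) ∨ (glue R1 R2 b1 b2 f =ᶠ[𝓝 z] b2) ∨
        (z ∉ K ∧ glue R1 R2 b1 b2 f =ᶠ[𝓝 z] f) := by
    intro α b1 b2 f e1 e2 z hzL
    rcases hloc z hzL with h | h | ⟨hk, h⟩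
    · left
      filter_upwards [h] with y hy
      unfold glue
      split_ifs with c1 c2
      · rfl
      · tauto
      · rcases hy with hy | hy
        · tauto
        · exact e1 y hy.1
    · right; left
      filter_upwards [h] with y hy
      unfold glue
      rw [if_neg hy.1]
      split_ifs with c2
      · rfl
      · exact e2 y (by tauto)
    · right; right
      refine ⟨hk, ?_⟩
      filter_upwards [h] with y hy
      unfold glue
      rw [if_neg hy.1, if_neg hy.2]
  have gout : ∀ {α : Type} (b1 b2 f : Euc 2 → α) (z), z ∉ ball (0 : Euc 2) 2 → glue R1 R2 b1 b2 f z = f z := by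
    intro α b1 b2 f z hz
    unfold glue
    rw [if_neg (fun h => hz (hR1 h)), if_neg (fun h => hz (hR2 h))]
  obtain ⟨b1, κ1, e1⟩ := hu1
  obtain ⟨b2, κ2, e2⟩ := hu2
  set v := glue R1 R2 (rig b1 κ1) (rig b2 κ2) u with hv
  have gv := gl (rig b1 κ1) (rig b2 κ2) u e1 e2
  have pair : AdmissiblePair univ v L := by
    apply pair_of_good hLc
    intro x hx
    rcases gv x hx with h | h | ⟨hk, h⟩
    · exact ⟨_, h, GoodAt.smooth (rig_contDiff b1 κ1)⟩
    · exact ⟨_, h, GoodAt.smooth (rig_contDiff b2 κ2)⟩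
    · exact ⟨_, h, GoodAt.of_pair hmin.pair hk⟩
  have sep : KeepsSeparation univ K (ball 0 2) L := by
    intro x hx y hy hxy hcon
    set C := connectedComponentIn (univ \ K) x with hC
    set g : Euc 2 → Prop := glue R1 R2 (fun _ => ∃ a ∈ H1, a ∈ C) (fun _ => ∃ a ∈ H2, a ∈ C) (fun z => z ∈ C) with hg
    have gg := gl (fun _ => ∃ a ∈ H1, a ∈ C) (fun _ => ∃ a ∈ H2, a ∈ C) (fun z => z ∈ C)
      (fun y hy => propext ⟨fun h => ⟨y, hy, h⟩, fun ⟨a, ha, h⟩ => comp_const_on hH1 hK1 x ha hy h⟩)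
      (fun y hy => propext ⟨fun h => ⟨y, hy, h⟩, fun ⟨a, ha, h⟩ => comp_const_on hH2 hK2 x ha hy h⟩)
    have lc : ∀ z, z ∉ L → ∀ᶠ w in 𝓝 z, (g w ↔ g z) := by
      intro z hzL
      rcases gg z hzL with h | h | ⟨hk, h⟩
      · filter_upwards [h] with w hw
        rw [hg, hw, h.eq_of_nhds]
      · filter_upwards [h] with w hw
        rw [hg, hw, h.eq_of_nhds]
      · filter_upwards [h, comp_locconst hKc x z hk] with w hw hw2
        rw [hg, hw, h.eq_of_nhds]; exact hw2
    have oU : IsOpen {z | z ∉ L ∧ g z} := by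
      rw [isOpen_iff_mem_nhds]
      rintro z ⟨z1, z2⟩
      filter_upwards [lc z z1, hLc.isOpen_compl.mem_nhds z1] with w hw hw2
      exact ⟨hw2, hw.2 z2⟩
    have oV : IsOpen {z | z ∉ L ∧ ¬ g z} := by
      rw [isOpen_iff_mem_nhds]
      rintro z ⟨z1, z2⟩
      filter_upwards [lc z z1, hLc.isOpen_compl.mem_nhds z1] with w hw hw2
      exact ⟨hw2, fun h => z2 (hw.1 h)⟩
    have hx2 := hx.2; have hy2 := hy.2
    simp only [mem_union, not_or] at hx2 hy2
    have gx : g x := by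
      rw [hg, gout _ _ _ x hx2.2]; exact mem_connectedComponentIn ⟨trivial, hx2.1⟩
    have gy : ¬ g y := by
      rw [hg, gout _ _ _ y hy2.2]; exact hxy
    have hxL : x ∉ L := by
      rintro (h | h)
      · exact hx2.1 h.1
      · exact hx2.2 (hSB h)
    have pre := isPreconnected_connectedComponentIn (F := univ \ L) (x := x)
    rcases isPreconnected_iff_subset_of_disjoint.1 pre _ _ oU oV (by
      intro w hw
      have hwL := (connectedComponentIn_subset _ _ hw).2
      by_cases h : g w
      · exact Or.inl ⟨hwL, h⟩
      · exact Or.inr ⟨hwL, h⟩) (by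
      ext w; constructor
      · rintro ⟨-, h1, h2⟩; exact h2.2 h1.2
      · rintro ⟨⟩) with h | h
    · exact gy (h hcon).2
    · exact (h (mem_connectedComponentIn ⟨trivial, hxL⟩)).2 gx
  have out : L \ ball 0 2 = K \ ball 0 2 := by
    ext w; constructor
    · rintro ⟨h | h, hw⟩
      · exact ⟨h.1, hw⟩
      · exact absurd (hSB h) hw
    · rintro ⟨h, hw⟩
      exact ⟨Or.inl ⟨h, fun h' => hw (hWK ⟨h, h'⟩)⟩, hw⟩
  have top : TopCompetitor univ u K (ball 0 2) v L := by
    refine ⟨⟨pair, out, Eventually.of_forall ?_⟩, sep⟩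
    rintro x ⟨-, hx⟩
    exact gout _ _ _ x (fun h => hx (Or.inr h))
  have M := hmin.minimality 0 h0 2 two_pos v L top
  have ez : elastic 𝓒 v (ball 0 2 \ L) = 0 := by
    apply elastic_zero_of (measurableSet_ball.diff hLc.measurableSet)
    filter_upwards [hz] with x hx hxL
    rcases gv x hxL.2 with h | h | ⟨hk, h⟩
    · rw [eSym_congr h, rig_eSym]
    · rw [eSym_congr h, rig_eSym]
    · rw [eSym_congr h, hx hk]
  rw [ez, zero_add] at M
  have M2 : Hm 2 (K ∩ ball 0 2) ≤ Hm 2 (L ∩ ball 0 2) := le_trans (le_add_left le_rfl) M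
  have fin : Hm 2 (K ∩ ball 0 2) ≠ ⊤ := Hm_fin hmin 0 two_pos
  have sub : ∀ ν : Euc 2, ‖ν‖ = 1 → ν ∈ K → ray1 ν ⊆ W → ray1 ν ⊆ K ∩ ball 0 2 ∩ W := by
    rintro ν h1 h2 h3 x ⟨t, t0, t1, rfl⟩
    refine ⟨⟨(hcone t t0 ν).1 h2, ?_⟩, h3 ⟨t, t0, t1, rfl⟩⟩
    rw [mem_ball_zero_iff, norm_smul, h1, Real.norm_eq_abs, abs_of_pos t0]; linarith
  have low : 2 ≤ Hm 2 (K ∩ ball 0 2 ∩ W) := by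
    calc (2 : ℝ≥0∞) = Hm 2 (ray1 ν₁ ∪ ray1 ν₂) := by
          rw [measure_union (ray1_disj n1 n2 hne) (ray1_meas n2), ray1_Hm n1, ray1_Hm n2]; norm_num
      _ ≤ _ := measure_mono (union_subset (sub _ n1 k1 hW1) (sub _ n2 k2 hW2))
  have split := measure_inter_add_sdiff (μ := Hm 2) (K ∩ ball 0 2) hW.measurableSet
  have Lle : Hm 2 (L ∩ ball 0 2) ≤ Hm 2 S + Hm 2 ((K ∩ ball 0 2) \ W) := by
    refine le_trans (measure_mono ?_) (measure_union_le _ _)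
    rintro w ⟨h | h, hw⟩
    · exact Or.inr ⟨⟨h.1, hw⟩, h.2⟩
    · exact Or.inl h
  have fin2 : Hm 2 ((K ∩ ball 0 2) \ W) ≠ ⊤ := ne_top_of_le_ne_top fin (measure_mono sdiff_subset)
  have := (split.le.trans (M2.trans Lle))
  exact low.trans ((ENNReal.add_le_add_iff_right fin2).1 this)

end

section
lemma open_and {p q : Euc 2 → Prop} (hp : IsOpen {z | p z}) (hq : IsOpen {z | q z}) : IsOpen {z | p z ∧ q z} :=
  hp.inter hq

lemma closed_and {p q : Euc 2 → Prop} (hp : IsClosed {z | p z}) (hq : IsClosed {z | q z}) : IsClosed {z | p z ∧ q z} :=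
  hp.inter hq

lemma convex_and {p q : Euc 2 → Prop} (hp : Convex ℝ {z | p z}) (hq : Convex ℝ {z | q z}) : Convex ℝ {z | p z ∧ q z} :=
  hp.inter hq

lemma exists_coords {ν₁ ν₂ : Euc 2} (n1 : ‖ν₁‖ = 1) (n2 : ‖ν₂‖ = 1) (hc1 : -1 < rInner ν₁ ν₂) (hc2 : rInner ν₁ ν₂ < 1) :
    ∃ X Y : Euc 2 →L[ℝ] ℝ, X ν₁ = 1 ∧ X ν₂ = 0 ∧ Y ν₁ = 0 ∧ Y ν₂ = 1 ∧ ∀ z, z = X z • ν₁ + Y z • ν₂ := by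
  have e1 := norm_sq_euc ν₁
  have e2 := norm_sq_euc ν₂
  rw [n1] at e1; rw [n2] at e2
  rw [rInner_eq] at hc1 hc2
  set D := ν₁ 0 * ν₂ 1 - ν₁ 1 * ν₂ 0 with hD
  have hD0 : D ≠ 0 := by
    intro h
    have : D ^ 2 + (ν₁ 0 * ν₂ 0 + ν₁ 1 * ν₂ 1) ^ 2 = (ν₁ 0 ^ 2 + ν₁ 1 ^ 2) * (ν₂ 0 ^ 2 + ν₂ 1 ^ 2) := by rw [hD]; ring
    rw [h, ← e1, ← e2] at this
    nlinarith
  let p0 : Euc 2 →L[ℝ] ℝ := EuclideanSpace.proj 0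
  let p1 : Euc 2 →L[ℝ] ℝ := EuclideanSpace.proj 1
  refine ⟨(ν₂ 1 / D) • p0 - (ν₂ 0 / D) • p1, (ν₁ 0 / D) • p1 - (ν₁ 1 / D) • p0, ?_, ?_, ?_, ?_, ?_⟩
  · simp [p0, p1]; field_simp; rw [hD]; ring
  · simp [p0, p1]; field_simp; ring
  · simp [p0, p1]; field_simp; ring
  · simp [p0, p1]; field_simp; rw [hD]
  · intro z
    ext i
    fin_cases i
    · simp [p0, p1]; field_simp; rw [hD]; ring
    · simp [p0, p1]; field_simp; rw [hD]; ring

lemma coord_norm {ν₁ ν₂ : Euc 2} (n1 : ‖ν₁‖ = 1) (n2 : ‖ν₂‖ = 1) {a b : ℝ} (ha : 0 ≤ a) (hb : 0 ≤ b) (hab : a + b < 2) :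
    a • ν₁ + b • ν₂ ∈ ball (0 : Euc 2) 2 := by
  rw [mem_ball_zero_iff]
  calc ‖a • ν₁ + b • ν₂‖ ≤ ‖a • ν₁‖ + ‖b • ν₂‖ := norm_add_le _ _
    _ = a + b := by rw [norm_smul, norm_smul, n1, n2, Real.norm_eq_abs, Real.norm_eq_abs, abs_of_nonneg ha, abs_of_nonneg hb]; ring
    _ < 2 := hab

lemma u_rigid {𝓒 : Mat 2 →ₗ[ℝ] Mat 2} {u : Euc 2 → Euc 2} {K : Set (Euc 2)} (hmin : GlobalMin 𝓒 u K)
    (hz : ∀ᵐ x, x ∉ K → eSym u x = 0) {U : Set (Euc 2)} (hU : IsOpen U) (hc : Convex ℝ U) (hK : U ⊆ Kᶜ) :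
    ∃ b κ, ∀ y ∈ U, u y = rig b κ y := by
  apply rigid_of_zero hU hc
  · intro x hx; exact hmin.pair.diffOn x ⟨trivial, hK hx⟩
  · filter_upwards [hz] with x hx hxU
    exact hx (hK hxU)

lemma norm_sub_sq_unit {ν₁ ν₂ : Euc 2} (n1 : ‖ν₁‖ = 1) (n2 : ‖ν₂‖ = 1) : ‖ν₁ - ν₂‖ ^ 2 = 2 - 2 * rInner ν₁ ν₂ := by
  rw [norm_sub_sq_real, n1, n2]; unfold rInner; ring

theorem no_wedge {𝓒 : Mat 2 →ₗ[ℝ] Mat 2} {u : Euc 2 → Euc 2} {K : Set (Euc 2)} (hmin : GlobalMin 𝓒 u K)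
    (hcone : ∀ t : ℝ, 0 < t → ∀ x, x ∈ K ↔ t • x ∈ K)
    (hz : ∀ᵐ x, x ∉ K → eSym u x = 0)
    {ν₁ ν₂ : Euc 2} (n1 : ‖ν₁‖ = 1) (n2 : ‖ν₂‖ = 1) (hc1 : -1 < rInner ν₁ ν₂) (hc2 : rInner ν₁ ν₂ < 1)
    (hK : K = {x | ∃ t : ℝ, 0 ≤ t ∧ (x = t • ν₁ ∨ x = t • ν₂)}) : False := by
  obtain ⟨X, Y, X1, X2, Y1, Y2, hXY⟩ := exists_coords n1 n2 hc1 hc2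
  have k1 : ν₁ ∈ K := by rw [hK]; exact ⟨1, zero_le_one, Or.inl (by simp)⟩
  have k2 : ν₂ ∈ K := by rw [hK]; exact ⟨1, zero_le_one, Or.inr (by simp)⟩
  have h0 : (0 : Euc 2) ∈ K := by rw [hK]; exact ⟨0, le_rfl, Or.inl (by simp)⟩
  have hne : ν₁ ≠ ν₂ := by rintro rfl; rw [X1] at X2; norm_num at X2
  have Kc : ∀ z ∈ K, (0 ≤ X z ∧ Y z = 0) ∨ (0 ≤ Y z ∧ X z = 0) := by
    intro z hzK
    rw [hK] at hzK
    obtain ⟨t, t0, rfl | rfl⟩ := hzK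
    · left; simp [X1, Y1, t0]
    · right; simp [X2, Y2, t0]
  have oX : IsOpen {z | X z < 0} := isOpen_lt (by fun_prop) (by fun_prop)
  have oY : IsOpen {z | Y z < 0} := isOpen_lt (by fun_prop) (by fun_prop)
  have cX : Convex ℝ {z | X z < 0} := convex_halfSpace_lt X.toLinearMap.isLinear 0
  have cY : Convex ℝ {z | Y z < 0} := convex_halfSpace_lt Y.toLinearMap.isLinear 0
  have kX : {z | X z < 0} ⊆ Kᶜ := by
    intro z (hz : X z < 0) hk
    rcases Kc z hk with h | h <;> linarith [h.1, h.2]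
  have kY : {z | Y z < 0} ⊆ Kᶜ := by
    intro z (hz : Y z < 0) hk
    rcases Kc z hk with h | h <;> linarith [h.1, h.2]
  have w1 : -ν₁ - ν₂ ∈ {z | X z < 0} := by simp [X1, X2]
  have w2 : -ν₁ - ν₂ ∈ {z | Y z < 0} := by simp [Y1, Y2]
  have M := comp_arg hmin hcone h0 hz n1 n2 k1 k2 hne (W := {z | X z < 1 ∧ Y z < 1}) (S := segment ℝ ν₁ ν₂)
    (R1 := {z | 0 ≤ X z ∧ 0 ≤ Y z ∧ X z + Y z ≤ 1}) (R2 := ∅) (H1 := {z | X z < 0} ∪ {z | Y z < 0}) (H2 := ∅)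
    ?_ ?_ ?_ ?_ (isClosed_seg _ _) ?_ ?_ (empty_subset _) ?_ isPreconnected_empty ?_ (empty_subset _) ?_
    ⟨0, 0, fun y hy => hy.elim⟩ ?_
  · rw [Hm_segment] at M
    have h2 : 2 ≤ ‖ν₁ - ν₂‖ := by
      have : ENNReal.ofReal 2 ≤ ENNReal.ofReal ‖ν₁ - ν₂‖ := by simpa using M
      exact (ENNReal.ofReal_le_ofReal_iff (norm_nonneg _)).1 this
    have := norm_sub_sq_unit n1 n2
    nlinarith
  · apply open_and <;> exact isOpen_lt (by fun_prop) (by fun_prop)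
  · rintro x ⟨t, t0, t1, rfl⟩
    simp [X1, Y1, t1]
  · rintro x ⟨t, t0, t1, rfl⟩
    simp [X2, Y2, t1]
  · rintro x ⟨hx, hx1 : X x < 1, hx2 : Y x < 1⟩
    rw [hXY x]
    rcases Kc x hx with h | h
    · exact coord_norm n1 n2 h.1 h.2.ge (by linarith [h.2])
    · exact coord_norm n1 n2 h.2.ge h.1 (by linarith [h.2])
  · exact (convex_ball _ _).segment_subset (by rw [mem_ball_zero_iff, n1]; norm_num) (by rw [mem_ball_zero_iff, n2]; norm_num)
  · rintro x ⟨h1, h2, h3⟩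
    rw [hXY x]
    exact coord_norm n1 n2 h1 h2 (by linarith)
  · exact IsPreconnected.union _ w1 w2 cX.isPreconnected cY.isPreconnected
  · exact union_subset kX kY
  · obtain ⟨b, κ, e⟩ := u_rigid hmin hz oX cX kX
    obtain ⟨b', κ', e'⟩ := u_rigid hmin hz oY cY kY
    have := rig_unique (oX.inter oY) ⟨_, w1, w2⟩ (fun y hy => (e y hy.1).symm.trans (e' y hy.2))
    refine ⟨b, κ, ?_⟩
    rintro y (hy | hy)
    · exact e y hy
    · rw [this]; exact e' y hy
  · intro z hzL
    have hzL1 : z ∉ K \ {z | X z < 1 ∧ Y z < 1} := fun h => hzL (Or.inl h)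
    have hzS : z ∉ segment ℝ ν₁ ν₂ := fun h => hzL (Or.inr h)
    by_cases hR : z ∈ {z | 0 ≤ X z ∧ 0 ≤ Y z ∧ X z + Y z ≤ 1}
    · left
      obtain ⟨h1, h2, h3⟩ := hR
      have h4 : X z + Y z < 1 := by
        refine lt_of_le_of_ne h3 fun h => hzS ?_
        exact ⟨X z, Y z, h1, h2, h, (hXY z).symm⟩
      have : ∀ᶠ y in 𝓝 z, X y + Y y < 1 := (isOpen_lt (f := fun y => X y + Y y) (by fun_prop) continuous_const).mem_nhds h4
      filter_upwards [this] with y hy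
      by_cases c1 : 0 ≤ X y
      · by_cases c2 : 0 ≤ Y y
        · exact Or.inl ⟨c1, c2, hy.le⟩
        · exact Or.inr ⟨Or.inr (not_le.1 c2), fun h => h.elim⟩
      · exact Or.inr ⟨Or.inl (not_le.1 c1), fun h => h.elim⟩
    · right; right
      constructor
      · intro hk
        have hw : X z < 1 ∧ Y z < 1 := by
          by_contra hw
          exact hzL1 ⟨hk, hw⟩
        apply hR
        rcases Kc z hk with h | h
        · exact ⟨h.1, h.2.ge, by linarith [h.2, hw.1]⟩
        · exact ⟨h.2.ge, h.1, by linarith [h.2, hw.2]⟩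
      · have cl : IsClosed {z | 0 ≤ X z ∧ 0 ≤ Y z ∧ X z + Y z ≤ 1} :=
          closed_and (isClosed_le (by fun_prop) (by fun_prop))
            (closed_and (isClosed_le (by fun_prop) (by fun_prop)) (isClosed_le (by fun_prop) (by fun_prop)))
        filter_upwards [cl.isOpen_compl.mem_nhds hR] with y hy
        exact ⟨hy, fun h => h.elim⟩

end

section
lemma eps_half {K : Set (Euc 2)} (hcone : ∀ t : ℝ, 0 < t → ∀ x, x ∈ K ↔ t • x ∈ K)
    (hfin : {ν : Euc 2 | ‖ν‖ = 1 ∧ ν ∈ K}.Finite) (X Y : Euc 2 →L[ℝ] ℝ) :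
    ∀ᶠ ε in 𝓝[>] (0:ℝ), ∀ z ∈ K, 0 < X z → |Y z| < ε * X z → Y z = 0 := by
  have h : ∀ᶠ ε in 𝓝[>] (0:ℝ), ∀ ν ∈ {ν : Euc 2 | ‖ν‖ = 1 ∧ ν ∈ K}, Y ν ≠ 0 → ε * X ν < |Y ν| := by
    rw [eventually_all_finite hfin]
    intro ν hν
    by_cases hY : Y ν = 0
    · simp [hY]
    · have : Tendsto (fun ε : ℝ => ε * X ν) (𝓝[>] 0) (𝓝 0) := by
        have : Tendsto (fun ε : ℝ => ε * X ν) (𝓝 0) (𝓝 (0 * X ν)) := (continuous_id.mul continuous_const).tendsto 0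
        rw [zero_mul] at this
        exact this.mono_left nhdsWithin_le_nhds
      filter_upwards [this.eventually_lt_const (abs_pos.2 hY)] with ε hε _
      exact hε
  filter_upwards [h] with ε hε z hz hX hY
  by_contra hne
  have z0 : z ≠ 0 := by rintro rfl; simp at hX
  have nz : 0 < ‖z‖ := norm_pos_iff.2 z0
  have := hε (‖z‖⁻¹ • z) ⟨by rw [norm_smul, norm_inv, norm_norm, inv_mul_cancel₀ nz.ne'], (hcone _ (inv_pos.2 nz) z).1 hz⟩
    (by simp [hne, z0])
  simp only [map_smul, smul_eq_mul, abs_mul, abs_inv, abs_norm] at this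
  have h2 := mul_lt_mul_of_pos_left hY (inv_pos.2 nz)
  linarith

lemma len_bound {ν₁ ν₂ : Euc 2} (n1 : ‖ν₁‖ = 1) (n2 : ‖ν₂‖ = 1) (hc1 : -(1/2) < rInner ν₁ ν₂) (hc2 : rInner ν₁ ν₂ < 1) :
    ∃ s : ℝ, 0 < s ∧ s < 1/4 ∧
      ‖(0 : Euc 2) - s • (ν₁ + ν₂)‖ + ‖s • (ν₁ + ν₂) - ν₁‖ + ‖s • (ν₁ + ν₂) - ν₂‖ < 2 := by
  set q := ‖ν₁ + ν₂‖ with hq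
  have q2 : q ^ 2 = 2 + 2 * rInner ν₁ ν₂ := by
    rw [hq, norm_add_sq_real, n1, n2]; unfold rInner; ring
  have q0 : 0 ≤ q := norm_nonneg _
  have q1 : 1 < q := by nlinarith
  have q3 : q < 2 := by nlinarith
  set s := (q - 1) / (2 * q) with hs
  have sq : s * q = (q - 1) / 2 := by rw [hs]; field_simp
  have s0 : 0 < s := by rw [hs]; apply div_pos <;> linarith
  have s1 : s < 1/4 := by rw [hs, div_lt_div_iff₀] <;> linarith
  refine ⟨s, s0, s1, ?_⟩
  have a0 : ‖(0 : Euc 2) - s • (ν₁ + ν₂)‖ = s * q := by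
    rw [zero_sub, norm_neg, norm_smul, Real.norm_eq_abs, abs_of_pos s0]
  have a1 : ‖s • (ν₁ + ν₂) - ν₁‖ ^ 2 = 1 - s * q ^ 2 + (s * q) ^ 2 := by
    have h : inner ℝ (ν₁ + ν₂) ν₁ = 1 + rInner ν₁ ν₂ := by
      rw [inner_add_left, real_inner_self_eq_norm_sq, n1, real_inner_comm]; unfold rInner; ring
    rw [norm_sub_sq_real, n1, norm_smul, Real.norm_eq_abs, abs_of_pos s0, ← hq, real_inner_smul_left, h, q2]; ring
  have a2 : ‖s • (ν₁ + ν₂) - ν₂‖ ^ 2 = 1 - s * q ^ 2 + (s * q) ^ 2 := by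
    have h : inner ℝ (ν₁ + ν₂) ν₂ = 1 + rInner ν₁ ν₂ := by
      rw [inner_add_left, real_inner_self_eq_norm_sq, n2]; unfold rInner; ring
    rw [norm_sub_sq_real, n2, norm_smul, Real.norm_eq_abs, abs_of_pos s0, ← hq, real_inner_smul_left, h, q2]; ring
  have e : s * q ^ 2 = (q - 1) / 2 * q := by rw [← sq]; ring
  rw [e, sq] at a1 a2
  rw [a0, sq]
  nlinarith [sq_nonneg (‖s • (ν₁ + ν₂) - ν₁‖ - 1), sq_nonneg (‖s • (ν₁ + ν₂) - ν₂‖ - 1), mul_pos (sub_pos.2 q1) (sub_pos.2 q1)]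

lemma tri_seg {ν₁ ν₂ z : Euc 2} {a b s : ℝ} (s0 : 0 < s) (hz : z = a • ν₁ + b • ν₂) (hb : 0 ≤ b) (hba : b ≤ a)
    (h : a + (1 / s - 1) * b = 1) : z ∈ segment ℝ (s • (ν₁ + ν₂)) ν₁ := by
  have hbs : b / s ≤ 1 := by
    rw [div_le_one s0]
    have : b / s = 1 - a + b := by field_simp at h ⊢; linarith
    have : b / s ≤ 1 := by linarith
    rwa [div_le_one s0] at this
  refine ⟨b / s, 1 - b / s, div_nonneg hb s0.le, sub_nonneg.2 hbs, by ring, ?_⟩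
  have ea : a = 1 - b / s + b := by field_simp at h ⊢; linarith
  rw [hz, ea, smul_smul, div_mul_cancel₀ _ s0.ne']
  module

lemma diag_seg {ν₁ ν₂ z : Euc 2} {a b s : ℝ} (s0 : 0 < s) (hz : z = a • ν₁ + b • ν₂) (hab : a = b) (ha : 0 ≤ a)
    (h : a + (1 / s - 1) * a ≤ 1) : z ∈ segment ℝ 0 (s • (ν₁ + ν₂)) := by
  subst hab
  have e : a / s = a + (1 / s - 1) * a := by field_simp; ring
  refine ⟨1 - a / s, a / s, by linarith, div_nonneg ha s0.le, by ring, ?_⟩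
  rw [hz, smul_smul, div_mul_cancel₀ _ s0.ne']
  module

theorem no_acute {𝓒 : Mat 2 →ₗ[ℝ] Mat 2} {u : Euc 2 → Euc 2} {K : Set (Euc 2)} (hmin : GlobalMin 𝓒 u K)
    (hcone : ∀ t : ℝ, 0 < t → ∀ x, x ∈ K ↔ t • x ∈ K) (h0 : (0 : Euc 2) ∈ K)
    (hz : ∀ᵐ x, x ∉ K → eSym u x = 0)
    {ν₁ ν₂ : Euc 2} (n1 : ‖ν₁‖ = 1) (n2 : ‖ν₂‖ = 1) (k1 : ν₁ ∈ K) (k2 : ν₂ ∈ K)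
    (hc1 : -(1/2) < rInner ν₁ ν₂) (hc2 : rInner ν₁ ν₂ < 1) : False := by
  obtain ⟨X, Y, X1, X2, Y1, Y2, hXY⟩ := exists_coords n1 n2 (by linarith) hc2
  have hfin := finite_dirs hmin hcone
  obtain ⟨ε, ⟨eK1, eK2⟩, e0⟩ := (((eps_half hcone hfin X Y).and (eps_half hcone hfin Y X)).and self_mem_nhdsWithin).exists
  have e0 : 0 < ε := e0
  obtain ⟨s, s0, s1, hlen⟩ := len_bound n1 n2 hc1 hc2
  set p := s • (ν₁ + ν₂) with hp
  set k := 1 / s - 1 with hk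
  have kk : 1 < k := by
    have : 4 < 1 / s := by rw [lt_div_iff₀ s0]; linarith
    rw [hk]; linarith
  have hne : ν₁ ≠ ν₂ := by rintro rfl; rw [X1] at X2; norm_num at X2
  set R1 := {z | 0 ≤ Y z ∧ Y z ≤ X z ∧ X z + k * Y z ≤ 1} with hR1
  set R2 := {z | 0 ≤ X z ∧ X z ≤ Y z ∧ Y z + k * X z ≤ 1} with hR2
  set W := {z | (0 < X z ∧ X z < 1 ∧ |Y z| < ε * X z) ∨ (0 < Y z ∧ Y z < 1 ∧ |X z| < ε * Y z)} with hW
  set H1 := {z | 0 < X z ∧ -ε * X z < Y z ∧ Y z < 0} with hH1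
  set H2 := {z | 0 < Y z ∧ -ε * Y z < X z ∧ X z < 0} with hH2
  have convl : ∀ (A B : Euc 2 →L[ℝ] ℝ), Convex ℝ {z | 0 < A z ∧ -ε * A z < B z ∧ B z < 0} := by
    intro A B
    refine convex_and (convex_halfSpace_gt A.toLinearMap.isLinear 0) (convex_and ?_ (convex_halfSpace_lt B.toLinearMap.isLinear 0))
    have := convex_halfSpace_gt ((ε • A + B).toLinearMap.isLinear) 0
    have e : {z | -ε * A z < B z} = {w | 0 < (ε • A + B).toLinearMap w} := by
      ext z
      have : (ε • A + B).toLinearMap z = ε * A z + B z := by simp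
      rw [mem_ofPred_eq, mem_ofPred_eq, this]
      constructor <;> intro h <;> linarith
    rw [e]; exact this
  have opl : ∀ (A B : Euc 2 →L[ℝ] ℝ), IsOpen {z | 0 < A z ∧ -ε * A z < B z ∧ B z < 0} := by
    intro A B
    refine open_and ?_ (open_and ?_ ?_) <;> exact isOpen_lt (by fun_prop) (by fun_prop)
  have cll : ∀ (A B : Euc 2 →L[ℝ] ℝ), IsClosed {z | 0 ≤ B z ∧ B z ≤ A z ∧ A z + k * B z ≤ 1} := by
    intro A B
    refine closed_and ?_ (closed_and ?_ ?_) <;> exact isClosed_le (by fun_prop) (by fun_prop)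
  have kH1 : H1 ⊆ Kᶜ := by
    rintro z ⟨a1, a2, a3⟩ hk
    have := eK1 z hk a1 (by rw [abs_lt]; constructor <;> nlinarith)
    linarith
  have kH2 : H2 ⊆ Kᶜ := by
    rintro z ⟨a1, a2, a3⟩ hk
    have := eK2 z hk a1 (by rw [abs_lt]; constructor <;> nlinarith)
    linarith
  have WK : ∀ z, z ∈ K → z ∈ W → (0 < X z ∧ X z < 1 ∧ Y z = 0) ∨ (0 < Y z ∧ Y z < 1 ∧ X z = 0) := by
    rintro z hk (⟨a, b, c⟩ | ⟨a, b, c⟩)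
    · exact Or.inl ⟨a, b, eK1 z hk a c⟩
    · exact Or.inr ⟨a, b, eK2 z hk a c⟩
  have m1 : ν₁ ∈ ball (0 : Euc 2) 2 := by rw [mem_ball_zero_iff, n1]; norm_num
  have m2 : ν₂ ∈ ball (0 : Euc 2) 2 := by rw [mem_ball_zero_iff, n2]; norm_num
  have mp : p ∈ ball (0 : Euc 2) 2 := by
    rw [hp, smul_add]; exact coord_norm n1 n2 s0.le s0.le (by linarith)
  have m0 : (0 : Euc 2) ∈ ball (0 : Euc 2) 2 := mem_ball_self two_pos
  have M := comp_arg hmin hcone h0 hz n1 n2 k1 k2 hne (W := W) (S := segment ℝ 0 p ∪ segment ℝ p ν₁ ∪ segment ℝ p ν₂)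
    (R1 := R1) (R2 := R2) (H1 := H1) (H2 := H2)
    ?_ ?_ ?_ ?_ (((isClosed_seg _ _).union (isClosed_seg _ _)).union (isClosed_seg _ _)) ?_ ?_ ?_
    (convl X Y).isPreconnected (convl Y X).isPreconnected kH1 kH2 (u_rigid hmin hz (opl X Y) (convl X Y) kH1)
    (u_rigid hmin hz (opl Y X) (convl Y X) kH2) ?_
  · have le : Hm 2 (segment ℝ 0 p ∪ segment ℝ p ν₁ ∪ segment ℝ p ν₂) ≤ ENNReal.ofReal (‖0 - p‖ + ‖p - ν₁‖ + ‖p - ν₂‖) := by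
      rw [ENNReal.ofReal_add (by positivity) (by positivity), ENNReal.ofReal_add (by positivity) (by positivity),
        ← Hm_segment, ← Hm_segment, ← Hm_segment]
      exact (measure_union_le _ _).trans (add_le_add_left (measure_union_le _ _) _)
    have h2 : ENNReal.ofReal 2 ≤ ENNReal.ofReal (‖0 - p‖ + ‖p - ν₁‖ + ‖p - ν₂‖) := by simpa using M.trans le
    have := (ENNReal.ofReal_le_ofReal_iff (by positivity)).1 h2
    linarith
  · have : W = {z | 0 < X z ∧ X z < 1 ∧ |Y z| < ε * X z} ∪ {z | 0 < Y z ∧ Y z < 1 ∧ |X z| < ε * Y z} := rfl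
    rw [this]
    apply IsOpen.union <;> refine open_and ?_ (open_and ?_ ?_) <;> exact isOpen_lt (by fun_prop) (by fun_prop)
  · rintro x ⟨t, t0, t1, rfl⟩
    left; simp [X1, Y1, t0, t1, e0]
  · rintro x ⟨t, t0, t1, rfl⟩
    right; simp [X2, Y2, t0, t1, e0]
  · rintro x ⟨hx, hx1⟩
    rw [hXY x]
    rcases WK x hx hx1 with h | h
    · exact coord_norm n1 n2 h.1.le h.2.2.ge (by linarith [h.2.2, h.2.1])
    · exact coord_norm n1 n2 h.2.2.ge h.1.le (by linarith [h.2.2, h.2.1])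
  · exact union_subset (union_subset ((convex_ball _ _).segment_subset m0 mp) ((convex_ball _ _).segment_subset mp m1))
      ((convex_ball _ _).segment_subset mp m2)
  · rintro x ⟨h1, h2, h3⟩
    rw [hXY x]
    have := mul_nonneg (sub_nonneg.2 kk.le) h1
    exact coord_norm n1 n2 (h1.trans h2) h1 (by linarith)
  · rintro x ⟨h1, h2, h3⟩
    rw [hXY x]
    have := mul_nonneg (sub_nonneg.2 kk.le) h1
    exact coord_norm n1 n2 h1 (h1.trans h2) (by linarith)
  · intro z hzL
    have hzL1 : z ∉ K \ W := fun h => hzL (Or.inl h)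
    have hz0 : z ∉ segment ℝ 0 p := fun h => hzL (Or.inr (Or.inl (Or.inl h)))
    have hz1 : z ∉ segment ℝ p ν₁ := fun h => hzL (Or.inr (Or.inl (Or.inr h)))
    have hz2 : z ∉ segment ℝ p ν₂ := fun h => hzL (Or.inr (Or.inr h))
    by_cases c1 : z ∈ R1
    · left
      obtain ⟨h1, h2, h3⟩ := c1
      have h4 : X z + k * Y z < 1 := lt_of_le_of_ne h3 fun h => hz1 (tri_seg s0 (hXY z) h1 h2 h)
      have h5 : Y z < X z := lt_of_le_of_ne h2 fun h => hz0 (diag_seg s0 (hXY z) h.symm (h1.trans h2) (by rw [h] at h3; exact h3))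
      have h6 : 0 < X z := by linarith
      have E1 : ∀ᶠ y in 𝓝 z, X y + k * Y y < 1 := (isOpen_lt (f := fun y => X y + k * Y y) (by fun_prop) continuous_const).mem_nhds h4
      have E2 : ∀ᶠ y in 𝓝 z, Y y < X y := (isOpen_lt (f := fun y => Y y) (by fun_prop) X.continuous).mem_nhds h5
      have E3 : ∀ᶠ y in 𝓝 z, 0 < X y := (isOpen_lt continuous_const X.continuous).mem_nhds h6
      have E4 : ∀ᶠ y in 𝓝 z, -ε * X y < Y y := (isOpen_lt (f := fun y => -ε * X y) (by fun_prop) Y.continuous).mem_nhds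
        (show -ε * X z < Y z by nlinarith [mul_pos e0 h6])
      filter_upwards [E1, E2, E3, E4] with y y1 y2 y3 y4
      by_cases c : 0 ≤ Y y
      · exact Or.inl ⟨c, y2.le, y1.le⟩
      · refine Or.inr ⟨⟨y3, y4, not_le.1 c⟩, fun h => c (h.1.trans h.2.1)⟩
    · by_cases c2 : z ∈ R2
      · right; left
        obtain ⟨h1, h2, h3⟩ := c2
        have h4 : Y z + k * X z < 1 := lt_of_le_of_ne h3 fun h => hz2 (by
          have := tri_seg (ν₁ := ν₂) (ν₂ := ν₁) (z := z) s0 (by rw [add_comm]; exact hXY z) h1 h2 h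
          rwa [add_comm ν₂ ν₁] at this)
        have h5 : X z < Y z := lt_of_le_of_ne h2 fun h => hz0 (diag_seg s0 (hXY z) h h1 (by rw [← h] at h3; exact h3))
        have h6 : 0 < Y z := by linarith
        have E1 : ∀ᶠ y in 𝓝 z, Y y + k * X y < 1 := (isOpen_lt (f := fun y => Y y + k * X y) (by fun_prop) continuous_const).mem_nhds h4
        have E2 : ∀ᶠ y in 𝓝 z, X y < Y y := (isOpen_lt (f := fun y => X y) (by fun_prop) Y.continuous).mem_nhds h5
        have E3 : ∀ᶠ y in 𝓝 z, 0 < Y y := (isOpen_lt continuous_const Y.continuous).mem_nhds h6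
        have E4 : ∀ᶠ y in 𝓝 z, -ε * Y y < X y := (isOpen_lt (f := fun y => -ε * Y y) (by fun_prop) X.continuous).mem_nhds
          (show -ε * Y z < X z by nlinarith [mul_pos e0 h6])
        filter_upwards [E1, E2, E3, E4] with y y1 y2 y3 y4
        refine ⟨fun h => absurd h.2.1 (not_le.2 y2), ?_⟩
        by_cases c : 0 ≤ X y
        · exact Or.inl ⟨c, y2.le, y1.le⟩
        · exact Or.inr ⟨y3, y4, not_le.1 c⟩
      · right; right
        constructor
        · intro hk
          have hw : z ∈ W := by
            by_contra hw
            exact hzL1 ⟨hk, hw⟩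
          rcases WK z hk hw with h | h
          · exact c1 ⟨h.2.2.ge, by rw [h.2.2]; exact h.1.le, by rw [h.2.2]; linarith [h.2.1]⟩
          · exact c2 ⟨h.2.2.ge, by rw [h.2.2]; exact h.1.le, by rw [h.2.2]; linarith [h.2.1]⟩
        · filter_upwards [(cll X Y).isOpen_compl.mem_nhds c1, (cll Y X).isOpen_compl.mem_nhds c2] with y y1 y2
          exact ⟨y1, y2⟩

end

section
lemma cone_mem {K : Set (Euc 2)} (hcone : ∀ t : ℝ, 0 < t → ∀ x, x ∈ K ↔ t • x ∈ K) {x : Euc 2} (hx : x ∈ K) (h : x ≠ 0) :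
    ∃ ν, ‖ν‖ = 1 ∧ ν ∈ K ∧ x = ‖x‖ • ν := by
  have nz : 0 < ‖x‖ := norm_pos_iff.2 h
  refine ⟨‖x‖⁻¹ • x, ?_, (hcone _ (inv_pos.2 nz) x).1 hx, ?_⟩
  · rw [norm_smul, norm_inv, norm_norm, inv_mul_cancel₀ nz.ne']
  · rw [smul_smul, mul_inv_cancel₀ nz.ne', one_smul]

lemma cone_smul {K : Set (Euc 2)} (hcone : ∀ t : ℝ, 0 < t → ∀ x, x ∈ K ↔ t • x ∈ K) (h0 : (0 : Euc 2) ∈ K)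
    {ν : Euc 2} (hν : ν ∈ K) {t : ℝ} (ht : 0 ≤ t) : t • ν ∈ K := by
  rcases ht.eq_or_lt with rfl | h
  · rw [zero_smul]; exact h0
  · exact (hcone t h ν).1 hν

lemma unit_inner_lt {a b : Euc 2} (ha : ‖a‖ = 1) (hb : ‖b‖ = 1) (hne : a ≠ b) : rInner a b < 1 := by
  have := norm_sub_sq_unit ha hb
  have h : 0 < ‖a - b‖ := norm_pos_iff.2 (sub_ne_zero.2 hne)
  nlinarith [pow_pos h 2]

lemma unit_opp {a b : Euc 2} (ha : ‖a‖ = 1) (hb : ‖b‖ = 1) (h : rInner a b ≤ -1) : b = -a := by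
  have : ‖a + b‖ ^ 2 = 2 + 2 * rInner a b := by
    rw [norm_add_sq_real, ha, hb]; unfold rInner; ring
  have h2 : ‖a + b‖ ^ 2 = 0 := le_antisymm (by linarith) (sq_nonneg _)
  have h3 : a + b = 0 := by simpa using h2
  exact (neg_eq_of_add_eq_zero_right h3).symm

lemma three_sum {a b c : Euc 2} (ha : ‖a‖ = 1) (hb : ‖b‖ = 1) (hc : ‖c‖ = 1) (h1 : rInner a b ≤ -(1/2))
    (h2 : rInner b c ≤ -(1/2)) (h3 : rInner a c ≤ -(1/2)) :
    rInner a b = -(1/2) ∧ rInner b c = -(1/2) ∧ rInner a c = -(1/2) ∧ a + b + c = 0 := by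
  have e : ‖a + b + c‖ ^ 2 = 3 + 2 * (rInner a b + rInner b c + rInner a c) := by
    rw [norm_add_sq_real, norm_add_sq_real, inner_add_left, ha, hb, hc]; unfold rInner; ring
  have n := sq_nonneg ‖a + b + c‖
  refine ⟨by linarith, by linarith, by linarith, ?_⟩
  have : ‖a + b + c‖ ^ 2 = 0 := le_antisymm (by linarith) n
  simpa using this

theorem classification_aux {𝓒 : Mat 2 →ₗ[ℝ] Mat 2} {lam μ : ℝ} (hμ : 0 < μ) (hl : 0 < μ + lam)
    (hiso : ∀ ξ : Mat 2, ξᵀ = ξ → 𝓒 ξ = (lam * Matrix.trace ξ) • (1 : Mat 2) + (2 * μ) • ξ)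
    {u : Euc 2 → Euc 2} {K : Set (Euc 2)} (hmin : GlobalMin 𝓒 u K)
    (hcone : ∀ t : ℝ, 0 < t → ∀ x, x ∈ K ↔ t • x ∈ K) :
    K = ∅ ∨ (∃ ν : Euc 2, ‖ν‖ = 1 ∧ K = {x | rInner ν x = 0}) ∨
      (∃ ν : Euc 2, ‖ν‖ = 1 ∧ K = {x | ∃ t : ℝ, 0 ≤ t ∧ x = t • ν}) ∨
      (∃ ν₁ ν₂ ν₃ : Euc 2, ‖ν₁‖ = 1 ∧ ‖ν₂‖ = 1 ∧ ‖ν₃‖ = 1 ∧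
        rInner ν₁ ν₂ = -(1 / 2) ∧ rInner ν₂ ν₃ = -(1 / 2) ∧ rInner ν₁ ν₃ = -(1 / 2) ∧
        K = {x | ∃ t : ℝ, 0 ≤ t ∧ (x = t • ν₁ ∨ x = t • ν₂ ∨ x = t • ν₃)}) := by
  rcases K.eq_empty_or_nonempty with h | ⟨x0, hx0⟩
  · exact Or.inl h
  right
  have hKc : IsClosed K := closed_of_pair hmin.pair
  have h0 : (0 : Euc 2) ∈ K := by
    have ht : Tendsto (fun t : ℝ => t • x0) (𝓝[>] 0) (𝓝 0) := by
      have : Tendsto (fun t : ℝ => t • x0) (𝓝 0) (𝓝 ((0:ℝ) • x0)) := (continuous_id.smul continuous_const).tendsto 0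
      rw [zero_smul] at this
      exact this.mono_left nhdsWithin_le_nhds
    refine hKc.mem_of_tendsto ht ?_
    filter_upwards [self_mem_nhdsWithin] with t ht
    exact (hcone t ht x0).1 hx0
  have hex : ∃ a : Euc 2, ‖a‖ = 1 ∧ a ∈ K := by
    by_contra hno
    have : K ⊆ {0} := by
      intro x hx
      by_contra hne
      obtain ⟨ν, h1, h2, -⟩ := cone_mem hcone hx hne
      exact hno ⟨ν, h1, h2⟩
    have h1 := hmin.coral 0 h0 1 one_pos
    have h2 : Hm 2 (K ∩ ball 0 1) = 0 :=
      measure_mono_null (inter_subset_left.trans this) (measure_singleton 0)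
    rw [h2] at h1
    exact lt_irrefl _ h1
  obtain ⟨a, ha, aK⟩ := hex
  by_cases hb : ∃ b : Euc 2, ‖b‖ = 1 ∧ b ∈ K ∧ b ≠ a
  swap
  · push Not at hb
    right; left
    refine ⟨a, ha, ?_⟩
    ext x; constructor
    · intro hx
      by_cases hx0 : x = 0
      · exact ⟨0, le_rfl, by simp [hx0]⟩
      · obtain ⟨ν, h1, h2, h3⟩ := cone_mem hcone hx hx0
        rw [hb ν h1 h2] at h3
        exact ⟨_, norm_nonneg _, h3⟩
    · rintro ⟨t, ht, rfl⟩
      exact cone_smul hcone h0 aK ht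
  obtain ⟨b, hb, bK, hba⟩ := hb
  have hz := strain_zero hμ hl hiso hmin hcone h0 ha hb aK bK hba.symm
  have pair : ∀ x y : Euc 2, ‖x‖ = 1 → ‖y‖ = 1 → x ∈ K → y ∈ K → x ≠ y → rInner x y ≤ -(1/2) := by
    intro x y hx hy xK yK hne
    by_contra hc
    exact no_acute hmin hcone h0 hz hx hy xK yK (not_le.1 hc) (unit_inner_lt hx hy hne)
  by_cases hc : ∃ c : Euc 2, ‖c‖ = 1 ∧ c ∈ K ∧ c ≠ a ∧ c ≠ b
  swap
  · push Not at hc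
    left
    have KK : K = {x | ∃ t : ℝ, 0 ≤ t ∧ (x = t • a ∨ x = t • b)} := by
      ext x; constructor
      · intro hx
        by_cases hx0 : x = 0
        · exact ⟨0, le_rfl, by simp [hx0]⟩
        · obtain ⟨ν, h1, h2, h3⟩ := cone_mem hcone hx hx0
          refine ⟨_, norm_nonneg x, ?_⟩
          by_cases hν : ν = a
          · left; rw [hν] at h3; exact h3
          · right; rw [hc ν h1 h2 hν] at h3; exact h3
      · rintro ⟨t, ht, rfl | rfl⟩
        · exact cone_smul hcone h0 aK ht
        · exact cone_smul hcone h0 bK ht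
    have opp : b = -a := by
      apply unit_opp ha hb
      by_contra hlt
      exact no_wedge hmin hcone hz ha hb (not_le.1 hlt) (unit_inner_lt ha hb hba.symm) KK
    have a1 := norm_sq_euc a
    rw [ha] at a1
    refine ⟨!₂[-a 1, a 0], ?_, ?_⟩
    · have := norm_sq_euc !₂[-a 1, a 0]
      simp only [PiLp.toLp_apply, Matrix.cons_val_zero, Matrix.cons_val_one] at this
      have h : ‖(!₂[-a 1, a 0] : Euc 2)‖ ^ 2 = 1 := by rw [this]; linarith
      nlinarith [norm_nonneg (!₂[-a 1, a 0] : Euc 2)]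
    · rw [KK, opp]
      ext x
      simp only [mem_ofPred_eq, rInner_eq, PiLp.toLp_apply, Matrix.cons_val_zero, Matrix.cons_val_one]
      constructor
      · rintro ⟨t, -, rfl | rfl⟩ <;> simp <;> ring
      · intro h
        have hx : x = (a 0 * x 0 + a 1 * x 1) • a := by
          ext i
          fin_cases i
          · simp; linear_combination x 0 * a1 - a 1 * h
          · simp; linear_combination x 1 * a1 + a 0 * h
        rcases le_total 0 (a 0 * x 0 + a 1 * x 1) with hs | hs
        · exact ⟨_, hs, Or.inl hx⟩
        · refine ⟨-(a 0 * x 0 + a 1 * x 1), by linarith, Or.inr ?_⟩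
          rw [smul_neg, neg_smul, neg_neg]; exact hx
  obtain ⟨c, hc, cK, hca, hcb⟩ := hc
  right; right
  obtain ⟨i1, i2, i3, sum⟩ := three_sum ha hb hc (pair a b ha hb aK bK hba.symm) (pair b c hb hc bK cK hcb.symm)
    (pair a c ha hc aK cK hca.symm)
  refine ⟨a, b, c, ha, hb, hc, i1, i2, i3, ?_⟩
  ext x; constructor
  · intro hx
    by_cases hx0 : x = 0
    · exact ⟨0, le_rfl, by simp [hx0]⟩
    · obtain ⟨d, h1, h2, h3⟩ := cone_mem hcone hx hx0
      refine ⟨_, norm_nonneg x, ?_⟩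
      by_cases da : d = a
      · left; rw [da] at h3; exact h3
      by_cases db : d = b
      · right; left; rw [db] at h3; exact h3
      right; right
      have := three_sum ha hb h1 (pair a b ha hb aK bK hba.symm) (pair b d hb h1 bK h2 (Ne.symm db))
        (pair a d ha h1 aK h2 (Ne.symm da))
      have e : d = c := add_left_cancel (this.2.2.2.trans sum.symm)
      rw [e] at h3; exact h3
  · rintro ⟨t, ht, rfl | rfl | rfl⟩
    · exact cone_smul hcone h0 aK ht
    · exact cone_smul hcone h0 bK ht
    · exact cone_smul hcone h0 cK ht

end

/-- Classification of conical global minimizers in the plane. -/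
theorem classification_of_conical_global_minimizers
    (𝓒 : Mat 2 →ₗ[ℝ] Mat 2) (lam μ : ℝ) (hμ : 0 < μ) (hlam : 0 < μ + lam)
    (hskew : ∀ ξ : Mat 2, 𝓒 (ξ - ξᵀ) = 0)
    (hiso : ∀ ξ : Mat 2, ξᵀ = ξ →
      𝓒 ξ = (lam * Matrix.trace ξ) • (1 : Mat 2) + (2 * μ) • ξ)
    (u : Euc 2 → Euc 2) (K : Set (Euc 2)) (hmin : GlobalMin 𝓒 u K)
    (hcone : ∀ t : ℝ, 0 < t → ∀ x : Euc 2, x ∈ K ↔ t • x ∈ K) :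
    K = ∅ ∨
    (∃ ν : Euc 2, ‖ν‖ = 1 ∧ K = {x : Euc 2 | rInner ν x = 0}) ∨
    (∃ ν : Euc 2, ‖ν‖ = 1 ∧ K = {x : Euc 2 | ∃ t : ℝ, 0 ≤ t ∧ x = t • ν}) ∨
    (∃ ν₁ ν₂ ν₃ : Euc 2, ‖ν₁‖ = 1 ∧ ‖ν₂‖ = 1 ∧ ‖ν₃‖ = 1 ∧
      rInner ν₁ ν₂ = -(1/2) ∧ rInner ν₂ ν₃ = -(1/2) ∧ rInner ν₁ ν₃ = -(1/2) ∧
      K = {x : Euc 2 | ∃ t : ℝ, 0 ≤ t ∧ (x = t • ν₁ ∨ x = t • ν₂ ∨ x = t • ν₃)}) := by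
  exact classification_aux hμ hlam hiso hmin hcone

end Griffith
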